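/- Let q ≥ 10⁵ be an integer, let a be an integer coprime to q, and let A be a real number with 1 ≤ A ≤ 8. Then for every real number x with x ≥ exp(0.03·A·√q·(log q)³), |ψ(x;q,a) − x/φ(q)| ≤ (1/160)·x/(log x)^A and |θ(x;q,a) − x/φ(q)| ≤ (1/160)·x/(log x)^A. -/

import Mathlib

/-- `ψ(x;q,a) = ∑_{n ≤ x, n ≡ a (mod q)} Λ(n)`. -/
noncomputable def psi (x : ℝ) (q : ℕ) (a : ℤ) : ℝ :=
  ∑ n ∈ Finset.Icc 1 ⌊x⌋₊,
    if (n : ZMod q) = (a : ZMod q) then ArithmeticFunction.vonMangoldt n else 0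

/-- `θ(x;q,a) = ∑_{p ≤ x, p prime, p ≡ a (mod q)} log p`. -/
noncomputable def theta (x : ℝ) (q : ℕ) (a : ℤ) : ℝ :=
  ∑ p ∈ (Finset.Icc 1 ⌊x⌋₊).filter (fun p : ℕ => p.Prime ∧ (p : ZMod q) = (a : ZMod q)),
    Real.log (p : ℝ)

open Set MeasureTheory Filter Topology Finset
open Complex hiding cos cosh exp exp_add exp_log exp_nat_mul exp_sub log log_exp log_mul
  norm_of_nonneg sinh
open Real (add_one_le_exp cos cosh cosh_eq cosh_pos exp exp_add exp_half exp_le_exp exp_le_one_iff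
  exp_log exp_nat_mul exp_one_lt_d9 exp_pos exp_sub le_log_iff_exp_le le_sqrt_of_sq_le log log_div
  log_exp log_le_log log_le_sub_one_of_pos log_mul log_nonneg log_pow log_rpow log_sqrt
  log_two_gt_d9 log_two_lt_d9 norm_eq_abs norm_of_nonneg one_le_exp pi_gt_d4 pi_gt_three pi_lt_d4
  pi_lt_four pi_ne_zero pi_pos rpow_add rpow_def_of_pos rpow_le_rpow_of_exponent_le rpow_mul
  rpow_natCast rpow_neg rpow_neg_one rpow_one rpow_zero sinh sinh_pos_iff sq_sqrt sqrt_eq_rpow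
  sqrt_le_iff sqrt_mul sqrt_pos sqrt_sq)
open Metric (ball closedBall isOpen_ball ball_subset_closedBall mem_ball_self
  closedBall_subset_ball)
open ArithmeticFunction (vonMangoldt_nonneg)
open DirichletCharacter (LFunction LFunction_eq_LSeries rootNumber differentiable_LFunction
  eq_one_iff_conductor_eq_one completedLFunction)
open scoped ComplexConjugate Real ArithmeticFunction.vonMangoldt

/-- The discrepancy between the summatory function of `a` and the linear function `m * t`. -/
noncomputable def sumDiscrepancy (a : ℕ → ℂ) (m : ℂ) (t : ℝ) : ℂ :=
  ∑ k ∈ Finset.Icc 1 ⌊t⌋₊, a k - m * t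

lemma measurable_sumDiscrepancy (a : ℕ → ℂ) (m : ℂ) : Measurable (sumDiscrepancy a m) := by
  unfold sumDiscrepancy
  have h : Measurable fun t : ℝ => ∑ k ∈ Finset.Icc 1 ⌊t⌋₊, a k :=
    (measurable_from_nat (f := fun n => ∑ k ∈ Finset.Icc 1 n, a k)).comp Nat.measurable_floor
  fun_prop

lemma differentiableAt_integral_Ioi_mul_cpow {u : ℝ → ℂ} (hu : Measurable u) {B c : ℝ} (hc : 0 < c)
    (hB : ∀ t, c ≤ t → ‖u t‖ ≤ B) {s : ℂ} (hs : 0 < s.re) :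
    DifferentiableAt ℂ (fun z : ℂ => ∫ t in Ioi c, u t * (t : ℂ) ^ (-(z + 1))) s := by
  set f : ℝ → ℂ := (Ioi c).indicator u with hf
  have hfm : Measurable f := hu.indicator measurableSet_Ioi
  have hB0 : 0 ≤ B := (norm_nonneg _).trans (hB c le_rfl)
  have hfB : ∀ t, ‖f t‖ ≤ B := by
    intro t
    by_cases ht : t ∈ Ioi c
    · simpa [hf, ht] using hB t (le_of_lt ht)
    · simpa [hf, ht] using hB0
  have h1 : DifferentiableAt ℂ (mellin f) (-s) := by
    refine mellin_differentiableAt_of_isBigO_rpow (a := 0) (b := -s.re - 1) ?_ ?_ (by simpa) ?_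
      (by simp)
    · refine LocallyIntegrable.locallyIntegrableOn ?_ _
      intro x
      refine ⟨Set.Icc (x - 1) (x + 1), Icc_mem_nhds (by linarith) (by linarith), ?_⟩
      exact Measure.integrableOn_of_bounded (M := B) (by simp) hfm.aestronglyMeasurable
        (ae_of_all _ hfB)
    · simp only [neg_zero, rpow_zero]
      exact Asymptotics.IsBigO.of_bound B (Eventually.of_forall fun t => by simpa using hfB t)
    · refine Asymptotics.IsBigO.of_bound 1 ?_
      have : ∀ᶠ t in 𝓝[>] (0:ℝ), t < c := by
        apply mem_nhdsWithin_of_mem_nhds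
        exact Iio_mem_nhds hc
      filter_upwards [this] with t ht
      have : t ∉ Ioi c := by simp [ht.le]
      simp [hf, this]
  have h2 : (fun z : ℂ => ∫ t in Ioi c, u t * (t : ℂ) ^ (-(z + 1))) = fun z => mellin f (-z) := by
    ext z
    rw [mellin]
    have : ∀ t : ℝ, (t : ℂ) ^ (-z - 1) • f t =
        (Ioi c).indicator (fun t : ℝ => u t * (t : ℂ) ^ (-(z + 1))) t := by
      intro t
      by_cases ht : t ∈ Ioi c
      · simp only [hf, indicator_of_mem ht, smul_eq_mul]
        rw [mul_comm]; congr 2; ring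
      · simp [hf, indicator_of_notMem ht]
    simp_rw [this]
    rw [setIntegral_indicator measurableSet_Ioi]
    congr 2
    ext t; simp only [Set.mem_Ioi, Set.mem_inter_iff]
    constructor
    · intro h; exact ⟨hc.trans h, h⟩
    · exact fun h => h.2
  rw [h2]
  exact h1.comp s differentiableAt_id.neg

lemma norm_integral_Ioi_mul_cpow_le {u : ℝ → ℂ} {B c : ℝ} (hc : 0 < c)
    (hB : ∀ t, c ≤ t → ‖u t‖ ≤ B) {s : ℂ} (hs : 0 < s.re) :
    ‖∫ t in Ioi c, u t * (t : ℂ) ^ (-(s + 1))‖ ≤ B * c ^ (-s.re) / s.re := by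
  have h := integral_Ioi_rpow_of_lt (a := -(s.re + 1)) (by linarith) hc
  have h' := integrableOn_Ioi_rpow_of_lt (a := -(s.re + 1)) (by linarith) hc
  calc _ ≤ ∫ t in Ioi c, B * t ^ (-(s.re + 1)) := by
        refine norm_integral_le_of_norm_le (h'.const_mul B) ?_
        refine (ae_restrict_iff' measurableSet_Ioi).2 (ae_of_all _ fun t ht => ?_)
        have ht' : 0 < t := hc.trans ht
        rw [norm_mul, norm_cpow_eq_rpow_re_of_pos ht']
        have e : (-(s + 1)).re = -(s.re + 1) := by simp
        rw [e]
        exact mul_le_mul_of_nonneg_right (hB t (le_of_lt ht)) (by positivity)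
    _ = _ := by
        rw [integral_const_mul, h]
        have : -(s.re + 1) + 1 = -s.re := by ring
        rw [this, neg_div_neg_eq, mul_div_assoc]

lemma LSeries_eq_partial_sum_add {a : ℕ → ℂ} {m : ℂ} {B : ℝ}
    (hB : ∀ t : ℝ, 1 ≤ t → ‖sumDiscrepancy a m t‖ ≤ B) {s : ℂ} (hs : 1 < s.re)
    (ha : LSeriesSummable a s) {N : ℕ} (hN : 1 ≤ N) :
    LSeries a s = ∑ n ∈ Finset.Icc 1 N, a n * (n : ℂ) ^ (-s) - sumDiscrepancy a m N * (N : ℂ) ^ (-s)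
      + m * (N : ℂ) ^ (1 - s) / (s - 1)
      + s * ∫ t in Ioi (N : ℝ), sumDiscrepancy a m t * (t : ℂ) ^ (-(s + 1)) := by
  set b : ℕ → ℂ := fun n => if n ∈ Finset.Icc 1 N then a n else 0 with hb
  set a' : ℕ → ℂ := fun n => if N < n then a n else 0 with ha'
  have hterm : ∀ n, LSeries.term a s n = LSeries.term b s n + LSeries.term a' s n := by
    intro n
    rcases eq_or_ne n 0 with rfl | hn
    · simp
    · simp only [LSeries.term_of_ne_zero hn, hb, ha', Finset.mem_Icc]
      have : 1 ≤ n := Nat.one_le_iff_ne_zero.2 hn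
      by_cases h : N < n
      · have : ¬ (n ≤ N) := by omega
        simp [h, this]
      · have h2 : n ≤ N := by omega
        simp [h, h2, this]
  have hbs : HasSum (LSeries.term b s) (∑ n ∈ Finset.Icc 1 N, a n * (n : ℂ) ^ (-s)) := by
    have h0 : ∀ n ∉ Finset.Icc 1 N, LSeries.term b s n = 0 := by
      intro n hn
      rcases eq_or_ne n 0 with rfl | hn0
      · simp
      · rw [LSeries.term_of_ne_zero hn0, hb]; simp only [if_neg hn, zero_div]
    have h1 : ∑ n ∈ Finset.Icc 1 N, a n * (n : ℂ) ^ (-s) =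
        ∑ n ∈ Finset.Icc 1 N, LSeries.term b s n := ?_
    · rw [h1]
      exact hasSum_sum_of_ne_finset_zero h0
    refine sum_congr rfl fun n hn => ?_
    have hn0 : n ≠ 0 := by have := (Finset.mem_Icc.1 hn).1; omega
    rw [LSeries.term_of_ne_zero hn0, cpow_neg]
    simp only [hb, hn, if_true, div_eq_mul_inv]
  have ha's : LSeriesSummable a' s := by
    have : LSeries.term a' s = fun n => LSeries.term a s n - LSeries.term b s n := by
      ext n; rw [hterm]; ring
    rw [LSeriesSummable, this]
    exact Summable.sub ha hbs.summable
  have hsum : LSeries a s = ∑ n ∈ Finset.Icc 1 N, a n * (n : ℂ) ^ (-s) + LSeries a' s := by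
    rw [LSeries, LSeries, ← hbs.tsum_eq, ← hbs.summable.tsum_add ha's]
    exact tsum_congr hterm
  have hNR : (1 : ℝ) ≤ N := by exact_mod_cast hN
  have hN0 : (0 : ℝ) < N := by linarith
  have hpart : ∀ M : ℕ, ∑ k ∈ Finset.Icc 1 M, a' k =
      if N < M then ∑ k ∈ Finset.Icc 1 M, a k - ∑ k ∈ Finset.Icc 1 N, a k else 0 := by
    intro M
    split_ifs with h
    · rw [← Finset.sum_sdiff (f := a)
        (Finset.Icc_subset_Icc_right h.le : Finset.Icc 1 N ⊆ Finset.Icc 1 M), add_sub_cancel_right]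
      rw [← Finset.sum_sdiff (Finset.Icc_subset_Icc_right h.le : Finset.Icc 1 N ⊆ Finset.Icc 1 M)]
      rw [sum_congr rfl (g := a), add_eq_left]
      · refine sum_eq_zero fun k hk => ?_
        have := (Finset.mem_Icc.1 hk).2
        simp only [ha']; rw [if_neg (by omega)]
      · intro k hk
        simp only [Finset.mem_sdiff, Finset.mem_Icc] at hk
        simp only [ha']; rw [if_pos (by omega)]
    · refine sum_eq_zero fun k hk => ?_
      have := (Finset.mem_Icc.1 hk).2
      simp only [ha']; rw [if_neg (by omega)]
  have hO : (fun n ↦ ∑ k ∈ Finset.Icc 1 n, a' k) =O[atTop] fun n : ℕ ↦ (n : ℝ) ^ (1 : ℝ) := by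
    refine Asymptotics.IsBigO.of_bound (2 * B + ‖m‖ * 2) ?_
    filter_upwards [eventually_ge_atTop 1] with n hn
    have hB0 : 0 ≤ B := (norm_nonneg _).trans (hB 1 le_rfl)
    have hnR : (1 : ℝ) ≤ n := by exact_mod_cast hn
    have key : ∀ k : ℕ, 1 ≤ k → k ≤ n → ‖∑ j ∈ Finset.Icc 1 k, a j‖ ≤ B + ‖m‖ * n := by
      intro k hk hkn
      have h1 := hB k (by exact_mod_cast hk)
      have h2 : ∑ j ∈ Finset.Icc 1 k, a j = sumDiscrepancy a m k + m * k := by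
        simp [sumDiscrepancy]
      rw [h2]
      refine (norm_add_le _ _).trans (add_le_add h1 ?_)
      rw [norm_mul]
      gcongr
      simpa using hkn
    rw [hpart, rpow_one, norm_of_nonneg (by positivity)]
    split_ifs with h
    · refine (norm_sub_le _ _).trans ?_
      have := key n hn le_rfl
      have := key N hN h.le
      nlinarith [norm_nonneg m]
    · simp; positivity
  rw [hsum, LSeries_eq_mul_integral a' zero_le_one hs ha's hO]
  have hint : ∫ t in Ioi (1 : ℝ), (∑ k ∈ Finset.Icc 1 ⌊t⌋₊, a' k) * (t : ℂ) ^ (-(s + 1)) =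
      ∫ t in Ioi (N : ℝ), (∑ k ∈ Finset.Icc 1 ⌊t⌋₊, a k - ∑ k ∈ Finset.Icc 1 N, a k) *
        (t : ℂ) ^ (-(s + 1)) := by
    have h1 : ∀ t ∈ Ioi (1 : ℝ), (∑ k ∈ Finset.Icc 1 ⌊t⌋₊, a' k) * (t : ℂ) ^ (-(s + 1)) =
        (Ioi (N : ℝ)).indicator (fun t : ℝ => (∑ k ∈ Finset.Icc 1 ⌊t⌋₊, a k -
          ∑ k ∈ Finset.Icc 1 N, a k) * (t : ℂ) ^ (-(s + 1))) t := by
      intro t ht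
      have ht0 : (0:ℝ) ≤ t := by have : (1:ℝ) < t := ht; linarith
      rw [hpart]
      by_cases h : t ∈ Ioi (N : ℝ)
      · rw [indicator_of_mem h]
        have hle : N ≤ ⌊t⌋₊ := Nat.le_floor (le_of_lt h)
        rcases hle.lt_or_eq with h' | h'
        · simp [h']
        · simp [← h']
      · rw [indicator_of_notMem h]
        have h3 : t ≤ N := by simpa using h
        have : ¬ (N < ⌊t⌋₊) := by
          rw [not_lt]
          exact Nat.floor_le_of_le h3
        simp [this]
    rw [setIntegral_congr_fun measurableSet_Ioi h1, setIntegral_indicator measurableSet_Ioi]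
    congr 2
    ext t; simp only [Set.mem_Ioi, Set.mem_inter_iff]
    exact ⟨fun h => h.2, fun h => ⟨by linarith, h⟩⟩
  rw [hint]
  have hre : (-(s + 1)).re < -1 := by simp; linarith
  have hre' : (-s).re < -1 := by simp; linarith
  have hI1 := integrableOn_Ioi_cpow_of_lt hre hN0
  have hI2 := integrableOn_Ioi_cpow_of_lt hre' hN0
  have hdm := measurable_sumDiscrepancy a m
  have hI3 : IntegrableOn (fun t : ℝ => sumDiscrepancy a m t * (t : ℂ) ^ (-(s + 1))) (Ioi (N : ℝ)) := by
    refine Integrable.bdd_mul (c := B) hI1 hdm.aestronglyMeasurable ?_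
    refine (ae_restrict_iff' measurableSet_Ioi).2 (ae_of_all _ fun t ht => ?_)
    exact hB t (by have : (N : ℝ) < t := ht; linarith)
  have hpt : ∀ t ∈ Ioi (N : ℝ), (∑ k ∈ Finset.Icc 1 ⌊t⌋₊, a k - ∑ k ∈ Finset.Icc 1 N, a k) *
        (t : ℂ) ^ (-(s + 1)) = sumDiscrepancy a m t * (t : ℂ) ^ (-(s + 1)) + (m * (t : ℂ) ^ (-s)
        - (∑ k ∈ Finset.Icc 1 N, a k) * (t : ℂ) ^ (-(s + 1))) := by
    intro t ht
    have ht0 : (t : ℂ) ≠ 0 := by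
      have : (N : ℝ) < t := ht
      exact_mod_cast (hN0.trans this).ne'
    have : (t : ℂ) ^ (-s) = t * (t : ℂ) ^ (-(s + 1)) := by
      rw [show -s = 1 + -(s + 1) by ring, cpow_add _ _ ht0, cpow_one]
    rw [this, sumDiscrepancy]
    ring
  have hI4 : IntegrableOn (fun t : ℝ => m * (t : ℂ) ^ (-s)
        - (∑ k ∈ Finset.Icc 1 N, a k) * (t : ℂ) ^ (-(s + 1))) (Ioi (N : ℝ)) :=
    (hI2.const_mul m).sub (hI1.const_mul _)
  rw [setIntegral_congr_fun measurableSet_Ioi hpt, integral_add hI3 hI4, integral_sub (hI2.const_mul m) (hI1.const_mul _), integral_const_mul,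
    integral_const_mul, integral_Ioi_cpow_of_lt hre hN0, integral_Ioi_cpow_of_lt hre' hN0]
  have hs0 : s ≠ 0 := by rintro rfl; simp at hs; linarith
  have hs1 : s - 1 ≠ 0 := by
    intro h; have : s = 1 := by linear_combination h
    rw [this] at hs; simp at hs
  have hNc : (N : ℂ) ≠ 0 := by exact_mod_cast hN0.ne'
  have e1 : -(s + 1) + 1 = -s := by ring
  have e2 : -s + 1 = 1 - s := by ring
  have e3 : (N : ℂ) ^ (1 - s) = N * (N : ℂ) ^ (-s) := by
    rw [sub_eq_add_neg, cpow_add _ _ hNc, cpow_one]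
  have e4 : ∑ k ∈ Finset.Icc 1 N, a k = sumDiscrepancy a m N + m * N := by simp [sumDiscrepancy]
  have hs1' : (1 - s) ≠ 0 := by intro h; apply hs1; linear_combination -h
  have e5 : (1 - s) = -(s - 1) := by ring
  push_cast
  rw [e1, e2, e3, e4, e5]
  field_simp
  ring

/-- Partial summation, continued analytically to the half plane `0 < re s`. -/
theorem eq_partial_sum_add_of_differentiableOn {a : ℕ → ℂ} {m : ℂ} {B : ℝ}
    (hB : ∀ t : ℝ, 1 ≤ t → ‖sumDiscrepancy a m t‖ ≤ B)
    (ha : ∀ s : ℂ, 1 < s.re → LSeriesSummable a s) {G : ℂ → ℂ}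
    (hG : DifferentiableOn ℂ G {s | 0 < s.re})
    (hGL : ∀ s : ℂ, 1 < s.re → G s = (s - 1) * LSeries a s) {N : ℕ} (hN : 1 ≤ N) {s : ℂ}
    (hs : 0 < s.re) :
    G s = (s - 1) * (∑ n ∈ Finset.Icc 1 N, a n * (n : ℂ) ^ (-s) -
        sumDiscrepancy a m N * (N : ℂ) ^ (-s)
      + s * ∫ t in Ioi (N : ℝ), sumDiscrepancy a m t * (t : ℂ) ^ (-(s + 1)))
      + m * (N : ℂ) ^ (1 - s) := by
  have hNR : (1 : ℝ) ≤ N := by exact_mod_cast hN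
  have hN0 : (0 : ℝ) < N := by linarith
  have hNc : (N : ℂ) ≠ 0 := by exact_mod_cast hN0.ne'
  have hopen : IsOpen {s : ℂ | 0 < s.re} := isOpen_lt continuous_const continuous_re
  set R : ℂ → ℂ := fun s => (s - 1) * (∑ n ∈ Finset.Icc 1 N, a n * (n : ℂ) ^ (-s) -
        sumDiscrepancy a m N * (N : ℂ) ^ (-s)
      + s * ∫ t in Ioi (N : ℝ), sumDiscrepancy a m t * (t : ℂ) ^ (-(s + 1)))
      + m * (N : ℂ) ^ (1 - s) with hR
  have hRd : DifferentiableOn ℂ R {s | 0 < s.re} := by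
    intro z hz
    refine DifferentiableAt.differentiableWithinAt ?_
    have h1 := differentiableAt_integral_Ioi_mul_cpow (measurable_sumDiscrepancy a m) hN0
      (fun t ht => hB t (hNR.trans ht)) hz
    have h2 : DifferentiableAt ℂ (fun s : ℂ => ∑ n ∈ Finset.Icc 1 N, a n * (n : ℂ) ^ (-s)) z := by
      refine DifferentiableAt.fun_sum fun n hn => ?_
      have : (n : ℂ) ≠ 0 := by
        have := (Finset.mem_Icc.1 hn).1
        exact_mod_cast (by omega : n ≠ 0)
      exact (differentiableAt_id.neg.const_cpow (Or.inl this)).const_mul _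
    have h3 : DifferentiableAt ℂ (fun s : ℂ => (N : ℂ) ^ (-s)) z :=
      differentiableAt_id.neg.const_cpow (Or.inl hNc)
    have h4 : DifferentiableAt ℂ (fun s : ℂ => (N : ℂ) ^ (1 - s)) z :=
      (differentiableAt_id.const_sub 1).const_cpow (Or.inl hNc)
    simp only [hR]
    exact ((differentiableAt_id.sub_const 1).mul ((h2.sub (h3.const_mul _)).add
      (differentiableAt_id.mul h1))).add (h4.const_mul _)
  have hpre : IsPreconnected {s : ℂ | 0 < s.re} := (convex_halfSpace_re_gt 0).isPreconnected
  have heq := (hG.analyticOnNhd hopen).eqOn_of_preconnected_of_eventuallyEq (hRd.analyticOnNhd hopen)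
    hpre (show (2 : ℂ) ∈ {s : ℂ | 0 < s.re} by simp) (by
      have : {s : ℂ | 1 < s.re} ∈ 𝓝 (2 : ℂ) :=
        (isOpen_lt continuous_const continuous_re).mem_nhds (by simp)
      filter_upwards [this] with z hz
      have hz' : 1 < z.re := hz
      have hz1 : z - 1 ≠ 0 := by
        intro h; have : z = 1 := by linear_combination h
        rw [this] at hz'; simp at hz'
      rw [hGL z hz', LSeries_eq_partial_sum_add hB hz' (ha z hz') hN, hR]
      field_simp
      ring)
  exact heq hs

lemma rpow_neg_telescope {d : ℝ} (hd : 0 < d) {k : ℕ} (hk : 1 ≤ k) :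
    ((k + 1 : ℕ) : ℝ) ^ (-(1 + d)) ≤ ((k : ℝ) ^ (-d) - ((k + 1 : ℕ) : ℝ) ^ (-d)) / d := by
  have hk0 : (0 : ℝ) < k := by exact_mod_cast hk
  have hk1 : (0 : ℝ) < ((k + 1 : ℕ) : ℝ) := by positivity
  have hlog : log k ≤ log ((k + 1 : ℕ) : ℝ) - 1 / ((k + 1 : ℕ) : ℝ) := by
    have h := log_le_sub_one_of_pos (div_pos hk0 hk1)
    rw [log_div hk0.ne' hk1.ne'] at h
    have h2 : (k : ℝ) / ((k + 1 : ℕ) : ℝ) - 1 = -(1 / ((k + 1 : ℕ) : ℝ)) := by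
      push_cast; field_simp; ring
    linarith
  have h1 : (k : ℝ) ^ (-d) ≥ ((k + 1 : ℕ) : ℝ) ^ (-d) * (1 + d / ((k + 1 : ℕ) : ℝ)) := by
    rw [rpow_def_of_pos hk0, rpow_def_of_pos hk1]
    calc exp (log ((k + 1 : ℕ) : ℝ) * -d) * (1 + d / ((k + 1 : ℕ) : ℝ))
        ≤ exp (log ((k + 1 : ℕ) : ℝ) * -d) * exp (d / ((k + 1 : ℕ) : ℝ)) := by
          gcongr
          linarith [add_one_le_exp (d / ((k + 1 : ℕ) : ℝ))]
      _ = exp (log ((k + 1 : ℕ) : ℝ) * -d + d / ((k + 1 : ℕ) : ℝ)) := by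
          rw [exp_add]
      _ ≤ _ := by
          apply exp_le_exp.mpr
          have : d / ((k + 1 : ℕ) : ℝ) = d * (1 / ((k + 1 : ℕ) : ℝ)) := by ring
          rw [this]
          nlinarith
  rw [le_div_iff₀ hd]
  have h3 : ((k + 1 : ℕ) : ℝ) ^ (-(1 + d)) = ((k + 1 : ℕ) : ℝ) ^ (-d) / ((k + 1 : ℕ) : ℝ) := by
    rw [show -(1 + d) = -d + -1 by ring, rpow_add hk1, rpow_neg_one, div_eq_mul_inv]
  rw [h3]
  have : ((k + 1 : ℕ) : ℝ) ^ (-d) * (1 + d / ((k + 1 : ℕ) : ℝ)) =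
    ((k + 1 : ℕ) : ℝ) ^ (-d) + ((k + 1 : ℕ) : ℝ) ^ (-d) / ((k + 1 : ℕ) : ℝ) * d := by ring
  linarith

lemma sum_Icc_rpow_neg_le {d : ℝ} (hd : 0 < d) (N : ℕ) :
    ∑ n ∈ Finset.Icc 1 N, (n : ℝ) ^ (-(1 + d)) ≤ 1 + 1 / d := by
  rcases Nat.eq_zero_or_pos N with rfl | hN
  · simp; positivity
  suffices h : ∑ n ∈ Finset.Icc 1 N, (n : ℝ) ^ (-(1 + d)) ≤ 1 + (1 - (N : ℝ) ^ (-d)) / d by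
    refine h.trans ?_
    have : (0 : ℝ) ≤ (N : ℝ) ^ (-d) := by positivity
    gcongr
    linarith
  induction N, hN using Nat.le_induction with
  | base => simp
  | succ k hk ih =>
    rw [sum_Icc_succ_top (by omega)]
    have := rpow_neg_telescope hd hk
    calc _ ≤ 1 + (1 - (k : ℝ) ^ (-d)) / d + ((k : ℝ) ^ (-d) - ((k + 1 : ℕ) : ℝ) ^ (-d)) / d :=
          add_le_add ih this
      _ = _ := by ring

lemma norm_LSeries_term_le {a : ℕ → ℂ} (ha : ∀ n, ‖a n‖ ≤ 1) (s : ℂ) {n : ℕ} (hn : n ≠ 0) :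
    ‖LSeries.term a s n‖ ≤ (n : ℝ) ^ (-s.re) := by
  rw [LSeries.norm_term_eq, if_neg hn, rpow_neg (by positivity), ← one_div]
  gcongr
  exact ha n

lemma norm_LSeries_le_of_sum_rpow_le {a : ℕ → ℂ} (ha : ∀ n, ‖a n‖ ≤ 1) {s : ℂ} {C : ℝ}
    (hs : 1 < s.re) (hC : ∀ N : ℕ, ∑ n ∈ Finset.Icc 1 N, (n : ℝ) ^ (-s.re) ≤ C) :
    ‖LSeries a s‖ ≤ C := by
  have hsum : Summable fun n => ‖LSeries.term a s n‖ :=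
    (LSeriesSummable_of_bounded_of_one_lt_re (fun n _ => ha n) hs).norm
  refine (norm_tsum_le_tsum_norm hsum).trans ?_
  refine Real.tsum_le_of_sum_range_le (fun _ => norm_nonneg _) fun N => ?_
  have h1 : ∑ n ∈ Finset.range N, ‖LSeries.term a s n‖ ≤
      ∑ n ∈ Finset.Icc 1 N, ‖LSeries.term a s n‖ := by
    rw [← Finset.sum_filter_add_sum_filter_not (Finset.range N) (fun n => n = 0)]
    have : ∑ n ∈ Finset.range N with n = 0, ‖LSeries.term a s n‖ = 0 := by
      refine sum_eq_zero fun n hn => ?_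
      rw [(mem_filter.mp hn).2]; simp
    rw [this, zero_add]
    refine sum_le_sum_of_subset_of_nonneg (fun n hn => ?_) fun _ _ _ => norm_nonneg _
    simp only [mem_filter, Finset.mem_range] at hn
    simp only [Finset.mem_Icc]; omega
  exact h1.trans (le_trans (sum_le_sum fun n hn => norm_LSeries_term_le ha s
    (n := n) (by simp only [Finset.mem_Icc] at hn; omega)) (hC N))

/-- A Dirichlet series with coefficients bounded by `1` is bounded by `1 + 1 / (σ - 1)`. -/
lemma norm_LSeries_le_of_norm_le_one {a : ℕ → ℂ} (ha : ∀ n, ‖a n‖ ≤ 1) {s : ℂ} (hs : 1 < s.re) :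
    ‖LSeries a s‖ ≤ 1 + 1 / (s.re - 1) :=
  norm_LSeries_le_of_sum_rpow_le ha hs fun N => by
    simpa using sum_Icc_rpow_neg_le (d := s.re - 1) (by linarith) N

lemma norm_LFunction_ge {N : ℕ} [NeZero N] (χ : DirichletCharacter ℂ N) {s : ℂ} (hs : 1 < s.re) :
    (1 + 1 / (s.re - 1))⁻¹ ≤ ‖LFunction χ s‖ := by
  rw [LFunction_eq_LSeries χ hs]
  have h := DirichletCharacter.LSeries.mul_mu_eq_one χ hs
  have h2 := norm_LSeries_le_of_norm_le_one
    (a := ((fun n : ℕ => χ n) * fun n => (ArithmeticFunction.moebius n : ℂ))) (s := s) (fun n => by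
      simp only [Pi.mul_apply, norm_mul]
      refine mul_le_one₀ (χ.norm_le_one _) (norm_nonneg _) ?_
      rw [Complex.norm_intCast]
      exact_mod_cast ArithmeticFunction.abs_moebius_le_one) hs
  have h3 := congrArg norm h
  rw [norm_mul, norm_one] at h3
  have hpos : 0 < 1 + 1 / (s.re - 1) := by have : 0 < s.re - 1 := by linarith
                                           positivity
  rw [inv_le_iff_one_le_mul₀ hpos]
  exact h3.symm.le.trans (by gcongr)

/-- A crude bound for `-L'/L` to the right of `1`. -/
lemma norm_LSeries_twist_vonMangoldt_le {N : ℕ} (χ : DirichletCharacter ℂ N) {s : ℂ}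
    (hs : 1 < s.re) :
    ‖LSeries ((fun n : ℕ => χ n) * fun n => (Λ n : ℂ)) s‖ ≤
      2 / (s.re - 1) * (1 + 2 / (s.re - 1)) := by
  set d := s.re - 1 with hd
  have hd0 : 0 < d := by linarith
  have h1 := norm_LSeries_le_of_norm_le_one (s := s - (d / 2 : ℝ))
    (a := fun n => χ n * (Λ n : ℂ) * ((d / 2 : ℝ) : ℂ) *
      (n : ℂ) ^ (-(d / 2 : ℝ) : ℂ)) (fun n => by
      rcases Nat.eq_zero_or_pos n with rfl | hn
      · simp
      have hn' : (0 : ℝ) < n := by exact_mod_cast hn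
      rw [norm_mul, norm_mul, norm_mul, Complex.norm_natCast_cpow_of_pos hn, norm_real,
        norm_real, norm_of_nonneg vonMangoldt_nonneg,
        norm_of_nonneg (by positivity)]
      simp only [neg_re, ofReal_re]
      have hlog : log n * (d / 2) ≤ (n : ℝ) ^ (d / 2) := by
        rw [mul_comm, ← log_rpow hn']
        exact (log_le_sub_one_of_pos (by positivity)).trans (by linarith)
      calc _ ≤ 1 * log n * (d / 2) * (n : ℝ) ^ (-(d / 2)) := by
            gcongr
            · exact χ.norm_le_one _
            · exact ArithmeticFunction.vonMangoldt_le_log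
        _ ≤ (n : ℝ) ^ (d / 2) * (n : ℝ) ^ (-(d / 2)) := by
            gcongr; linarith
        _ = 1 := by rw [← rpow_add hn']; simp) (by
      simp only [sub_re, ofReal_re]; linarith)
  have h2 : LSeries (fun n => χ n * (Λ n : ℂ) * ((d / 2 : ℝ) : ℂ) *
      (n : ℂ) ^ (-(d / 2 : ℝ) : ℂ)) (s - (d / 2 : ℝ)) = ((d / 2 : ℝ) : ℂ) *
      LSeries ((fun n : ℕ => χ n) * fun n => (Λ n : ℂ)) s := by
    rw [LSeries, LSeries, ← tsum_mul_left]
    congr 1; ext n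
    rcases eq_or_ne n 0 with rfl | hn
    · simp
    have hn' : (n : ℂ) ≠ 0 := by exact_mod_cast hn
    rw [LSeries.term_of_ne_zero hn, LSeries.term_of_ne_zero hn, Pi.mul_apply, cpow_sub _ _ hn',
      cpow_neg]
    have : (n : ℂ) ^ ((d / 2 : ℝ) : ℂ) ≠ 0 := by simp [cpow_eq_zero_iff, hn']
    have : (n : ℂ) ^ s ≠ 0 := by simp [cpow_eq_zero_iff, hn']
    field_simp
  rw [h2, norm_mul, norm_real, norm_of_nonneg (by positivity)] at h1
  simp only [sub_re, ofReal_re] at h1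
  have h4 : s.re - d / 2 - 1 = d / 2 := by rw [hd]; ring
  rw [h4] at h1
  have h5 : 1 + 1 / (d / 2) = 1 + 2 / d := by field_simp
  rw [h5] at h1
  calc _ = 2 / d * (d / 2 * ‖LSeries ((fun n : ℕ => χ n) *
        fun n => (Λ n : ℂ)) s‖) := by field_simp
    _ ≤ _ := by gcongr

lemma norm_gaussSum_inv {N : ℕ} [NeZero N] (χ : DirichletCharacter ℂ N) :
    ‖gaussSum χ⁻¹ (ZMod.stdAddChar (N := N))‖ = ‖gaussSum χ (ZMod.stdAddChar (N := N))‖ := by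
  have h : gaussSum χ⁻¹ (ZMod.stdAddChar (N := N)) =
      χ (-1) * (starRingEnd ℂ) (gaussSum χ (ZMod.stdAddChar (N := N))) := by
    rw [gaussSum, gaussSum, map_sum, mul_sum,
      ← Equiv.sum_comp (Equiv.neg (ZMod N)) (fun x => χ⁻¹ x * ZMod.stdAddChar x)]
    refine sum_congr rfl fun a _ => ?_
    rw [Equiv.neg_apply, map_mul, AddChar.map_neg_eq_conj]
    have h1 : χ⁻¹ (-a) = χ (-1) * (starRingEnd ℂ) (χ a) := by
      rw [← MulChar.star_eq_inv, MulChar.star_apply, ← neg_one_mul, map_mul, star_mul', ← MulChar.star_apply χ (-1), MulChar.star_eq_inv]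
      congr 1
      rcases χ.even_or_odd with h | h
      · rw [MulChar.inv_apply_eq_inv', h, inv_one]
      · rw [MulChar.inv_apply_eq_inv', h]; norm_num
    rw [h1]; ring
  rw [h, norm_mul, RCLike.norm_conj]
  rcases χ.even_or_odd with h | h <;> rw [h] <;> simp

lemma completedLFunction_two_ne_zero {N : ℕ} [NeZero N] (χ : DirichletCharacter ℂ N) :
    completedLFunction χ 2 ≠ 0 := by
  intro h
  have h2 : LFunction χ 2 = 0 := by
    rw [DirichletCharacter.LFunction_eq_completed_div_gammaFactor χ 2 (Or.inl two_ne_zero), h,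
      zero_div]
  exact DirichletCharacter.LFunction_ne_zero_of_one_le_re χ (Or.inr (by norm_num)) (by norm_num) h2

lemma norm_rootNumber {N : ℕ} [NeZero N] {χ : DirichletCharacter ℂ N} (hχ : χ.IsPrimitive) :
    ‖rootNumber χ‖ = 1 := by
  have hχ' : χ⁻¹.IsPrimitive := by
    rw [DirichletCharacter.isPrimitive_def] at *
    rw [DirichletCharacter.conductor_inv, hχ]
  have hN : (N : ℂ) ≠ 0 := NeZero.ne _
  have h1 := hχ.completedLFunction_one_sub (-1)
  have h2 := hχ'.completedLFunction_one_sub 2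
  rw [inv_inv] at h2
  norm_num at h1 h2
  have h3 : rootNumber χ * rootNumber χ⁻¹ = 1 := by
    rw [h2] at h1
    have h4 : (N : ℂ) ^ (-(3 / 2) : ℂ) * (N : ℂ) ^ (3 / 2 : ℂ) = 1 := by
      rw [← cpow_add _ _ hN]; simp
    apply mul_right_cancel₀ (completedLFunction_two_ne_zero χ)
    rw [one_mul]
    nth_rw 2 [h1]
    linear_combination -(rootNumber χ * rootNumber χ⁻¹ * completedLFunction χ 2) * h4
  have h4 : ‖rootNumber χ⁻¹‖ = ‖rootNumber χ‖ := by
    have hI : ∀ p : Prop, [Decidable p] → ‖I ^ (if p then 0 else 1)‖ = 1 := by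
      intro p _; split_ifs <;> simp
    rw [rootNumber, rootNumber, norm_div, norm_div, norm_div,
      norm_div, hI, hI, norm_gaussSum_inv]
  have h5 := congrArg norm h3
  rw [norm_mul, h4, norm_one] at h5
  nlinarith [norm_nonneg (rootNumber χ)]

lemma norm_cos_le_cosh (z : ℂ) : ‖Complex.cos z‖ ≤ cosh z.im := by
  rw [Complex.cos, cosh_eq, norm_div]
  have h : ‖cexp (z * I) + cexp (-z * I)‖ ≤ exp z.im + exp (-z.im) := by
    refine (norm_add_le _ _).trans ?_
    rw [norm_exp, norm_exp]; simp [add_comm]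
  simpa using div_le_div_of_nonneg_right h (by norm_num : (0 : ℝ) ≤ 2)

lemma norm_sin_le_cosh (z : ℂ) : ‖Complex.sin z‖ ≤ cosh z.im := by
  rw [← Complex.cos_sub_pi_div_two]
  refine (norm_cos_le_cosh _).trans (le_of_eq ?_)
  congr 1
  simp [← ofReal_ofNat, ← ofReal_div]

/-- The functional equation for primitive characters, as a bound for `L` to the left of `1/2`. -/
lemma norm_LFunction_one_sub_le_of_le {N : ℕ} [NeZero N] {χ : DirichletCharacter ℂ N}
    (hχ : χ.IsPrimitive) (hN : N ≠ 1) {s : ℂ} (hs : 0 < s.re) {M : ℝ}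
    (hcos : ‖Complex.cos (π * s / 2)‖ ≤ M) (hsin : ‖Complex.sin (π * s / 2)‖ ≤ M) :
    ‖LFunction χ (1 - s)‖ ≤ (N : ℝ) ^ (s.re - 1 / 2) *
      (‖Gammaℂ s‖ * M) * ‖LFunction χ⁻¹ s‖ := by
  have hN0 : 0 < N := Nat.pos_of_ne_zero (NeZero.ne N)
  have hs0 : ∀ n : ℕ, s ≠ -n := by
    intro n h; rw [h] at hs; simp at hs; linarith [(Nat.cast_nonneg n : (0 : ℝ) ≤ n)]
  rw [DirichletCharacter.LFunction_eq_completed_div_gammaFactor χ _ (Or.inr hN),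
    DirichletCharacter.LFunction_eq_completed_div_gammaFactor χ⁻¹ _ (Or.inr hN),
    hχ.completedLFunction_one_sub]
  have hnN : ‖(N : ℂ) ^ (s - 1 / 2)‖ = (N : ℝ) ^ (s.re - 1 / 2) := by
    rw [norm_natCast_cpow_of_pos hN0]; simp
  have key : ‖(DirichletCharacter.gammaFactor χ (1 - s))⁻¹‖ ≤
      ‖Gammaℂ s‖ * M *
        ‖(DirichletCharacter.gammaFactor χ⁻¹ s)⁻¹‖ := by
    rcases χ.even_or_odd with h | h
    · have h' : χ⁻¹.Even := by
        rw [DirichletCharacter.Even, MulChar.inv_apply_eq_inv', h, inv_one]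
      rw [h.gammaFactor_def, h'.gammaFactor_def, inv_Gammaℝ_one_sub hs0, norm_mul, norm_mul]
      gcongr
    · have h' : χ⁻¹.Odd := by
        rw [DirichletCharacter.Odd, MulChar.inv_apply_eq_inv', h]; norm_num
      rw [h.gammaFactor_def, h'.gammaFactor_def, show (1 - s + 1) = 2 - s by ring,
        inv_Gammaℝ_two_sub hs0, norm_mul, norm_mul]
      gcongr
  rw [div_eq_mul_inv, norm_mul, norm_mul, norm_mul, hnN, norm_rootNumber hχ, div_eq_mul_inv (completedLFunction χ⁻¹ s),
    norm_mul, mul_one]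
  calc _ ≤ (N : ℝ) ^ (s.re - 1 / 2) * ‖completedLFunction χ⁻¹ s‖ *
        (‖Gammaℂ s‖ * M *
        ‖(DirichletCharacter.gammaFactor χ⁻¹ s)⁻¹‖) := by gcongr
    _ = _ := by ring

lemma norm_LFunction_one_sub_le {N : ℕ} [NeZero N] {χ : DirichletCharacter ℂ N}
    (hχ : χ.IsPrimitive) (hN : N ≠ 1) {s : ℂ} (hs : 0 < s.re) :
    ‖LFunction χ (1 - s)‖ ≤ (N : ℝ) ^ (s.re - 1 / 2) *
      (‖Gammaℂ s‖ * cosh (π * s.im / 2)) * ‖LFunction χ⁻¹ s‖ := by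
  have him : (π * s / 2).im = π * s.im / 2 := by
    rw [← ofReal_ofNat, div_ofReal_im, im_ofReal_mul]
  rw [← him]
  exact norm_LFunction_one_sub_le_of_le hχ hN hs (norm_cos_le_cosh _) (norm_sin_le_cosh _)

lemma norm_Gamma_le {s : ℂ} (hs : 0 < s.re) : ‖Gamma s‖ ≤ Real.Gamma s.re := by
  rw [Complex.Gamma_eq_integral hs, Real.Gamma_eq_integral hs, Complex.GammaIntegral]
  refine (norm_integral_le_integral_norm _).trans (le_of_eq ?_)
  refine setIntegral_congr_fun measurableSet_Ioi fun x hx => ?_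
  simp only [norm_mul, norm_real]
  rw [norm_cpow_eq_rpow_re_of_pos hx, norm_of_nonneg (exp_pos _).le]
  simp

lemma norm_Gamma_one_add_mul_I_sq {t : ℝ} (ht : t ≠ 0) :
    ‖Gamma (1 + t * I)‖ ^ 2 = π * t / sinh (π * t) := by
  have h1 : Gamma (1 + t * I) = t * I * Gamma (t * I) := by
    rw [add_comm, Gamma_add_one]
    simpa using ht
  have h2 := Complex.Gamma_mul_Gamma_one_sub (t * I)
  have h3 : Gamma (1 - t * I) = (starRingEnd ℂ) (Gamma (1 + t * I)) := by
    rw [← Complex.Gamma_conj]; congr 1; simp [sub_eq_add_neg]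
  have h4 : Gamma (1 + t * I) * (starRingEnd ℂ) (Gamma (1 + t * I)) =
      ((π * t / sinh (π * t) : ℝ) : ℂ) := by
    rw [← h3, h1, mul_assoc, h2, show (π : ℂ) * (t * I) = ((π * t : ℝ) : ℂ) * I by
      push_cast; ring, Complex.sin_mul_I]
    push_cast
    have : Complex.sinh (π * t) ≠ 0 := by
      have h5 : sinh (π * t) ≠ 0 := by
        rw [Ne, Real.sinh_eq_zero]; exact mul_ne_zero pi_ne_zero ht
      exact_mod_cast h5
    field_simp
  rw [Complex.mul_conj] at h4
  have := ofReal_injective h4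
  rw [← this, Complex.normSq_eq_norm_sq]

lemma norm_sum_range_character_le {N : ℕ} [NeZero N] {χ : DirichletCharacter ℂ N} (hχ : χ ≠ 1)
    (n : ℕ) : ‖∑ k ∈ Finset.range n, χ k‖ ≤ N := by
  have hT : ∀ n : ℕ, ∑ i ∈ Finset.range N, χ ((n + i : ℕ) : ZMod N) = 0 := by
    intro n
    induction n with
    | zero =>
      have h := χ.sum_eq_zero_of_ne_one hχ
      rw [← h]
      refine Finset.sum_bij' (fun i _ => (i : ZMod N)) (fun a _ => a.val) (by simp)
        (fun a _ => by simpa using ZMod.val_lt a) (fun i hi => ?_) (by simp) (by simp)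
      simpa using Nat.mod_eq_of_lt (Finset.mem_range.1 hi)
    | succ n ih =>
      have h1 := sum_range_succ (fun i => χ ((n + i : ℕ) : ZMod N)) N
      have h2 := sum_range_succ' (fun i => χ ((n + i : ℕ) : ZMod N)) N
      rw [h1, ih] at h2
      have h3 : χ ((n + N : ℕ) : ZMod N) = χ ((n + 0 : ℕ) : ZMod N) := by simp
      rw [h3] at h2
      have h4 : ∑ k ∈ Finset.range N, χ ((n + (k + 1) : ℕ) : ZMod N) =
          ∑ k ∈ Finset.range N, χ ((n + 1 + k : ℕ) : ZMod N) :=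
        sum_congr rfl fun i _ => by rw [add_assoc n 1 i, add_comm 1 i]
      rw [h4, zero_add] at h2
      exact add_eq_right.mp h2.symm
  induction n using Nat.strong_induction_on with
  | _ n ih =>
    rcases lt_or_ge n N with h | h
    · refine (norm_sum_le_of_le _ (fun k _ => χ.norm_le_one _)).trans ?_
      simpa using h.le
    · have hN : 0 < N := Nat.pos_of_ne_zero (NeZero.ne N)
      have := ih (n - N) (by omega)
      have h1 : n = n - N + N := by omega
      rw [h1, Finset.sum_range_add, hT, add_zero]
      exact this

lemma norm_sumDiscrepancy_character_le {N : ℕ} [NeZero N] {χ : DirichletCharacter ℂ N}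
    (hχ : χ ≠ 1) (t : ℝ) : ‖sumDiscrepancy (fun n => χ n) 0 t‖ ≤ N := by
  rcases eq_or_ne N 1 with rfl | hN
  · exact absurd (Subsingleton.elim χ 1) hχ
  have h := norm_sum_range_character_le hχ (⌊t⌋₊ + 1)
  rw [sumDiscrepancy, zero_mul, sub_zero]
  rw [sum_range_succ'] at h
  rw [Nat.cast_zero, χ.map_zero' hN, add_zero] at h
  have : ∑ k ∈ Finset.Icc 1 ⌊t⌋₊, χ (k : ZMod N) =
      ∑ k ∈ Finset.range ⌊t⌋₊, χ ((k + 1 : ℕ) : ZMod N) := by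
    rw [Finset.range_eq_Ico, Finset.sum_Ico_add' (fun k : ℕ => χ (k : ZMod N))]
    rfl
  rwa [this]

lemma norm_sumDiscrepancy_one_le {t : ℝ} (ht : 1 ≤ t) :
    ‖sumDiscrepancy (fun _ => 1) 1 t‖ ≤ 1 := by
  have h1 := Nat.floor_le (by linarith : 0 ≤ t)
  have h2 := Nat.lt_floor_add_one t
  have : sumDiscrepancy (fun _ => 1) 1 t = ((⌊t⌋₊ - t : ℝ) : ℂ) := by
    simp [sumDiscrepancy]
  rw [this, norm_real, norm_eq_abs, abs_le]
  constructor <;> linarith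

lemma norm_le_of_partial_sum {a : ℕ → ℂ} {m : ℂ} {B : ℝ} (ha1 : ∀ n, ‖a n‖ ≤ 1)
    (hB : ∀ t : ℝ, 1 ≤ t → ‖sumDiscrepancy a m t‖ ≤ B) {G : ℂ → ℂ}
    (hG : DifferentiableOn ℂ G {s | 0 < s.re})
    (hGL : ∀ s : ℂ, 1 < s.re → G s = (s - 1) * LSeries a s) {N : ℕ} (hN : 1 ≤ N) {s : ℂ}
    (hs : 0 < s.re) :
    ‖G s‖ ≤ ‖s - 1‖ * (∑ n ∈ Finset.Icc 1 N, (n : ℝ) ^ (-s.re) + B * (N : ℝ) ^ (-s.re) *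
      (1 + ‖s‖ / s.re)) + ‖m‖ * (N : ℝ) ^ (1 - s.re) := by
  have hNR : (1 : ℝ) ≤ N := by exact_mod_cast hN
  rw [eq_partial_sum_add_of_differentiableOn hB
    (fun s hs => LSeriesSummable_of_bounded_of_one_lt_re (fun n _ => ha1 n) hs) hG hGL hN hs]
  have hn : ∀ n : ℕ, 1 ≤ n → ∀ z : ℂ, ‖(n : ℂ) ^ z‖ = (n : ℝ) ^ z.re :=
    fun n hn z => norm_natCast_cpow_of_pos hn z
  refine (norm_add_le _ _).trans ?_
  rw [norm_mul, norm_mul m, hn N hN]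
  have e1 : (1 - s).re = 1 - s.re := by simp
  rw [e1]
  gcongr
  have h3 := norm_integral_Ioi_mul_cpow_le (u := sumDiscrepancy a m) (B := B) (c := N)
    (by linarith) (fun t ht => hB t (hNR.trans ht)) hs
  calc _ ≤ ‖∑ n ∈ Finset.Icc 1 N, a n * (n : ℂ) ^ (-s)‖ + ‖sumDiscrepancy a m N * (N : ℂ) ^ (-s)‖
        + ‖s * ∫ t in Ioi (N : ℝ), sumDiscrepancy a m t * (t : ℂ) ^ (-(s + 1))‖ := by
        refine (norm_add_le _ _).trans ?_
        gcongr
        exact norm_sub_le _ _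
    _ ≤ ∑ n ∈ Finset.Icc 1 N, (n : ℝ) ^ (-s.re) + B * (N : ℝ) ^ (-s.re) +
        ‖s‖ * (B * (N : ℝ) ^ (-s.re) / s.re) := by
        gcongr
        · refine norm_sum_le_of_le _ fun n hn' => ?_
          rw [norm_mul, hn n (Finset.mem_Icc.1 hn').1, neg_re]
          exact mul_le_of_le_one_left (by positivity) (ha1 n)
        · rw [norm_mul, hn N hN, neg_re]
          gcongr
          exact hB N hNR
        · rw [norm_mul]; gcongr
    _ = _ := by ring

lemma sum_Icc_rpow_neg_le_log {N : ℕ} {σ : ℝ} (hσ : 1 ≤ σ) :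
    ∑ n ∈ Finset.Icc 1 N, (n : ℝ) ^ (-σ) ≤ 1 + log N := by
  have h := harmonic_le_one_add_log N
  refine le_trans ?_ h
  rw [harmonic_eq_sum_Icc]
  push_cast
  refine sum_le_sum fun n hn => ?_
  have hn1 : (1 : ℝ) ≤ n := by exact_mod_cast (Finset.mem_Icc.1 hn).1
  rw [← rpow_neg_one]
  exact rpow_le_rpow_of_exponent_le hn1 (by linarith)

lemma norm_div_re_le {s : ℂ} {c : ℝ} (hs : 0 < s.re) (hc : 1 ≤ c) (h : 1 ≤ c * s.re) :
    ‖s‖ / s.re ≤ c * (1 + |s.im|) := by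
  rw [div_le_iff₀ hs]
  have := norm_le_abs_re_add_abs_im s
  rw [abs_of_pos hs] at this
  nlinarith [mul_nonneg (abs_nonneg s.im) (sub_nonneg.2 h), mul_nonneg hs.le (sub_nonneg.2 hc)]

/-- The logarithmic factor in the bounds for `L`-functions on the line `re s = 1`. -/
noncomputable def logScale (Q t : ℝ) : ℝ := log (Q * (|t| + 3)) + 5 / 2

lemma norm_le_logScale_of_one_le_re {a : ℕ → ℂ} {m : ℂ} {B Q : ℝ} (ha1 : ∀ n, ‖a n‖ ≤ 1)
    (hm : ‖m‖ ≤ 1) (hB1 : 1 ≤ B) (hBQ : B ≤ Q)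
    (hB : ∀ t : ℝ, 1 ≤ t → ‖sumDiscrepancy a m t‖ ≤ B) {G : ℂ → ℂ}
    (hG : DifferentiableOn ℂ G {s | 0 < s.re})
    (hGL : ∀ s : ℂ, 1 < s.re → G s = (s - 1) * LSeries a s) {s : ℂ} (hs : 1 ≤ s.re) :
    ‖G s‖ ≤ ‖s - 1‖ * (logScale Q s.im - 1 / 2) + ‖m‖ := by
  set N := ⌈B * (|s.im| + 2)⌉₊ with hNdef
  have hBt : 2 ≤ B * (|s.im| + 2) := by nlinarith [abs_nonneg s.im]
  have hN1 : B * (|s.im| + 2) ≤ N := Nat.le_ceil _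
  have hN2 : (N : ℝ) ≤ Q * (|s.im| + 3) := by
    have := Nat.ceil_lt_add_one (by linarith : 0 ≤ B * (|s.im| + 2))
    have h2 : B * (|s.im| + 3) ≤ Q * (|s.im| + 3) := by gcongr
    rw [← hNdef] at this
    linarith
  have hNpos : (0 : ℝ) < N := by linarith
  have hN : 1 ≤ N := by
    have : (0 : ℝ) < N := hNpos
    exact_mod_cast this
  have hNR : (1 : ℝ) ≤ N := by exact_mod_cast hN
  have h := norm_le_of_partial_sum ha1 hB hG hGL hN (by linarith : 0 < s.re)
  have h1 : (N : ℝ) ^ (1 - s.re) ≤ 1 := Real.rpow_le_one_of_one_le_of_nonpos hNR (by linarith)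
  have h2 : (N : ℝ) ^ (-s.re) ≤ (N : ℝ)⁻¹ := by
    rw [← rpow_neg_one]
    exact rpow_le_rpow_of_exponent_le hNR (by linarith)
  have h3 := norm_div_re_le (s := s) (c := 1) (by linarith) le_rfl (by linarith)
  rw [one_mul] at h3
  have h4 : B * (N : ℝ) ^ (-s.re) * (1 + ‖s‖ / s.re) ≤ 1 := by
    calc _ ≤ B * (N : ℝ)⁻¹ * (1 + (1 + |s.im|)) := by gcongr
      _ = (B * (|s.im| + 2)) / N := by field_simp; ring
      _ ≤ 1 := by rw [div_le_one hNpos]; exact hN1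
  have h5 := sum_Icc_rpow_neg_le_log (N := N) hs
  have h6 : log N ≤ log (Q * (|s.im| + 3)) := log_le_log hNpos hN2
  refine h.trans ?_
  rw [logScale]
  gcongr
  · linarith
  · exact mul_le_of_le_one_right (norm_nonneg _) h1

lemma norm_Gammaℂ_one_add (t : ℝ) : ‖Gammaℂ (1 + t * I)‖ = ‖Gamma (1 + t * I)‖ / π := by
  have h2pi : (0 : ℝ) < 2 * π := by positivity
  rw [Gammaℂ_def, norm_mul, norm_mul, show (2 * (π : ℂ)) = ((2 * π : ℝ) : ℂ) by push_cast; ring,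
    norm_cpow_eq_rpow_re_of_pos h2pi]
  simp only [neg_re, add_re, one_re, mul_re, ofReal_re, I_re, mul_zero, ofReal_im, I_im, zero_mul,
    sub_zero, add_zero, rpow_neg_one, norm_ofNat]
  field_simp

lemma pi_mul_div_sinh_eq {t u : ℝ} (hu : u = π * |t| / 2) :
    π * t / sinh (π * t) = 2 * u / sinh (2 * u) := by
  rw [hu]
  rcases abs_cases t with h | h
  · rw [h.1]; congr 1 <;> ring_nf
  · rw [h.1, show 2 * (π * -t / 2) = -(π * t) by ring, Real.sinh_neg, neg_div_neg_eq]

lemma norm_Gammaℂ_mul_cosh_le (t : ℝ) :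
    ‖Gammaℂ (1 + t * I)‖ * cosh (π * t / 2) ≤ √((|t| + 1) / (2 * π)) := by
  have hpi := pi_gt_three
  refine le_sqrt_of_sq_le ?_
  rw [mul_pow, norm_Gammaℂ_one_add, div_pow]
  rcases eq_or_ne t 0 with rfl | ht
  · simp
    rw [← mul_inv, inv_le_inv₀ (by positivity) (by positivity)]
    nlinarith
  rw [norm_Gamma_one_add_mul_I_sq ht]
  set u := π * |t| / 2 with hu
  have hupos : 0 < u := by positivity
  have hcosh : cosh (π * t / 2) = cosh u := by
    rw [hu]
    rcases abs_cases t with h | h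
    · rw [h.1]
    · rw [h.1, ← Real.cosh_neg]; congr 1; ring
  have hdiv := pi_mul_div_sinh_eq hu
  rw [hcosh, hdiv, Real.sinh_two_mul]
  have hs : 0 < sinh u := sinh_pos_iff.2 hupos
  have hc : 0 < cosh u := cosh_pos u
  have key : u * cosh u ≤ (u + 1) * sinh u := by
    have h1 : u ≤ sinh u := Real.self_le_sinh_iff.2 hupos.le
    have h2 : cosh u - sinh u = exp (-u) := Real.cosh_sub_sinh u
    have h3 : exp (-u) ≤ 1 := by rw [exp_le_one_iff]; linarith
    nlinarith
  have e1 : 2 * u / (2 * sinh u * cosh u) / π ^ 2 * cosh u ^ 2 =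
      u * cosh u / sinh u / π ^ 2 := by field_simp
  rw [e1]
  calc _ ≤ (u + 1) / π ^ 2 := by
        gcongr; rw [div_le_iff₀ hs]; exact key
    _ ≤ _ := by
        rw [hu, div_le_div_iff₀ (by positivity) (by positivity)]
        nlinarith [abs_nonneg t]

/-- An analytic function on a neighbourhood of the critical strip with the growth of an
`L`-function of conductor at most `Q`. -/
structure StripFunction (g : ℂ → ℂ) (Q m : ℝ) : Prop where
  conductor_ge : 30 ≤ Q
  mass_nonneg : 0 ≤ m
  differentiableAt : ∀ s : ℂ, -1 < s.re → DifferentiableAt ℂ g s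
  right : ∀ s : ℂ, 1 ≤ s.re → ‖g s‖ ≤ logScale Q s.im
  left : ∀ t : ℝ, ‖g (t * I)‖ ≤ √(Q * (|t| + 1) / (2 * π)) * logScale Q t
  lower : ∀ s : ℂ, 1 < s.re → exp (-(m / (s.re - 1))) ≤ ‖g s‖
  growth : ∃ C B : ℝ, ∀ s : ℂ, 0 < s.re → s.re < 1 → ‖g s‖ ≤ C * exp (B * |s.im|)

lemma logScale_pos {Q : ℝ} (hQ : 30 ≤ Q) (t : ℝ) : 0 < logScale Q t := by
  have : 0 ≤ log (Q * (|t| + 3)) := log_nonneg (by nlinarith [abs_nonneg t])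
  rw [logScale]; linarith

lemma cosh_le_exp_abs (x : ℝ) : cosh x ≤ exp |x| := by
  rw [← Real.cosh_abs, cosh_eq]
  have : exp (-|x|) ≤ exp |x| := exp_le_exp.2 (by linarith [abs_nonneg x])
  linarith

lemma Gamma_le_of_mem_Icc {σ : ℝ} (h1 : 3 / 4 ≤ σ) (h2 : σ ≤ 1) : Real.Gamma σ ≤ 2 := by
  have h3 := Real.convexOn_Gamma.2 (show (1 : ℝ) ∈ Set.Ioi (0 : ℝ) by simp)
    (show (2 : ℝ) ∈ Set.Ioi (0 : ℝ) by simp)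
    (show 0 ≤ 1 - σ by linarith) (show 0 ≤ σ by linarith) (by ring)
  have e : (1 - σ) • (1 : ℝ) + σ • (2 : ℝ) = σ + 1 := by simp; ring
  rw [e, Real.Gamma_add_one (by linarith), Real.Gamma_one, Real.Gamma_two] at h3
  simp at h3
  have : 0 < Real.Gamma σ := Real.Gamma_pos_of_pos (by linarith)
  nlinarith

lemma norm_Gammaℂ_le_of_mem {s : ℂ} (h1 : 3 / 4 ≤ s.re) (h2 : s.re ≤ 1) : ‖Gammaℂ s‖ ≤ 4 := by
  have h2pi : (1 : ℝ) < 2 * π := by linarith [pi_gt_three]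
  rw [Gammaℂ_def, norm_mul, norm_mul, show (2 * (π : ℂ)) = ((2 * π : ℝ) : ℂ) by push_cast; ring,
    norm_cpow_eq_rpow_re_of_pos (by linarith)]
  have h3 := (norm_Gamma_le (by linarith : 0 < s.re)).trans (Gamma_le_of_mem_Icc h1 h2)
  have h4 : (2 * π) ^ (-s).re ≤ 1 :=
    Real.rpow_le_one_of_one_le_of_nonpos h2pi.le (by rw [neg_re]; linarith)
  have h5 : 0 ≤ (2 * π) ^ (-s).re := by positivity
  rw [norm_ofNat]
  nlinarith [norm_nonneg (Gamma s)]

section LFunction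

variable {f : ℕ} [NeZero f] {χ : DirichletCharacter ℂ f}

lemma norm_LFunction_le_of_one_le_re (hχ : χ ≠ 1) {Q : ℝ} (hQ : f ≤ Q) {s : ℂ}
    (hs : 1 ≤ s.re) : ‖LFunction χ s‖ ≤ logScale Q s.im := by
  have hf : (1 : ℝ) ≤ f := by exact_mod_cast Nat.pos_of_ne_zero (NeZero.ne f)
  have hd := differentiable_LFunction hχ
  have main : ∀ s : ℂ, 1 ≤ s.re → s ≠ 1 →
      ‖LFunction χ s‖ ≤ logScale Q s.im := by
    intro s hs hs1
    have h := norm_le_logScale_of_one_le_re (a := fun n => χ n) (m := 0) (B := f) (Q := Q)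
      (G := fun s => (s - 1) * LFunction χ s)
      (fun n => χ.norm_le_one _) (by simp) hf hQ (fun t _ => norm_sumDiscrepancy_character_le hχ t)
      ((differentiable_id.sub_const 1).mul hd).differentiableOn
      (fun s hs => by rw [LFunction_eq_LSeries χ hs]) hs
    simp only [norm_mul, norm_zero, add_zero] at h
    have h2 : 0 < ‖s - 1‖ := norm_pos_iff.2 (sub_ne_zero.2 hs1)
    have := le_of_mul_le_mul_left h h2
    linarith
  rcases eq_or_ne s 1 with rfl | hs1
  · have hc : Tendsto (fun t : ℝ => ‖LFunction χ (1 + t * I)‖) (𝓝[≠] 0)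
        (𝓝 ‖LFunction χ (1 + (0 : ℝ) * I)‖) := by
      have : Continuous fun t : ℝ => ‖LFunction χ (1 + t * I)‖ :=
        (hd.continuous.comp (by fun_prop)).norm
      exact this.continuousAt.tendsto.mono_left nhdsWithin_le_nhds
    have hl : Tendsto (fun t : ℝ => logScale Q t) (𝓝[≠] 0) (𝓝 (logScale Q 0)) := by
      have : ContinuousAt (fun t : ℝ => logScale Q t) 0 := by
        unfold logScale
        refine ContinuousAt.add (ContinuousAt.log (by fun_prop) ?_) continuousAt_const
        have : (0 : ℝ) < Q := by linarith
        positivity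
      exact this.tendsto.mono_left nhdsWithin_le_nhds
    have := le_of_tendsto_of_tendsto hc hl (by
      filter_upwards [self_mem_nhdsWithin] with t ht
      refine (main (1 + t * I) (by simp) ?_).trans_eq (by simp)
      intro h
      have := congrArg Complex.im h
      simp at this
      exact ht this)
    simpa using this
  · exact main s hs hs1

lemma norm_LFunction_le_of_quarter_le_re (hχ : χ ≠ 1) {s : ℂ} (hs : 1 / 4 ≤ s.re)
    (hs1 : s ≠ 1) (hs2 : s.re ≤ 1) :
    ‖LFunction χ s‖ ≤ 10 * f * exp |s.im| := by
  have hf : (1 : ℝ) ≤ f := by exact_mod_cast Nat.pos_of_ne_zero (NeZero.ne f)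
  have hd := differentiable_LFunction hχ
  have h := norm_le_of_partial_sum (a := fun n => χ n) (m := 0) (B := f)
      (G := fun s => (s - 1) * LFunction χ s)
      (fun n => χ.norm_le_one _) (fun t _ => norm_sumDiscrepancy_character_le hχ t)
      ((differentiable_id.sub_const 1).mul hd).differentiableOn
      (fun s hs => by rw [LFunction_eq_LSeries χ hs]) le_rfl
      (by linarith : 0 < s.re)
  have h2 : 0 < ‖s - 1‖ := norm_pos_iff.2 (sub_ne_zero.2 hs1)
  simp only [norm_mul, norm_zero, zero_mul, add_zero] at h
  have h3 := le_of_mul_le_mul_left h h2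
  simp at h3
  have h4 : ‖s‖ / s.re ≤ 4 * (1 + |s.im|) :=
    norm_div_re_le (by linarith) (by norm_num) (by linarith)
  have h5 := add_one_le_exp |s.im|
  have h6 := abs_nonneg s.im
  calc _ ≤ 1 + f * (1 + 4 * exp |s.im|) := by
        refine h3.trans ?_
        gcongr
        linarith
    _ ≤ _ := by nlinarith

lemma stripFunction_LFunction (hχ : χ.IsPrimitive) (hf1 : f ≠ 1) {Q : ℝ} (hQ : f ≤ Q)
    (hQ30 : 30 ≤ Q) : StripFunction (LFunction χ) Q 1 := by
  have hf : (1 : ℝ) ≤ f := by exact_mod_cast Nat.pos_of_ne_zero (NeZero.ne f)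
  have hχ1 : χ ≠ 1 := by
    rintro rfl
    rw [DirichletCharacter.isPrimitive_def, DirichletCharacter.conductor_one] at hχ
    exact hf1 hχ.symm
  have hχi : χ⁻¹ ≠ 1 := by simpa using hχ1
  refine ⟨hQ30, zero_le_one, fun s _ => differentiable_LFunction hχ1 s,
    fun s hs => norm_LFunction_le_of_one_le_re hχ1 hQ hs, fun t => ?_, fun s hs => ?_, ?_⟩
  · have h := norm_LFunction_one_sub_le hχ hf1 (s := 1 - t * I) (by simp)
    have h2 := norm_LFunction_le_of_one_le_re hχi hQ (s := 1 - t * I) (by simp)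
    have h3 := norm_Gammaℂ_mul_cosh_le (-t)
    rw [abs_neg] at h3
    have e : (1 : ℂ) + ((-t : ℝ) : ℂ) * I = 1 - t * I := by push_cast; ring
    rw [e] at h3
    have e2 : (1 - (t : ℂ) * I).im = -t := by simp
    have e3 : (1 - (t : ℂ) * I).re = 1 := by simp
    rw [e2] at h h2
    rw [e3, sub_sub_cancel] at h
    have e4 : logScale Q (-t) = logScale Q t := by simp [logScale]
    rw [e4] at h2
    refine h.trans ?_
    have hl := logScale_pos hQ30 t
    have e5 : (f : ℝ) ^ ((1 : ℝ) - 1 / 2) = √f := by rw [sqrt_eq_rpow]; norm_num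
    rw [e5]
    calc _ ≤ √f * √((|t| + 1) / (2 * π)) * logScale Q t := by gcongr
      _ = √(f * (|t| + 1) / (2 * π)) * logScale Q t := by
        rw [← sqrt_mul (by linarith), mul_div_assoc]
      _ ≤ _ := by gcongr
  · refine le_trans ?_ (norm_LFunction_ge χ hs)
    rw [Real.exp_neg]
    have h0 : 0 < 1 / (s.re - 1) := by have : 0 < s.re - 1 := by linarith
                                       positivity
    gcongr
    linarith [add_one_le_exp (1 / (s.re - 1))]
  · refine ⟨40 * f * f, 3, fun s hs0 hs1 => ?_⟩
    have him := abs_nonneg s.im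
    rcases le_or_gt (1 / 4) s.re with h | h
    · refine (norm_LFunction_le_of_quarter_le_re hχ1 h ?_ hs1.le).trans ?_
      · rintro rfl; simp at hs1
      · gcongr
        · nlinarith
        · linarith
    · have h1 := norm_LFunction_one_sub_le hχ hf1 (s := 1 - s) (by simp; linarith)
      rw [sub_sub_cancel] at h1
      refine h1.trans ?_
      have h2 := norm_LFunction_le_of_quarter_le_re hχi (s := 1 - s) (by simp; linarith)
        (by intro h; have : s = 0 := by linear_combination -h
            rw [this] at hs0; simp at hs0) (by simp; linarith)
      have h3 := norm_Gammaℂ_le_of_mem (s := 1 - s) (by simp; linarith) (by simp; linarith)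
      have h4 : cosh (π * (1 - s).im / 2) ≤ exp (2 * |s.im|) := by
        refine (cosh_le_exp_abs _).trans (exp_le_exp.2 ?_)
        rw [abs_div, abs_mul, abs_of_pos pi_pos]
        simp
        nlinarith [pi_lt_four]
      have h5 : (f : ℝ) ^ ((1 - s).re - 1 / 2) ≤ f := by
        refine (rpow_le_rpow_of_exponent_le hf ?_).trans_eq (rpow_one _)
        simp; linarith
      have e6 : |(1 - s).im| = |s.im| := by simp
      rw [e6] at h2
      calc _ ≤ f * (4 * exp (2 * |s.im|)) * (10 * f * exp |s.im|) := by gcongr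
        _ = 40 * f * f * (exp (2 * |s.im|) * exp |s.im|) := by ring
        _ = _ := by rw [← exp_add]; ring_nf

end LFunction

/-- The entire function `(s - 1) ζ(s)`. -/
noncomputable def zetaEntire : ℂ → ℂ := DirichletCharacter.LFunctionTrivChar₁ 1

lemma differentiable_zetaEntire : Differentiable ℂ zetaEntire :=
  DirichletCharacter.differentiable_LFunctionTrivChar₁ 1

lemma zetaEntire_of_ne_one {s : ℂ} (hs : s ≠ 1) : zetaEntire s = (s - 1) * riemannZeta s := by
  rw [zetaEntire, DirichletCharacter.LFunctionTrivChar₁, Function.update_of_ne hs,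
    DirichletCharacter.LFunctionTrivChar, DirichletCharacter.LFunction_modOne_eq]

lemma ne_one_of_one_lt_re {s : ℂ} (hs : 1 < s.re) : s ≠ 1 := by
  rintro rfl; simp at hs

lemma zetaEntire_eq_LSeries {s : ℂ} (hs : 1 < s.re) :
    zetaEntire s = (s - 1) * LSeries (fun _ => 1) s := by
  rw [zetaEntire_of_ne_one (ne_one_of_one_lt_re hs), ← LSeries_one_eq_riemannZeta hs]
  rfl

/-- The function `(s - 1) ζ(s) / (s + 1)`. -/
noncomputable def zetaReg (s : ℂ) : ℂ := zetaEntire s / (s + 1)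

lemma norm_sub_one_le_norm_add_one {s : ℂ} (hs : 0 ≤ s.re) : ‖s - 1‖ ≤ ‖s + 1‖ := by
  rw [← sq_le_sq₀ (norm_nonneg _) (norm_nonneg _), ← normSq_eq_norm_sq, ← normSq_eq_norm_sq,
    normSq_apply, normSq_apply]
  simp; nlinarith

lemma one_add_re_le_norm_add_one {s : ℂ} : 1 + s.re ≤ ‖s + 1‖ := by
  have := Complex.re_le_norm (s + 1)
  simp at this; linarith

lemma norm_zetaReg_le_of_one_le_re {Q : ℝ} (hQ : 30 ≤ Q) {s : ℂ} (hs : 1 ≤ s.re) :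
    ‖zetaReg s‖ ≤ logScale Q s.im := by
  have h := norm_le_logScale_of_one_le_re (a := fun _ => 1) (m := 1) (B := 1) (Q := Q)
    (G := zetaEntire) (by simp) (by simp) le_rfl (by linarith)
    (fun t ht => norm_sumDiscrepancy_one_le ht) differentiable_zetaEntire.differentiableOn
    (fun s hs => zetaEntire_eq_LSeries hs) hs
  have h1 := norm_sub_one_le_norm_add_one (s := s) (by linarith)
  have h2 := one_add_re_le_norm_add_one (s := s)
  have h3 : 0 ≤ log (Q * (|s.im| + 3)) := log_nonneg (by nlinarith [abs_nonneg s.im])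
  rw [zetaReg, norm_div, div_le_iff₀ (by linarith)]
  rw [logScale] at *
  simp at h
  nlinarith [norm_nonneg (s - 1)]

lemma norm_zetaReg_le_of_quarter_le_re {s : ℂ} (hs : 1 / 4 ≤ s.re) (hs2 : s.re ≤ 1) :
    ‖zetaReg s‖ ≤ 10 * exp |s.im| := by
  have h := norm_le_of_partial_sum (a := fun _ => 1) (m := 1) (B := 1)
    (G := zetaEntire) (by simp)
    (fun t ht => norm_sumDiscrepancy_one_le ht) differentiable_zetaEntire.differentiableOn
    (fun s hs => zetaEntire_eq_LSeries hs) le_rfl (by linarith : 0 < s.re)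
  have h1 := norm_sub_one_le_norm_add_one (s := s) (by linarith)
  have h2 := one_add_re_le_norm_add_one (s := s)
  simp at h
  have h4 : ‖s‖ / s.re ≤ 4 * (1 + |s.im|) :=
    norm_div_re_le (by linarith) (by norm_num) (by linarith)
  have h5 := add_one_le_exp |s.im|
  have h6 := abs_nonneg s.im
  have h7 : 0 ≤ ‖s‖ / s.re := div_nonneg (norm_nonneg _) (by linarith)
  rw [zetaReg, norm_div, div_le_iff₀ (by linarith)]
  calc _ ≤ ‖s - 1‖ * (1 + (1 + ‖s‖ / s.re)) + 1 := h
    _ ≤ ‖s + 1‖ * (1 + (1 + 4 * exp |s.im|)) + ‖s + 1‖ := by gcongr <;> linarith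
    _ ≤ _ := by nlinarith [norm_nonneg (s + 1)]

lemma norm_mul_I_sub_one_div (t : ℝ) : ‖((t : ℂ) * I - 1) / (t * I + 1)‖ = 1 := by
  have h : ‖(t : ℂ) * I - 1‖ = ‖(t : ℂ) * I + 1‖ := by
    rw [← sq_eq_sq₀ (norm_nonneg _) (norm_nonneg _), ← normSq_eq_norm_sq, ← normSq_eq_norm_sq,
      normSq_apply, normSq_apply]
    simp
  have h2 : 0 < ‖(t : ℂ) * I + 1‖ := by
    have := one_add_re_le_norm_add_one (s := (t : ℂ) * I)
    simp at this; linarith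
  rw [norm_div, h, div_self h2.ne']

lemma norm_riemannZeta_mul_I {t : ℝ} (ht : t ≠ 0) :
    ‖riemannZeta (t * I)‖ ^ 2 ≤ 30 * (|t| + 1) / (2 * π) * (t ^ 2 / (t ^ 2 + 4)) *
      ‖riemannZeta (1 - t * I)‖ ^ 2 := by
  have hpi := pi_gt_three
  have hpi4 := pi_lt_four
  have h := riemannZeta_one_sub (s := 1 - t * I) (fun n h => by
    have := congrArg Complex.re h; simp at this; linarith [(Nat.cast_nonneg n : (0 : ℝ) ≤ n)])
    (fun h => by have := congrArg Complex.im h; simp at this; exact ht this)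
  rw [sub_sub_cancel] at h
  have hG : ‖(2 : ℂ) * (2 * π) ^ (-(1 - t * I)) * Gamma (1 - t * I)‖ ^ 2 =
      (π * t / sinh (π * t)) / π ^ 2 := by
    have h1 := norm_Gammaℂ_one_add (-t)
    have h2 := norm_Gamma_one_add_mul_I_sq (t := -t) (by simpa using ht)
    have e : (1 : ℂ) + ((-t : ℝ) : ℂ) * I = 1 - t * I := by push_cast; ring
    rw [e] at h1 h2
    rw [Gammaℂ_def] at h1
    rw [h1, div_pow, h2, mul_neg, Real.sinh_neg, neg_div_neg_eq]
  have hcos : ‖Complex.cos (π * (1 - t * I) / 2)‖ ^ 2 = sinh (π * t / 2) ^ 2 := by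
    have : (π : ℂ) * (1 - t * I) / 2 = π / 2 - ((π * t / 2 : ℝ) : ℂ) * I := by
      push_cast; ring
    rw [this, Complex.cos_pi_div_two_sub, Complex.sin_mul_I, norm_mul, norm_I, mul_one,
      ← ofReal_sinh, norm_real, norm_eq_abs, sq_abs]
  rw [h, norm_mul, mul_pow, norm_mul, mul_pow, hG, hcos]
  refine mul_le_mul_of_nonneg_right ?_ (sq_nonneg _)
  set u := π * |t| / 2 with hu
  have htp : 0 < |t| := abs_pos.2 ht
  have hupos : 0 < u := by positivity
  have hsinh : sinh (π * t / 2) ^ 2 = sinh u ^ 2 := by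
    rw [hu]
    rcases abs_cases t with h | h
    · rw [h.1]
    · rw [h.1, show π * -t / 2 = -(π * t / 2) by ring, Real.sinh_neg, neg_sq]
  have hdiv := pi_mul_div_sinh_eq hu
  rw [hsinh, hdiv, Real.sinh_two_mul]
  have hs : 0 < sinh u := sinh_pos_iff.2 hupos
  have hc : 0 < cosh u := cosh_pos u
  have e1 : 2 * u / (2 * sinh u * cosh u) / π ^ 2 * sinh u ^ 2 =
      u * (sinh u / cosh u) / π ^ 2 := by field_simp
  rw [e1, ← Real.tanh_eq_sinh_div_cosh, ← sq_abs t]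
  have ht1 : Real.tanh u ≤ 1 := by
    rw [Real.tanh_eq_sinh_div_cosh, div_le_one hc]; exact (Real.sinh_lt_cosh u).le
  have ht2 : Real.tanh u ≤ u := by
    rw [Real.tanh_eq_sinh_div_cosh, div_le_iff₀ hc]
    have h1 : sinh u - u * cosh u ≤ 0 := by
      have hd : ∀ x, HasDerivAt (fun x => sinh x - x * cosh x)
          (cosh x - (1 * cosh x + x * sinh x)) x := fun x =>
        (Real.hasDerivAt_sinh x).sub ((hasDerivAt_id x).mul (Real.hasDerivAt_cosh x))
      have hanti : AntitoneOn (fun x => sinh x - x * cosh x) (Set.Ici 0) := by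
        refine antitoneOn_of_deriv_nonpos (convex_Ici 0)
          (fun x _ => (hd x).continuousAt.continuousWithinAt)
          (fun x _ => (hd x).differentiableAt.differentiableWithinAt) fun x hx => ?_
        rw [interior_Ici, Set.mem_Ioi] at hx
        rw [(hd x).deriv]
        nlinarith [sinh_pos_iff.2 hx]
      have := hanti (Set.mem_Ici.2 le_rfl) (Set.mem_Ici.2 hupos.le) hupos.le
      simpa using this
    linarith
  rcases le_or_gt |t| 1 with h1 | h1
  · calc _ ≤ u * u / π ^ 2 := by gcongr
      _ = |t| ^ 2 / 4 := by rw [hu]; field_simp; ring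
      _ ≤ _ := by
        rw [div_mul_div_comm, div_le_div_iff₀ (by norm_num) (by positivity)]
        have : 2 * π * (|t| ^ 2 + 4) ≤ 4 * (30 * (|t| + 1)) := by nlinarith
        nlinarith [sq_nonneg |t|]
  · calc _ ≤ u * 1 / π ^ 2 := by gcongr
      _ = |t| / (2 * π) := by rw [hu]; field_simp
      _ ≤ _ := by
        rw [div_mul_div_comm, div_le_div_iff₀ (by positivity) (by positivity)]
        have : |t| * (|t| ^ 2 + 4) ≤ 30 * (|t| + 1) * |t| ^ 2 := by
          have : |t| ^ 2 + 4 ≤ 30 * (|t| + 1) * |t| := by nlinarith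
          nlinarith
        nlinarith

lemma stripFunction_zetaReg {Q : ℝ} (hQ : 30 ≤ Q) : StripFunction zetaReg Q 3 := by
  have hdiff : ∀ s : ℂ, -1 < s.re → DifferentiableAt ℂ zetaReg s := by
    intro s hs
    refine (differentiable_zetaEntire s).div (differentiableAt_id.add_const 1) ?_
    intro h; have := congrArg Complex.re h; simp at this; linarith
  refine ⟨hQ, by norm_num, hdiff, fun s hs => norm_zetaReg_le_of_one_le_re hQ hs, fun t => ?_,
    fun s hs => ?_, ?_⟩
  · have hl := logScale_pos hQ t
    rcases eq_or_ne t 0 with rfl | ht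
    · have : zetaReg ((0 : ℝ) * I) = 1 / 2 := by
        rw [zetaReg]; simp [zetaEntire_of_ne_one, riemannZeta_zero]; norm_num
      rw [this]
      have h1 : (1 : ℝ) ≤ √(Q * (|(0 : ℝ)| + 1) / (2 * π)) := by
        rw [Real.one_le_sqrt, le_div_iff₀ (by positivity)]
        simp; linarith [pi_lt_four]
      have h2 : 0 ≤ log (Q * (|(0 : ℝ)| + 3)) := log_nonneg (by simp; linarith)
      have h3 : (1 : ℝ) ≤ logScale Q 0 := by
        have : (1 : ℝ) ≤ 5 / 2 := by norm_num
        exact this.trans (le_add_of_nonneg_left h2)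
      calc ‖(1 / 2 : ℂ)‖ ≤ 1 * 1 := by norm_num
        _ ≤ _ := mul_le_mul h1 h3 zero_le_one (by positivity)
    have htI : (t : ℂ) * I ≠ 1 := by
      intro h; have := congrArg Complex.re h; simp at this
    have htI' : 1 - (t : ℂ) * I ≠ 1 := by
      intro h; have := congrArg Complex.im h; simp at this; exact ht this
    have e1 : ‖zetaReg (t * I)‖ = ‖riemannZeta (t * I)‖ := by
      rw [zetaReg, zetaEntire_of_ne_one htI, mul_div_right_comm, norm_mul, norm_mul_I_sub_one_div,
        one_mul]
    have h1 := norm_zetaReg_le_of_one_le_re hQ (s := 1 - t * I) (by simp)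
    have e2 : logScale Q (1 - (t : ℂ) * I).im = logScale Q t := by simp [logScale]
    rw [e2, zetaReg, zetaEntire_of_ne_one htI'] at h1
    have e3 : ‖(1 - (t : ℂ) * I - 1) * riemannZeta (1 - t * I) / (1 - t * I + 1)‖ ^ 2 =
        t ^ 2 / (t ^ 2 + 4) * ‖riemannZeta (1 - t * I)‖ ^ 2 := by
      rw [norm_div, norm_mul, div_pow, mul_pow, ← normSq_eq_norm_sq (1 - (t : ℂ) * I - 1),
        ← normSq_eq_norm_sq (1 - (t : ℂ) * I + 1), normSq_apply, normSq_apply]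
      simp; ring
    have h2 := norm_riemannZeta_mul_I ht
    rw [mul_assoc, ← e3] at h2
    rw [e1]
    have hX : 0 ≤ Q * (|t| + 1) / (2 * π) := by
      have : 0 < Q := by linarith
      positivity
    refine le_of_sq_le_sq ?_ (by positivity)
    rw [mul_pow, sq_sqrt hX]
    refine h2.trans ?_
    gcongr
  · have hs1 := ne_one_of_one_lt_re hs
    have hz := norm_LFunction_ge (1 : DirichletCharacter ℂ 1) hs
    rw [DirichletCharacter.LFunction_modOne_eq] at hz
    have hd : 0 < s.re - 1 := by linarith
    have h1 : (1 + 2 / (s.re - 1))⁻¹ ≤ ‖s - 1‖ / ‖s + 1‖ := by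
      have h2 := norm_add_le (s - 1) 2
      have e : s - 1 + 2 = s + 1 := by ring
      have h3 := Complex.re_le_norm (s - 1)
      simp at h3
      rw [e, norm_ofNat] at h2
      have h4 : 0 < ‖s - 1‖ := by linarith
      rw [inv_le_comm₀ (by positivity) (div_pos h4 (by linarith [one_add_re_le_norm_add_one (s := s)])),
        inv_div, div_le_iff₀ h4]
      calc ‖s + 1‖ ≤ ‖s - 1‖ + 2 := h2
        _ ≤ ‖s - 1‖ + 2 / (s.re - 1) * ‖s - 1‖ := by
          gcongr
          rw [div_mul_eq_mul_div, le_div_iff₀ hd]; nlinarith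
        _ = _ := by ring
    rw [zetaReg, zetaEntire_of_ne_one hs1, norm_div, norm_mul, mul_div_right_comm]
    have hexp : exp (-(3 / (s.re - 1))) = (exp (2 / (s.re - 1)))⁻¹ *
        (exp (1 / (s.re - 1)))⁻¹ := by
      rw [← Real.exp_neg, ← Real.exp_neg, ← exp_add]; congr 1; ring
    rw [hexp]
    have h5 : (exp (2 / (s.re - 1)))⁻¹ ≤ (1 + 2 / (s.re - 1))⁻¹ := by
      gcongr; linarith [add_one_le_exp (2 / (s.re - 1))]
    have h6 : (exp (1 / (s.re - 1)))⁻¹ ≤ (1 + 1 / (s.re - 1))⁻¹ := by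
      gcongr; linarith [add_one_le_exp (1 / (s.re - 1))]
    exact mul_le_mul (h5.trans h1) (h6.trans hz) (by positivity) (by positivity)
  · obtain ⟨C, hC⟩ := (isCompact_Icc.reProdIm isCompact_Icc :
      IsCompact (Set.Icc (0 : ℝ) 1 ×ℂ Set.Icc (-1 : ℝ) 1)).exists_bound_of_continuousOn
      (f := zetaReg) (fun s hs => (hdiff s (by
        have := (mem_reProdIm.1 hs).1.1; linarith)).continuousAt.continuousWithinAt)
    refine ⟨160 + |C|, 4, fun s hs0 hs1 => ?_⟩
    have him := abs_nonneg s.im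
    have hC0 := abs_nonneg C
    rcases le_or_gt |s.im| 1 with h1 | h1
    · refine (hC s (mem_reProdIm.2 ⟨⟨hs0.le, hs1.le⟩, abs_le.1 h1⟩)).trans ?_
      have : 1 ≤ exp (4 * |s.im|) := one_le_exp (by positivity)
      nlinarith [le_abs_self C]
    rcases le_or_gt (1 / 4) s.re with h | h
    · refine (norm_zetaReg_le_of_quarter_le_re h hs1.le).trans ?_
      gcongr
      · linarith
      · linarith
    · have hsne : s ≠ 1 := by rintro rfl; simp at hs1
      have h0 : (1 - s) ≠ 1 := by
        intro h; have : s = 0 := by linear_combination -h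
        rw [this] at hs0; simp at hs0
      have hfe := riemannZeta_one_sub (s := 1 - s) (fun n h' => by
        have := congrArg Complex.re h'; simp at this
        linarith [(Nat.cast_nonneg n : (0 : ℝ) ≤ n)]) h0
      rw [sub_sub_cancel] at hfe
      have h2 := norm_zetaReg_le_of_quarter_le_re (s := 1 - s) (by simp; linarith)
        (by simp; linarith)
      have e6 : |(1 - s).im| = |s.im| := by simp
      rw [e6] at h2
      have h3 := norm_Gammaℂ_le_of_mem (s := 1 - s) (by simp; linarith) (by simp; linarith)
      have h4 : ‖Complex.cos (π * (1 - s) / 2)‖ ≤ exp (2 * |s.im|) := by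
        refine (norm_cos_le_cosh _).trans ((cosh_le_exp_abs _).trans (exp_le_exp.2 ?_))
        rw [← ofReal_ofNat, div_ofReal_im, im_ofReal_mul, abs_div, abs_mul, abs_of_pos pi_pos]
        simp
        nlinarith [pi_lt_four]
      -- `(s - 1) ζ(s) / (s + 1)` in terms of `ζ(1 - s) (- s) / (2 - s)`
      have hs2 : (1 - s + 1) ≠ 0 := by
        intro h; have := congrArg Complex.re h; simp at this; linarith
      have hs3 : s ≠ 0 := by rintro rfl; simp at hs0
      have hs4 : s + 1 ≠ 0 := by
        intro h; have := congrArg Complex.re h; simp at this; linarith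
      have e7 : s * zetaReg s = -(Gammaℂ (1 - s) * Complex.cos (π * (1 - s) / 2) *
          zetaReg (1 - s)) * ((s - 1) * (1 - s + 1) / (s + 1)) := by
        rw [zetaReg, zetaReg, zetaEntire_of_ne_one hsne, zetaEntire_of_ne_one h0, hfe, Gammaℂ_def]
        field_simp
        ring
      have h8 : 1 ≤ ‖s‖ := h1.le.trans (Complex.abs_im_le_norm s)
      have h9 : ‖(s - 1) * (1 - s + 1) / (s + 1)‖ ≤ 4 * exp |s.im| := by
        have ha := norm_sub_one_le_norm_add_one (s := s) hs0.le
        have hb : 0 < ‖s + 1‖ := norm_pos_iff.2 hs4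
        have hc : ‖1 - s + 1‖ ≤ 4 * exp |s.im| := by
          refine (norm_le_abs_re_add_abs_im _).trans ?_
          have : |(1 - s + 1).re| ≤ 3 := by
            rw [abs_le]; simp; constructor <;> linarith
          have e : |(1 - s + 1).im| = |s.im| := by simp
          rw [e]
          linarith [add_one_le_exp |s.im|]
        rw [norm_div, norm_mul, div_le_iff₀ hb]
        calc _ ≤ ‖s + 1‖ * (4 * exp |s.im|) := by gcongr
          _ = _ := by ring
      calc ‖zetaReg s‖ ≤ ‖s‖ * ‖zetaReg s‖ := le_mul_of_one_le_left (norm_nonneg _) h8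
        _ = ‖Gammaℂ (1 - s)‖ * ‖Complex.cos (π * (1 - s) / 2)‖ * ‖zetaReg (1 - s)‖ *
            ‖(s - 1) * (1 - s + 1) / (s + 1)‖ := by
          rw [← norm_mul, e7, norm_mul, norm_neg, norm_mul, norm_mul]
        _ ≤ 4 * exp (2 * |s.im|) * (10 * exp |s.im|) * (4 * exp |s.im|) := by
          gcongr
        _ = 160 * (exp (2 * |s.im|) * exp |s.im| * exp |s.im|) := by ring
        _ = 160 * exp (4 * |s.im|) := by
          rw [← exp_add, ← exp_add]; ring_nf
        _ ≤ _ := by gcongr; linarith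

lemma logScale_ge {Q : ℝ} (hQ : 30 ≤ Q) (t : ℝ) : 19 / 3 ≤ logScale Q t := by
  have h1 : log 64 ≤ log (Q * (|t| + 3)) :=
    log_le_log (by norm_num) (by nlinarith [abs_nonneg t])
  have h2 : log 64 = 6 * log 2 := by
    rw [show (64 : ℝ) = 2 ^ 6 by norm_num, log_pow]; norm_num
  have := log_two_gt_d9
  rw [logScale]; linarith

lemma logScale_le_of_abs_sub {Q : ℝ} (hQ : 30 ≤ Q) (y t : ℝ) :
    logScale Q y ≤ logScale Q t * exp (|y - t| / 19) := by
  have hl := logScale_ge hQ t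
  have hQ0 : 0 < Q := by linarith
  have ht := abs_nonneg t
  have hy := abs_nonneg y
  have hu : |y| ≤ |t| + |y - t| := by
    have := abs_add_le t (y - t); simpa using this
  have h0 := abs_nonneg (y - t)
  have h1 : log (Q * (|y| + 3)) ≤ log (Q * (|t| + 3)) + |y - t| / 3 := by
    have h2 : Q * (|y| + 3) ≤ Q * (|t| + 3) * exp (|y - t| / 3) := by
      have := add_one_le_exp (|y - t| / 3)
      calc Q * (|y| + 3) ≤ Q * ((|t| + 3) * (|y - t| / 3 + 1)) := by gcongr; nlinarith
        _ ≤ _ := by rw [mul_assoc]; gcongr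
    refine (log_le_log (by positivity) h2).trans_eq ?_
    rw [log_mul (by positivity) (by positivity), log_exp]
  have h3 := add_one_le_exp (|y - t| / 19)
  calc logScale Q y ≤ logScale Q t + |y - t| / 3 := by simp only [logScale]; linarith
    _ ≤ logScale Q t * (|y - t| / 19 + 1) := by nlinarith
    _ ≤ _ := by gcongr

namespace StripFunction

variable {g : ℂ → ℂ} {Q m : ℝ}

/-- The convexity bound in the critical strip. -/
theorem norm_le_of_mem_strip (hg : StripFunction g Q m) {s : ℂ} (h0 : 0 ≤ s.re) (h1 : s.re ≤ 1) :
    ‖g s‖ ≤ exp (1 / 16) * logScale Q s.im *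
      (Q * (|s.im| + 3) / (2 * π)) ^ ((1 - s.re) / 2) := by
  have hQ := hg.conductor_ge
  have hQ0 : 0 < Q := by linarith
  set b := Q * (|s.im| + 3) / (2 * π) with hb
  have ht := abs_nonneg s.im
  have hpi := pi_pos
  have hb0 : 0 < b := by positivity
  have hb1 : 1 ≤ b := by
    rw [hb, le_div_iff₀ (by positivity)]; nlinarith [pi_lt_four]
  have hl := logScale_ge hQ s.im
  set F : ℂ → ℂ := fun z => g z * cexp ((z - s) ^ 2 / 30) * (b : ℂ) ^ ((z - 1) / 2) with hF
  have hbc : (b : ℂ) ≠ 0 := by exact_mod_cast hb0.ne'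
  have hFn : ∀ z, ‖F z‖ = ‖g z‖ * exp (((z.re - s.re) ^ 2 - (z.im - s.im) ^ 2) / 30) *
      b ^ ((z.re - 1) / 2) := by
    intro z
    rw [hF]
    simp only [norm_mul]
    rw [norm_exp, norm_cpow_eq_rpow_re_of_pos hb0]
    congr 2
    · congr 1
      rw [show ((z - s) ^ 2 / 30 : ℂ) = (z - s) ^ 2 / ((30 : ℝ) : ℂ) by norm_num, div_ofReal_re, sq]
      simp; ring
    · rw [show ((z - 1) / 2 : ℂ) = (z - 1) / ((2 : ℝ) : ℂ) by norm_num, div_ofReal_re]; simp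
  have hFd : ∀ z : ℂ, -1 < z.re → DifferentiableAt ℂ F z := by
    intro z hz
    refine ((hg.differentiableAt z hz).mul (by fun_prop)).mul ?_
    exact ((differentiableAt_id.sub_const 1).div_const 2).const_cpow (Or.inl hbc)
  have hmain : ‖F s‖ ≤ exp (1 / 16) * logScale Q s.im := by
    have hexp16 : ∀ x : ℝ, x ≤ 1 / 16 → exp x ≤ exp (1 / 16) := fun x hx =>
      exp_le_exp.2 hx
    refine PhragmenLindelof.vertical_strip (a := 0) (b := 1) (f := F) ?_ ?_ ?_ ?_ h0 h1
    · refine DifferentiableOn.diffContOnCl fun z hz => (hFd z ?_).differentiableWithinAt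
      have : (0 : ℝ) ≤ z.re := closure_minimal (t := {z : ℂ | 0 ≤ z.re}) (fun w hw => hw.1.le)
        (isClosed_le continuous_const continuous_re) hz
      linarith
    · obtain ⟨C, B, hCB⟩ := hg.growth
      refine ⟨1, by simp; linarith [pi_gt_three], |B|, ?_⟩
      refine Asymptotics.IsBigO.of_bound (|C| * exp (1 / 30)) (mem_inf_of_right ?_)
      intro z hz
      have hz0 : 0 < z.re := hz.1
      have hz1 : z.re < 1 := hz.2
      change ‖F z‖ ≤ _
      rw [hFn, norm_of_nonneg (exp_pos _).le]
      have e1 : exp (((z.re - s.re) ^ 2 - (z.im - s.im) ^ 2) / 30) ≤ exp (1 / 30) := by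
        gcongr
        nlinarith [sq_nonneg (z.im - s.im)]
      have e2 : b ^ ((z.re - 1) / 2) ≤ 1 :=
        Real.rpow_le_one_of_one_le_of_nonpos hb1 (by linarith)
      have e3 : ‖g z‖ ≤ |C| * exp (|B| * exp (1 * |z.im|)) := by
        refine (hCB z hz0 hz1).trans ?_
        have : B * |z.im| ≤ |B| * exp (1 * |z.im|) := by
          have h5 := add_one_le_exp (1 * |z.im|)
          have h6 := le_abs_self B
          have h7 := abs_nonneg z.im
          have h8 := abs_nonneg B
          nlinarith
        exact mul_le_mul (le_abs_self C) (exp_le_exp.2 this) (exp_pos _).le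
          (abs_nonneg C)
      calc _ ≤ (|C| * exp (|B| * exp (1 * |z.im|))) * exp (1 / 30) * 1 := by
            gcongr
        _ = _ := by ring
    · intro z hz
      rw [hFn, hz]
      have hzI : z = z.im * I := by apply Complex.ext <;> simp [hz]
      have h2 := hg.left z.im
      rw [← hzI] at h2
      have h3 := logScale_le_of_abs_sub hQ z.im s.im
      set v := |z.im - s.im| with hv
      have hv0 : 0 ≤ v := abs_nonneg _
      have hvs : (z.im - s.im) ^ 2 = v ^ 2 := (sq_abs _).symm
      have hu : |z.im| ≤ |s.im| + v := by
        have := abs_add_le s.im (z.im - s.im); simpa using this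
      have h4 : √(Q * (|z.im| + 1) / (2 * π)) * b ^ ((0 - 1 : ℝ) / 2) ≤
          exp (max 0 ((v - 2) / 6)) := by
        have e1 : b ^ ((0 - 1 : ℝ) / 2) = (√b)⁻¹ := by
          rw [sqrt_eq_rpow, ← rpow_neg hb0.le]; norm_num
        rw [e1, ← div_eq_mul_inv, ← Real.sqrt_div' _ hb0.le]
        have e2 : Q * (|z.im| + 1) / (2 * π) / b = (|z.im| + 1) / (|s.im| + 3) := by
          rw [hb]; field_simp
        rw [e2]
        refine sqrt_le_iff.2 ⟨(exp_pos _).le, ?_⟩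
        rw [← exp_nat_mul, div_le_iff₀ (by linarith)]
        have h5 := add_one_le_exp (((2 : ℕ) : ℝ) * max 0 ((v - 2) / 6))
        have h6 : (v - 2) / 6 ≤ max 0 ((v - 2) / 6) := le_max_right _ _
        have h7 : 0 ≤ max 0 ((v - 2) / 6) := le_max_left _ _
        push_cast at *
        nlinarith
      rw [hvs]
      calc ‖g z‖ * exp (((0 - s.re) ^ 2 - v ^ 2) / 30) * b ^ ((0 - 1 : ℝ) / 2)
          ≤ (√(Q * (|z.im| + 1) / (2 * π)) * (logScale Q s.im * exp (v / 19))) *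
            exp ((1 - v ^ 2) / 30) * b ^ ((0 - 1 : ℝ) / 2) := by
            gcongr
            · exact h2.trans (by gcongr)
            · nlinarith
        _ = (√(Q * (|z.im| + 1) / (2 * π)) * b ^ ((0 - 1 : ℝ) / 2)) *
            (exp (v / 19) * exp ((1 - v ^ 2) / 30)) * logScale Q s.im := by ring
        _ ≤ exp (max 0 ((v - 2) / 6)) *
            (exp (v / 19) * exp ((1 - v ^ 2) / 30)) * logScale Q s.im := by gcongr
        _ ≤ _ := by
            rw [← exp_add, ← exp_add]
            gcongr
            rcases max_cases 0 ((v - 2) / 6) with h | h <;> rw [h.1]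
            · nlinarith [sq_nonneg (v - 15 / 19)]
            · nlinarith [sq_nonneg (v - 3.29)]
    · intro z hz
      rw [hFn, hz]
      have h2 := hg.right z hz.ge
      have h3 := logScale_le_of_abs_sub hQ z.im s.im
      set v := |z.im - s.im| with hv
      have hvs : (z.im - s.im) ^ 2 = v ^ 2 := (sq_abs _).symm
      rw [hvs, sub_self, zero_div, rpow_zero, mul_one]
      calc _ ≤ (logScale Q s.im * exp (v / 19)) * exp ((1 - v ^ 2) / 30) := by
            gcongr
            · exact h2.trans h3
            · nlinarith
        _ = (exp (v / 19) * exp ((1 - v ^ 2) / 30)) * logScale Q s.im := by ring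
        _ ≤ _ := by
            rw [← exp_add]
            gcongr
            nlinarith [sq_nonneg (v - 15 / 19)]
  rw [hFn, sub_self, sub_self] at hmain
  simp only [ne_eq, OfNat.ofNat_ne_zero, not_false_eq_true, zero_pow, zero_div, Real.exp_zero,
    mul_one, sub_zero] at hmain
  have e : (1 - s.re) / 2 = -((s.re - 1) / 2) := by ring
  rw [e, rpow_neg hb0.le, ← div_eq_mul_inv, le_div_iff₀ (by positivity)]
  exact hmain

end StripFunction

/-- The derivative at the centre of a disc in terms of the real part on the boundary circle. -/
lemma re_deriv_eq_integral_re {f : ℂ → ℂ} {c : ℂ} {r : ℝ} (hr : 0 < r)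
    (hf : DiffContOnCl ℂ f (ball c r)) (hfc : ContinuousOn f (closedBall c r)) :
    (deriv f c).re = (∫ θ in (0 : ℝ)..2 * π, (f (circleMap c r θ)).re * cos θ) /
      (π * r) := by
  have h1 := hf.circleIntegral_one_div_sub_center_pow_smul hr 1
  have h2 := hf.circleIntegral_eq_zero hr.le
  simp only [circleIntegral, deriv_circleMap, circleMap_sub_center, smul_eq_mul,
    Nat.factorial_one, Nat.cast_one, div_one, iteratedDeriv_one] at h1 h2
  have hr0 : (r : ℂ) ≠ 0 := by exact_mod_cast hr.ne'
  have hcont : Continuous fun θ : ℝ => f (circleMap c r θ) :=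
    hfc.comp_continuous (continuous_circleMap c r) fun θ => circleMap_mem_closedBall c hr.le θ
  have e1 : ∀ θ : ℝ, circleMap 0 r θ * I * (1 / circleMap 0 r θ ^ (1 + 1) * f (circleMap c r θ)) =
      (I / r) * (cexp (-(θ * I)) * f (circleMap c r θ)) := by
    intro θ
    have : cexp (θ * I) ≠ 0 := exp_ne_zero _
    rw [circleMap_zero, exp_neg]; field_simp; ring
  have e2 : ∀ θ : ℝ, circleMap 0 r θ * I * f (circleMap c r θ) =
      (I * r) * (cexp (θ * I) * f (circleMap c r θ)) := by
    intro θ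
    rw [circleMap_zero]; ring
  simp_rw [e1] at h1
  simp_rw [e2] at h2
  rw [intervalIntegral.integral_const_mul] at h1 h2
  have h3 : ∫ θ in (0 : ℝ)..2 * π, cexp (θ * I) * f (circleMap c r θ) = 0 := by
    rcases mul_eq_zero.1 h2 with h | h
    · exact absurd h (mul_ne_zero I_ne_zero hr0)
    · exact h
  have h4 : ∫ θ in (0 : ℝ)..2 * π, cexp (-(θ * I)) * f (circleMap c r θ) =
      2 * π * r * deriv f c := by
    have : (I / r) ≠ 0 := div_ne_zero I_ne_zero hr0
    apply mul_left_cancel₀ this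
    rw [h1]; field_simp
  have h5 : ∫ θ in (0 : ℝ)..2 * π, f (circleMap c r θ) * (cos θ : ℝ) =
      (π * r : ℝ) * deriv f c := by
    have h6 : ∀ θ : ℝ, f (circleMap c r θ) * (cos θ : ℝ) =
        (1 / 2 : ℂ) * (cexp (θ * I) * f (circleMap c r θ) +
          cexp (-(θ * I)) * f (circleMap c r θ)) := by
      intro θ
      rw [ofReal_cos, Complex.cos]; ring_nf
    simp_rw [h6]
    rw [intervalIntegral.integral_const_mul, intervalIntegral.integral_add, h3, h4]
    · push_cast; ring
    · exact (Continuous.mul (by fun_prop) hcont).intervalIntegrable _ _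
    · exact (Continuous.mul (by fun_prop) hcont).intervalIntegrable _ _
  have h7 := congrArg Complex.re h5
  rw [re_ofReal_mul] at h7
  rw [eq_div_iff (by positivity), mul_comm, ← h7]
  have h8 := intervalIntegral.intervalIntegral_re (𝕜 := ℂ) (a := 0) (b := 2 * π)
    (f := fun θ : ℝ => f (circleMap c r θ) * (cos θ : ℝ))
    ((hcont.mul (by fun_prop)).intervalIntegrable _ _) (μ := volume)
  simp only [RCLike.re_to_complex, re_mul_ofReal] at h8
  exact h8.symm

/-- A nonvanishing function has logarithmic derivative at the centre given by its logarithmic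
size on the boundary circle. -/
lemma re_logDeriv_eq_integral_log_norm {f : ℂ → ℂ} {c : ℂ} {r R : ℝ} (hr : 0 < r) (hrR : r < R)
    (hf : DifferentiableOn ℂ f (ball c R)) (hf0 : ∀ z ∈ closedBall c r, f z ≠ 0) :
    (logDeriv f c).re = (∫ θ in (0 : ℝ)..2 * π,
      log ‖f (circleMap c r θ)‖ * cos θ) / (π * r) := by
  have hopen : IsOpen (ball c R ∩ f ⁻¹' {0}ᶜ) :=
    hf.continuousOn.isOpen_inter_preimage isOpen_ball isOpen_compl_singleton
  obtain ⟨δ, hδ, hsub⟩ := (isCompact_closedBall c r).exists_thickening_subset_open hopen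
    fun z hz => ⟨closedBall_subset_ball hrR hz, hf0 z hz⟩
  rw [thickening_closedBall hδ hr.le] at hsub
  have hfd : ∀ z ∈ ball c (δ + r), DifferentiableAt ℂ f z := fun z hz =>
    (hf z (hsub hz).1).differentiableAt (isOpen_ball.mem_nhds (hsub hz).1)
  have hfn : ∀ z ∈ ball c (δ + r), f z ≠ 0 := fun z hz => (hsub hz).2
  have hfan : DifferentiableOn ℂ (logDeriv f) (ball c (δ + r)) := by
    have : DifferentiableOn ℂ f (ball c (δ + r)) := fun z hz =>
      (hfd z hz).differentiableWithinAt
    exact (this.deriv isOpen_ball).div this hfn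
  obtain ⟨l, hl⟩ := hfan.isExactOn_ball
  have hc : c ∈ ball c (δ + r) := mem_ball_self (by linarith)
  have hconst : ∀ z ∈ ball c (δ + r), f z * cexp (-l z) = f c * cexp (-l c) := by
    intro z hz
    have hd : ∀ z ∈ ball c (δ + r), HasDerivAt (fun z => f z * cexp (-l z)) 0 z := by
      intro z hz
      have h1 := (hfd z hz).hasDerivAt.mul (hl z hz).neg.cexp
      refine HasDerivAt.congr_deriv h1 ?_
      have := hfn z hz
      rw [logDeriv_apply]; field_simp; simp
    refine IsOpen.is_const_of_deriv_eq_zero (𝕜 := ℂ) (f := fun z => f z * cexp (-l z))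
      isOpen_ball (convex_ball c (δ + r)).isPreconnected
      (fun z hz => (hd z hz).differentiableAt.differentiableWithinAt)
      (fun z hz => (hd z hz).deriv) hz hc
  have hsub' : closedBall c r ⊆ ball c (δ + r) :=
    closedBall_subset_ball (by linarith)
  have hlc : ContinuousOn l (ball c (δ + r)) := fun z hz =>
    (hl z hz).continuousAt.continuousWithinAt
  have hld : DifferentiableOn ℂ l (closure (ball c r)) := fun z hz =>
    (hl z (hsub' (closure_minimal ball_subset_closedBall Metric.isClosed_closedBall
      hz))).differentiableAt.differentiableWithinAt
  have hre := re_deriv_eq_integral_re (f := l) hr hld.diffContOnCl (hlc.mono hsub')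
  rw [(hl c hc).deriv] at hre
  rw [hre]
  congr 1
  have hlog : ∀ θ : ℝ, (l (circleMap c r θ)).re * cos θ =
      log ‖f (circleMap c r θ)‖ * cos θ +
        ((l c).re - log ‖f c‖) * cos θ := by
    intro θ
    have hm := hsub' (circleMap_mem_closedBall c hr.le θ)
    have h1 := congrArg (fun z => log ‖z‖) (hconst _ hm)
    simp only [norm_mul, norm_exp] at h1
    rw [log_mul (norm_ne_zero_iff.2 (hfn _ hm)) (exp_pos _).ne',
      log_mul (norm_ne_zero_iff.2 (hfn _ hc)) (exp_pos _).ne', log_exp,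
      log_exp, neg_re, neg_re] at h1
    have : (l (circleMap c r θ)).re = log ‖f (circleMap c r θ)‖ +
      ((l c).re - log ‖f c‖) := by linarith
    rw [this, add_mul]
  simp_rw [hlog]
  rw [intervalIntegral.integral_add, intervalIntegral.integral_const_mul]
  · simp
  · apply Continuous.intervalIntegrable
    refine Continuous.mul (Continuous.log (Continuous.norm ?_) ?_) Real.continuous_cos
    · exact (hf.continuousOn.mono (closedBall_subset_ball hrR)).comp_continuous
        (continuous_circleMap c r) fun θ => circleMap_mem_closedBall c hr.le θ
    · intro θ
      exact norm_ne_zero_iff.2 (hf0 _ (circleMap_mem_closedBall c hr.le θ))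
  · apply Continuous.intervalIntegrable; fun_prop

/-- Factoring out the zeros of an analytic function in a closed disc. -/
lemma exists_eq_prod_mul {g : ℂ → ℂ} {c : ℂ} {R : ℝ} (hR : 0 < R)
    (hg : AnalyticOnNhd ℂ g (closedBall c R)) (hgc : g c ≠ 0) :
    ∃ (Z : Finset ℂ) (n : ℂ → ℕ) (h : ℂ → ℂ), AnalyticOnNhd ℂ h (closedBall c R) ∧
      (∀ z ∈ closedBall c R, h z ≠ 0) ∧
      (∀ u ∈ Z, n u ≠ 0) ∧
      ∀ z ∈ ball c R, g z = (∏ u ∈ Z, (z - u) ^ n u) * h z := by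
  classical
  set U := closedBall c R with hU
  have hc : c ∈ U := Metric.mem_closedBall_self hR.le
  have hfin : (MeromorphicOn.divisor g U).support.Finite :=
    (MeromorphicOn.divisor g U).finiteSupport (isCompact_closedBall c R)
  have hord : ∀ u : U, meromorphicOrderAt g u ≠ ⊤ := by
    refine (hg.meromorphicOn.exists_meromorphicOrderAt_ne_top_iff_forall
      ⟨⟨c, hc⟩, (convex_closedBall c R).isPreconnected⟩).1 ⟨⟨c, hc⟩, ?_⟩
    simp only
    rw [(hg c hc).meromorphicOrderAt_eq, (hg c hc).analyticOrderAt_eq_zero.2 hgc]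
    simp
  obtain ⟨h, hh, hh0, heq⟩ := hg.meromorphicOn.extract_zeros_poles hord hfin
  have hnn := MeromorphicOn.AnalyticOnNhd.divisor_nonneg hg
  refine ⟨hfin.toFinset, fun u => (MeromorphicOn.divisor g U u).toNat, h, hh,
    fun z hz => hh0 ⟨z, hz⟩, ?_, ?_⟩
  · intro u hu
    have h1 : MeromorphicOn.divisor g U u ≠ 0 := by simpa using hu
    have h2 : 0 ≤ MeromorphicOn.divisor g U u := hnn u
    have h3 : 0 < MeromorphicOn.divisor g U u := lt_of_le_of_ne h2 h1.symm
    simpa using h3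
  · intro z hz
    have hzU : z ∈ U := ball_subset_closedBall hz
    have hfp : (∏ᶠ u, (fun x : ℂ => x - u) ^ MeromorphicOn.divisor g U u) =
        fun x => ∏ u ∈ hfin.toFinset, (x - u) ^ (MeromorphicOn.divisor g U u).toNat := by
      rw [finprod_eq_prod_of_mulSupport_subset (s := hfin.toFinset)]
      · ext x
        rw [Finset.prod_apply]
        refine Finset.prod_congr rfl fun u _ => ?_
        have h2 : 0 ≤ MeromorphicOn.divisor g U u := hnn u
        rw [Pi.pow_apply, ← zpow_natCast, Int.toNat_of_nonneg h2]
      · rw [Function.FactorizedRational.mulSupport]; simp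
    rw [hfp] at heq
    have hprod : AnalyticAt ℂ (fun x => ∏ u ∈ hfin.toFinset,
        (x - u) ^ (MeromorphicOn.divisor g U u).toNat) z := by
      fun_prop
    have hacc : AccPt z (𝓟 U) := by
      have h1 : AccPt z (𝓟 (ball c R)) :=
        accPt_principal_iff_nhdsWithin.2 (by
          have := (nhdsWithin_inter_of_mem' (s := {z}ᶜ) (t := ball c R) (a := z)
            (mem_nhdsWithin_of_mem_nhds (isOpen_ball.mem_nhds hz)))
          rw [show ball c R \ {z} = {z}ᶜ ∩ ball c R by
            rw [Set.inter_comm, Set.sdiff_eq], this]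
          infer_instance)
      exact h1.mono (principal_mono.2 ball_subset_closedBall)
    have h3 := (hg z hzU).meromorphicAt.eventuallyEq_nhdsNE_of_eventuallyEq_codiscreteWithin
      (hprod.smul (hh z hzU)).meromorphicAt hzU hacc heq
    have h4 := (ContinuousAt.eventuallyEq_nhds_iff_eventuallyEq_nhdsNE (hg z hzU).continuousAt
      (hprod.smul (hh z hzU)).continuousAt).1 h3
    exact h4.self_of_nhds

/-- The reflection of the factor `z - u` in the circle of centre `c` and radius `r`, when `u` lies
inside that circle. -/
noncomputable def reflectedFactor (c : ℂ) (r : ℝ) (u z : ℂ) : ℂ :=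
  if ‖u - c‖ < r then (r ^ 2 - (starRingEnd ℂ) (u - c) * (z - c)) / r else z - u

lemma differentiable_reflectedFactor (c : ℂ) (r : ℝ) (u : ℂ) :
    Differentiable ℂ (reflectedFactor c r u) := by
  unfold reflectedFactor
  split_ifs <;> fun_prop

lemma reflectedFactor_ne_zero {c : ℂ} {r : ℝ} (hr : 0 < r) {u z : ℂ} (hu : ‖u - c‖ ≠ r)
    (hz : ‖z - c‖ ≤ r) : reflectedFactor c r u z ≠ 0 := by
  unfold reflectedFactor
  split_ifs with h
  · refine div_ne_zero (fun h0 => ?_) (by exact_mod_cast hr.ne')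
    have h1 : ‖((r : ℂ)) ^ 2‖ = ‖(starRingEnd ℂ) (u - c) * (z - c)‖ := by
      rw [sub_eq_zero.1 h0]
    rw [norm_mul, norm_conj, norm_pow, norm_real, norm_of_nonneg hr.le] at h1
    nlinarith [norm_nonneg (u - c), norm_nonneg (z - c)]
  · intro h0
    rw [sub_eq_zero] at h0
    rw [h0] at hz
    exact h (lt_of_le_of_ne hz hu)

lemma norm_reflectedFactor {c : ℂ} {r : ℝ} (hr : 0 < r) {u z : ℂ} (hz : ‖z - c‖ = r) :
    ‖reflectedFactor c r u z‖ = ‖z - u‖ := by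
  unfold reflectedFactor
  split_ifs with h
  · have h1 : (r : ℂ) ^ 2 = (starRingEnd ℂ) (z - c) * (z - c) := by
      rw [conj_mul', hz]
    rw [h1, ← sub_mul, ← map_sub, norm_div, norm_mul, norm_conj, hz, norm_real,
      norm_of_nonneg hr.le, mul_div_assoc, div_self hr.ne', mul_one]
    congr 1; ring
  · rfl

lemma re_logDeriv_reflectedFactor {c : ℂ} {r : ℝ} (hr : 0 < r) {u : ℂ} (hu : u ≠ c) :
    (logDeriv (fun z => z - u) c - logDeriv (reflectedFactor c r u) c).re =
      if ‖u - c‖ < r then (c - u).re * (1 / ‖c - u‖ ^ 2 - 1 / r ^ 2) else 0 := by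
  have hr0 : (r : ℂ) ≠ 0 := by exact_mod_cast hr.ne'
  have hn : ‖c - u‖ ≠ 0 := norm_ne_zero_iff.2 (sub_ne_zero.2 hu.symm)
  have e1 : logDeriv (fun z : ℂ => z - u) c = 1 / (c - u) := by
    rw [logDeriv_apply]; simp
  split_ifs with h
  · have e2 : logDeriv (reflectedFactor c r u) c = (starRingEnd ℂ) (c - u) / (r : ℂ) ^ 2 := by
      have e3 : reflectedFactor c r u =
          fun z => ((r : ℂ) ^ 2 - (starRingEnd ℂ) (u - c) * (z - c)) / r := by
        funext z; simp [reflectedFactor, h]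
      have e4 : HasDerivAt (reflectedFactor c r u) (-((starRingEnd ℂ) (u - c)) / r) c := by
        rw [e3]
        have := ((((hasDerivAt_id c).sub_const c).const_mul ((starRingEnd ℂ) (u - c))).const_sub
          ((r : ℂ) ^ 2)).div_const (r : ℂ)
        simpa using this
      rw [logDeriv_apply, e4.deriv, e3]
      simp only [sub_self, mul_zero, sub_zero]
      rw [← neg_sub u c, map_neg]
      field_simp
    rw [e1, e2]
    have e5 : (1 : ℂ) / (c - u) = (starRingEnd ℂ) (c - u) / ((‖c - u‖ ^ 2 : ℝ) : ℂ) := by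
      rw [div_eq_div_iff (sub_ne_zero.2 hu.symm) (by exact_mod_cast pow_ne_zero 2 hn), conj_mul']
      push_cast; ring
    rw [e5, ← ofReal_pow, sub_re, div_ofReal_re, div_ofReal_re, conj_re]
    ring
  · have e2 : reflectedFactor c r u = fun z => z - u := by
      funext z; simp [reflectedFactor, h]
    rw [e2, sub_self, zero_re]

/-- A Jensen type inequality for the logarithmic derivative at the centre of a disc all of whose
zeros lie to the left of the centre. -/
theorem exists_neg_re_logDeriv_add_sum_le {g : ℂ → ℂ} {c : ℂ}
    (hg : AnalyticOnNhd ℂ g (closedBall c 1)) (hgc : g c ≠ 0)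
    (hleft : ∀ z ∈ ball c 1, g z = 0 → z.re ≤ c.re) (S : Finset ℂ)
    (hS : ∀ u ∈ S, g u = 0 ∧ ‖u - c‖ < 99 / 100) :
    ∃ r : ℝ, 99 / 100 < r ∧ r < 1 ∧ (∀ θ : ℝ, g (circleMap c r θ) ≠ 0) ∧
      -(logDeriv g c).re + ∑ u ∈ S, (c - u).re * (1 / ‖c - u‖ ^ 2 - 1 / r ^ 2) ≤
      -(∫ θ in (0 : ℝ)..2 * π, log ‖g (circleMap c r θ)‖ * cos θ) /
        (π * r) := by
  classical
  obtain ⟨Z, n, h, hh, hh0, hn, heq⟩ := exists_eq_prod_mul one_pos hg hgc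
  obtain ⟨r, hr, hrZ⟩ := (Set.Ioo_infinite (show (99 / 100 : ℝ) < 1 by norm_num)).exists_notMem_finset
    (Z.image fun u => ‖u - c‖)
  have hr0 : 0 < r := by linarith [hr.1]
  have hZr : ∀ u ∈ Z, ‖u - c‖ ≠ r := fun u hu h => hrZ (Finset.mem_image.2 ⟨u, hu, h⟩)
  have hsub : closedBall c r ⊆ ball c 1 := closedBall_subset_ball hr.2
  have hcb : c ∈ ball c 1 := mem_ball_self one_pos
  have hcm : c ∈ closedBall c r := Metric.mem_closedBall_self hr0.le
  have hZzero : ∀ u ∈ Z, u ∈ ball c 1 → g u = 0 := by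
    intro u hu hub
    rw [heq u hub, Finset.prod_eq_zero hu, zero_mul]
    simp [hn u hu]
  have hSZ : ∀ u ∈ S, u ∈ Z := by
    intro u hu
    have hub : u ∈ ball c 1 := by
      rw [Metric.mem_ball, dist_eq]; linarith [(hS u hu).2]
    have h1 := heq u hub
    rw [(hS u hu).1] at h1
    rcases mul_eq_zero.1 h1.symm with h2 | h2
    · obtain ⟨v, hv, hv2⟩ := Finset.prod_eq_zero_iff.1 h2
      have : u = v := sub_eq_zero.1 (pow_eq_zero_iff (hn v hv) |>.1 hv2)
      rwa [this]
    · exact absurd h2 (hh0 u (ball_subset_closedBall hub))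
  have hZc : ∀ u ∈ Z, u ≠ c := by
    rintro u hu rfl
    exact hgc (hZzero u hu hcb)
  set H : ℂ → ℂ := fun z => (∏ u ∈ Z, reflectedFactor c r u z ^ n u) * h z with hH
  have hhd : ∀ z ∈ ball c 1, DifferentiableAt ℂ h z := fun z hz =>
    (hh z (ball_subset_closedBall hz)).differentiableAt
  have hPd : ∀ z, DifferentiableAt ℂ (fun z => ∏ u ∈ Z, reflectedFactor c r u z ^ n u) z := by
    intro z
    refine DifferentiableAt.fun_finsetProd fun u _ => ?_
    exact (differentiable_reflectedFactor c r u z).pow _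
  have hHd : DifferentiableOn ℂ H (ball c 1) := fun z hz =>
    ((hPd z).mul (hhd z hz)).differentiableWithinAt
  have hP0 : ∀ z ∈ closedBall c r, ∀ u ∈ Z, reflectedFactor c r u z ^ n u ≠ 0 := by
    intro z hz u hu
    refine pow_ne_zero _ (reflectedFactor_ne_zero hr0 (hZr u hu) ?_)
    rwa [← dist_eq]
  have hH0 : ∀ z ∈ closedBall c r, H z ≠ 0 := fun z hz =>
    mul_ne_zero (Finset.prod_ne_zero_iff.2 (hP0 z hz))
      (hh0 z (ball_subset_closedBall (hsub hz)))
  have hint := re_logDeriv_eq_integral_log_norm hr0 hr.2 hHd hH0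
  have hnorm : ∀ θ : ℝ, ‖g (circleMap c r θ)‖ = ‖H (circleMap c r θ)‖ := by
    intro θ
    have hm := circleMap_mem_closedBall c hr0.le θ
    have hs : ‖circleMap c r θ - c‖ = r := by
      rw [circleMap_sub_center, norm_circleMap_zero, abs_of_pos hr0]
    rw [heq _ (hsub hm), hH, norm_mul, norm_mul, norm_prod, norm_prod]
    congr 1
    refine Finset.prod_congr rfl fun u _ => ?_
    rw [norm_pow, norm_pow, norm_reflectedFactor hr0 hs]
  refine ⟨r, hr.1, hr.2, fun θ => ?_, ?_⟩
  · rw [← norm_ne_zero_iff, hnorm, norm_ne_zero_iff]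
    exact hH0 _ (circleMap_mem_closedBall c hr0.le θ)
  · simp_rw [hnorm]
    rw [neg_div, ← hint]
    have hfac0 : ∀ u ∈ Z, (c - u) ^ n u ≠ 0 := fun u hu =>
      pow_ne_zero _ (sub_ne_zero.2 (hZc u hu).symm)
    have hlg : logDeriv g c = ∑ u ∈ Z, n u * logDeriv (fun z => z - u) c + logDeriv h c := by
      have h1 : g =ᶠ[𝓝 c] fun z => (∏ u ∈ Z, (z - u) ^ n u) * h z :=
        Filter.eventually_of_mem (isOpen_ball.mem_nhds hcb) heq
      have h2 : logDeriv g c = logDeriv (fun z => (∏ u ∈ Z, (z - u) ^ n u) * h z) c := by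
        rw [logDeriv_apply, logDeriv_apply, h1.deriv_eq, h1.self_of_nhds]
      rw [h2, logDeriv_mul c (Finset.prod_ne_zero_iff.2 hfac0) (hh0 c (ball_subset_closedBall
        hcb)) (by fun_prop) (hhd c hcb), logDeriv_prod hfac0 (fun u _ => by fun_prop)]
      congr 1
      exact sum_congr rfl fun u _ => logDeriv_fun_pow (by fun_prop) _
    have hlH : logDeriv H c = ∑ u ∈ Z, n u * logDeriv (reflectedFactor c r u) c +
        logDeriv h c := by
      rw [hH, logDeriv_mul c (Finset.prod_ne_zero_iff.2 (hP0 c hcm)) (hh0 c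
        (ball_subset_closedBall hcb)) (hPd c) (hhd c hcb), logDeriv_prod
        (f := fun u z => reflectedFactor c r u z ^ n u) (hP0 c hcm)
        (fun u _ => (differentiable_reflectedFactor c r u c).pow _)]
      congr 1
      exact sum_congr rfl fun u _ =>
        logDeriv_fun_pow (differentiable_reflectedFactor c r u c) _
    have hdiff : (logDeriv g c).re - (logDeriv H c).re = ∑ u ∈ Z, (n u : ℝ) *
        (if ‖u - c‖ < r then (c - u).re * (1 / ‖c - u‖ ^ 2 - 1 / r ^ 2) else 0) := by
      rw [← sub_re, hlg, hlH, add_sub_add_right_eq_sub, ← sum_sub_distrib, re_sum]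
      refine sum_congr rfl fun u hu => ?_
      rw [← mul_sub, ← ofReal_natCast, re_ofReal_mul, re_logDeriv_reflectedFactor hr0 (hZc u hu)]
    have hpos : ∀ u ∈ Z, 0 ≤ (if ‖u - c‖ < r then
        (c - u).re * (1 / ‖c - u‖ ^ 2 - 1 / r ^ 2) else 0) := by
      intro u hu
      split_ifs with h1
      · have hub : u ∈ ball c 1 := by
          rw [Metric.mem_ball, dist_eq]; linarith [hr.2]
        have h2 := hleft u hub (hZzero u hu hub)
        have h3 : 0 < ‖c - u‖ := norm_pos_iff.2 (sub_ne_zero.2 (hZc u hu).symm)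
        rw [norm_sub_rev] at h1
        refine mul_nonneg (by rw [sub_re]; linarith) (sub_nonneg.2 ?_)
        exact one_div_le_one_div_of_le (by positivity) (by gcongr)
      · exact le_rfl
    have hle : ∑ u ∈ S, (c - u).re * (1 / ‖c - u‖ ^ 2 - 1 / r ^ 2) ≤ ∑ u ∈ Z, (n u : ℝ) *
        (if ‖u - c‖ < r then (c - u).re * (1 / ‖c - u‖ ^ 2 - 1 / r ^ 2) else 0) := by
      calc _ ≤ ∑ u ∈ S, (n u : ℝ) *
            (if ‖u - c‖ < r then (c - u).re * (1 / ‖c - u‖ ^ 2 - 1 / r ^ 2) else 0) := by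
            refine sum_le_sum fun u hu => ?_
            have h1 := hpos u (hSZ u hu)
            have h2 : (1 : ℝ) ≤ n u := by
              exact_mod_cast Nat.one_le_iff_ne_zero.2 (hn u (hSZ u hu))
            rw [if_pos ((hS u hu).2.trans hr.1)] at h1 ⊢
            nlinarith
        _ ≤ _ := sum_le_sum_of_subset_of_nonneg hSZ fun u hu _ =>
            mul_nonneg (Nat.cast_nonneg _) (hpos u hu)
    linarith

/-- The bound for the logarithmic derivative just to the right of the line `re s = 1`, at height
`t`, for a function of conductor `Q` and mass `m`. -/
noncomputable def discBound (Q m t : ℝ) : ℝ :=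
  2 / (99 / 100 * π) * (log (logScale Q (|t| + 1)) + 1 / 16) +
    log (Q * (|t| + 4) / (2 * π)) / 4 + m * (100 / 99) ^ 2

namespace StripFunction

variable {g : ℂ → ℂ} {Q m : ℝ}

lemma ne_zero (hg : StripFunction g Q m) {s : ℂ} (hs : 1 < s.re) : g s ≠ 0 := by
  have := (exp_pos _).trans_le (hg.lower s hs)
  exact norm_pos_iff.1 this

lemma logScale_mono {Q y t : ℝ} (hQ : 0 < Q) (h : |y| ≤ |t|) : logScale Q y ≤ logScale Q t := by
  have := abs_nonneg y
  unfold logScale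
  gcongr

/-- An upper bound for `log ‖g‖` in the half plane `0 ≤ re s`. -/
lemma log_norm_le (hg : StripFunction g Q m) {s : ℂ} {t x : ℝ} (h0 : 0 ≤ s.re)
    (ht : |s.im| ≤ |t| + 1) (hx0 : 0 ≤ x) (hx : 1 - s.re ≤ x) :
    log ‖g s‖ ≤ log (logScale Q (|t| + 1)) + 1 / 16 +
      x * (log (Q * (|t| + 4) / (2 * π)) / 2) := by
  have hQ := hg.conductor_ge
  have hQ0 : 0 < Q := by linarith
  have hpi := pi_pos
  have hpi4 := pi_lt_four
  have ht0 := abs_nonneg t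
  have hl := logScale_ge hQ (|t| + 1)
  have hl2 : logScale Q s.im ≤ logScale Q (|t| + 1) :=
    logScale_mono hQ0 (by rwa [abs_of_nonneg (by linarith : 0 ≤ |t| + 1)])
  have hb1 : 1 ≤ Q * (|t| + 4) / (2 * π) := by
    rw [le_div_iff₀ (by positivity)]; nlinarith
  have hlb := log_nonneg hb1
  have hll : 0 ≤ log (logScale Q (|t| + 1)) := log_nonneg (by linarith)
  rcases eq_or_ne (g s) 0 with h | h
  · rw [h]; simp; positivity
  have hn : 0 < ‖g s‖ := norm_pos_iff.2 h
  rcases le_total 1 s.re with h1 | h1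
  · have := log_le_log hn ((hg.right s h1).trans hl2)
    have := mul_nonneg hx0 (div_nonneg hlb zero_le_two)
    linarith
  · have h2 := log_le_log hn (hg.norm_le_of_mem_strip h0 h1)
    have hs0 := abs_nonneg s.im
    have hlp := logScale_pos hQ s.im
    have hbp : 0 < Q * (|s.im| + 3) / (2 * π) := by positivity
    rw [log_mul (by positivity) (by positivity), log_mul (by positivity) (by positivity),
      log_exp, log_rpow hbp] at h2
    have h3 := log_le_log hlp hl2
    have h4 : log (Q * (|s.im| + 3) / (2 * π)) ≤
        log (Q * (|t| + 4) / (2 * π)) := by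
      apply log_le_log hbp
      gcongr ?_ / _
      gcongr Q * ?_
      linarith
    have h5 : (1 - s.re) / 2 * log (Q * (|s.im| + 3) / (2 * π)) ≤
        x / 2 * log (Q * (|t| + 4) / (2 * π)) := by
      calc _ ≤ (1 - s.re) / 2 * log (Q * (|t| + 4) / (2 * π)) := by
            apply mul_le_mul_of_nonneg_left h4; linarith
        _ ≤ _ := by apply mul_le_mul_of_nonneg_right _ hlb; linarith
    linarith

/-- The logarithmic derivative to the right of the line `re s = 1` is controlled by `discBound`,
with room for the contribution of any finite set of nearby zeros. -/
theorem neg_re_logDeriv_add_sum_le (hg : StripFunction g Q m) {s : ℂ} (h1 : 1 < s.re)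
    (h2 : s.re ≤ 101 / 100) (S : Finset ℂ) (hS : ∀ u ∈ S, g u = 0 ∧ ‖u - s‖ < 99 / 100) :
    -(logDeriv g s).re + ∑ u ∈ S, (s - u).re * (1 / ‖s - u‖ ^ 2 - (100 / 99) ^ 2) ≤
      discBound Q m s.im := by
  have hQ := hg.conductor_ge
  have hQ0 : 0 < Q := by linarith
  have hm := hg.mass_nonneg
  have hpi := pi_pos
  have hpi4 := pi_lt_four
  have hre : ∀ z ∈ closedBall s 1, 0 < z.re := by
    intro z hz
    have h3 := (abs_re_le_norm (z - s)).trans (by rwa [← dist_eq, ← Metric.mem_closedBall])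
    rw [sub_re, abs_le] at h3
    linarith [h3.1]
  have han : AnalyticOnNhd ℂ g (closedBall s 1) := by
    have hd : DifferentiableOn ℂ g {z : ℂ | -1 < z.re} := fun z hz =>
      (hg.differentiableAt z hz).differentiableWithinAt
    refine (hd.analyticOnNhd (isOpen_lt continuous_const continuous_re)).mono fun z hz => ?_
    have := hre z hz
    change -1 < z.re
    linarith
  have hright : ∀ z, g z = 0 → z.re ≤ 1 := fun z hz => by
    by_contra! h
    exact hg.ne_zero h hz
  obtain ⟨r, hr1, hr2, hr0, hmain⟩ := exists_neg_re_logDeriv_add_sum_le han (hg.ne_zero h1)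
    (fun z _ hz => (hright z hz).trans h1.le) S hS
  set t := s.im with ht
  set M := log (logScale Q (|t| + 1)) + 1 / 16 with hM
  set b := log (Q * (|t| + 4) / (2 * π)) with hb
  have ht0 := abs_nonneg t
  have hrp : 0 < r := by linarith
  have hM0 : 0 ≤ M := by
    have := logScale_ge hQ (|t| + 1)
    have := log_nonneg (show 1 ≤ logScale Q (|t| + 1) by linarith)
    rw [hM]; linarith
  have hcont : Continuous fun θ : ℝ => log ‖g (circleMap s r θ)‖ * cos θ := by
    refine Continuous.mul (Continuous.log (Continuous.norm ?_) fun θ =>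
      norm_ne_zero_iff.2 (hr0 θ)) Real.continuous_cos
    refine (han.continuousOn).comp_continuous (continuous_circleMap s r) fun θ => ?_
    exact Metric.closedBall_subset_closedBall hr2.le (circleMap_mem_closedBall s hrp.le θ)
  have hper : Function.Periodic (fun θ : ℝ => log ‖g (circleMap s r θ)‖ * cos θ)
      (2 * π) := by
    intro θ
    simp only [periodic_circleMap s r θ, Real.cos_add_two_pi]
  have hpt : ∀ θ : ℝ, circleMap s r θ = s + r * cos θ + r * Real.sin θ * I := by
    intro θ
    rw [circleMap, exp_mul_I, ofReal_cos, ofReal_sin]; ring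
  have hptre : ∀ θ : ℝ, (circleMap s r θ).re = s.re + r * cos θ := by
    intro θ; rw [hpt, ← ofReal_mul, ← ofReal_mul]; simp [-ofReal_mul, -ofReal_cos, -ofReal_sin]
  have hptim : ∀ θ : ℝ, (circleMap s r θ).im = t + r * Real.sin θ := by
    intro θ; rw [hpt, ← ofReal_mul, ← ofReal_mul]; simp [ht, -ofReal_mul, -ofReal_cos, -ofReal_sin]
  have hshift : ∫ θ in (0 : ℝ)..2 * π, log ‖g (circleMap s r θ)‖ * cos θ =
      (∫ θ in (-(π / 2))..Real.pi / 2, log ‖g (circleMap s r θ)‖ * cos θ) +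
      ∫ θ in (π / 2)..Real.pi + π / 2,
        log ‖g (circleMap s r θ)‖ * cos θ := by
    rw [intervalIntegral.integral_add_adjacent_intervals (hcont.intervalIntegrable _ _)
      (hcont.intervalIntegrable _ _)]
    have := hper.intervalIntegral_add_eq 0 (-(π / 2))
    rw [zero_add] at this
    rw [this]
    congr 1; ring
  have hR : -(m / r * π) ≤
      ∫ θ in (-(π / 2))..Real.pi / 2, log ‖g (circleMap s r θ)‖ * cos θ := by
    have h3 : ∫ θ in (-(π / 2))..Real.pi / 2, -(m / r) = -(m / r * π) := by
      rw [intervalIntegral.integral_const, smul_eq_mul]; ring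
    rw [← h3]
    refine intervalIntegral.integral_mono_on (by linarith) (by simp)
      (hcont.intervalIntegrable _ _) fun θ hθ => ?_
    have hc : 0 ≤ cos θ := Real.cos_nonneg_of_mem_Icc hθ
    rcases hc.eq_or_lt with hc | hc
    · rw [← hc, mul_zero, neg_nonpos]; positivity
    have hgt : 1 < (circleMap s r θ).re := by rw [hptre]; nlinarith
    have h4 := hg.lower _ hgt
    have h5 := (le_log_iff_exp_le (norm_pos_iff.2 (hr0 θ))).2 h4
    have h6 : m / ((circleMap s r θ).re - 1) ≤ m / (r * cos θ) := by
      gcongr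
      rw [hptre]; linarith
    have h7 : m / (r * cos θ) * cos θ = m / r := by field_simp
    nlinarith
  have hL : -(2 * M + r * b / 4 * π) ≤ ∫ θ in (π / 2)..Real.pi + π / 2,
        log ‖g (circleMap s r θ)‖ * cos θ := by
    have h3 : ∫ θ in (π / 2)..Real.pi + π / 2,
        (M * cos θ + -(r * b / 2) * cos θ ^ 2) = -(2 * M + r * b / 4 * π) := by
      rw [intervalIntegral.integral_add, intervalIntegral.integral_const_mul,
        intervalIntegral.integral_const_mul, integral_cos, integral_cos_sq]
      · rw [add_comm π, Real.sin_add_pi, Real.cos_add_pi, Real.sin_pi_div_two,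
          Real.cos_pi_div_two]
        ring
      all_goals exact Continuous.intervalIntegrable (by fun_prop) _ _
    rw [← h3]
    refine intervalIntegral.integral_mono_on (by linarith)
      (Continuous.intervalIntegrable (by fun_prop) _ _)
      (hcont.intervalIntegrable _ _) fun θ hθ => ?_
    have hc : cos θ ≤ 0 := Real.cos_nonpos_of_pi_div_two_le_of_le hθ.1 hθ.2
    have h4 : log ‖g (circleMap s r θ)‖ ≤ M + (-(r * cos θ)) * (b / 2) := by
      apply hg.log_norm_le
      · exact (hre _ (Metric.closedBall_subset_closedBall hr2.le
          (circleMap_mem_closedBall s hrp.le θ))).le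
      · rw [hptim]
        refine (abs_add_le _ _).trans ?_
        rw [abs_mul, abs_of_pos hrp]
        have := Real.abs_sin_le_one θ
        have := abs_nonneg (Real.sin θ)
        nlinarith
      · nlinarith
      · rw [hptre]; linarith
    have h5 := mul_le_mul_of_nonpos_right h4 hc
    calc _ = (M + (-(r * cos θ)) * (b / 2)) * cos θ := by ring
      _ ≤ _ := h5
  have hI : -(∫ θ in (0 : ℝ)..2 * π, log ‖g (circleMap s r θ)‖ * cos θ) /
      (π * r) ≤ discBound Q m t := by
    rw [hshift]
    calc _ ≤ (m / r * π + (2 * M + r * b / 4 * π)) / (π * r) := by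
          gcongr; linarith
      _ = 2 / (r * π) * M + b / 4 + m * (1 / r) ^ 2 := by field_simp; ring
      _ ≤ _ := by
          rw [discBound, ← hM, ← hb]
          have : 1 / r ≤ 100 / 99 := by rw [div_le_div_iff₀ hrp (by norm_num)]; linarith
          gcongr
  refine le_trans ?_ (hmain.trans hI)
  gcongr with u hu
  · have := hright u (hS u hu).1
    rw [sub_re]; linarith
  · rw [div_le_iff₀ (by positivity)]
    have : (99 / 100 : ℝ) ^ 2 ≤ r ^ 2 := by gcongr
    nlinarith

end StripFunction

/-- The integral of the fractional part against `t ^ (-(s + 1))`, up to sign. -/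
noncomputable def fractIntegral (s : ℂ) : ℂ :=
  ∫ t in Set.Ioi (1 : ℝ), sumDiscrepancy (fun _ => 1) 1 t * (t : ℂ) ^ (-(s + 1))

lemma norm_fractIntegral_le {s : ℂ} (hs : 0 < s.re) : ‖fractIntegral s‖ ≤ 1 / s.re := by
  have h := norm_integral_Ioi_mul_cpow_le (u := sumDiscrepancy (fun _ => 1) 1) (B := 1) one_pos
    (fun t ht => norm_sumDiscrepancy_one_le ht) hs
  rw [Real.one_rpow, mul_one] at h
  exact h

lemma differentiableAt_fractIntegral {s : ℂ} (hs : 0 < s.re) :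
    DifferentiableAt ℂ fractIntegral s :=
  differentiableAt_integral_Ioi_mul_cpow (measurable_sumDiscrepancy _ _) one_pos
    (fun _ ht => norm_sumDiscrepancy_one_le ht) hs

lemma zetaEntire_eq_mul {s : ℂ} (hs : 0 < s.re) :
    zetaEntire s = s * (1 + (s - 1) * fractIntegral s) := by
  have h := eq_partial_sum_add_of_differentiableOn (a := fun _ => 1) (m := 1) (B := 1)
    (G := zetaEntire) (fun t ht => norm_sumDiscrepancy_one_le ht)
    (fun s hs => LSeriesSummable_of_bounded_of_one_lt_re (m := 1) (fun n _ => by simp) hs)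
    differentiable_zetaEntire.differentiableOn (fun s hs => zetaEntire_eq_LSeries hs) le_rfl hs
  rw [h, fractIntegral]
  simp [sumDiscrepancy]
  ring

lemma zetaEntire_ne_zero {s : ℂ} (hs : 0 < s.re) (h : ‖s - 1‖ < s.re) : zetaEntire s ≠ 0 := by
  rw [zetaEntire_eq_mul hs]
  refine mul_ne_zero (by rintro rfl; simp at hs) fun h0 => ?_
  have h1 : ‖(s - 1) * fractIntegral s‖ = 1 := by
    rw [eq_neg_of_add_eq_zero_right h0]; simp
  have h2 := norm_fractIntegral_le hs
  rw [norm_mul] at h1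
  have : ‖s - 1‖ * (1 / s.re) < 1 := by rw [mul_one_div, div_lt_one hs]; exact h
  nlinarith [norm_nonneg (s - 1)]

lemma neg_re_logDeriv_zetaEntire_le {s : ℂ} (hs : 1 < s.re) (h : ‖s - 1‖ ≤ 1 / 20) :
    -(logDeriv zetaEntire s).re ≤ 1 / 2 := by
  have hs0 : 0 < s.re := by linarith
  have hsne : s ≠ 0 := by rintro rfl; simp at hs0
  have hJ := norm_fractIntegral_le hs0
  have hJ1 : ‖fractIntegral s‖ ≤ 1 := hJ.trans (by rw [div_le_one hs0]; exact hs.le)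
  have hd : ‖deriv fractIntegral s‖ ≤ 4 := by
    have := norm_deriv_le_of_forall_mem_sphere_norm_le (c := s) (R := 1 / 2) (C := 2)
      (f := fractIntegral) (by norm_num)
      (DifferentiableOn.diffContOnCl fun z hz => by
        rw [closure_ball _ (by norm_num), Metric.mem_closedBall, dist_eq] at hz
        have := (abs_re_le_norm (z - s)).trans hz
        rw [abs_le, sub_re] at this
        exact (differentiableAt_fractIntegral (by linarith [this.1])).differentiableWithinAt)
      (fun z hz => by
        rw [mem_sphere_iff_norm] at hz
        have := (abs_re_le_norm (z - s)).trans hz.le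
        rw [abs_le, sub_re] at this
        refine (norm_fractIntegral_le (by linarith [this.1])).trans ?_
        rw [div_le_iff₀ (by linarith [this.1])]; linarith [this.1])
    norm_num at this ⊢; exact this
  set u := 1 + (s - 1) * fractIntegral s with hu
  set v := fractIntegral s + (s - 1) * deriv fractIntegral s with hv
  have hG : HasDerivAt zetaEntire (u + s * v) s := by
    have h1 := (differentiableAt_fractIntegral hs0).hasDerivAt
    have h2 := (hasDerivAt_id s).mul
      ((((hasDerivAt_id s).sub_const 1).mul h1).const_add 1)
    refine (h2.congr_of_eventuallyEq ?_).congr_deriv ?_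
    · filter_upwards [(isOpen_lt continuous_const continuous_re).mem_nhds hs0] with z hz
      rw [zetaEntire_eq_mul hz]; rfl
    · simp [hu, hv]
  have hun : 95 / 100 ≤ ‖u‖ := by
    have : ‖(s - 1) * fractIntegral s‖ ≤ 1 / 20 := by
      rw [norm_mul]; nlinarith [norm_nonneg (s - 1), norm_nonneg (fractIntegral s)]
    have h2 := norm_sub_norm_le (1 : ℂ) (-((s - 1) * fractIntegral s))
    rw [norm_neg, norm_one, sub_neg_eq_add] at h2
    linarith
  have hu0 : u ≠ 0 := norm_pos_iff.1 (by linarith)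
  have hvn : ‖v‖ ≤ 120 / 100 := by
    refine (norm_add_le _ _).trans ?_
    rw [norm_mul]
    nlinarith [norm_nonneg (s - 1), norm_nonneg (deriv fractIntegral s)]
  have e : logDeriv zetaEntire s = 1 / s + v / u := by
    rw [logDeriv_apply, hG.deriv, zetaEntire_eq_mul hs0, ← hu]
    field_simp
  have h1 : ‖v / u‖ ≤ 127 / 100 := by
    rw [norm_div, div_le_iff₀ (by linarith)]; linarith
  have h2 : ‖1 / s - 1‖ ≤ 1 / 20 := by
    have : 1 / s - 1 = -(s - 1) / s := by field_simp; ring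
    rw [this, norm_div, norm_neg, div_le_iff₀ (norm_pos_iff.2 hsne)]
    have := re_le_norm s
    nlinarith
  rw [e, add_re]
  have h3 := neg_le_of_abs_le ((abs_re_le_norm (v / u)).trans h1)
  have h4 := neg_le_of_abs_le ((abs_re_le_norm (1 / s - 1)).trans h2)
  rw [sub_re, one_re] at h4
  linarith

section

variable {f : ℕ} [NeZero f]

/-- The Dirichlet series of `ψ Λ`. -/
noncomputable def mangoldtSeries (ψ : DirichletCharacter ℂ f) (s : ℂ) : ℂ :=
  LSeries (fun n => ψ n * (Λ n : ℂ)) s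

/-- The `L`-function of `ψ`, with the pole removed when the modulus is one. -/
noncomputable def regularizedL (ψ : DirichletCharacter ℂ f) : ℂ → ℂ :=
  if f = 1 then zetaReg else LFunction ψ

/-- The polar part of the logarithmic derivative, present when the modulus is one. -/
noncomputable def poleTerm (f : ℕ) (s : ℂ) : ℂ :=
  if f = 1 then 1 / (s - 1) - 1 / (s + 1) else 0

lemma stripFunction_regularizedL {ψ : DirichletCharacter ℂ f} (hψ : ψ.IsPrimitive) {Q : ℝ}
    (hQ : f ≤ Q) (hQ30 : 30 ≤ Q) : StripFunction (regularizedL ψ) Q (if f = 1 then 3 else 1) := by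
  rw [regularizedL]
  split_ifs with h
  · exact stripFunction_zetaReg hQ30
  · exact stripFunction_LFunction hψ h hQ hQ30

lemma logDeriv_zetaReg {s : ℂ} (hs : 0 < s.re) (h : zetaEntire s ≠ 0) :
    logDeriv zetaReg s = logDeriv zetaEntire s - 1 / (s + 1) := by
  have h1 : s + 1 ≠ 0 := by
    intro h; have := congrArg Complex.re h; simp at this; linarith
  have := logDeriv_div (f := zetaEntire) (g := fun s => s + 1) s h h1
    (differentiable_zetaEntire s) (differentiableAt_id.add_const 1)
  have e : zetaReg = fun s => zetaEntire s / (s + 1) := rfl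
  rw [e, this]
  congr 1
  rw [logDeriv_apply]
  simp

lemma LSeries_vonMangoldt_eq_zetaEntire {s : ℂ} (hs : 1 < s.re) :
    LSeries (fun n => (Λ n : ℂ)) s =
      -logDeriv zetaEntire s + 1 / (s - 1) := by
  have h1 := ne_one_of_one_lt_re hs
  have hz : riemannZeta s ≠ 0 := riemannZeta_ne_zero_of_one_lt_re hs
  have hs1 : s - 1 ≠ 0 := sub_ne_zero.2 h1
  rw [ArithmeticFunction.LSeries_vonMangoldt_eq_deriv_riemannZeta_div hs]
  have e : zetaEntire =ᶠ[𝓝 s] fun z => (z - 1) * riemannZeta z := by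
    filter_upwards [isOpen_ne.mem_nhds h1] with z hz
    exact zetaEntire_of_ne_one hz
  have h2 := logDeriv_mul (f := fun z => z - 1) (g := riemannZeta) s hs1 hz
    (differentiableAt_id.sub_const 1) (differentiableAt_riemannZeta h1)
  have e2 : logDeriv zetaEntire s = logDeriv (fun z => (z - 1) * riemannZeta z) s := by
    rw [logDeriv_apply, logDeriv_apply, e.deriv_eq, e.eq_of_nhds]
  rw [e2, h2, logDeriv_apply, logDeriv_apply]
  simp
  ring

lemma mangoldtSeries_modOne (ψ : DirichletCharacter ℂ 1) :
    mangoldtSeries ψ = LSeries (fun n => (Λ n : ℂ)) := by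
  funext s
  rw [mangoldtSeries]
  congr 1
  funext n
  rw [Subsingleton.elim (n : ZMod 1) 1]
  simp

lemma mangoldtSeries_eq (ψ : DirichletCharacter ℂ f) {s : ℂ} (hs : 1 < s.re) :
    mangoldtSeries ψ s = -logDeriv (regularizedL ψ) s + poleTerm f s := by
  by_cases hf : f = 1
  · subst hf
    have hz : zetaEntire s ≠ 0 := by
      rw [zetaEntire_of_ne_one (ne_one_of_one_lt_re hs)]
      exact mul_ne_zero (sub_ne_zero.2 (ne_one_of_one_lt_re hs))
        (riemannZeta_ne_zero_of_one_lt_re hs)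
    rw [mangoldtSeries_modOne, LSeries_vonMangoldt_eq_zetaEntire hs, regularizedL, poleTerm,
      if_pos rfl, if_pos rfl, logDeriv_zetaReg (by linarith) hz]
    ring
  · rw [regularizedL, poleTerm, if_neg hf, if_neg hf, add_zero, logDeriv_apply,
      DirichletCharacter.deriv_LFunction_eq_deriv_LSeries _ hs,
      LFunction_eq_LSeries _ hs, ← neg_div,
      ← DirichletCharacter.LSeries_twist_vonMangoldt_eq _ hs]
    rfl

lemma discBound_thirty_le {Q : ℝ} (hQ : 10 ^ 5 ≤ Q) (t : ℝ) :
    discBound 30 3 t ≤ discBound Q 1 t + 3 / 100 := by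
  have hpi := pi_pos
  have ht := abs_nonneg t
  have h1 : log (logScale 30 (|t| + 1)) ≤ log (logScale Q (|t| + 1)) := by
    refine log_le_log (logScale_pos le_rfl _) ?_
    rw [logScale, logScale]
    gcongr; linarith
  have h2 : log (30 * (|t| + 4) / (2 * π)) + 811 / 100 ≤
      log (Q * (|t| + 4) / (2 * π)) := by
    have h3 : exp (811 / 100) ≤ 10000 / 3 := by
      have h := exp_one_lt_d9
      have h5 : exp (811 / 100) = exp 1 ^ 8 * exp (11 / 100) := by
        rw [← exp_nat_mul, ← exp_add]; norm_num
      have h6 : exp (11 / 100) ≤ 1.11628 := by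
        have := Real.exp_bound' (x := 11 / 100) (by norm_num) (by norm_num) (n := 4) (by norm_num)
        refine this.trans ?_
        norm_num [sum_range_succ, Nat.factorial]
      rw [h5]
      calc _ ≤ 2.7182818286 ^ 8 * (1.11628 : ℝ) := by gcongr
        _ ≤ _ := by norm_num
    have h4 : (811 : ℝ) / 100 = log (exp (811 / 100)) := (log_exp _).symm
    rw [h4, ← log_mul (by positivity) (by positivity)]
    refine log_le_log (by positivity) ?_
    rw [div_mul_eq_mul_div]
    refine div_le_div_of_nonneg_right ?_ (by positivity)
    calc 30 * (|t| + 4) * exp (811 / 100) ≤ 30 * (|t| + 4) * (10000 / 3) := by gcongr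
      _ ≤ _ := by nlinarith
  rw [discBound, discBound]
  have : 2 / (99 / 100 * π) * (log (logScale 30 (|t| + 1)) + 1 / 16) ≤
    2 / (99 / 100 * π) * (log (logScale Q (|t| + 1)) + 1 / 16) := by gcongr
  linarith

lemma re_mangoldtSeries_add_sum_le {ψ : DirichletCharacter ℂ f} (hψ : ψ.IsPrimitive) {Q : ℝ}
    (hQ : f ≤ Q) (hQ5 : 10 ^ 5 ≤ Q) {s : ℂ} (h1 : 1 < s.re) (h2 : s.re ≤ 101 / 100)
    (S : Finset ℂ) (hS : ∀ u ∈ S, regularizedL ψ u = 0 ∧ ‖u - s‖ < 99 / 100) :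
    (mangoldtSeries ψ s).re + ∑ u ∈ S, (s - u).re * (1 / ‖s - u‖ ^ 2 - (100 / 99) ^ 2) ≤
      discBound Q 1 s.im + 3 / 100 + if f = 1 then (1 / (s - 1)).re else 0 := by
  rw [mangoldtSeries_eq ψ h1, add_re, neg_re]
  by_cases hf : f = 1
  · have h := (stripFunction_regularizedL hψ (Q := 30) (by rw [hf]; norm_num) le_rfl)
    rw [if_pos hf] at h
    have h3 := h.neg_re_logDeriv_add_sum_le h1 h2 S hS
    have h4 := discBound_thirty_le hQ5 s.im
    rw [poleTerm, if_pos hf, if_pos hf, sub_re]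
    have h5 : 0 ≤ (1 / (s + 1)).re := by
      rw [one_div, inv_re]
      refine div_nonneg ?_ (normSq_nonneg _)
      simp; linarith
    linarith
  · have h := (stripFunction_regularizedL hψ hQ (by linarith))
    rw [if_neg hf] at h
    have h3 := h.neg_re_logDeriv_add_sum_le h1 h2 S hS
    rw [poleTerm, if_neg hf, if_neg hf, zero_re]
    linarith

lemma re_mangoldtSeries_modOne_le (ψ : DirichletCharacter ℂ 1) {s : ℂ} (hs : 1 < s.re)
    (h : ‖s - 1‖ ≤ 1 / 20) : (mangoldtSeries ψ s).re ≤ (1 / (s - 1)).re + 1 / 2 := by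
  rw [mangoldtSeries_modOne, LSeries_vonMangoldt_eq_zetaEntire hs, add_re, neg_re]
  linarith [neg_re_logDeriv_zetaEntire_le hs h]

end

/-- Positivity of a combination of shifted von Mangoldt series whose coefficients have a
nonnegative real part, averaged against a Fejér-type kernel. -/
lemma sum_re_LSeries_mul_vonMangoldt_nonneg {ι : Type*} (I : Finset ι) (b γ : ι → ℝ)
    (u : ι → ℕ → ℂ) (hu : ∀ i n, ‖u i n‖ ≤ 1)
    (hpos : ∀ n : ℕ, n ≠ 0 → 0 ≤ (∑ i ∈ I, b i * (u i n * (n : ℂ) ^ (-(γ i * Complex.I : ℂ)))).re)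
    {σ : ℝ} (hσ : 1 < σ) (m : ℕ) (a : ℕ → ℝ) (κ : ℝ) :
    0 ≤ ∑ k ∈ range m, ∑ l ∈ range m, a k * a l * ∑ i ∈ I, b i *
      (LSeries (fun n => u i n * (Λ n : ℂ))
        ((σ : ℂ) + ((γ i + (k - l : ℝ) * κ : ℝ) : ℂ) * Complex.I)).re := by
  set D : ι → ℕ → ℕ → ℂ := fun i k l => (σ : ℂ) + ((γ i + (k - l : ℝ) * κ : ℝ) : ℂ) * Complex.I
  set v : ι → ℕ → ℂ := fun i n => u i n * (Λ n : ℂ)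
  have hsum : ∀ i k l, LSeriesSummable (v i) (D i k l) := by
    intro i k l
    have h := ArithmeticFunction.LSeriesSummable_vonMangoldt (s := D i k l) (by simp [D, hσ])
    refine Summable.of_norm_bounded h.norm fun n => ?_
    rcases eq_or_ne n 0 with rfl | hn
    · simp
    rw [LSeries.term_of_ne_zero hn, LSeries.term_of_ne_zero hn, norm_div, norm_div, norm_mul]
    gcongr
    exact mul_le_of_le_one_left (norm_nonneg _) (hu i n)
  have hH : HasSum (fun n => ∑ k ∈ range m, ∑ l ∈ range m, a k * a l * ∑ i ∈ I, b i *
      (LSeries.term (v i) (D i k l) n).re)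
      (∑ k ∈ range m, ∑ l ∈ range m, a k * a l * ∑ i ∈ I, b i * (LSeries (v i) (D i k l)).re) :=
    hasSum_sum fun k _ => hasSum_sum fun l _ => (hasSum_sum fun i _ =>
      (Complex.hasSum_re (hsum i k l).hasSum).mul_left (b i)).mul_left _
  refine hH.nonneg fun n => ?_
  rcases eq_or_ne n 0 with rfl | hn
  · simp
  have hn0 : (n : ℂ) ≠ 0 := by exact_mod_cast hn
  set y : ℂ := (n : ℂ) ^ (-(κ * Complex.I : ℂ)) with hy
  have hyc : conj y = (n : ℂ) ^ (κ * Complex.I : ℂ) := by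
    have h := cpow_conj (n : ℂ) (κ * Complex.I) (by rw [natCast_arg]; exact pi_ne_zero.symm)
    rw [conj_natCast, map_mul, conj_I, conj_ofReal, mul_neg] at h
    rw [hy, h, starRingEnd_self_apply]
  set P : ℂ := ∑ i ∈ I, b i * (u i n * (n : ℂ) ^ (-(γ i * Complex.I : ℂ))) with hP
  set c : ℝ := Λ n * (n : ℝ) ^ (-σ) with hc
  have hc0 : 0 ≤ c := mul_nonneg vonMangoldt_nonneg (by positivity)
  have hcc : (c : ℂ) = (Λ n : ℂ) * (n : ℂ) ^ (-(σ : ℂ)) := by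
    rw [hc, ofReal_mul, ofReal_cpow (Nat.cast_nonneg n)]; simp
  have hterm : ∀ i k l, LSeries.term (v i) (D i k l) n =
      c * ((u i n * (n : ℂ) ^ (-(γ i * Complex.I : ℂ))) * (y ^ k * conj (y ^ l))) := by
    intro i k l
    rw [LSeries.term_of_ne_zero hn, div_eq_mul_inv, ← cpow_neg, map_pow, hyc, hy, ← cpow_nat_mul,
      ← cpow_nat_mul, hcc]
    have : (n : ℂ) ^ (-D i k l) = (n : ℂ) ^ (-(σ : ℂ)) * (n : ℂ) ^ (-(γ i * Complex.I : ℂ)) *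
        ((n : ℂ) ^ ((k : ℂ) * -(κ * Complex.I)) * (n : ℂ) ^ ((l : ℂ) * (κ * Complex.I))) := by
      rw [← cpow_add _ _ hn0, ← cpow_add _ _ hn0, ← cpow_add _ _ hn0]
      congr 1; simp only [D]; push_cast; ring
    rw [this]; simp only [v]; ring
  have key : ∑ k ∈ range m, ∑ l ∈ range m, a k * a l * ∑ i ∈ I, b i *
      (LSeries.term (v i) (D i k l) n).re =
      c * (P * ((∑ k ∈ range m, a k * y ^ k) * conj (∑ k ∈ range m, a k * y ^ k))).re := by
    have e1 : ∀ k l, a k * a l * ∑ i ∈ I, b i * (LSeries.term (v i) (D i k l) n).re =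
        (c * (P * ((a k * y ^ k) * conj (a l * y ^ l)))).re := by
      intro k l
      have : (c * (P * ((a k * y ^ k) * conj (a l * y ^ l))) : ℂ) =
          ((a k * a l : ℝ) : ℂ) * ∑ i ∈ I, (b i : ℂ) * LSeries.term (v i) (D i k l) n := by
        rw [hP, sum_mul, mul_sum, mul_sum]
        refine sum_congr rfl fun i _ => ?_
        rw [hterm]; push_cast; simp only [map_mul, conj_ofReal]; ring
      rw [this, re_ofReal_mul, re_sum]
      simp only [re_ofReal_mul]
    simp only [e1]
    rw [← re_ofReal_mul, map_sum, Finset.sum_mul_sum]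
    simp only [mul_sum, re_sum]
  rw [key, mul_conj, mul_comm P, re_ofReal_mul]
  exact mul_nonneg hc0 (mul_nonneg (normSq_nonneg _) (hpos n hn))

section

variable {f : ℕ} [NeZero f]

lemma LFunction_conj {ψ : DirichletCharacter ℂ f} (hψ : ψ ≠ 1) (hr : ∀ n : ZMod f, conj (ψ n) = ψ n)
    (s : ℂ) : LFunction ψ (conj s) = conj (LFunction ψ s) := by
  have h1 : AnalyticOnNhd ℂ (LFunction ψ) Set.univ :=
    (differentiable_LFunction hψ).differentiableOn.analyticOnNhd isOpen_univ
  have h2 : AnalyticOnNhd ℂ (conj ∘ LFunction ψ ∘ conj) Set.univ :=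
    (Differentiable.differentiableOn fun z => by
      have := DifferentiableAt.conj_conj (𝕜 := ℂ) (x := conj z)
        (differentiable_LFunction hψ (conj z))
      simpa using this).analyticOnNhd isOpen_univ
  have h3 : LFunction ψ =ᶠ[𝓝 2] conj ∘ LFunction ψ ∘ conj := by
    filter_upwards [(isOpen_lt continuous_const continuous_re).mem_nhds
      (show (1 : ℝ) < (2 : ℂ).re by norm_num)] with z hz
    simp only [Function.comp]
    rw [LFunction_eq_LSeries _ hz,
      LFunction_eq_LSeries _ (by simpa using hz), LSeries, LSeries, conj_tsum]
    refine tsum_congr fun n => ?_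
    rcases eq_or_ne n 0 with rfl | hn
    · simp
    rw [LSeries.term_of_ne_zero hn, LSeries.term_of_ne_zero hn, map_div₀, hr,
      cpow_conj _ _ (by rw [natCast_arg]; exact pi_ne_zero.symm), conj_natCast,
      starRingEnd_self_apply]
  have h4 := congrFun (h1.eq_of_eventuallyEq h2 h3) (conj s)
  simpa using h4

end

lemma discBound_mono {Q m t T : ℝ} (hQ : 30 ≤ Q) (h : |t| ≤ T) :
    discBound Q m t ≤ discBound Q m T := by
  have hT : |T| = T := abs_of_nonneg ((abs_nonneg t).trans h)
  have h0 := abs_nonneg t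
  have hQ0 : 0 < Q := by linarith
  rw [discBound, discBound, hT]
  have h1 : logScale Q (|t| + 1) ≤ logScale Q (T + 1) := by
    rw [logScale, logScale, abs_of_nonneg (by linarith : 0 ≤ |t| + 1),
      abs_of_nonneg (by linarith : 0 ≤ T + 1)]
    gcongr
  have h2 := logScale_pos hQ (|t| + 1)
  have hpi := pi_pos
  gcongr

lemma five_le_discBound {Q : ℝ} (hQ : 10 ^ 5 ≤ Q) (t : ℝ) : 5 ≤ discBound Q 1 t := by
  refine le_trans ?_ (discBound_mono (Q := Q) (m := 1) (t := 0) (T := |t|) (by linarith) (by simp)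
    |>.trans_eq (by simp [discBound]))
  have hpi := pi_pos
  have hpi2 := Real.pi_lt_d2
  have he := exp_one_lt_d9
  have h1 : 11 ≤ log (Q * 4 / (2 * π)) := by
    rw [le_log_iff_exp_le (by positivity), le_div_iff₀ (by positivity)]
    have : exp 11 = exp 1 ^ 11 := by rw [← exp_nat_mul]; norm_num
    have h3 : exp 11 ≤ 60000 := by
      rw [this]
      calc _ ≤ (2.7182818286 : ℝ) ^ 11 := by gcongr
        _ ≤ _ := by norm_num
    nlinarith
  have h2 : 2 ≤ log (logScale Q 1) := by
    have h3 : 8 ≤ log (Q * (1 + 3)) := by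
      rw [le_log_iff_exp_le (by positivity)]
      have : exp 8 = exp 1 ^ 8 := by rw [← exp_nat_mul]; norm_num
      have h3 : exp 8 ≤ 3000 := by
        rw [this]
        calc _ ≤ (2.7182818286 : ℝ) ^ 8 := by gcongr
          _ ≤ _ := by norm_num
      nlinarith
    have h4 : exp 2 ≤ 8 := by
      have : exp 2 = exp 1 ^ 2 := by rw [← exp_nat_mul]; norm_num
      rw [this]
      calc _ ≤ (2.7182818286 : ℝ) ^ 2 := by gcongr
        _ ≤ _ := by norm_num
    rw [le_log_iff_exp_le (logScale_pos (by linarith) _), logScale, abs_one]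
    exact h4.trans (h3.trans (le_add_of_nonneg_right (by norm_num)))
  rw [discBound, abs_zero, zero_add, zero_add]
  have h5 : 64 / 100 ≤ 2 / (99 / 100 * π) := by
    rw [le_div_iff₀ (by positivity)]; nlinarith
  nlinarith

lemma re_one_div_sub_one {d t : ℝ} : (1 / (((1 + d : ℝ) : ℂ) + t * I - 1)).re = d / (d ^ 2 + t ^ 2) := by
  rw [one_div, inv_re, normSq_apply]
  simp
  congr 1; ring

section

variable {f : ℕ} [NeZero f] {ψ : DirichletCharacter ℂ f} {Q : ℝ}

lemma re_mangoldtSeries_le (hψ : ψ.IsPrimitive) (hQ : f ≤ Q) (hQ5 : 10 ^ 5 ≤ Q) {d t T : ℝ}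
    (hd : 0 < d) (hd2 : d ≤ 1 / 100) (ht : |t| ≤ T) :
    (mangoldtSeries ψ (((1 + d : ℝ) : ℂ) + t * I)).re ≤ discBound Q 1 T + 3 / 100 +
      if f = 1 then d / (d ^ 2 + t ^ 2) else 0 := by
  have h := re_mangoldtSeries_add_sum_le hψ hQ hQ5 (s := ((1 + d : ℝ) : ℂ) + t * I)
    (by simp; linarith) (by simp; linarith) ∅ (by simp)
  rw [re_one_div_sub_one] at h
  have h2 := discBound_mono (Q := Q) (m := 1) (by linarith) ht
  have e : (((1 + d : ℝ) : ℂ) + t * I).im = t := by simp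
  rw [e, Finset.sum_empty, add_zero] at h
  linarith

lemma re_mangoldtSeries_le_of_zeros (hψ : ψ.IsPrimitive) (hQ : f ≤ Q) (hQ5 : 10 ^ 5 ≤ Q)
    {d t T β : ℝ} (hd : 0 < d) (hd2 : d ≤ 1 / 100) (ht : |t| ≤ T) (S : Finset ℝ)
    (hS : ∀ u ∈ S, regularizedL ψ ((β : ℂ) + u * I) = 0)
    (hβ : 0 ≤ 1 + d - β) (hβ2 : 1 + d - β ≤ 1 / 20) (hu : ∀ u ∈ S, |t - u| ≤ 9 / 10) :
    (mangoldtSeries ψ (((1 + d : ℝ) : ℂ) + t * I)).re ≤ discBound Q 1 T + 3 / 100 +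
      (if f = 1 then d / (d ^ 2 + t ^ 2) else 0) -
      ∑ u ∈ S, ((1 + d - β) / ((1 + d - β) ^ 2 + (t - u) ^ 2) - (1 + d - β) * (100 / 99) ^ 2) := by
  set s : ℂ := ((1 + d : ℝ) : ℂ) + t * I
  have hsub : ∀ u : ℝ, s - ((β : ℂ) + u * I) = ((1 + d - β : ℝ) : ℂ) + ((t - u : ℝ) : ℂ) * I := by
    intro u; simp only [s]; push_cast; ring
  have hinj : Function.Injective (fun u : ℝ => (β : ℂ) + u * I) := by
    intro u v h; have := congrArg Complex.im h; simpa using this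
  have hn : ∀ u : ℝ, ‖s - ((β : ℂ) + u * I)‖ ^ 2 = (1 + d - β) ^ 2 + (t - u) ^ 2 := by
    intro u; rw [hsub, ← normSq_eq_norm_sq, normSq_add_mul_I]
  have h := re_mangoldtSeries_add_sum_le hψ hQ hQ5 (s := s)
    (by simp [s]; linarith) (by simp [s]; linarith) (S.map ⟨_, hinj⟩) (by
      intro z hz
      rw [Finset.mem_map] at hz
      obtain ⟨u, hu', rfl⟩ := hz
      refine ⟨hS u hu', ?_⟩
      have h1 := hn u
      have h2 := hu u hu'
      rw [norm_sub_rev]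
      refine lt_of_pow_lt_pow_left₀ 2 (by norm_num) ?_
      change ‖s - ((β : ℂ) + u * I)‖ ^ 2 < _
      rw [h1, ← sq_abs (t - u)]
      nlinarith [abs_nonneg (t - u)])
  rw [Finset.sum_map] at h
  simp only [Function.Embedding.coeFn_mk] at h
  rw [re_one_div_sub_one] at h
  have h2 := discBound_mono (Q := Q) (m := 1) (by linarith) ht
  have e : s.im = t := by simp [s]
  rw [e] at h
  have e2 : ∑ u ∈ S, (s - ((β : ℂ) + u * I)).re * (1 / ‖s - ((β : ℂ) + u * I)‖ ^ 2 - (100 / 99) ^ 2) =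
      ∑ u ∈ S, ((1 + d - β) / ((1 + d - β) ^ 2 + (t - u) ^ 2) - (1 + d - β) * (100 / 99) ^ 2) := by
    refine sum_congr rfl fun u _ => ?_
    rw [hn u, hsub]
    simp only [add_re, ofReal_re, mul_re, I_re, mul_zero, ofReal_im, I_im, mul_one, sub_self,
      add_zero]
    ring
  rw [e2] at h
  linarith

end

/-- Coefficients of the trigonometric polynomial used to average the classical inequality. -/
noncomputable def averagingWeight (k : ℕ) : ℝ := ([3, 5, 6, 7, 6, 5, 3] : List ℝ).getD k 0

lemma averagingWeight_nonneg (k : ℕ) : 0 ≤ averagingWeight k := by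
  rcases lt_or_ge k 7 with h | h
  · interval_cases k <;> norm_num [averagingWeight]
  · rw [averagingWeight, List.getD_eq_default _ _ (by simpa using h)]

lemma sum_averagingWeight : ∑ k ∈ range 7, ∑ l ∈ range 7, averagingWeight k * averagingWeight l =
    1225 := by
  norm_num [averagingWeight, sum_range_succ]

lemma averaged_kernel_five : 1202 ≤ ∑ k ∈ range 7, ∑ l ∈ range 7,
    averagingWeight k * averagingWeight l * (8 / (1 + ((k - l : ℝ) * (49 / 100)) ^ 2) -
      5 * ((52 / 100) / ((52 / 100) ^ 2 + ((k - l : ℝ) * (49 / 100)) ^ 2))) := by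
  norm_num [averagingWeight, sum_range_succ]

lemma averaged_kernel_six : 700 ≤ ∑ k ∈ range 7, ∑ l ∈ range 7,
    averagingWeight k * averagingWeight l * (8 / (1 + ((k - l : ℝ) * (57 / 100)) ^ 2) -
      6 * ((66 / 100) / ((66 / 100) ^ 2 + ((k - l : ℝ) * (57 / 100)) ^ 2))) := by
  norm_num [averagingWeight, sum_range_succ]

/-- Extraction of a zero-free bound from an averaged inequality. -/
lemma one_le_mul_of_averaged {G : ℝ → ℝ} {T : ℕ → ℕ → ℝ} {B w c : ℝ} (hw : 0 < w)
    (hT : ∀ k < 7, ∀ l < 7, T k l ≤ B - G (k - l : ℝ) / w)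
    (hG : c ≤ ∑ k ∈ range 7, ∑ l ∈ range 7, averagingWeight k * averagingWeight l * G (k - l : ℝ))
    (hpos : 0 ≤ ∑ k ∈ range 7, ∑ l ∈ range 7, averagingWeight k * averagingWeight l * T k l) :
    c ≤ 1225 * B * w := by
  have h : ∑ k ∈ range 7, ∑ l ∈ range 7, averagingWeight k * averagingWeight l * T k l ≤
      ∑ k ∈ range 7, ∑ l ∈ range 7, (averagingWeight k * averagingWeight l * B -
        averagingWeight k * averagingWeight l * G (k - l : ℝ) / w) := by
    refine sum_le_sum fun k hk => sum_le_sum fun l hl => ?_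
    have := mul_le_mul_of_nonneg_left (hT k (by simpa using hk) l (by simpa using hl))
      (mul_nonneg (averagingWeight_nonneg k) (averagingWeight_nonneg l))
    refine this.trans_eq ?_
    ring
  simp only [sum_sub_distrib, ← sum_mul, ← Finset.sum_div] at h
  rw [sum_averagingWeight] at h
  have h2 := hpos.trans h
  have h3 : c / w ≤ 1225 * B := by
    refine le_trans ?_ (sub_nonneg.1 h2)
    gcongr
  rwa [div_le_iff₀ hw] at h3

lemma re_quartic_nonneg {z : ℂ} (hz : ‖z‖ = 1) : 0 ≤ (5 + 8 * z + 4 * z ^ 2 + z ^ 3).re := by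
  have h : z.re ^ 2 + z.im ^ 2 = 1 := by
    have := normSq_eq_norm_sq z
    rw [normSq_apply, hz] at this; nlinarith
  have e : (5 + 8 * z + 4 * z ^ 2 + z ^ 3).re = (1 + z.re) * (1 + 2 * z.re) ^ 2 := by
    have h2 : z.im ^ 2 = 1 - z.re ^ 2 := by linarith
    simp [pow_succ, mul_re]
    linear_combination (-4 - 3 * z.re) * h2
  rw [e]
  have := neg_le_of_abs_le ((abs_re_le_norm z).trans hz.le)
  exact mul_nonneg (by linarith) (sq_nonneg _)

lemma norm_natCast_cpow_neg_mul_I {n : ℕ} (hn : n ≠ 0) (γ : ℝ) :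
    ‖(n : ℂ) ^ (-(γ * I : ℂ))‖ = 1 := by
  rw [norm_natCast_cpow_of_pos (Nat.pos_of_ne_zero hn)]; simp

lemma neg_one_le_re_of_norm_le {z : ℂ} (hz : ‖z‖ ≤ 1) : -1 ≤ z.re :=
  neg_le_of_abs_le ((abs_re_le_norm z).trans hz)

section

variable {f f₂ f₃ : ℕ} [NeZero f] [NeZero f₂] [NeZero f₃] {ψ : DirichletCharacter ℂ f}
  {ψ₂ : DirichletCharacter ℂ f₂} {ψ₃ : DirichletCharacter ℂ f₃}

lemma norm_twist_le (ψ : DirichletCharacter ℂ f) {n : ℕ} (hn : n ≠ 0) (γ : ℝ) :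
    ‖ψ n * (n : ℂ) ^ (-(γ * I : ℂ))‖ ≤ 1 := by
  rw [norm_mul, norm_natCast_cpow_neg_mul_I hn, mul_one]
  exact ψ.norm_le_one _

lemma norm_twist_eq_one (ψ : DirichletCharacter ℂ f) {n : ℕ} (hn : n ≠ 0) (hc : n.Coprime f)
    (γ : ℝ) : ‖ψ n * (n : ℂ) ^ (-(γ * I : ℂ))‖ = 1 := by
  rw [norm_mul, norm_natCast_cpow_neg_mul_I hn, mul_one]
  have := ψ.unit_norm_eq_one (ZMod.unitOfCoprime n hc)
  rwa [ZMod.coe_unitOfCoprime] at this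

lemma character_eq_zero (ψ : DirichletCharacter ℂ f) {n : ℕ} (hc : ¬ n.Coprime f) :
    ψ n = 0 :=
  ψ.map_nonunit fun h => hc ((ZMod.isUnit_iff_coprime n f).1 h)

lemma natCast_cpow_neg_nat_mul (n : ℕ) (j : ℕ) (γ : ℝ) :
    (n : ℂ) ^ (-(((j * γ : ℝ) : ℂ) * I)) = ((n : ℂ) ^ (-(γ * I : ℂ))) ^ j := by
  rw [← cpow_nat_mul]; congr 1; push_cast; ring

lemma averaged_five_nonneg (h₂ : ∀ n : ℕ, n.Coprime f → ψ₂ n = ψ n ^ 2)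
    (h₃ : ∀ n : ℕ, n.Coprime f → ψ₃ n = ψ n ^ 3) (γ : ℝ) {σ : ℝ} (hσ : 1 < σ) (κ : ℝ) :
    0 ≤ ∑ k ∈ range 7, ∑ l ∈ range 7, averagingWeight k * averagingWeight l *
      (5 * (mangoldtSeries (1 : DirichletCharacter ℂ 1) (σ + (((k - l : ℝ) * κ : ℝ) : ℂ) * I)).re +
      8 * (mangoldtSeries ψ (σ + ((γ + (k - l : ℝ) * κ : ℝ) : ℂ) * I)).re +
      4 * (mangoldtSeries ψ₂ (σ + ((2 * γ + (k - l : ℝ) * κ : ℝ) : ℂ) * I)).re +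
      (mangoldtSeries ψ₃ (σ + ((3 * γ + (k - l : ℝ) * κ : ℝ) : ℂ) * I)).re) := by
  have h := sum_re_LSeries_mul_vonMangoldt_nonneg (Finset.univ : Finset (Fin 4)) ![5, 8, 4, 1]
    ![0, γ, 2 * γ, 3 * γ] ![fun n => (1 : DirichletCharacter ℂ 1) n, fun n => ψ n, fun n => ψ₂ n,
      fun n => ψ₃ n] (by
        intro i n
        fin_cases i <;> simp [DirichletCharacter.norm_le_one]) (by
        intro n hn
        rw [Fin.sum_univ_four]
        simp only [Matrix.cons_val]
        have e1 : (1 : DirichletCharacter ℂ 1) (n : ZMod 1) = 1 := by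
          rw [Subsingleton.elim (n : ZMod 1) 1, map_one]
        have e2 := natCast_cpow_neg_nat_mul n 2 γ
        have e3 := natCast_cpow_neg_nat_mul n 3 γ
        push_cast at e2 e3
        rw [e1]
        push_cast
        by_cases hc : n.Coprime f
        · have := re_quartic_nonneg (norm_twist_eq_one ψ hn hc γ)
          rw [h₂ n hc, h₃ n hc, e2, e3, ← mul_pow, ← mul_pow]
          simpa using this
        · have h2 := neg_one_le_re_of_norm_le (norm_twist_le ψ₂ hn (2 * γ))
          have h3 := neg_one_le_re_of_norm_le (norm_twist_le ψ₃ hn (3 * γ))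
          push_cast at h2 h3
          rw [character_eq_zero ψ hc]
          simp only [zero_mul, mul_zero, neg_zero, cpow_zero, add_re, mul_one, one_mul, add_zero]
          rw [show (4 : ℂ) = ((4 : ℝ) : ℂ) by norm_num, re_ofReal_mul]
          rw [mul_re] at *
          norm_num
          linarith) hσ 7 averagingWeight κ
  simp only [Fin.sum_univ_four, Matrix.cons_val, zero_add, one_mul] at h
  exact h

lemma averaged_six_nonneg (h₂ : ∀ n : ℕ, n.Coprime f → ψ₂ n = ψ n ^ 2)
    (h₃ : ∀ n : ℕ, n.Coprime f → ψ n ^ 3 = 1) (γ : ℝ) {σ : ℝ} (hσ : 1 < σ) (κ : ℝ) :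
    0 ≤ ∑ k ∈ range 7, ∑ l ∈ range 7, averagingWeight k * averagingWeight l *
      (6 * (mangoldtSeries (1 : DirichletCharacter ℂ 1) (σ + (((k - l : ℝ) * κ : ℝ) : ℂ) * I)).re +
      8 * (mangoldtSeries ψ (σ + ((γ + (k - l : ℝ) * κ : ℝ) : ℂ) * I)).re +
      4 * (mangoldtSeries ψ₂ (σ + ((2 * γ + (k - l : ℝ) * κ : ℝ) : ℂ) * I)).re) := by
  have h := sum_re_LSeries_mul_vonMangoldt_nonneg (Finset.univ : Finset (Fin 3)) ![6, 8, 4]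
    ![0, γ, 2 * γ] ![fun n => (1 : DirichletCharacter ℂ 1) n, fun n => ψ n, fun n => ψ₂ n] (by
        intro i n
        fin_cases i <;> simp [DirichletCharacter.norm_le_one]) (by
        intro n hn
        rw [Fin.sum_univ_three]
        simp only [Matrix.cons_val]
        have e1 : (1 : DirichletCharacter ℂ 1) (n : ZMod 1) = 1 := by
          rw [Subsingleton.elim (n : ZMod 1) 1, map_one]
        have e2 := natCast_cpow_neg_nat_mul n 2 γ
        push_cast at e2
        rw [e1]
        push_cast
        by_cases hc : n.Coprime f
        · have h1 := norm_twist_eq_one ψ hn hc γ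
          have h4 := re_quartic_nonneg h1
          have h5 : ‖(ψ n * (n : ℂ) ^ (-(γ * I : ℂ))) ^ 3‖ ≤ 1 := by rw [norm_pow, h1, one_pow]
          have h6 := (re_le_norm _).trans h5
          rw [add_re] at h4
          rw [h₂ n hc, e2, ← mul_pow]
          simp only [zero_mul, neg_zero, cpow_zero, add_re, mul_one] at h4 ⊢
          norm_num at h4 ⊢
          linarith
        · have h2 := neg_one_le_re_of_norm_le (norm_twist_le ψ₂ hn (2 * γ))
          push_cast at h2
          rw [character_eq_zero ψ hc]
          simp only [zero_mul, mul_zero, neg_zero, cpow_zero, add_re, mul_one, add_zero]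
          rw [show (4 : ℂ) = ((4 : ℝ) : ℂ) by norm_num, re_ofReal_mul]
          rw [mul_re] at *
          norm_num
          linarith) hσ 7 averagingWeight κ
  simp only [Fin.sum_univ_three, Matrix.cons_val, zero_add] at h
  exact h

end

lemma abs_natCast_sub_le {k l : ℕ} (hk : k < 7) (hl : l < 7) : |(k - l : ℝ)| ≤ 6 := by
  have h1 : (k : ℝ) ≤ 6 := by exact_mod_cast Nat.le_of_lt_succ hk
  have h2 : (l : ℝ) ≤ 6 := by exact_mod_cast Nat.le_of_lt_succ hl
  have h3 : (0 : ℝ) ≤ k := Nat.cast_nonneg k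
  have h4 : (0 : ℝ) ≤ l := Nat.cast_nonneg l
  rw [abs_le]; constructor <;> linarith

lemma re_mangoldtSeries_one_le {d t : ℝ} (hd : 0 < d) (h : d + |t| ≤ 1 / 20) :
    (mangoldtSeries (1 : DirichletCharacter ℂ 1) (((1 + d : ℝ) : ℂ) + t * I)).re ≤
      d / (d ^ 2 + t ^ 2) + 1 / 2 := by
  have h1 := re_mangoldtSeries_modOne_le (1 : DirichletCharacter ℂ 1)
    (s := ((1 + d : ℝ) : ℂ) + t * I) (by simp; linarith) (by
      have e : ((1 + d : ℝ) : ℂ) + t * I - 1 = (d : ℂ) + t * I := by push_cast; ring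
      rw [e]
      refine (norm_le_abs_re_add_abs_im _).trans ?_
      simpa [abs_of_pos hd] using h)
  rwa [re_one_div_sub_one] at h1

lemma div_sq_add_sq_le {d t r : ℝ} (hd : 0 ≤ d) (hr : 0 < r) (h : r ≤ |t|) :
    d / (d ^ 2 + t ^ 2) ≤ d / r ^ 2 := by
  have : r ^ 2 ≤ t ^ 2 := by rw [← sq_abs t]; gcongr
  gcongr
  nlinarith [sq_nonneg d]

lemma div_scaled {c w y : ℝ} (hw : 0 < w) (hc : 0 < c) :
    c * w / ((c * w) ^ 2 + (y * w) ^ 2) = c / (c ^ 2 + y ^ 2) / w := by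
  have : (c * w) ^ 2 + (y * w) ^ 2 = (c ^ 2 + y ^ 2) * w * w := by ring
  have h : c ^ 2 + y ^ 2 ≠ 0 := by positivity
  rw [this]
  field_simp

section

variable {f f₂ f₃ : ℕ} [NeZero f] [NeZero f₂] [NeZero f₃] {ψ : DirichletCharacter ℂ f}
  {ψ₂ : DirichletCharacter ℂ f₂} {ψ₃ : DirichletCharacter ℂ f₃} {Q β γ : ℝ}

set_option maxHeartbeats 800000 in
/-- A zero-free region, away from the poles of the `L`-functions of `ψ`, `ψ ^ 2`, `ψ ^ 3`, or
with a pole of the `L`-function of `ψ ^ 2` compensated by the zero conjugate to the given one. -/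
theorem one_le_discBound_mul_one_sub_of_zero (hψ : ψ.IsPrimitive) (hψ₂ : ψ₂.IsPrimitive)
    (hψ₃ : ψ₃.IsPrimitive) (hQ : f ≤ Q) (hQ₂ : f₂ ≤ Q) (hQ₃ : f₃ ≤ Q) (hQ5 : 10 ^ 5 ≤ Q)
    (h₂ : ∀ n : ℕ, n.Coprime f → ψ₂ n = ψ n ^ 2) (h₃ : ∀ n : ℕ, n.Coprime f → ψ₃ n = ψ n ^ 3)
    (hβ : β < 1) (hz : regularizedL ψ ((β : ℂ) + γ * I) = 0)
    (hcase : 2 / 5 ≤ |γ| ∨ (f ≠ 1 ∧ f₂ ≠ 1 ∧ f₃ ≠ 1) ∨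
      (f ≠ 1 ∧ f₃ ≠ 1 ∧ γ ≠ 0 ∧ |γ| < 2 / 5 ∧ regularizedL ψ ((β : ℂ) + (-γ : ℝ) * I) = 0)) :
    1 ≤ 2762 / 100 * (discBound Q 1 (3 * |γ| + 1) + 28 / 100) * (1 - β) := by
  by_contra! hcon
  set K := discBound Q 1 (3 * |γ| + 1) + 3 / 100 with hK
  have hK5 : 5 ≤ K := by rw [hK]; linarith [five_le_discBound hQ5 (3 * |γ| + 1)]
  obtain ⟨w, hw⟩ : ∃ w, w = (1 - β) / (48 / 100) := ⟨_, rfl⟩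
  have hw0 : 0 < w := by rw [hw]; apply div_pos <;> linarith
  have hβw : β = 1 - 48 / 100 * w := by rw [hw]; ring
  have hcon' : 2762 / 100 * (K + 25 / 100) * (48 / 100 * w) < 1 := by
    rw [hβw] at hcon; rw [hK]; linarith
  have hw1 : w < 1437 / 100000 := by nlinarith
  have hd0 : 0 < 52 / 100 * w := by positivity
  have hγ0 := abs_nonneg γ
  have hone : 1 + 52 / 100 * w - β = w := by rw [hβw]; ring
  have hfin := one_le_mul_of_averaged (w := w) (c := 1202) (B := 13 * (K + 25 / 100))
    (G := fun j => 8 / (1 + (j * (49 / 100)) ^ 2) -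
      5 * ((52 / 100) / ((52 / 100) ^ 2 + (j * (49 / 100)) ^ 2))) hw0 (fun k hk l hl => ?_)
    averaged_kernel_five (averaged_five_nonneg h₂ h₃ γ (σ := 1 + 52 / 100 * w) (by linarith)
      (49 / 100 * w))
  · nlinarith
  have hj := abs_natCast_sub_le hk hl
  set j : ℝ := (k - l : ℝ) with hjdef
  set y := j * (49 / 100) with hy
  have ey : j * (49 / 100 * w) = y * w := by rw [hy]; ring
  have hyw : |y * w| ≤ 4226 / 100000 := by
    rw [abs_mul, abs_of_pos hw0, hy, abs_mul, abs_of_pos (by norm_num : (0 : ℝ) < 49 / 100)]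
    nlinarith [abs_nonneg j]
  have hyw' := abs_le.1 hyw
  rw [ey]
  have habs : ∀ c : ℝ, 0 ≤ c → c ≤ 3 → |c * γ + y * w| ≤ 3 * |γ| + 1 := by
    intro c hc hc3
    refine (abs_add_le _ _).trans ?_
    rw [abs_mul, abs_of_nonneg hc]
    nlinarith
  have hD0 := re_mangoldtSeries_one_le (t := y * w) hd0 (by linarith)
  rw [div_scaled hw0 (by norm_num)] at hD0
  have hD2 := re_mangoldtSeries_le hψ₂ hQ₂ hQ5 (t := 2 * γ + y * w) hd0 (by linarith)
    (habs 2 (by norm_num) (by norm_num))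
  have hD3 := re_mangoldtSeries_le hψ₃ hQ₃ hQ5 (t := 3 * γ + y * w) hd0 (by linarith)
    (habs 3 (by norm_num) (by norm_num))
  have hT1 : |γ + y * w| ≤ 3 * |γ| + 1 := by simpa using habs 1 (by norm_num) (by norm_num)
  have hsub : γ + y * w - γ = y * w := by ring
  have hmain : w / (w ^ 2 + (y * w) ^ 2) = 1 / (1 + y ^ 2) / w := by
    have := div_scaled (c := 1) (y := y) hw0 one_pos
    simpa using this
  have hG : (8 / (1 + y ^ 2) - 5 * ((52 / 100) / ((52 / 100) ^ 2 + y ^ 2))) / w =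
      8 * (1 / (1 + y ^ 2) / w) - 5 * ((52 / 100) / ((52 / 100) ^ 2 + y ^ 2) / w) := by ring
  rw [hG]
  rw [← hK] at hD2 hD3
  have hsingle := re_mangoldtSeries_le_of_zeros hψ hQ hQ5 (β := β) (t := γ + y * w) hd0
    (by linarith) hT1 {γ} (by simpa using hz) (by rw [hone]; exact hw0.le)
    (by rw [hone]; linarith) (by
      intro u hu; rw [Finset.mem_singleton] at hu; rw [hu, hsub]; linarith)
  rw [sum_singleton, hone, hsub, hmain, ← hK] at hsingle
  rcases hcase with hc | ⟨hf, hf2, hf3⟩ | ⟨hf, hf3, hγ, hγ4, hz'⟩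
  · have habs' : ∀ c : ℝ, 1 ≤ c → c * |γ| - 4226 / 100000 ≤ |c * γ + y * w| := by
      intro c hc
      have h1 := abs_sub_abs_le_abs_sub (c * γ) (-(y * w))
      rw [abs_neg, abs_mul, abs_of_pos (by linarith), sub_neg_eq_add] at h1
      linarith
    have l1 := div_sq_add_sq_le hd0.le (by norm_num : (0 : ℝ) < 35 / 100)
      (show 35 / 100 ≤ |γ + y * w| by
        have := habs' 1 le_rfl
        rw [one_mul, one_mul] at this; linarith)
    have l2 := div_sq_add_sq_le hd0.le (by norm_num : (0 : ℝ) < 75 / 100)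
      (show 75 / 100 ≤ |2 * γ + y * w| by have := habs' 2 (by norm_num); linarith)
    have l3 := div_sq_add_sq_le hd0.le (by norm_num : (0 : ℝ) < 1)
      (show 1 ≤ |3 * γ + y * w| by have := habs' 3 (by norm_num); linarith)
    have i1 : (if f = 1 then 52 / 100 * w / ((52 / 100 * w) ^ 2 + (γ + y * w) ^ 2) else 0) ≤
        62 / 1000 := by
      split_ifs
      · refine l1.trans ?_
        rw [div_le_iff₀ (by norm_num)]; linarith only [hw1]
      · norm_num
    have i2 : (if f₂ = 1 then 52 / 100 * w / ((52 / 100 * w) ^ 2 + (2 * γ + y * w) ^ 2) else 0) ≤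
        14 / 1000 := by
      split_ifs
      · refine l2.trans ?_
        rw [div_le_iff₀ (by norm_num)]; linarith only [hw1]
      · norm_num
    have i3 : (if f₃ = 1 then 52 / 100 * w / ((52 / 100 * w) ^ 2 + (3 * γ + y * w) ^ 2) else 0) ≤
        10 / 1000 := by
      split_ifs
      · refine l3.trans ?_
        rw [div_le_iff₀ (by norm_num)]; linarith only [hw1]
      · norm_num
    linarith
  · rw [if_neg hf2] at hD2
    rw [if_neg hf3] at hD3
    rw [if_neg hf] at hsingle
    linarith
  · rw [if_neg hf3] at hD3
    have hne : γ ≠ -γ := fun h => hγ (by linarith)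
    have hsub2 : γ + y * w - -γ = 2 * γ + y * w := by ring
    have hpair := re_mangoldtSeries_le_of_zeros hψ hQ hQ5 (β := β) (t := γ + y * w) hd0
      (by linarith) hT1 {γ, -γ} (by
        intro u hu
        rw [Finset.mem_insert, Finset.mem_singleton] at hu
        rcases hu with rfl | rfl
        · exact hz
        · exact hz') (by rw [hone]; exact hw0.le)
      (by rw [hone]; linarith) (by
        intro u hu
        rw [Finset.mem_insert, Finset.mem_singleton] at hu
        rcases hu with rfl | rfl
        · rw [hsub]; linarith
        · rw [hsub2]
          refine (abs_add_le _ _).trans ?_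
          rw [abs_mul, abs_of_pos (by norm_num : (0 : ℝ) < 2)]; linarith)
    rw [Finset.sum_pair hne, hone, hsub, hsub2, hmain, ← hK, if_neg hf] at hpair
    have hi : (if f₂ = 1 then 52 / 100 * w / ((52 / 100 * w) ^ 2 + (2 * γ + y * w) ^ 2) else 0) ≤
        2 * (w / (w ^ 2 + (2 * γ + y * w) ^ 2)) := by
      have hp : 0 < w ^ 2 + (2 * γ + y * w) ^ 2 := by positivity
      have hp' : 0 < (52 / 100 * w) ^ 2 + (2 * γ + y * w) ^ 2 := by positivity
      split_ifs
      · rw [← mul_div_assoc, div_le_div_iff₀ hp' hp]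
        have : 0 ≤ w * (2 * γ + y * w) ^ 2 := by positivity
        have : 0 < w ^ 3 := by positivity
        nlinarith
      · positivity
    linarith

/-- A weaker zero-free region that also covers the case in which `ψ ^ 3` is principal. -/
theorem one_le_discBound_mul_one_sub_of_zero_of_cube (hψ : ψ.IsPrimitive) (hψ₂ : ψ₂.IsPrimitive)
    (hQ : f ≤ Q) (hQ₂ : f₂ ≤ Q) (hQ5 : 10 ^ 5 ≤ Q)
    (h₂ : ∀ n : ℕ, n.Coprime f → ψ₂ n = ψ n ^ 2) (h₃ : ∀ n : ℕ, n.Coprime f → ψ n ^ 3 = 1)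
    (hβ : β < 1) (hz : regularizedL ψ ((β : ℂ) + γ * I) = 0) (hf : f ≠ 1) (hf₂ : f₂ ≠ 1) :
    1 ≤ 6178 / 100 * (discBound Q 1 (2 * |γ| + 1) + 30 / 100) * (1 - β) := by
  by_contra! hcon
  set K := discBound Q 1 (2 * |γ| + 1) + 3 / 100 with hK
  have hK5 : 5 ≤ K := by rw [hK]; linarith [five_le_discBound hQ5 (2 * |γ| + 1)]
  obtain ⟨w, hw⟩ : ∃ w, w = (1 - β) / (34 / 100) := ⟨_, rfl⟩
  have hw0 : 0 < w := by rw [hw]; apply div_pos <;> linarith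
  have hβw : β = 1 - 34 / 100 * w := by rw [hw]; ring
  have hcon' : 6178 / 100 * (K + 27 / 100) * (34 / 100 * w) < 1 := by
    rw [hβw] at hcon; rw [hK]; linarith
  have hw1 : w < 1 / 100 := by nlinarith
  have hd0 : 0 < 66 / 100 * w := by positivity
  have hγ0 := abs_nonneg γ
  have hone : 1 + 66 / 100 * w - β = w := by rw [hβw]; ring
  have hfin := one_le_mul_of_averaged (w := w) (c := 700) (B := 12 * (K + 27 / 100))
    (G := fun j => 8 / (1 + (j * (57 / 100)) ^ 2) -
      6 * ((66 / 100) / ((66 / 100) ^ 2 + (j * (57 / 100)) ^ 2))) hw0 (fun k hk l hl => ?_)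
    averaged_kernel_six (averaged_six_nonneg h₂ h₃ γ (σ := 1 + 66 / 100 * w) (by linarith)
      (57 / 100 * w))
  · nlinarith
  have hj := abs_natCast_sub_le hk hl
  set j : ℝ := (k - l : ℝ) with hjdef
  set y := j * (57 / 100) with hy
  have ey : j * (57 / 100 * w) = y * w := by rw [hy]; ring
  have hyw : |y * w| ≤ 35 / 1000 := by
    rw [abs_mul, abs_of_pos hw0, hy, abs_mul, abs_of_pos (by norm_num : (0 : ℝ) < 57 / 100)]
    nlinarith [abs_nonneg j]
  rw [ey]
  have hD0 := re_mangoldtSeries_one_le (t := y * w) hd0 (by linarith)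
  rw [div_scaled hw0 (by norm_num)] at hD0
  have hD2 := re_mangoldtSeries_le hψ₂ hQ₂ hQ5 (t := 2 * γ + y * w) (T := 2 * |γ| + 1) hd0
    (by linarith) (by
      refine (abs_add_le _ _).trans ?_
      rw [abs_mul, abs_of_pos (by norm_num : (0 : ℝ) < 2)]; linarith)
  have hsub : γ + y * w - γ = y * w := by ring
  have hmain : w / (w ^ 2 + (y * w) ^ 2) = 1 / (1 + y ^ 2) / w := by
    have := div_scaled (c := 1) (y := y) hw0 one_pos
    simpa using this
  have hG : (8 / (1 + y ^ 2) - 6 * ((66 / 100) / ((66 / 100) ^ 2 + y ^ 2))) / w =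
      8 * (1 / (1 + y ^ 2) / w) - 6 * ((66 / 100) / ((66 / 100) ^ 2 + y ^ 2) / w) := by ring
  rw [hG]
  have hsingle := re_mangoldtSeries_le_of_zeros hψ hQ hQ5 (β := β) (t := γ + y * w)
    (T := 2 * |γ| + 1) hd0 (by linarith) ((abs_add_le _ _).trans (by linarith)) {γ}
    (by simpa using hz) (by rw [hone]; exact hw0.le)
    (by rw [hone]; linarith) (by
      intro u hu; rw [Finset.mem_singleton] at hu; rw [hu, hsub]; linarith)
  rw [sum_singleton, hone, hsub, hmain, ← hK, if_neg hf] at hsingle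
  rw [← hK, if_neg hf₂] at hD2
  linarith

end

section

variable {f : ℕ} [NeZero f] {ψ : DirichletCharacter ℂ f}

lemma character_pow_apply (ψ : DirichletCharacter ℂ f) (k : ℕ) {n : ZMod f} (hn : IsUnit n) :
    (ψ ^ k) n = ψ n ^ k := by
  obtain ⟨u, rfl⟩ := hn
  exact MulChar.pow_apply_coe ψ k u

lemma primitiveCharacter_pow_apply (ψ : DirichletCharacter ℂ f) (k : ℕ) {n : ℕ}
    (hn : n.Coprime f) : (ψ ^ k).primitiveCharacter n = ψ n ^ k := by
  have hc : IsCoprime (n : ℤ) f := Nat.isCoprime_iff_coprime.mpr hn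
  have h := DirichletCharacter.primitiveCharacter_apply_of_isCoprime (χ := ψ ^ k) hc
  have hu : IsUnit (n : ZMod f) := (ZMod.isUnit_iff_coprime n f).mpr hn
  simp only [Int.cast_natCast] at h
  rw [h, character_pow_apply ψ k hu]

lemma conductor_pow_le (ψ : DirichletCharacter ℂ f) (k : ℕ) : (ψ ^ k).conductor ≤ f :=
  Nat.le_of_dvd (NeZero.pos f) (DirichletCharacter.conductor_dvd_level _)

lemma regularizedL_ne_zero_of_one_le_re (hψ : ψ.IsPrimitive) {s : ℂ} (hs : 1 ≤ s.re) :
    regularizedL ψ s ≠ 0 := by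
  unfold regularizedL
  split_ifs with hf
  · unfold zetaReg
    have h1 : s + 1 ≠ 0 := fun h => by
      have := congrArg Complex.re h
      simp at this
      linarith
    refine div_ne_zero ?_ h1
    by_cases h : s = 1
    · subst h
      exact zetaEntire_ne_zero (by simp) (by simp)
    · rw [zetaEntire_of_ne_one h]
      exact mul_ne_zero (sub_ne_zero.mpr h) (riemannZeta_ne_zero_of_one_le_re hs)
  · refine DirichletCharacter.LFunction_ne_zero_of_one_le_re ψ (.inl fun h => hf ?_) hs
    rw [← hψ]
    exact DirichletCharacter.eq_one_iff_conductor_eq_one.mp h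

/-- A zero-free region for primitive `L`-functions, away from real zeros of real characters. -/
theorem regularizedL_ne_zero (hψ : ψ.IsPrimitive) {Q T δ : ℝ} (hQ : f ≤ Q) (hQ5 : 10 ^ 5 ≤ Q)
    (hδ : δ ≤ 1 / 10) (hhigh : 2762 / 100 * (discBound Q 1 (3 * T + 1) + 28 / 100) * δ ≤ 1)
    (hlow : 6178 / 100 * (discBound Q 1 (9 / 5) + 30 / 100) * δ ≤ 1)
    (hreal : ψ ^ 2 = 1 → ψ ≠ 1 → ∀ β : ℝ, 1 - δ < β → β < 1 →
      LFunction ψ β ≠ 0)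
    {s : ℂ} (hs : 1 - δ < s.re) (hT : |s.im| ≤ T) : regularizedL ψ s ≠ 0 := by
  intro hz
  obtain ⟨β, γ, rfl⟩ : ∃ β γ : ℝ, s = (β : ℂ) + γ * I := ⟨s.re, s.im, (re_add_im s).symm⟩
  simp only [add_re, ofReal_re, mul_re, I_re, mul_zero, ofReal_im, I_im, mul_one, sub_self,
    add_zero, add_im, mul_im, zero_add] at hs hT
  have hβ1 : β < 1 := by
    by_contra! h
    have h1 : 1 ≤ ((β : ℂ) + γ * I).re := by simpa using h
    exact regularizedL_ne_zero_of_one_le_re hψ h1 hz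
  have hβ9 : 9 / 10 < β := by linarith
  have hδ0 : 0 < δ := by linarith
  have hmono := discBound_mono (Q := Q) (m := 1) (t := 3 * |γ| + 1) (T := 3 * T + 1)
    (by linarith) (by rw [abs_of_nonneg (by positivity)]; linarith)
  have hK := five_le_discBound hQ5 (3 * |γ| + 1)
  have hcontra : ¬ (1 ≤ 2762 / 100 * (discBound Q 1 (3 * |γ| + 1) + 28 / 100) * (1 - β)) := by
    intro h
    have h1 : 2762 / 100 * (discBound Q 1 (3 * |γ| + 1) + 28 / 100) * (1 - β) <
        2762 / 100 * (discBound Q 1 (3 * |γ| + 1) + 28 / 100) * δ := by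
      apply mul_lt_mul_of_pos_left (by linarith); linarith
    have h2 : 2762 / 100 * (discBound Q 1 (3 * |γ| + 1) + 28 / 100) * δ ≤
        2762 / 100 * (discBound Q 1 (3 * T + 1) + 28 / 100) * δ := by gcongr
    linarith
  have : NeZero (ψ ^ 2).conductor := ⟨DirichletCharacter.conductor_ne_zero _⟩
  have : NeZero (ψ ^ 3).conductor := ⟨DirichletCharacter.conductor_ne_zero _⟩
  have hQ₂ : ((ψ ^ 2).conductor : ℝ) ≤ Q := le_trans (by exact_mod_cast conductor_pow_le ψ 2) hQ
  have hQ₃ : ((ψ ^ 3).conductor : ℝ) ≤ Q := le_trans (by exact_mod_cast conductor_pow_le ψ 3) hQ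
  have main := one_le_discBound_mul_one_sub_of_zero hψ
    (ψ ^ 2).primitiveCharacter_isPrimitive (ψ ^ 3).primitiveCharacter_isPrimitive
    hQ hQ₂ hQ₃ hQ5 (fun n hn => primitiveCharacter_pow_apply ψ 2 hn)
    (fun n hn => primitiveCharacter_pow_apply ψ 3 hn) hβ1 hz
  by_cases hγ : 2 / 5 ≤ |γ|
  · exact hcontra (main (.inl hγ))
  push Not at hγ
  by_cases hf : f = 1
  · simp only [regularizedL, hf, if_true, zetaReg] at hz
    have h1 : ((β : ℂ) + γ * I) + 1 ≠ 0 := fun h => by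
      have := congrArg Complex.re h
      simp at this
      linarith
    refine zetaEntire_ne_zero (s := (β : ℂ) + γ * I) (by simpa using by linarith) ?_
      ((div_eq_zero_iff.mp hz).resolve_right h1)
    have e : ((β : ℂ) + γ * I) - 1 = ((β - 1 : ℝ) : ℂ) + γ * I := by push_cast; ring
    rw [e]
    refine (norm_add_le _ _).trans_lt ?_
    have e1 : |β - 1| = 1 - β := by rw [abs_of_neg (by linarith)]; ring
    rw [norm_mul, norm_I, norm_real, norm_real, norm_eq_abs, norm_eq_abs, e1]
    simp
    linarith
  have hψ1 : ψ ≠ 1 := fun h => hf <| by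
    rw [← hψ]; exact DirichletCharacter.eq_one_iff_conductor_eq_one.mp h
  by_cases h2 : ψ ^ 2 = 1
  · have h3 : ψ ^ 3 ≠ 1 := fun h => hψ1 <| by rw [pow_succ, h2, one_mul] at h; exact h
    have hr : ∀ n : ZMod f, conj (ψ n) = ψ n := by
      intro n
      have := congrArg (fun χ => χ n) h2
      by_cases hn : IsUnit n
      · simp only [character_pow_apply ψ 2 hn, MulChar.one_apply hn] at this
        rcases sq_eq_sq_iff_eq_or_eq_neg.mp (this.trans (one_pow 2).symm) with h | h <;> simp [h]
      · simp [ψ.map_nonunit hn]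
    have hL : regularizedL ψ = LFunction ψ := by simp [regularizedL, hf]
    rw [hL] at hz
    by_cases hγ0 : γ = 0
    · exact hreal h2 hψ1 β hs hβ1 (by simpa [hγ0] using hz)
    · refine hcontra (main (.inr (.inr ⟨hf, ?_, hγ0, hγ, ?_⟩)))
      · exact fun h => h3 (DirichletCharacter.eq_one_iff_conductor_eq_one.mpr h)
      · have := LFunction_conj hψ1 hr ((β : ℂ) + γ * I)
        rw [hz, map_zero] at this
        rw [hL, ← this]
        congr 1
        simp
  · have h2' : (ψ ^ 2).conductor ≠ 1 :=
      fun h => h2 (DirichletCharacter.eq_one_iff_conductor_eq_one.mpr h)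
    by_cases h3 : ψ ^ 3 = 1
    · have h := one_le_discBound_mul_one_sub_of_zero_of_cube hψ
        (ψ ^ 2).primitiveCharacter_isPrimitive hQ hQ₂ hQ5
        (fun n hn => primitiveCharacter_pow_apply ψ 2 hn) (fun n hn => by
          have hu : IsUnit (n : ZMod f) := (ZMod.isUnit_iff_coprime n f).mpr hn
          rw [← character_pow_apply ψ 3 hu, h3, MulChar.one_apply hu]) hβ1 hz hf h2'
      have hmono := discBound_mono (Q := Q) (m := 1) (t := 2 * |γ| + 1) (T := 9 / 5)
        (by linarith) (by rw [abs_of_nonneg (by positivity)]; linarith)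
      have hK := five_le_discBound hQ5 (2 * |γ| + 1)
      have h1 : 6178 / 100 * (discBound Q 1 (2 * |γ| + 1) + 30 / 100) * (1 - β) <
          6178 / 100 * (discBound Q 1 (2 * |γ| + 1) + 30 / 100) * δ := by
        apply mul_lt_mul_of_pos_left (by linarith); linarith
      have h2 : 6178 / 100 * (discBound Q 1 (2 * |γ| + 1) + 30 / 100) * δ ≤
          6178 / 100 * (discBound Q 1 (9 / 5) + 30 / 100) * δ := by gcongr
      linarith
    · exact hcontra (main (.inr (.inl ⟨hf, h2',
        fun h => h3 (DirichletCharacter.eq_one_iff_conductor_eq_one.mpr h)⟩)))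

end

/-- The derivative at the centre of a disc, in terms of an upper bound for the real part. -/
lemma norm_deriv_le_of_re_le {f : ℂ → ℂ} {c : ℂ} {R M : ℝ} (hR : 0 < R) (hM : 0 < M)
    (hf : DifferentiableOn ℂ f (ball c R)) (hc : f c = 0)
    (hre : ∀ z ∈ ball c R, (f z).re ≤ M) : ‖deriv f c‖ ≤ 2 * M / R := by
  have hne : ∀ z ∈ ball c R, (2 * M : ℂ) - f z ≠ 0 := by
    intro z hz h
    have h1 := congrArg Complex.re h
    have h2 := hre z hz
    simp at h1
    linarith
  have hd : DifferentiableOn ℂ (fun z => f z / (2 * M - f z)) (ball c R) :=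
    hf.div (hf.const_sub _) hne
  have hmaps : MapsTo (fun z => f z / (2 * M - f z)) (ball c R)
      (closedBall ((fun z => f z / (2 * M - f z)) c) 1) := by
    intro z hz
    simp only [hc, zero_div, mem_closedBall_iff_norm, sub_zero, norm_div]
    refine div_le_one_of_le₀ ?_ (norm_nonneg _)
    rw [← sq_le_sq₀ (norm_nonneg _) (norm_nonneg _), Complex.sq_norm, Complex.sq_norm,
      normSq_apply, normSq_apply]
    have := hre z hz
    simp
    nlinarith
  have h := norm_deriv_le_div_of_mapsTo_ball hd hmaps hR
  have hfc : HasDerivAt f (deriv f c) c :=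
    (hf.differentiableAt (Metric.ball_mem_nhds c hR)).hasDerivAt
  have h2 := hfc.div (hfc.const_sub (2 * M : ℂ)) (hne c (mem_ball_self hR))
  have h3 : deriv (fun z => f z / (2 * M - f z)) c = deriv f c / (2 * M) := by
    rw [show (fun z => f z / (2 * M - f z)) = f / fun z => (2 * M : ℂ) - f z from rfl, h2.deriv]
    have : (M : ℂ) ≠ 0 := by exact_mod_cast hM.ne'
    rw [hc]
    field_simp
    ring
  rw [h3, norm_div, div_le_div_iff₀ (by simpa using hM.ne') hR] at h
  rw [le_div_iff₀ hR]
  simpa [abs_of_pos hM] using h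

/-- A bound for the derivative inside a disc, in terms of an upper bound for the real part. -/
lemma norm_deriv_le_of_re_le_of_mem_ball {f : ℂ → ℂ} {c z : ℂ} {R r M : ℝ} (hM : 0 < M)
    (hf : DifferentiableOn ℂ f (ball c R)) (hc : f c = 0)
    (hre : ∀ z ∈ ball c R, (f z).re ≤ M) (hz : ‖z - c‖ ≤ r) (hr : r < R) :
    ‖deriv f z‖ ≤ 2 * M * (R + r) / (R - r) ^ 2 := by
  have hr0 : 0 ≤ r := (norm_nonneg _).trans hz
  have hRr : 0 < R - r := by linarith
  have hsub : ball z (R - r) ⊆ ball c R := by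
    apply Metric.ball_subset_ball'
    rw [dist_eq_norm]
    linarith
  have hmem : z ∈ ball c R := hsub (mem_ball_self hRr)
  have h1 : ‖f z‖ ≤ 2 * M * r / (R - r) := by
    have h := borelCaratheodory_zero (f := fun w => f (c + w)) (z := z - c) (R := R) hM
      (hf.comp (by fun_prop) fun w hw => by
        simpa [mem_ball_iff_norm] using hw)
      (fun w hw => hre _ (by simpa [mem_ball_iff_norm] using hw)) (by linarith)
      (by simpa [mem_ball_iff_norm] using hz.trans_lt hr) (by simpa using hc)
    simp only [add_sub_cancel] at h
    refine h.trans ?_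
    gcongr
  have h2 : M - (f z).re ≤ M * (R + r) / (R - r) := by
    have : -(f z).re ≤ ‖f z‖ := (neg_le_abs _).trans (abs_re_le_norm _)
    calc M - (f z).re ≤ M + 2 * M * r / (R - r) := by linarith
      _ = M * (R + r) / (R - r) := by field_simp; ring
  have h3 : 0 < M * (R + r) / (R - r) := by have : 0 < R + r := by linarith
                                            positivity
  have h := norm_deriv_le_of_re_le (f := fun w => f w - f z) hRr h3
    ((hf.mono hsub).sub_const _) (by simp) (fun w hw => by
      simp only [sub_re]
      linarith [hre w (hsub hw)])
  rw [deriv_sub_const] at h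
  refine h.trans (le_of_eq ?_)
  field_simp

namespace StripFunction

variable {g : ℂ → ℂ} {Q m : ℝ}

/-- A bound for the logarithmic derivative to the right of a zero-free region. -/
theorem norm_logDeriv_le (hg : StripFunction g Q m) {δ θ T lam : ℝ} (hδ : 0 < δ) (hδ2 : δ ≤ 1 / 10)
    (hθ : 0 ≤ θ) (hθ1 : θ < 1)
    (hne : ∀ s : ℂ, 1 - δ < s.re → |s.im| ≤ T → g s ≠ 0) {s : ℂ} (hs : 1 - θ * δ ≤ s.re)
    (hs2 : s.re ≤ 1 + δ) (hT : |s.im| + 1 ≤ T)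
    (hlam : exp (-lam) ≤ ‖g ((1 + δ : ℝ) + s.im * I)‖) :
    ‖logDeriv g s‖ ≤ 8 * (log (logScale Q (|s.im| + 1)) + 1 / 16 +
      δ * (log (Q * (|s.im| + 4) / (2 * π)) / 2) + lam) / (δ * (1 - θ) ^ 2) := by
  set c : ℂ := (1 + δ : ℝ) + s.im * I with hcdef
  have hcre : c.re = 1 + δ := by simp [hcdef]
  have hcim : c.im = s.im := by simp [hcdef]
  set M := log (logScale Q (|s.im| + 1)) + 1 / 16 +
      δ * (log (Q * (|s.im| + 4) / (2 * π)) / 2) + lam with hM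
  have hball : ∀ z ∈ ball c (2 * δ), 1 - δ < z.re ∧ |z.im - s.im| ≤ 2 * δ := by
    intro z hz
    rw [mem_ball_iff_norm] at hz
    have h1 := (abs_re_le_norm (z - c)).trans_lt hz
    have h2 := (abs_im_le_norm (z - c)).trans_lt hz
    rw [sub_re, hcre, abs_lt] at h1
    rw [sub_im, hcim] at h2
    exact ⟨by linarith, h2.le⟩
  have him : ∀ z ∈ ball c (2 * δ), |z.im| ≤ |s.im| + 1 := by
    intro z hz
    have := abs_sub_abs_le_abs_sub z.im s.im
    linarith [(hball z hz).2]
  have hgne : ∀ z ∈ ball c (2 * δ), g z ≠ 0 := fun z hz =>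
    hne z (hball z hz).1 ((him z hz).trans hT)
  have hgd : ∀ z ∈ ball c (2 * δ), DifferentiableAt ℂ g z := fun z hz =>
    hg.differentiableAt z (by linarith [(hball z hz).1])
  have hcb : c ∈ ball c (2 * δ) := mem_ball_self (by linarith)
  have hgdo : DifferentiableOn ℂ g (ball c (2 * δ)) := fun z hz =>
    (hgd z hz).differentiableWithinAt
  have hld : DifferentiableOn ℂ (logDeriv g) (ball c (2 * δ)) :=
    (hgdo.deriv isOpen_ball).div hgdo hgne
  obtain ⟨G, hGc, hG⟩ := hld.isExactOn_ball.with_val_at c 0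
  have hconst : ∀ z ∈ ball c (2 * δ), cexp (-G z) * g z = g c := by
    intro z hz
    have hd : ∀ w ∈ ball c (2 * δ), HasDerivAt (fun w => cexp (-G w) * g w) 0 w := by
      intro w hw
      have := ((hG w hw).neg.cexp).mul (hgd w hw).hasDerivAt
      convert! this using 1
      rw [logDeriv_apply]
      have := hgne w hw
      field_simp
      ring
    have := isOpen_ball.is_const_of_deriv_eq_zero (convex_ball c (2 * δ)).isPreconnected
      (fun w hw => (hd w hw).differentiableAt.differentiableWithinAt)
      (fun w hw => (hd w hw).deriv) hz hcb
    rw [this, hGc]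
    simp
  have hlogc : -lam ≤ log ‖g c‖ := by
    rw [le_log_iff_exp_le (norm_pos_iff.mpr (hgne c hcb))]
    exact hlam
  have hGre : ∀ z ∈ ball c (2 * δ), (G z).re = log ‖g z‖ - log ‖g c‖ := by
    intro z hz
    rw [← hconst z hz, norm_mul, log_mul (by simp) (by simpa using hgne z hz), norm_exp,
      log_exp]
    simp
  have hQ := hg.conductor_ge
  have hQt : 1 < Q * (|s.im| + 4) / (2 * π) := by
    rw [lt_div_iff₀ (by positivity)]
    nlinarith [abs_nonneg s.im, pi_lt_four]
  have hlq := Real.log_pos hQt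
  have hMpos : 0 < M := by
    have := hg.log_norm_le (s := c) (t := s.im) (x := 0) (by rw [hcre]; linarith)
      (him c hcb) le_rfl (by rw [hcre]; linarith)
    have h2 : 0 < δ * (log (Q * (|s.im| + 4) / (2 * π)) / 2) := by positivity
    rw [hM]; linarith
  have hre : ∀ z ∈ ball c (2 * δ), (G z).re ≤ M := by
    intro z hz
    have := hg.log_norm_le (s := z) (t := s.im) (x := δ) (by linarith [(hball z hz).1])
      (him z hz) hδ.le (by linarith [(hball z hz).1])
    rw [hGre z hz, hM]; linarith
  have hsc : ‖s - c‖ ≤ (1 + θ) * δ := by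
    have : s - c = ((s.re - (1 + δ) : ℝ) : ℂ) := by
      apply Complex.ext <;> simp [hcre, hcim]
    rw [this, norm_real, norm_eq_abs, abs_le]
    constructor <;> nlinarith
  have hr : (1 + θ) * δ < 2 * δ := by nlinarith
  have hsb : s ∈ ball c (2 * δ) := by
    rw [mem_ball_iff_norm]; linarith
  have h := norm_deriv_le_of_re_le_of_mem_ball hMpos
    (fun z hz => (hG z hz).differentiableAt.differentiableWithinAt) hGc hre hsc hr
  rw [(hG s hsb).deriv] at h
  refine h.trans ?_
  have e : (2 * δ - (1 + θ) * δ) ^ 2 = δ * (δ * (1 - θ) ^ 2) := by ring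
  have hθ' : 0 < 1 - θ := by linarith
  rw [e, div_le_div_iff₀ (by positivity) (by positivity)]
  have : 2 * M * (2 * δ + (1 + θ) * δ) ≤ 8 * M * δ := by nlinarith [mul_pos hMpos hδ]
  calc 2 * M * (2 * δ + (1 + θ) * δ) * (δ * (1 - θ) ^ 2) ≤ 8 * M * δ * (δ * (1 - θ) ^ 2) := by gcongr
    _ = _ := by ring

end StripFunction

/-- The density of the centred Gaussian with standard deviation `h`. -/
noncomputable def gaussDensity (h y : ℝ) : ℝ :=
  exp (-(y ^ 2 / (2 * h ^ 2))) / (h * Real.sqrt (2 * π))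

/-- The function `u ↦ exp (a * u)` on the positive half line, convolved with a Gaussian. -/
noncomputable def smoothExp (h a y : ℝ) : ℝ :=
  ∫ u in Set.Ioi (0 : ℝ), exp (a * u) * gaussDensity h (y - u)

/-- The weight on the vertical line through `c` used to smooth a summatory function. -/
noncomputable def kernelLine (h c v t : ℝ) : ℂ :=
  cexp (((c : ℂ) + t * I) * v + h ^ 2 * ((c : ℂ) + t * I) ^ 2 / 2)

lemma continuous_gaussDensity (h : ℝ) : Continuous (gaussDensity h) := by
  unfold gaussDensity; fun_prop

lemma gaussDensity_nonneg {h : ℝ} (hh : 0 < h) (y : ℝ) : 0 ≤ gaussDensity h y := by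
  unfold gaussDensity; positivity

lemma continuous_kernelLine (h c v : ℝ) : Continuous (kernelLine h c v) := by
  unfold kernelLine; fun_prop

lemma norm_kernelLine (h c v t : ℝ) :
    ‖kernelLine h c v t‖ = exp (c * v + h ^ 2 * c ^ 2 / 2) * exp (-(h ^ 2 / 2) * t ^ 2) := by
  rw [kernelLine, norm_exp, ← exp_add]
  congr 1
  simp [sq]
  ring

lemma integrable_norm_kernelLine {h : ℝ} (hh : 0 < h) (c v : ℝ) :
    Integrable fun t => ‖kernelLine h c v t‖ := by
  simp_rw [norm_kernelLine]
  exact (integrable_exp_neg_mul_sq (by positivity)).const_mul _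

lemma integral_kernelLine {h : ℝ} (hh : 0 < h) (c v : ℝ) :
    ∫ t, kernelLine h c v t = 2 * π * gaussDensity h v := by
  have hb : (-(h ^ 2 / 2 : ℝ) : ℂ).re < 0 := by
    rw [← ofReal_neg, ofReal_re]; nlinarith [sq_pos_of_pos hh]
  have e : ∀ t : ℝ, kernelLine h c v t =
      cexp ((-(h ^ 2 / 2 : ℝ) : ℂ) * t ^ 2 + ((v + h ^ 2 * c) * I) * t +
        (c * v + h ^ 2 * c ^ 2 / 2)) := by
    intro t
    rw [kernelLine]
    congr 1
    push_cast
    linear_combination (h ^ 2 * t ^ 2 / 2 : ℂ) * I_sq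
  simp_rw [e]
  rw [integral_cexp_quadratic hb]
  have hhc : (h : ℂ) ≠ 0 := by exact_mod_cast hh.ne'
  have e1 : (c * v + h ^ 2 * c ^ 2 / 2 : ℂ) - ((v + h ^ 2 * c) * I) ^ 2 /
      (4 * (-(h ^ 2 / 2 : ℝ) : ℂ)) = ((-(v ^ 2 / (2 * h ^ 2)) : ℝ) : ℂ) := by
    push_cast
    rw [mul_pow, I_sq]
    field_simp
    ring
  have e2 : ((π : ℂ) / -(-(h ^ 2 / 2 : ℝ) : ℂ)) ^ (1 / 2 : ℂ) =
      ((2 * π / (h * Real.sqrt (2 * π)) : ℝ) : ℂ) := by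
    rw [neg_neg, ← ofReal_div, show (1 / 2 : ℂ) = ((1 / 2 : ℝ) : ℂ) by push_cast; rfl,
      ← ofReal_cpow (by positivity), ← sqrt_eq_rpow]
    congr 1
    have h2 : 0 < Real.sqrt (2 * π) := by positivity
    have h3 : π / (h ^ 2 / 2) = (2 * π / (h * Real.sqrt (2 * π))) ^ 2 := by
      rw [div_pow, mul_pow, mul_pow, sq_sqrt (by positivity)]
      field_simp
    rw [h3, sqrt_sq (by positivity)]
  rw [e1, e2, ← ofReal_exp, gaussDensity]
  push_cast
  ring

/-- The inverse Laplace transform of `1 / (s - a)`, smoothed by a Gaussian. -/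
theorem integral_kernelLine_div {h : ℝ} (hh : 0 < h) {a c : ℝ} (hac : a < c) (v : ℝ) :
    ∫ t, kernelLine h c v t / (((c : ℂ) + t * I) - a) = 2 * π * smoothExp h a v := by
  set G : ℝ → ℝ → ℂ := fun t u => kernelLine h c v t * cexp (-(((c : ℂ) + t * I) - a) * u) with hG
  have hnorm : ∀ t u, ‖G t u‖ = ‖kernelLine h c v t‖ * exp (-(c - a) * u) := by
    intro t u
    rw [hG, norm_mul, norm_exp]
    simp
  have hint : Integrable (Function.uncurry G) (volume.prod (volume.restrict (Set.Ioi (0 : ℝ)))) := by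
    have h1 := (integrable_norm_kernelLine hh c v).mul_prod
      (exp_neg_integrableOn_Ioi 0 (b := c - a) (by linarith) :
        Integrable (fun u => exp (-(c - a) * u)) (volume.restrict (Set.Ioi (0 : ℝ))))
    refine h1.mono' ?_ (Eventually.of_forall fun p => ?_)
    · have := continuous_kernelLine h c v
      apply Continuous.aestronglyMeasurable
      rw [hG]
      unfold Function.uncurry
      fun_prop
    · exact (hnorm p.1 p.2).le
  have e1 : ∀ t : ℝ, kernelLine h c v t / (((c : ℂ) + t * I) - a) =
      ∫ u in Set.Ioi (0 : ℝ), G t u := by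
    intro t
    rw [hG]
    simp only
    rw [integral_const_mul, integral_exp_mul_complex_Ioi (by simp; linarith)]
    rw [ofReal_zero, mul_zero, Complex.exp_zero, neg_div_neg_eq, mul_one_div]
  have e2 : ∀ u : ℝ, ∫ t, G t u = 2 * π * (exp (a * u) * gaussDensity h (v - u) : ℝ) := by
    intro u
    have : ∀ t : ℝ, G t u = cexp (a * u) * kernelLine h c (v - u) t := by
      intro t
      simp only [hG, kernelLine]
      rw [← Complex.exp_add, ← Complex.exp_add]
      congr 1
      push_cast
      ring
    simp_rw [this]
    rw [integral_const_mul, integral_kernelLine hh]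
    push_cast
    ring
  simp_rw [e1]
  rw [integral_integral_swap hint]
  simp_rw [e2]
  rw [integral_const_mul, integral_complex_ofReal, smoothExp]

/-- Termwise application of the smoothing kernel to a Dirichlet series. -/
theorem hasSum_mul_smoothExp {h σ : ℝ} (hh : 0 < h) (hσ : 0 < σ) {b : ℕ → ℂ} (hb0 : b 0 = 0)
    (hb : LSeriesSummable b σ) (v : ℝ) :
    HasSum (fun n : ℕ => b n * smoothExp h 0 (v - log n))
      ((2 * π : ℂ)⁻¹ * ∫ t : ℝ, LSeries b ((σ : ℂ) + t * I) *
        (kernelLine h σ v t / ((σ : ℂ) + t * I))) := by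
  set G : ℕ → ℝ → ℂ := fun n t => LSeries.term b ((σ : ℂ) + t * I) n *
    (kernelLine h σ v t / ((σ : ℂ) + t * I)) with hG
  have hs0 : ∀ t : ℝ, (σ : ℂ) + t * I ≠ 0 := fun t ht => by
    have := congrArg Complex.re ht
    simp at this
    linarith
  have hsn : ∀ t : ℝ, σ ≤ ‖(σ : ℂ) + t * I‖ := fun t => by
    have := (le_abs_self _).trans (abs_re_le_norm ((σ : ℂ) + t * I))
    simpa using this
  have hterm : ∀ n (t : ℝ), ‖LSeries.term b ((σ : ℂ) + t * I) n‖ = ‖LSeries.term b σ n‖ := by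
    intro n t
    simp [LSeries.norm_term_eq]
  have hGnorm : ∀ n t, ‖G n t‖ ≤ ‖LSeries.term b σ n‖ * (‖kernelLine h σ v t‖ * σ⁻¹) := by
    intro n t
    rw [hG, norm_mul, hterm, norm_div, div_eq_mul_inv]
    gcongr
    exact hsn t
  have hterm2 : ∀ n, n ≠ 0 → ∀ t : ℝ, G n t =
      b n * (kernelLine h σ (v - log n) t / (((σ : ℂ) + t * I) - (0 : ℝ))) := by
    intro n hn t
    have hnc : (n : ℂ) ≠ 0 := by exact_mod_cast hn
    rw [hG]
    simp only
    rw [LSeries.term_of_ne_zero hn, cpow_def_of_ne_zero hnc, kernelLine, kernelLine]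
    have : cexp (((σ : ℂ) + t * I) * ((v - log n : ℝ) : ℂ) +
        h ^ 2 * ((σ : ℂ) + t * I) ^ 2 / 2) = cexp (((σ : ℂ) + t * I) * v +
        h ^ 2 * ((σ : ℂ) + t * I) ^ 2 / 2) / cexp (Complex.log n * ((σ : ℂ) + t * I)) := by
      rw [← Complex.exp_sub]
      congr 1
      rw [← natCast_log]
      push_cast
      ring
    rw [this]
    simp only [ofReal_zero, sub_zero]
    ring
  have hmeas : ∀ n, AEStronglyMeasurable (G n) := by
    intro n
    by_cases hn : n = 0
    · have : G n = fun _ => 0 := by ext t; simp [hG, hn]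
      rw [this]; exact aestronglyMeasurable_const
    · rw [funext (hterm2 n hn)]
      apply Continuous.aestronglyMeasurable
      refine continuous_const.mul ((continuous_kernelLine _ _ _).div (by fun_prop) fun t => ?_)
      simpa using hs0 t
  have hdom : Integrable fun t => ‖kernelLine h σ v t‖ * σ⁻¹ :=
    (integrable_norm_kernelLine hh σ v).mul_const _
  have hint : ∀ n, Integrable (G n) := fun n =>
    (hdom.const_mul _).mono' (hmeas n) (Eventually.of_forall (hGnorm n))
  have hsum : Summable fun n => ∫ t, ‖G n t‖ := by
    refine Summable.of_nonneg_of_le (fun n => integral_nonneg fun t => norm_nonneg _)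
      (fun n => integral_mono (hint n).norm (hdom.const_mul _) (hGnorm n)) ?_
    simp_rw [integral_const_mul]
    exact hb.norm.mul_right _
  have key := (hasSum_integral_of_summable_integral_norm hint hsum).mul_left
    ((2 * π : ℂ)⁻¹)
  have e1 : ∀ n : ℕ, (2 * π : ℂ)⁻¹ * ∫ t, G n t =
      b n * smoothExp h 0 (v - log n) := by
    intro n
    by_cases hn : n = 0
    · simp [hn, hb0, hG]
    · simp_rw [hterm2 n hn]
      rw [integral_const_mul, integral_kernelLine_div hh hσ]
      have : (π : ℂ) ≠ 0 := by exact_mod_cast pi_ne_zero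
      field_simp
  have e2 : ∀ t, ∑' n, G n t = LSeries b ((σ : ℂ) + t * I) *
      (kernelLine h σ v t / ((σ : ℂ) + t * I)) := by
    intro t
    simp only [hG]
    rw [tsum_mul_right]
    rfl
  simp_rw [e1, e2] at key
  exact key

section

variable {h : ℝ}

lemma gaussDensity_neg (h y : ℝ) : gaussDensity h (-y) = gaussDensity h y := by
  simp [gaussDensity]

lemma gaussDensity_eq (h y : ℝ) : gaussDensity h y =
    exp (-(1 / (2 * h ^ 2)) * y ^ 2) / (h * Real.sqrt (2 * π)) := by
  rw [gaussDensity]; ring_nf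

lemma integrable_gaussDensity (hh : 0 < h) : Integrable (gaussDensity h) := by
  rw [funext (gaussDensity_eq h)]
  exact (integrable_exp_neg_mul_sq (b := 1 / (2 * h ^ 2)) (by positivity)).div_const _

lemma integral_gaussDensity (hh : 0 < h) : ∫ y, gaussDensity h y = 1 := by
  have h1 := integral_gaussian (1 / (2 * h ^ 2))
  simp_rw [gaussDensity_eq]
  rw [integral_div, h1, show π / (1 / (2 * h ^ 2)) = h ^ 2 * (2 * π) by field_simp,
    sqrt_mul (by positivity), sqrt_sq hh.le]
  exact div_self (by positivity)

lemma integrable_gaussDensity_sub (hh : 0 < h) (y : ℝ) :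
    Integrable fun u => gaussDensity h (y - u) :=
  (integrable_gaussDensity hh).comp_sub_left y

lemma smoothExp_zero (h y : ℝ) :
    smoothExp h 0 y = ∫ u in Set.Ioi (0 : ℝ), gaussDensity h (y - u) := by
  simp [smoothExp]

lemma smoothExp_nonneg (hh : 0 < h) (a y : ℝ) : 0 ≤ smoothExp h a y :=
  integral_nonneg fun u => mul_nonneg (exp_pos _).le (gaussDensity_nonneg hh _)

/-- Completing the square. -/
lemma smoothExp_eq (hh : 0 < h) (a y : ℝ) :
    smoothExp h a y = exp (a * y + a ^ 2 * h ^ 2 / 2) * smoothExp h 0 (y + a * h ^ 2) := by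
  rw [smoothExp_zero, smoothExp, ← integral_const_mul]
  refine integral_congr_ae (Eventually.of_forall fun u => ?_)
  simp only [gaussDensity]
  rw [← mul_div_assoc, ← mul_div_assoc, ← exp_add, ← exp_add]
  congr 2
  field_simp
  ring

lemma smoothExp_zero_add_neg (hh : 0 < h) (y : ℝ) : smoothExp h 0 y + smoothExp h 0 (-y) = 1 := by
  have h1 : smoothExp h 0 (-y) = ∫ u in Set.Iic (0 : ℝ), gaussDensity h (y - u) := by
    rw [smoothExp_zero, ← neg_zero, ← integral_comp_neg_Iic, neg_zero]
    refine integral_congr_ae (Eventually.of_forall fun u => ?_)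
    simp only
    rw [← gaussDensity_neg]
    ring_nf
  have h2 := intervalIntegral.integral_Iic_add_Ioi (b := (0 : ℝ))
    (integrable_gaussDensity_sub hh y).integrableOn (integrable_gaussDensity_sub hh y).integrableOn
  rw [integral_sub_left_eq_self (gaussDensity h) volume y, integral_gaussDensity hh] at h2
  rw [h1, smoothExp_zero]
  linarith

lemma smoothExp_zero_le_one (hh : 0 < h) (y : ℝ) : smoothExp h 0 y ≤ 1 := by
  linarith [smoothExp_zero_add_neg hh y, smoothExp_nonneg hh 0 (-y)]

lemma smoothExp_zero_neg_le (hh : 0 < h) {y : ℝ} (hy : 0 ≤ y) :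
    smoothExp h 0 (-y) ≤ exp (-(y ^ 2 / (2 * h ^ 2))) := by
  have h1 : smoothExp h 0 (-y) ≤
      ∫ u in Set.Ioi (0 : ℝ), exp (-(y ^ 2 / (2 * h ^ 2))) * gaussDensity h (0 - u) := by
    rw [smoothExp_zero]
    refine setIntegral_mono_on (integrable_gaussDensity_sub hh _).integrableOn
      ((integrable_gaussDensity_sub hh 0).integrableOn.const_mul _) measurableSet_Ioi
      fun u hu => ?_
    have hu0 : 0 < u := hu
    simp only [gaussDensity]
    rw [← mul_div_assoc, ← exp_add]
    gcongr
    rw [← neg_add, neg_le_neg_iff, ← add_div]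
    gcongr
    nlinarith
  rw [integral_const_mul, ← smoothExp_zero] at h1
  have := smoothExp_zero_le_one hh 0
  nlinarith [exp_pos (-(y ^ 2 / (2 * h ^ 2)))]

lemma one_sub_le_smoothExp_zero (hh : 0 < h) {y : ℝ} (hy : 0 ≤ y) :
    1 - exp (-(y ^ 2 / (2 * h ^ 2))) ≤ smoothExp h 0 y := by
  linarith [smoothExp_zero_add_neg hh y, smoothExp_zero_neg_le hh hy]

/-- For a nonnegative exponent, the smoothed exponential is close to the exponential. -/
lemma smoothExp_mem_Icc (hh : 0 < h) {a y : ℝ} (ha : 0 ≤ a) (hy : 0 ≤ y) :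
    exp (a * y + a ^ 2 * h ^ 2 / 2) - 1 ≤ smoothExp h a y ∧
      smoothExp h a y ≤ exp (a * y + a ^ 2 * h ^ 2 / 2) := by
  rw [smoothExp_eq hh]
  have h1 := smoothExp_zero_le_one hh (y + a * h ^ 2)
  have h2 := one_sub_le_smoothExp_zero hh (y := y + a * h ^ 2) (by positivity)
  constructor
  · have h3 : exp (a * y + a ^ 2 * h ^ 2 / 2) *
        exp (-((y + a * h ^ 2) ^ 2 / (2 * h ^ 2))) ≤ 1 := by
      rw [← exp_add, exp_le_one_iff]
      have : a * y + a ^ 2 * h ^ 2 / 2 + -((y + a * h ^ 2) ^ 2 / (2 * h ^ 2)) =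
        -(y ^ 2 / (2 * h ^ 2)) := by field_simp; ring
      rw [this]
      simp only [Left.neg_nonpos_iff]
      positivity
    nlinarith [exp_pos (a * y + a ^ 2 * h ^ 2 / 2)]
  · nlinarith [exp_pos (a * y + a ^ 2 * h ^ 2 / 2)]

end

section

variable {h : ℝ}

lemma le_norm_add_mul_I (x t : ℝ) : x ≤ ‖(x : ℂ) + t * I‖ := by
  have := (le_abs_self _).trans (abs_re_le_norm ((x : ℂ) + t * I))
  simpa using this

lemma abs_le_norm_add_mul_I (x t : ℝ) : |t| ≤ ‖(x : ℂ) + t * I‖ := by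
  have := abs_im_le_norm ((x : ℂ) + t * I)
  simpa using this

lemma norm_kernelLine_le {c v t : ℝ} :
    ‖kernelLine h c v t‖ ≤ exp (c * v + h ^ 2 * c ^ 2 / 2) := by
  rw [norm_kernelLine]
  refine mul_le_of_le_one_right (exp_pos _).le ?_
  rw [exp_le_one_iff]
  nlinarith [sq_nonneg h, sq_nonneg t, mul_nonneg (sq_nonneg h) (sq_nonneg t)]

/-- The integral over a truncated vertical line of a function bounded by `M / ‖s‖`. -/
lemma norm_integral_le_of_norm_le_div {f : ℝ → ℂ} {x V M : ℝ} (hx : 9 / 10 ≤ x) (hV : 1 ≤ V)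
    (hM : 0 ≤ M) (hf : ContinuousOn f (Set.Icc (-V) V))
    (hb : ∀ t, |t| ≤ V → ‖f t‖ ≤ M / ‖(x : ℂ) + t * I‖) :
    ‖∫ t in -V..V, f t‖ ≤ 2 * M * (10 / 9 + log V) := by
  have hint : ∀ a b, -V ≤ a → a ≤ b → b ≤ V → IntervalIntegrable f volume a b := by
    intro a b ha hab hbV
    refine (hf.mono ?_).intervalIntegrable
    rw [Set.uIcc_of_le hab]
    exact Set.Icc_subset_Icc ha hbV
  have hpos : ∀ t : ℝ, 0 < ‖(x : ℂ) + t * I‖ := fun t => lt_of_lt_of_le (by linarith)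
    (le_norm_add_mul_I x t)
  have e : ∫ t in -V..V, f t = (∫ t in -V..(-1), f t) + (∫ t in (-1 : ℝ)..1, f t) +
      ∫ t in (1 : ℝ)..V, f t := by
    rw [intervalIntegral.integral_add_adjacent_intervals 
      (hint _ _ le_rfl (by linarith) (by linarith)) (hint _ _ (by linarith) (by norm_num) hV),
      intervalIntegral.integral_add_adjacent_intervals
      (hint _ _ le_rfl (by linarith) (by linarith)) (hint _ _ (by linarith) hV le_rfl)]
  have h2 : ‖∫ t in (-1 : ℝ)..1, f t‖ ≤ 10 / 9 * M * |1 - (-1)| := by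
    refine intervalIntegral.norm_integral_le_of_norm_le_const fun t ht => ?_
    rw [Set.uIoc_of_le (by norm_num)] at ht
    refine (hb t ((abs_le.mpr ⟨ht.1.le, ht.2⟩).trans hV)).trans ?_
    rw [div_le_iff₀ (hpos t)]
    have := le_norm_add_mul_I x t
    nlinarith
  have h3 : ∀ g : ℝ → ℂ, (∀ t ∈ Set.Ioc 1 V, ‖g t‖ ≤ M * t⁻¹) →
      ‖∫ t in (1 : ℝ)..V, g t‖ ≤ M * log V := by
    intro g hg
    have hi : IntervalIntegrable (fun t : ℝ => M * t⁻¹) volume 1 V := by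
      refine ContinuousOn.intervalIntegrable ?_
      rw [Set.uIcc_of_le hV]
      refine continuousOn_const.mul (continuousOn_inv₀.mono fun t ht => ?_)
      exact (lt_of_lt_of_le one_pos ht.1).ne'
    refine (intervalIntegral.norm_integral_le_of_norm_le hV
      (Eventually.of_forall hg) hi).trans (le_of_eq ?_)
    rw [intervalIntegral.integral_const_mul, integral_inv_of_pos one_pos (by linarith), div_one]
  have h4 := h3 f fun t ht => by
    have ht0 : 0 < t := by linarith [ht.1]
    refine (hb t (by rw [abs_of_pos ht0]; exact ht.2)).trans ?_
    rw [← div_eq_mul_inv]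
    gcongr
    have := abs_le_norm_add_mul_I x t
    rwa [abs_of_pos ht0] at this
  have h5 : ‖∫ t in -V..(-1), f t‖ ≤ M * log V := by
    rw [← intervalIntegral.integral_comp_neg]
    refine h3 _ fun t ht => ?_
    have ht0 : 0 < t := by linarith [ht.1]
    refine (hb (-t) (by rw [abs_neg, abs_of_pos ht0]; exact ht.2)).trans ?_
    rw [← div_eq_mul_inv]
    gcongr
    have := abs_le_norm_add_mul_I x (-t)
    rwa [abs_neg, abs_of_pos ht0] at this
  rw [e]
  refine (norm_add_le _ _).trans ((add_le_add_left (norm_add_le _ _) _).trans ?_)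
  norm_num at h2
  linarith

/-- Shifting a truncated vertical line integral to the left. -/
lemma norm_integral_kernelLine_le {F : ℂ → ℂ} {x c v V B : ℝ} (hx : 9 / 10 ≤ x) (hxc : x ≤ c)
    (hc : c ≤ 2) (hV : 1 ≤ V) (hv : 0 ≤ v) (hB : 0 ≤ B)
    (hF : ∀ s : ℂ, x ≤ s.re → s.re ≤ c → |s.im| ≤ V → DifferentiableAt ℂ F s ∧ ‖F s‖ ≤ B) :
    ‖∫ t in -V..V, F ((c : ℂ) + t * I) * (kernelLine h c v t / ((c : ℂ) + t * I))‖ ≤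
      2 * (B * exp (x * v + h ^ 2 * x ^ 2 / 2)) * (10 / 9 + log V) +
      2 * ((c - x) * (B * exp (c * v + h ^ 2 * c ^ 2 / 2) *
        exp (-(h ^ 2 / 2) * V ^ 2) / V)) := by
  set H : ℂ → ℂ := fun s => F s * (cexp (s * v + h ^ 2 * s ^ 2 / 2) / s) with hH
  have hs0 : ∀ s : ℂ, x ≤ s.re → s ≠ 0 := fun s hs h0 => by
    rw [h0] at hs; simp at hs; linarith
  have hHd : ∀ s : ℂ, x ≤ s.re → s.re ≤ c → |s.im| ≤ V → DifferentiableAt ℂ H s := by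
    intro s h1 h2 h3
    have := (hF s h1 h2 h3).1
    have h4 := hs0 s h1
    rw [hH]
    fun_prop (disch := assumption)
  have hrect := Complex.integral_boundary_rect_eq_zero_of_differentiableOn H
    ((x : ℂ) + (-V : ℝ) * I) ((c : ℂ) + V * I) (by
      intro s hs
      rw [mem_reProdIm] at hs
      simp only [add_re, ofReal_re, mul_re, I_re, mul_zero, ofReal_im, I_im, mul_one, sub_self,
        add_zero, add_im, mul_im, zero_add] at hs
      rw [Set.uIcc_of_le hxc, Set.uIcc_of_le (by linarith)] at hs
      exact (hHd s hs.1.1 hs.1.2 (abs_le.mpr ⟨hs.2.1, hs.2.2⟩)).differentiableWithinAt)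
  simp only [add_re, ofReal_re, mul_re, I_re, mul_zero, ofReal_im, I_im, mul_one, sub_self,
    add_zero, add_im, mul_im, zero_add] at hrect
  have hkl : ∀ (a t : ℝ), H ((a : ℂ) + t * I) =
      F ((a : ℂ) + t * I) * (kernelLine h a v t / ((a : ℂ) + t * I)) := fun a t => rfl
  have hhor : ∀ y : ℝ, |y| = V → ‖∫ a in x..c, H ((a : ℂ) + y * I)‖ ≤
      (c - x) * (B * exp (c * v + h ^ 2 * c ^ 2 / 2) *
        exp (-(h ^ 2 / 2) * V ^ 2) / V) := by
    intro y hy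
    have hy2 : y ^ 2 = V ^ 2 := by rw [← sq_abs, hy]
    have := intervalIntegral.norm_integral_le_of_norm_le_const (a := x) (b := c)
      (f := fun a : ℝ => H ((a : ℂ) + y * I))
      (C := B * exp (c * v + h ^ 2 * c ^ 2 / 2) * exp (-(h ^ 2 / 2) * V ^ 2) / V)
      (fun a ha => by
        rw [Set.uIoc_of_le hxc] at ha
        have ha0 : 0 ≤ a := by linarith [ha.1]
        rw [hkl, norm_mul, norm_div, norm_kernelLine, hy2]
        have h1 := (hF ((a : ℂ) + y * I) (by simpa using ha.1.le) (by simpa using ha.2)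
          (by simpa using hy.le)).2
        have h2 := abs_le_norm_add_mul_I a y
        rw [hy] at h2
        have h3 := ha.2
        have hV0 : 0 < V := by linarith
        rw [mul_assoc B, mul_div_assoc B]
        refine mul_le_mul h1 (div_le_div₀ (by positivity) ?_ hV0 h2) (by positivity) hB
        gcongr)
    rw [abs_of_nonneg (by linarith)] at this
    exact this.trans_eq (mul_comm _ _)
  have hleft : ‖∫ t in -V..V, H ((x : ℂ) + t * I)‖ ≤
      2 * (B * exp (x * v + h ^ 2 * x ^ 2 / 2)) * (10 / 9 + log V) := by
    refine norm_integral_le_of_norm_le_div hx hV (by positivity) ?_ ?_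
    · intro t ht
      have h1 := (hHd ((x : ℂ) + t * I) (by simp) (by simpa using hxc)
        (by simpa using abs_le.mpr ⟨ht.1, ht.2⟩)).continuousAt
      have h2 : ContinuousAt (fun t : ℝ => (x : ℂ) + t * I) t := by fun_prop
      exact (ContinuousAt.comp (f := fun t : ℝ => (x : ℂ) + t * I) h1 h2).continuousWithinAt
    · intro t ht
      rw [hkl, norm_mul, norm_div, ← mul_div_assoc]
      have h1 := (hF ((x : ℂ) + t * I) (by simp) (by simpa using hxc) (by simpa using ht)).2
      gcongr
      exact norm_kernelLine_le
  have e : ∫ t in -V..V, H ((c : ℂ) + t * I) = (∫ t in -V..V, H ((x : ℂ) + t * I)) -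
      I * ((∫ a in x..c, H ((a : ℂ) + V * I)) - ∫ a in x..c, H ((a : ℂ) + (-V : ℝ) * I)) := by
    have h2 : I * I = -1 := I_mul_I
    simp only [smul_eq_mul] at hrect
    linear_combination (-I) * hrect + ((∫ t in -V..V, H ((c : ℂ) + t * I)) -
      ∫ t in -V..V, H ((x : ℂ) + t * I)) * h2
  change ‖∫ t in -V..V, H ((c : ℂ) + t * I)‖ ≤ _
  rw [e]
  refine (norm_sub_le _ _).trans (add_le_add hleft ?_)
  rw [norm_mul, norm_I, one_mul]
  refine (norm_sub_le _ _).trans ?_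
  have h1 := hhor V (abs_of_nonneg (by linarith))
  have h2 := hhor (-V) (by rw [abs_neg]; exact abs_of_nonneg (by linarith))
  linarith

end

section

variable {h : ℝ} {f : ℕ} [NeZero f]

lemma norm_regularizedL_ge (ψ : DirichletCharacter ℂ f) {s : ℂ} (hs : 1 < s.re) (hs2 : s.re ≤ 2) :
    (1 + 1 / (s.re - 1))⁻¹ / 9 ≤ ‖regularizedL ψ s‖ := by
  have hd0 : 0 < s.re - 1 := by linarith
  have hp : 0 < (1 + 1 / (s.re - 1))⁻¹ := by positivity
  by_cases hf : f = 1
  · subst hf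
    rw [regularizedL, if_pos rfl, zetaReg, norm_div]
    have hn1 : 0 < ‖s + 1‖ := by
      have := (le_abs_self _).trans (abs_re_le_norm (s + 1))
      simp only [add_re, one_re] at this
      linarith
    rw [le_div_iff₀ hn1]
    have htri : ‖s + 1‖ ≤ ‖s - 1‖ + 2 := by
      have : s + 1 = (s - 1) + 2 := by ring
      rw [this]
      exact (norm_add_le _ _).trans (by simp)
    have hle1 : (1 + 1 / (s.re - 1))⁻¹ ≤ 1 / 2 := by
      rw [inv_le_comm₀ (by positivity) (by norm_num)]
      have : 1 ≤ 1 / (s.re - 1) := by rw [le_div_iff₀ hd0]; linarith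
      norm_num
      norm_num at this
      linarith
    by_cases hfar : 1 / 4 ≤ ‖s - 1‖
    · have hne : s ≠ 1 := ne_one_of_one_lt_re hs
      have h1 := norm_LFunction_ge (1 : DirichletCharacter ℂ 1) hs
      rw [DirichletCharacter.LFunction_modOne_eq] at h1
      rw [zetaEntire_of_ne_one hne, norm_mul]
      have : ‖s + 1‖ / 9 ≤ ‖s - 1‖ := by linarith
      nlinarith [norm_nonneg (s - 1)]
    · push Not at hfar
      have hs0 : 0 < s.re := by linarith
      rw [zetaEntire_eq_mul hs0, norm_mul]
      have hJ : ‖fractIntegral s‖ ≤ 1 := (norm_fractIntegral_le hs0).trans (by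
        rw [div_le_one hs0]; exact hs.le)
      have h1 : 3 / 4 ≤ ‖1 + (s - 1) * fractIntegral s‖ := by
        have h2 : ‖(s - 1) * fractIntegral s‖ ≤ 1 / 4 := by
          rw [norm_mul]; nlinarith [norm_nonneg (s - 1), norm_nonneg (fractIntegral s)]
        have h3 := norm_sub_norm_le (1 : ℂ) (-((s - 1) * fractIntegral s))
        rw [norm_neg, sub_neg_eq_add, norm_one] at h3
        linarith
      have h2 : 1 ≤ ‖s‖ := hs.le.trans ((le_abs_self _).trans (abs_re_le_norm s))
      nlinarith
  · rw [regularizedL, if_neg hf]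
    have := norm_LFunction_ge ψ hs
    linarith

/-- Truncating an integral whose integrand is dominated by a Gaussian. -/
lemma norm_integral_sub_intervalIntegral_le {g : ℝ → ℂ} {V M : ℝ} (hh : 0 < h) (hV : 0 ≤ V)
    (hM : 0 ≤ M) (hg : Integrable g)
    (hb : ∀ t, V ≤ |t| → ‖g t‖ ≤ M * exp (-(h ^ 2 / 2) * t ^ 2)) :
    ‖(∫ t, g t) - ∫ t in -V..V, g t‖ ≤
      2 * (M * exp (-(h ^ 2 / 2) * V ^ 2) * √(π / (h ^ 2 / 2))) := by
  have key : ∀ k : ℝ → ℂ, Integrable k → 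
      (∀ t, V ≤ t → ‖k t‖ ≤ M * exp (-(h ^ 2 / 2) * t ^ 2)) → ‖∫ t in Set.Ioi V, k t‖ ≤
      M * exp (-(h ^ 2 / 2) * V ^ 2) * √(π / (h ^ 2 / 2)) := by
    intro k hk hb
    have hi : Integrable fun t : ℝ => M * exp (-(h ^ 2 / 2) * V ^ 2) *
        exp (-(h ^ 2 / 2) * (t - V) ^ 2) :=
      ((integrable_exp_neg_mul_sq (by positivity)).comp_sub_right V).const_mul _
    have h1 : ‖∫ t in Set.Ioi V, k t‖ ≤ ∫ t in Set.Ioi V, M * exp (-(h ^ 2 / 2) * V ^ 2) *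
        exp (-(h ^ 2 / 2) * (t - V) ^ 2) := by
      refine norm_integral_le_of_norm_le hi.integrableOn ?_
      refine (ae_restrict_iff' measurableSet_Ioi).mpr (Eventually.of_forall fun t ht => ?_)
      have ht : V < t := ht
      refine (hb t ht.le).trans ?_
      rw [mul_assoc, ← exp_add]
      gcongr
      nlinarith [mul_nonneg (sq_nonneg h) (mul_nonneg hV (sub_nonneg.mpr ht.le))]
    refine h1.trans ?_
    refine (setIntegral_le_integral hi (Eventually.of_forall fun t => by
      simp only [Pi.zero_apply]; positivity)).trans (le_of_eq ?_)
    rw [integral_const_mul, integral_sub_right_eq_self (fun t : ℝ => exp (-(h ^ 2 / 2) * t ^ 2)),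
      integral_gaussian]
  have h1 := key g hg fun t ht => hb t (ht.trans (le_abs_self t))
  have h2 := key (fun t => g (-t)) hg.comp_neg fun t ht => by
    have := hb (-t) (by rw [abs_neg]; exact ht.trans (le_abs_self t))
    rwa [neg_sq] at this
  rw [integral_comp_neg_Ioi] at h2
  have e1 : ∫ t, g t = (∫ t in Set.Iic (-V), g t) + ∫ t in Set.Ioi (-V), g t :=
    (intervalIntegral.integral_Iic_add_Ioi hg.integrableOn hg.integrableOn).symm
  have e2 : ∫ t in -V..V, g t = (∫ t in Set.Ioi (-V), g t) - ∫ t in Set.Ioi V, g t :=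
    (intervalIntegral.integral_Ioi_sub_Ioi hg.integrableOn (by linarith)).symm
  rw [e1, e2]
  have e3 : (∫ t in Set.Iic (-V), g t) + (∫ t in Set.Ioi (-V), g t) -
      ((∫ t in Set.Ioi (-V), g t) - ∫ t in Set.Ioi V, g t) =
      (∫ t in Set.Iic (-V), g t) + ∫ t in Set.Ioi V, g t := by ring
  rw [e3]
  exact (norm_add_le _ _).trans (by linarith)

lemma integrable_kernelLine_div (hh : 0 < h) {a c : ℝ} (hac : a < c) (v : ℝ) :
    Integrable fun t : ℝ => kernelLine h c v t / (((c : ℂ) + t * I) - a) := by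
  have hre : ∀ t : ℝ, c - a ≤ ‖((c : ℂ) + t * I) - a‖ := fun t => by
    have := le_norm_add_mul_I (c - a) t
    push_cast at this
    rwa [show ((c : ℂ) + t * I) - a = c - a + t * I by ring]
  have hpos : ∀ t : ℝ, 0 < ‖((c : ℂ) + t * I) - a‖ := fun t => by linarith [hre t]
  refine Integrable.mono' ((integrable_norm_kernelLine hh c v).mul_const (c - a)⁻¹) ?_ ?_
  · refine Continuous.aestronglyMeasurable ?_
    exact (continuous_kernelLine h c v).div (by fun_prop) fun t => norm_pos_iff.mp (hpos t)
  · refine Eventually.of_forall fun t => ?_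
    rw [norm_div, div_eq_mul_inv]
    have := hre t
    have h2 : 0 < c - a := by linarith
    gcongr

lemma integrable_poleTerm_mul_kernelLine (hh : 0 < h) (f : ℕ) {c : ℝ} (hc : 1 < c) (v : ℝ) :
    (Integrable fun t : ℝ => poleTerm f ((c : ℂ) + t * I) *
      (kernelLine h c v t / ((c : ℂ) + t * I))) ∧
    ((2 * π : ℂ)⁻¹ * ∫ t : ℝ, poleTerm f ((c : ℂ) + t * I) *
      (kernelLine h c v t / ((c : ℂ) + t * I)) =
        if f = 1 then (smoothExp h 1 v : ℂ) - 2 * smoothExp h 0 v + smoothExp h (-1) v else 0) := by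
  by_cases hf : f = 1
  · have i1 := integrable_kernelLine_div hh hc v
    have i0 := integrable_kernelLine_div hh (show (0 : ℝ) < c by linarith) v
    have i2 := integrable_kernelLine_div hh (show (-1 : ℝ) < c by linarith) v
    have e : (fun t : ℝ => poleTerm f ((c : ℂ) + t * I) *
        (kernelLine h c v t / ((c : ℂ) + t * I))) = fun t : ℝ =>
        kernelLine h c v t / (((c : ℂ) + t * I) - (1 : ℝ)) -
          2 * (kernelLine h c v t / (((c : ℂ) + t * I) - (0 : ℝ))) +
          kernelLine h c v t / (((c : ℂ) + t * I) - (-1 : ℝ)) := by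
      funext t
      have hre : ((c : ℂ) + t * I).re = c := by simp
      have n1 : (c : ℂ) + t * I - 1 ≠ 0 := fun h0 => by
        have := congrArg re h0; simp at this; linarith
      have n0 : (c : ℂ) + t * I ≠ 0 := fun h0 => by
        have := congrArg re h0; simp at this; linarith
      have n2 : (c : ℂ) + t * I + 1 ≠ 0 := fun h0 => by
        have := congrArg re h0; simp at this; linarith
      rw [poleTerm, if_pos hf]
      push_cast
      rw [sub_zero, sub_neg_eq_add]
      generalize (c : ℂ) + t * I = s at *
      field_simp
      ring
    rw [e, if_pos hf]
    have i3 : Integrable fun t : ℝ => kernelLine h c v t / (((c : ℂ) + t * I) - (1 : ℝ)) -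
        2 * (kernelLine h c v t / (((c : ℂ) + t * I) - (0 : ℝ))) := i1.sub (i0.const_mul 2)
    refine ⟨i3.add i2, ?_⟩
    rw [integral_add i3 i2, integral_sub i1 (i0.const_mul 2),
      integral_const_mul, integral_kernelLine_div hh hc, integral_kernelLine_div hh (by linarith),
      integral_kernelLine_div hh (by linarith)]
    have : (π : ℂ) ≠ 0 := by exact_mod_cast pi_ne_zero
    field_simp
  · simp [poleTerm, hf]

lemma norm_smoothExp_polar_sub_le (hh : 0 < h) (hh1 : h ≤ 1) {v : ℝ} (hv : 1 ≤ v) :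
    |smoothExp h 1 v - 2 * smoothExp h 0 v + smoothExp h (-1) v - exp (v + h ^ 2 / 2)| ≤ 3 := by
  have h1 := smoothExp_mem_Icc hh zero_le_one (show 0 ≤ v by linarith)
  have h2 := smoothExp_zero_le_one hh v
  have h3 := smoothExp_nonneg hh 0 v
  have h4 := smoothExp_nonneg hh (-1) v
  have h5 : smoothExp h (-1) v ≤ 1 := by
    rw [smoothExp_eq hh]
    have h6 := smoothExp_zero_le_one hh (v + -1 * h ^ 2)
    have h7 := smoothExp_nonneg hh 0 (v + -1 * h ^ 2)
    have h8 : exp (-1 * v + (-1) ^ 2 * h ^ 2 / 2) ≤ 1 := by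
      rw [exp_le_one_iff]; nlinarith
    nlinarith [exp_pos (-1 * v + (-1) ^ 2 * h ^ 2 / 2)]
  have e : (1 : ℝ) * v + 1 ^ 2 * h ^ 2 / 2 = v + h ^ 2 / 2 := by ring
  rw [e] at h1
  rw [abs_le]
  constructor <;> linarith [h1.1, h1.2]

end

section

variable {h : ℝ} {f : ℕ} [NeZero f]

/-- The bound for the logarithmic derivative up to height `V` in a zero-free strip. -/
noncomputable def logDerivBound (Q δ θ V : ℝ) : ℝ :=
  8 * (log (logScale Q (V + 1)) + 1 / 16 + δ * (log (Q * (V + 4) / (2 * π)) / 2) +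
    (log (1 + 1 / δ) + log 9)) / (δ * (1 - θ) ^ 2)

lemma norm_logDeriv_regularizedL_le {ψ : DirichletCharacter ℂ f} (hψ : ψ.IsPrimitive)
    {Q δ θ V T : ℝ} (hQ : f ≤ Q) (hQ30 : 30 ≤ Q) (hδ : 0 < δ) (hδ' : δ ≤ 1 / 10) (hθ : 0 ≤ θ)
    (hθ' : θ < 1) (hT : V + 1 ≤ T)
    (hne : ∀ s : ℂ, 1 - δ < s.re → |s.im| ≤ T → regularizedL ψ s ≠ 0) {s : ℂ}
    (hs : 1 - θ * δ ≤ s.re) (hs' : s.re ≤ 1 + δ) (hV : |s.im| ≤ V) :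
    ‖logDeriv (regularizedL ψ) s‖ ≤ logDerivBound Q δ θ V := by
  have hg := stripFunction_regularizedL hψ hQ hQ30
  have hVs : 0 ≤ |s.im| := abs_nonneg _
  have h1 := hg.norm_logDeriv_le hδ hδ' hθ hθ' hne hs hs' (by linarith)
    (lam := log (1 + 1 / δ) + log 9) (by
      have := norm_regularizedL_ge ψ (s := ((1 + δ : ℝ) : ℂ) + s.im * I) (by simp; linarith)
        (by simp; linarith)
      refine le_trans (le_of_eq ?_) this
      rw [← log_mul (by positivity) (by norm_num), Real.exp_neg, exp_log (by positivity)]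
      simp [mul_comm, div_eq_mul_inv])
  refine h1.trans ?_
  have h1θ : 0 < 1 - θ := by linarith
  have hl1 : 0 < logScale Q (|s.im| + 1) := logScale_pos hQ30 _
  have hl2 : logScale Q (|s.im| + 1) ≤ logScale Q (V + 1) :=
    StripFunction.logScale_mono (by linarith) (by
      rw [abs_of_nonneg (a := |s.im| + 1) (by linarith), abs_of_nonneg (a := V + 1) (by linarith)]
      linarith)
  unfold logDerivBound
  gcongr

/-- A smoothed sum of the von Mangoldt function twisted by a primitive character. -/
theorem exists_hasSum_mul_smoothExp {ψ : DirichletCharacter ℂ f} (hψ : ψ.IsPrimitive)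
    {Q δ θ V T v : ℝ} (hQ : f ≤ Q) (hQ30 : 30 ≤ Q) (hδ : 0 < δ) (hδ' : δ ≤ 1 / 10) (hθ : 0 ≤ θ)
    (hθ' : θ < 1) (hV : 1 ≤ V) (hT : V + 1 ≤ T) (hh : 0 < h) (hh1 : h ≤ 1) (hv : 1 ≤ v * δ)
    (hne : ∀ s : ℂ, 1 - δ < s.re → |s.im| ≤ T → regularizedL ψ s ≠ 0) :
    ∃ S : ℂ, HasSum (fun n : ℕ => ψ n * (Λ n : ℂ) *
        smoothExp h 0 (v - log n)) S ∧
      ‖S - (if f = 1 then (exp (v + h ^ 2 / 2) : ℂ) else 0)‖ ≤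
        (2 * π)⁻¹ * (2 * (logDerivBound Q δ θ V *
            exp ((1 - θ * δ) * v + h ^ 2 * (1 - θ * δ) ^ 2 / 2)) * (10 / 9 + log V) +
          2 * ((1 / v + θ * δ) * (logDerivBound Q δ θ V *
            exp ((1 + 1 / v) * v + h ^ 2 * (1 + 1 / v) ^ 2 / 2) *
              exp (-(h ^ 2 / 2) * V ^ 2) / V)) +
          2 * ((2 * v * (1 + 2 * v) + v + 1) *
            exp ((1 + 1 / v) * v + h ^ 2 * (1 + 1 / v) ^ 2 / 2) / V *
              exp (-(h ^ 2 / 2) * V ^ 2) * √(π / (h ^ 2 / 2)))) + 3 := by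
  have hv0 : 0 < v := by nlinarith
  have hv1 : 1 ≤ v := by nlinarith
  set c := 1 + 1 / v with hc
  have hdv : 0 < 1 / v := by positivity
  have hdv1 : 1 / v ≤ δ := by rw [div_le_iff₀ hv0]; linarith
  have hc1 : 1 < c := by linarith
  set b : ℕ → ℂ := fun n => ψ n * (Λ n : ℂ) with hb
  have hbs : LSeriesSummable b (c : ℂ) :=
    DirichletCharacter.LSeriesSummable_twist_vonMangoldt ψ (by simpa using hc1)
  have hsum := hasSum_mul_smoothExp hh (show 0 < c by linarith) (b := b) (by simp [hb]) hbs v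
  refine ⟨_, hsum, ?_⟩
  set F : ℂ → ℂ := fun s => -logDeriv (regularizedL ψ) s with hF
  have hL : ∀ t : ℝ, LSeries b ((c : ℂ) + t * I) =
      F ((c : ℂ) + t * I) + poleTerm f ((c : ℂ) + t * I) := fun t =>
    mangoldtSeries_eq ψ (by simpa using hc1)
  have hpole := integrable_poleTerm_mul_kernelLine hh f hc1 v
  have hg := stripFunction_regularizedL hψ hQ hQ30
  have hre : ∀ t : ℝ, ((c : ℂ) + t * I).re = c := fun t => by simp
  have him : ∀ t : ℝ, ((c : ℂ) + t * I).im = t := fun t => by simp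
  have hFd : ∀ s : ℂ, 1 - δ < s.re → regularizedL ψ s ≠ 0 → DifferentiableAt ℂ F s := by
    intro s hs hs0
    have ho : IsOpen {z : ℂ | -1 < z.re} := isOpen_lt continuous_const continuous_re
    have hd : DifferentiableOn ℂ (regularizedL ψ) {z : ℂ | -1 < z.re} := fun z hz =>
      (hg.differentiableAt z hz).differentiableWithinAt
    have hs1 : s ∈ {z : ℂ | -1 < z.re} := by change -1 < s.re; linarith
    have h1 : DifferentiableAt ℂ (deriv (regularizedL ψ)) s :=
      (hd.deriv ho).differentiableAt (ho.mem_nhds hs1)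
    have h2 := hg.differentiableAt s hs1
    have h3 := (h1.div h2 hs0).neg
    exact h3
  have hB1 : ∀ t : ℝ, ‖F ((c : ℂ) + t * I)‖ ≤ 2 * v * (1 + 2 * v) + v + 1 := by
    intro t
    have h1 : F ((c : ℂ) + t * I) = LSeries b ((c : ℂ) + t * I) - poleTerm f ((c : ℂ) + t * I) := by
      rw [hL]; ring
    have h2 := norm_LSeries_twist_vonMangoldt_le ψ (s := (c : ℂ) + t * I) (by simpa using hc1)
    rw [hre, show 2 / (c - 1) = 2 * v by rw [hc]; field_simp; ring] at h2
    have h3 : ‖poleTerm f ((c : ℂ) + t * I)‖ ≤ v + 1 := by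
      rw [poleTerm]
      split_ifs
      · refine (norm_sub_le _ _).trans (add_le_add ?_ ?_)
        · rw [norm_div, norm_one, one_div, inv_le_comm₀ (by
            have := le_norm_add_mul_I (c - 1) t
            rw [show (c : ℂ) + t * I - 1 = ((c - 1 : ℝ) : ℂ) + t * I by push_cast; ring]
            linarith) hv0]
          have := le_norm_add_mul_I (c - 1) t
          rw [show (c : ℂ) + t * I - 1 = ((c - 1 : ℝ) : ℂ) + t * I by push_cast; ring, ← one_div]
          linarith
        · rw [norm_div, norm_one]
          have := le_norm_add_mul_I (c + 1) t
          rw [show (c : ℂ) + t * I + 1 = ((c + 1 : ℝ) : ℂ) + t * I by push_cast; ring]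
          rw [div_le_one (by linarith)]
          linarith
      · rw [norm_zero]; linarith
    rw [h1]
    refine (norm_sub_le _ _).trans ?_
    have : ‖LSeries b ((c : ℂ) + t * I)‖ ≤ 2 * v * (1 + 2 * v) := h2
    linarith
  have hFc : Continuous fun t : ℝ => F ((c : ℂ) + t * I) := by
    refine continuous_iff_continuousAt.mpr fun t => ?_
    have h1 : DifferentiableAt ℂ F ((c : ℂ) + t * I) := hFd _ (by rw [hre]; linarith)
      (hg.ne_zero (by rw [hre]; exact hc1))
    have h2 : ContinuousAt (fun t : ℝ => (c : ℂ) + t * I) t := by fun_prop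
    exact ContinuousAt.comp (f := fun t : ℝ => (c : ℂ) + t * I) h1.continuousAt h2
  have hk0 := integrable_kernelLine_div hh (show (0 : ℝ) < c by linarith) v
  simp only [ofReal_zero, sub_zero] at hk0
  have hFi : Integrable fun t : ℝ => F ((c : ℂ) + t * I) *
      (kernelLine h c v t / ((c : ℂ) + t * I)) :=
    hk0.bdd_mul hFc.aestronglyMeasurable (Eventually.of_forall hB1)
  have hsplit : ∫ t : ℝ, LSeries b ((c : ℂ) + t * I) * (kernelLine h c v t / ((c : ℂ) + t * I)) =
      (∫ t : ℝ, F ((c : ℂ) + t * I) * (kernelLine h c v t / ((c : ℂ) + t * I))) +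
        ∫ t : ℝ, poleTerm f ((c : ℂ) + t * I) * (kernelLine h c v t / ((c : ℂ) + t * I)) := by
    rw [← integral_add hFi hpole.1]
    refine integral_congr_ae (Eventually.of_forall fun t => ?_)
    simp only [hL]; ring
  rw [hsplit, mul_add, hpole.2]
  have hmain := norm_integral_kernelLine_le (h := h) (F := F) (x := 1 - θ * δ) (c := c) (v := v)
    (V := V) (B := logDerivBound Q δ θ V) (by nlinarith) (by nlinarith) (by linarith) hV hv0.le
    ((norm_nonneg _).trans (norm_logDeriv_regularizedL_le hψ hQ hQ30 hδ hδ' hθ hθ' hT hne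
      (s := 1) (by simp; positivity) (by simp; linarith) (by simp; linarith)))
    (fun s h1 h2 h3 => ⟨hFd s (by nlinarith) (hne s (by nlinarith) (by linarith)), by
      rw [hF, norm_neg]
      exact norm_logDeriv_regularizedL_le hψ hQ hQ30 hδ hδ' hθ hθ' hT hne h1 (by linarith) h3⟩)
  rw [show c - (1 - θ * δ) = 1 / v + θ * δ by rw [hc]; ring] at hmain
  have htail := norm_integral_sub_intervalIntegral_le hh (V := V)
    (M := (2 * v * (1 + 2 * v) + v + 1) * exp (c * v + h ^ 2 * c ^ 2 / 2) / V)
    (by linarith) (by positivity) hFi (fun t ht => by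
      have ht0 : 0 < ‖(c : ℂ) + t * I‖ := lt_of_lt_of_le (by linarith) (le_norm_add_mul_I c t)
      rw [norm_mul, norm_div, norm_kernelLine, ← mul_div_assoc, div_mul_eq_mul_div, mul_assoc]
      have := hB1 t
      have h4 := ht.trans (abs_le_norm_add_mul_I c t)
      gcongr)
  have hpol : ‖(if f = 1 then (smoothExp h 1 v : ℂ) - 2 * smoothExp h 0 v + smoothExp h (-1) v
      else 0) - (if f = 1 then (exp (v + h ^ 2 / 2) : ℂ) else 0)‖ ≤ 3 := by
    split_ifs
    · have := norm_smoothExp_polar_sub_le hh hh1 hv1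
      rw [← norm_eq_abs, ← norm_real] at this
      push_cast at this ⊢
      exact this
    · simp
  set I1 := ∫ t : ℝ, F ((c : ℂ) + t * I) * (kernelLine h c v t / ((c : ℂ) + t * I))
  set I2 := ∫ t in -V..V, F ((c : ℂ) + t * I) * (kernelLine h c v t / ((c : ℂ) + t * I))
  have hI : ‖I1‖ ≤ ‖I2‖ + ‖I1 - I2‖ := by
    have := norm_add_le I2 (I1 - I2)
    rwa [add_sub_cancel] at this
  rw [add_sub_assoc]
  refine (norm_add_le _ _).trans (add_le_add ?_ hpol)
  rw [norm_mul, norm_inv, norm_mul, norm_real, norm_eq_abs, abs_of_pos pi_pos,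
    Complex.norm_two]
  gcongr
  linarith

end

lemma cos_sq_five_pi_div_four : cos (5 * π / 4) ^ 2 = 1 / 2 := by
  rw [show 5 * π / 4 = π / 4 + π by ring, Real.cos_add_pi, neg_sq,
    Real.cos_pi_div_four, div_pow, sq_sqrt (by norm_num)]
  norm_num

lemma sin_sq_five_pi_div_four : Real.sin (5 * π / 4) ^ 2 = 1 / 2 := by
  rw [Real.sin_sq, cos_sq_five_pi_div_four]; norm_num

lemma norm_cos_sq_of_re {s : ℂ} (hs : s.re = 5 / 2) :
    ‖Complex.cos (π * s / 2)‖ ^ 2 = cosh (π * s.im) / 2 := by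
  have e : π * s / 2 = ((5 * π / 4 : ℝ) : ℂ) + ((π * s.im / 2 : ℝ) : ℂ) * I := by
    conv_lhs => rw [← re_add_im s, hs]
    push_cast; ring
  rw [e, Complex.cos_add_mul_I, ← ofReal_cos, ← ofReal_sin, ← ofReal_cosh, ← ofReal_sinh,
    ← ofReal_mul, ← ofReal_mul, ← normSq_eq_norm_sq, sub_eq_add_neg, ← neg_mul, ← ofReal_neg,
    normSq_add_mul_I, neg_sq, mul_pow, mul_pow, cos_sq_five_pi_div_four, sin_sq_five_pi_div_four,
    show π * s.im = 2 * (π * s.im / 2) by ring, Real.cosh_two_mul]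
  ring_nf

lemma norm_sin_sq_of_re {s : ℂ} (hs : s.re = 5 / 2) :
    ‖Complex.sin (π * s / 2)‖ ^ 2 = cosh (π * s.im) / 2 := by
  have e : π * s / 2 = ((5 * π / 4 : ℝ) : ℂ) + ((π * s.im / 2 : ℝ) : ℂ) * I := by
    conv_lhs => rw [← re_add_im s, hs]
    push_cast; ring
  rw [e, Complex.sin_add_mul_I, ← ofReal_cos, ← ofReal_sin, ← ofReal_cosh, ← ofReal_sinh,
    ← ofReal_mul, ← ofReal_mul, ← normSq_eq_norm_sq,
    normSq_add_mul_I, mul_pow, mul_pow, cos_sq_five_pi_div_four, sin_sq_five_pi_div_four,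
    show π * s.im = 2 * (π * s.im / 2) by ring, Real.cosh_two_mul]
  ring_nf

lemma norm_Gamma_half_add_mul_I_sq (t : ℝ) :
    ‖Gamma (1 / 2 + t * I)‖ ^ 2 = π / cosh (π * t) := by
  have h1 := Complex.Gamma_mul_Gamma_one_sub (1 / 2 + t * I)
  have h2 : Gamma (1 - (1 / 2 + t * I)) = conj (Gamma (1 / 2 + t * I)) := by
    rw [← Complex.Gamma_conj]
    congr 1
    simp only [map_add, map_mul, conj_I, conj_ofReal, map_div₀, map_one, map_ofNat]
    ring
  rw [h2, mul_conj, normSq_eq_norm_sq, show π * (1 / 2 + t * I) =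
    (π * t : ℝ) * I + π / 2 by push_cast; ring, Complex.sin_add_pi_div_two,
    Complex.cos_mul_I, ← ofReal_cosh, ← ofReal_div] at h1
  exact_mod_cast h1

lemma norm_Gamma_five_halves_sq {s : ℂ} (hs : s.re = 5 / 2) :
    ‖Gamma s‖ ^ 2 = (9 / 4 + s.im ^ 2) * (1 / 4 + s.im ^ 2) *
      (π / cosh (π * s.im)) := by
  have e : s = (1 / 2 + s.im * I) + 1 + 1 := by
    conv_lhs => rw [← re_add_im s, hs]
    push_cast; ring
  have h0 : (1 / 2 + s.im * I : ℂ) ≠ 0 := fun h => by have := congrArg re h; simp at this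
  have h1 : (1 / 2 + s.im * I + 1 : ℂ) ≠ 0 := fun h => by
    have := congrArg re h; simp at this; norm_num at this
  rw [e, Gamma_add_one _ h1, Gamma_add_one _ h0, ← e, norm_mul, norm_mul, mul_pow,
    mul_pow, norm_Gamma_half_add_mul_I_sq, ← normSq_eq_norm_sq, ← normSq_eq_norm_sq,
    normSq_apply, normSq_apply]
  simp
  ring

lemma norm_Gammaℂ_sq {s : ℂ} (hs : s.re = 5 / 2) :
    ‖Gammaℂ s‖ ^ 2 = 4 * ((2 * π) ^ 5)⁻¹ * ‖Gamma s‖ ^ 2 := by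
  have h2 : ‖(2 * π : ℂ) ^ (-s)‖ = (2 * π) ^ (-(5 / 2) : ℝ) := by
    rw [show (2 * π : ℂ) = ((2 * π : ℝ) : ℂ) by push_cast; ring,
      norm_cpow_eq_rpow_re_of_pos (by positivity), neg_re, hs]
  have h3 : ((2 * π) ^ (-(5 / 2) : ℝ)) ^ 2 = ((2 * π) ^ 5)⁻¹ := by
    rw [← rpow_natCast, ← rpow_mul (by positivity), ← rpow_natCast,
      ← rpow_neg (by positivity)]
    norm_num
  rw [Gammaℂ_def, norm_mul, norm_mul, mul_pow, mul_pow, h2, h3, norm_ofNat]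
  norm_num

lemma rpow_neg_le_of_sq_le {b y w : ℝ} {k : ℕ} (hb : 0 < b) (hy : 0 < y) (hw : w = k / 2)
    (h : 1 ≤ y ^ 2 * b ^ k) : b ^ (-w) ≤ y := by
  refine le_of_sq_le_sq ?_ hy.le
  rw [← rpow_natCast, ← rpow_mul hb.le, hw,
    show (-(k / 2 : ℝ) * ((2 : ℕ) : ℝ)) = -(k : ℝ) by push_cast; ring, rpow_neg hb.le,
    rpow_natCast]
  exact (inv_le_iff_one_le_mul₀ (by positivity)).2 h

lemma sum_Icc_rpow_five_halves_le (N : ℕ) :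
    ∑ n ∈ Finset.Icc 1 N, (n : ℝ) ^ (-(1 + 3 / 2) : ℝ) ≤ 137 / 100 := by
  have h2 : (2 : ℝ) ^ (-(1 + 3 / 2) : ℝ) ≤ 177 / 1000 :=
    rpow_neg_le_of_sq_le (by norm_num) (by norm_num) (k := 5) (by norm_num) (by norm_num)
  have h3 : (3 : ℝ) ^ (-(1 + 3 / 2) : ℝ) ≤ 642 / 10000 :=
    rpow_neg_le_of_sq_le (by norm_num) (by norm_num) (k := 5) (by norm_num) (by norm_num)
  have h4 : (3 : ℝ) ^ (-(3 / 2) : ℝ) ≤ 1925 / 10000 :=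
    rpow_neg_le_of_sq_le (by norm_num) (by norm_num) (k := 3) (by norm_num) (by norm_num)
  have key : ∀ N : ℕ, 3 ≤ N → ∑ n ∈ Finset.Icc 1 N, (n : ℝ) ^ (-(1 + 3 / 2) : ℝ) ≤
      137 / 100 - (N : ℝ) ^ (-(3 / 2) : ℝ) / (3 / 2) := by
    intro N hN
    induction N, hN using Nat.le_induction with
    | base => 
      rw [sum_Icc_succ_top (by omega), sum_Icc_succ_top (by omega), Finset.Icc_self,
        sum_singleton]
      push_cast
      norm_num at h2 h3 h4 ⊢
      linarith
    | succ k hk ih =>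
      rw [sum_Icc_succ_top (by omega)]
      have := rpow_neg_telescope (show (0 : ℝ) < 3 / 2 by norm_num) (show 1 ≤ k by omega)
      calc _ ≤ _ := add_le_add ih this
        _ = _ := by ring
  have h5 := key (N + 3) (by omega)
  have h6 : (0 : ℝ) ≤ ((N + 3 : ℕ) : ℝ) ^ (-(3 / 2) : ℝ) := by positivity
  refine (sum_le_sum_of_subset_of_nonneg (Finset.Icc_subset_Icc_right (by omega : N ≤ N + 3))
    fun n _ _ => by positivity).trans ?_
  linarith

lemma norm_LSeries_le_of_re_eq {a : ℕ → ℂ} (ha : ∀ n, ‖a n‖ ≤ 1) {s : ℂ} (hs : s.re = 5 / 2) :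
    ‖LSeries a s‖ ≤ 137 / 100 := by
  refine norm_LSeries_le_of_sum_rpow_le ha (by rw [hs]; norm_num) fun N => ?_
  have := sum_Icc_rpow_five_halves_le N
  rw [hs]
  norm_num at this ⊢
  exact this

/-- On the line `re = -3/2`, `ζ L` is bounded by its value at the reflected point. -/
lemma norm_zeta_mul_LFunction_le {f : ℕ} [NeZero f] {χ : DirichletCharacter ℂ f}
    (hχ : χ.IsPrimitive) (hf : f ≠ 1) {s : ℂ} (hs : s.re = 5 / 2) :
    ‖riemannZeta (1 - s) * LFunction χ (1 - s)‖ ≤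
      (f : ℝ) ^ 2 * (((2 * π) ^ 4)⁻¹ * (137 / 100) ^ 2) *
        ((9 / 4 + s.im ^ 2) * (1 / 4 + s.im ^ 2)) := by
  have hpi := pi_pos
  have hcp : 0 < cosh (π * s.im) := cosh_pos _
  set M := √(cosh (π * s.im) / 2) with hM
  have hM2 : M ^ 2 = cosh (π * s.im) / 2 := sq_sqrt (by positivity)
  have hc : ‖Complex.cos (π * s / 2)‖ = M := by
    rw [hM, ← norm_cos_sq_of_re hs, sqrt_sq (norm_nonneg _)]
  have hsn : ‖Complex.sin (π * s / 2)‖ = M := by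
    rw [hM, ← norm_sin_sq_of_re hs, sqrt_sq (norm_nonneg _)]
  have hL := norm_LFunction_one_sub_le_of_le hχ hf (s := s) (by rw [hs]; norm_num) hc.le hsn.le
  have h1s : 1 < s.re := by rw [hs]; norm_num
  have hL2 : ‖LFunction χ⁻¹ s‖ ≤ 137 / 100 := by
    rw [LFunction_eq_LSeries _ h1s]
    exact norm_LSeries_le_of_re_eq (fun n => DirichletCharacter.norm_le_one _ _) hs
  have hZ2 : ‖riemannZeta s‖ ≤ 137 / 100 := by
    rw [← LSeries_one_eq_riemannZeta h1s]
    exact norm_LSeries_le_of_re_eq (fun n => by simp) hs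
  have hZ : ‖riemannZeta (1 - s)‖ = ‖Gammaℂ s‖ * M * ‖riemannZeta s‖ := by
    rw [riemannZeta_one_sub (fun n h => by rw [h] at h1s; simp at h1s; linarith [n.cast_nonneg (α := ℝ)])
      (fun h => by rw [h] at h1s; simp at h1s), ← hc, Gammaℂ_def]
    simp only [norm_mul]
  have hf2 : (f : ℝ) ^ (s.re - 1 / 2) = (f : ℝ) ^ 2 := by
    rw [hs, ← rpow_natCast]; norm_num
  rw [hf2] at hL
  have hG : (‖Gammaℂ s‖ * M) ^ 2 = ((2 * π) ^ 4)⁻¹ *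
      ((9 / 4 + s.im ^ 2) * (1 / 4 + s.im ^ 2)) := by
    rw [mul_pow, hM2, norm_Gammaℂ_sq hs, norm_Gamma_five_halves_sq hs]
    field_simp
    ring
  rw [norm_mul, hZ]
  have hM0 : 0 ≤ M := Real.sqrt_nonneg _
  calc _ ≤ ‖Gammaℂ s‖ * M * (137 / 100) * ((f : ℝ) ^ 2 * (‖Gammaℂ s‖ * M) * (137 / 100)) := by
        gcongr
        exact hL.trans (by gcongr)
    _ = (f : ℝ) ^ 2 * (137 / 100) ^ 2 * (‖Gammaℂ s‖ * M) ^ 2 := by ring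
    _ = _ := by rw [hG]; ring

lemma exists_norm_Gammaℂ_le :
    ∃ C : ℝ, 0 ≤ C ∧ ∀ s : ℂ, 1 / 2 ≤ s.re → s.re ≤ 5 / 2 → ‖Gammaℂ s‖ ≤ C := by
  have hc : ContinuousOn Real.Gamma (Set.Icc (1 / 2) (5 / 2)) := fun x hx =>
    (Real.differentiableAt_Gamma fun m h => by
      have := hx.1; rw [h] at this; linarith [m.cast_nonneg (α := ℝ)]).continuousAt.continuousWithinAt
  obtain ⟨C, hC⟩ := (isCompact_Icc.image_of_continuousOn hc).bddAbove
  refine ⟨2 * |C|, by positivity, fun s h1 h2 => ?_⟩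
  have h3 : Real.Gamma s.re ≤ C := hC ⟨s.re, ⟨h1, h2⟩, rfl⟩
  have hp : ‖(2 * π : ℂ) ^ (-s)‖ ≤ 1 := by
    rw [show (2 * π : ℂ) = ((2 * π : ℝ) : ℂ) by push_cast; ring,
      norm_cpow_eq_rpow_re_of_pos (by positivity), neg_re]
    exact Real.rpow_le_one_of_one_le_of_nonpos (by linarith [pi_gt_three]) (by linarith)
  rw [Gammaℂ_def, norm_mul, norm_mul, norm_ofNat]
  calc _ ≤ 2 * 1 * |C| := by
        gcongr
        exact (norm_Gamma_le (by linarith)).trans (h3.trans (le_abs_self C))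
    _ = _ := by ring

lemma cosh_pi_mul_div_two_le (t : ℝ) : cosh (π * t / 2) ≤ exp (2 * |t|) := by
  refine (cosh_le_exp_abs _).trans (exp_le_exp.2 ?_)
  rw [abs_div, abs_mul, abs_of_pos pi_pos, abs_two]
  nlinarith [Real.pi_le_four, abs_nonneg t]

lemma logScale_le_exp {Q : ℝ} (hQ : 1 ≤ Q) (t : ℝ) :
    logScale Q t ≤ (3 * Q + 5 / 2) * exp |t| := by
  have h1 := add_one_le_exp |t|
  have h0 := abs_nonneg t
  have h2 : log (Q * (|t| + 3)) ≤ Q * (|t| + 3) := Real.log_le_self (by positivity)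
  rw [logScale]
  nlinarith

lemma exists_norm_LFunction_le_right {f : ℕ} [NeZero f] {χ : DirichletCharacter ℂ f}
    (hχ : χ ≠ 1) : ∃ C : ℝ, 0 ≤ C ∧ ∀ s : ℂ, 1 / 2 ≤ s.re → 1 ≤ |s.im| →
      ‖LFunction χ s‖ ≤ C * exp |s.im| := by
  have hf : (1 : ℝ) ≤ f := by exact_mod_cast Nat.pos_of_ne_zero (NeZero.ne f)
  refine ⟨10 * f, by positivity, fun s h1 h2 => ?_⟩
  have hs1 : s ≠ 1 := fun h => by rw [h] at h2; norm_num at h2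
  rcases le_total s.re 1 with h | h
  · exact norm_LFunction_le_of_quarter_le_re hχ (by linarith) hs1 h
  · refine (norm_LFunction_le_of_one_le_re hχ le_rfl h).trans
      ((logScale_le_exp hf _).trans ?_)
    gcongr; linarith

lemma exists_norm_LFunction_le {f : ℕ} [NeZero f] {χ : DirichletCharacter ℂ f}
    (hχ : χ.IsPrimitive) (hf1 : f ≠ 1) : ∃ C : ℝ, 0 ≤ C ∧ ∀ s : ℂ, -(3 / 2) ≤ s.re →
      1 ≤ |s.im| → ‖LFunction χ s‖ ≤ C * exp (3 * |s.im|) := by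
  have hf : (1 : ℝ) ≤ f := by exact_mod_cast Nat.pos_of_ne_zero (NeZero.ne f)
  have hne : χ ≠ 1 := fun h => by
    have h3 := hχ.symm
    rw [h, DirichletCharacter.conductor_one] at h3
    exact hf1 h3
  have hne' : χ⁻¹ ≠ 1 := fun h => hne (inv_eq_one.1 h)
  obtain ⟨C1, hC1, h1⟩ := exists_norm_LFunction_le_right hne
  obtain ⟨C2, hC2, h2⟩ := exists_norm_LFunction_le_right hne'
  obtain ⟨C3, hC3, h3⟩ := exists_norm_Gammaℂ_le
  refine ⟨C1 + (f : ℝ) ^ 2 * C3 * C2, by positivity, fun s hs ht => ?_⟩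
  have he : exp |s.im| ≤ exp (3 * |s.im|) := by
    rw [exp_le_exp]; linarith
  rcases le_total (1 / 2) s.re with h | h
  · refine (h1 s h ht).trans ?_
    calc _ ≤ C1 * exp (3 * |s.im|) := by gcongr
      _ ≤ _ := by gcongr; exact le_add_of_nonneg_right (by positivity)
  · have hw : (1 - s).re = 1 - s.re := by simp
    have hwi : (1 - s).im = -s.im := by simp
    have h4 := norm_LFunction_one_sub_le hχ hf1 (s := 1 - s) (by rw [hw]; linarith)
    rw [sub_sub_cancel] at h4
    have h5 := h2 (1 - s) (by rw [hw]; linarith) (by rw [hwi, abs_neg]; exact ht)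
    have h6 := h3 (1 - s) (by rw [hw]; linarith) (by rw [hw]; linarith)
    have h7 := cosh_pi_mul_div_two_le (1 - s).im
    rw [hwi, abs_neg] at h5 h7
    rw [hwi] at h4
    have h8 : (f : ℝ) ^ ((1 - s).re - 1 / 2) ≤ (f : ℝ) ^ 2 := by
      rw [← rpow_natCast]
      exact rpow_le_rpow_of_exponent_le hf (by rw [hw]; push_cast; linarith)
    calc _ ≤ _ := h4
      _ ≤ (f : ℝ) ^ 2 * (C3 * exp (2 * |s.im|)) * (C2 * exp |s.im|) := by gcongr
      _ = (f : ℝ) ^ 2 * C3 * C2 * exp (3 * |s.im|) := by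
        rw [show 3 * |s.im| = 2 * |s.im| + |s.im| by ring, exp_add]; ring
      _ ≤ _ := by gcongr; exact le_add_of_nonneg_left hC1

lemma exists_norm_zetaEntire_le_right : ∃ C : ℝ, 0 ≤ C ∧ ∀ s : ℂ, 1 / 2 ≤ s.re → s.re ≤ 5 / 2 →
      ‖zetaEntire s‖ ≤ C * exp (2 * |s.im|) := by
  refine ⟨93 * 5, by positivity, fun s h1 h2 => ?_⟩
  have hne : s + 1 ≠ 0 := fun h => by
    have := congrArg re h; simp at this; linarith
  have h3 : ‖zetaReg s‖ ≤ 93 * exp |s.im| := by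
    rcases le_total s.re 1 with h | h
    · refine (norm_zetaReg_le_of_quarter_le_re (by linarith) h).trans ?_
      gcongr; norm_num
    · refine (norm_zetaReg_le_of_one_le_re le_rfl h).trans
        ((logScale_le_exp (by norm_num) _).trans ?_)
      gcongr; norm_num
  have h4 : ‖s + 1‖ ≤ 5 * exp |s.im| := by
    have := norm_le_abs_re_add_abs_im (s + 1)
    simp only [add_re, one_re, add_im, one_im, add_zero] at this
    rw [abs_of_pos (by linarith)] at this
    linarith [add_one_le_exp |s.im|, abs_nonneg s.im]
  rw [show zetaEntire s = zetaReg s * (s + 1) by rw [zetaReg, div_mul_cancel₀ _ hne], norm_mul]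
  calc _ ≤ 93 * exp |s.im| * (5 * exp |s.im|) := by gcongr
    _ = _ := by rw [two_mul |s.im|, exp_add]; ring

lemma exists_norm_zetaEntire_le : ∃ C : ℝ, 0 ≤ C ∧ ∀ s : ℂ, -(3 / 2) ≤ s.re → s.re ≤ 5 / 2 →
      1 ≤ |s.im| → ‖zetaEntire s‖ ≤ C * exp (5 * |s.im|) := by
  obtain ⟨C1, hC1, h1⟩ := exists_norm_zetaEntire_le_right
  obtain ⟨C3, hC3, h3⟩ := exists_norm_Gammaℂ_le
  refine ⟨C1 + 4 * C3 * C1, by positivity, fun s hs hs2 ht => ?_⟩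
  have he : exp (2 * |s.im|) ≤ exp (5 * |s.im|) := by
    rw [exp_le_exp]; linarith
  rcases le_total (1 / 2) s.re with h | h
  · refine (h1 s h hs2).trans ?_
    calc _ ≤ C1 * exp (5 * |s.im|) := by gcongr
      _ ≤ _ := by gcongr; exact le_add_of_nonneg_right (by positivity)
  · set w := 1 - s with hwd
    have hw : w.re = 1 - s.re := by simp [w]
    have hwi : w.im = -s.im := by simp [w]
    have hsw : s = 1 - w := by simp [w]
    have hw0 : w ≠ 0 := fun h => by rw [h] at hw; simp at hw; linarith
    have hw1 : w ≠ 1 := fun h => by rw [← neg_eq_iff_eq_neg.2 hwi, h] at ht; norm_num at ht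
    have hs1 : s ≠ 1 := fun h => by rw [h] at ht; norm_num at ht
    have hz : zetaEntire s * (w - 1) = -w * Gammaℂ w * Complex.cos (π * w / 2) *
        zetaEntire w := by
      rw [zetaEntire_of_ne_one hs1, zetaEntire_of_ne_one hw1, hsw,
        riemannZeta_one_sub (fun n h => by rw [h] at hw; simp at hw; linarith [n.cast_nonneg (α := ℝ)])
        hw1, Gammaℂ_def]
      ring
    have h5 := h1 w (by rw [hw]; linarith) (by rw [hw]; linarith)
    have h6 := h3 w (by rw [hw]; linarith) (by rw [hw]; linarith)
    have h7 : ‖Complex.cos (π * w / 2)‖ ≤ exp (2 * |s.im|) := by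
      have := (norm_cos_le_cosh (π * w / 2)).trans_eq (congrArg cosh
        (show (π * w / 2).im = π * w.im / 2 by
          rw [← ofReal_ofNat, div_ofReal_im, im_ofReal_mul]))
      have h8 := cosh_pi_mul_div_two_le w.im
      rw [hwi, abs_neg] at h8
      rw [hwi] at this
      exact this.trans h8
    have h8 : ‖w‖ ≤ 4 * exp |s.im| := by
      have := norm_le_abs_re_add_abs_im w
      rw [hwi, abs_neg, hw, abs_of_pos (by linarith)] at this
      linarith [add_one_le_exp |s.im|, abs_nonneg s.im]
    have h9 : 1 ≤ ‖w - 1‖ := by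
      have := abs_im_le_norm (w - 1)
      rw [sub_im, one_im, sub_zero, hwi, abs_neg] at this
      linarith
    rw [hwi, abs_neg] at h5
    have h10 := congrArg norm hz
    simp only [norm_mul, norm_neg] at h10
    calc _ ≤ ‖zetaEntire s‖ * ‖w - 1‖ := le_mul_of_one_le_right (norm_nonneg _) h9
      _ = _ := h10
      _ ≤ 4 * exp |s.im| * C3 * exp (2 * |s.im|) * (C1 * exp (2 * |s.im|)) := by
        gcongr
      _ = 4 * C3 * C1 * exp (5 * |s.im|) := by
        rw [show 5 * |s.im| = |s.im| + 2 * |s.im| + 2 * |s.im| by ring, exp_add, exp_add]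
        ring
      _ ≤ _ := by gcongr; exact le_add_of_nonneg_left hC1

lemma exists_norm_le_exp_of_strip {g : ℂ → ℂ} (hg : Continuous g) {a b C B : ℝ} (hB : 0 ≤ B)
    (hgrow : ∀ s : ℂ, a ≤ s.re → s.re ≤ b → 1 ≤ |s.im| → ‖g s‖ ≤ C * exp (B * |s.im|)) :
    ∃ C' : ℝ, 0 ≤ C' ∧ ∀ s : ℂ, a ≤ s.re → s.re ≤ b → ‖g s‖ ≤ C' * exp (B * |s.im|) := by
  have hK : IsCompact (Set.Icc a b ×ℂ Set.Icc (-1) 1) := isCompact_Icc.reProdIm isCompact_Icc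
  obtain ⟨M, hM⟩ := hK.exists_bound_of_continuousOn hg.continuousOn
  refine ⟨|M| + |C|, by positivity, fun s h1 h2 => ?_⟩
  rcases le_total 1 |s.im| with h | h
  · refine (hgrow s h1 h2 h).trans ?_
    gcongr
    linarith [le_abs_self C, abs_nonneg M]
  · have h3 := hM s ⟨⟨h1, h2⟩, abs_le.1 h⟩
    have h4 : 1 ≤ exp (B * |s.im|) := one_le_exp (by positivity)
    have h5 : ‖g s‖ ≤ |M| + |C| := by linarith [le_abs_self M, abs_nonneg C]
    exact h5.trans (le_mul_of_one_le_right (by positivity) h4)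

lemma exp_mul_abs_mul_gaussian_le {h : ℝ} (hh : 0 < h) (B t : ℝ) :
    exp (B * |t|) * exp (-(h ^ 2 / 2) * t ^ 2) ≤
      exp (B ^ 2 / h ^ 2) * exp (-(h ^ 2 / 4) * t ^ 2) := by
  rw [← exp_add, ← exp_add, exp_le_exp]
  have h1 : B ^ 2 / h ^ 2 - B * |t| + h ^ 2 / 4 * t ^ 2 = (B / h - h * |t| / 2) ^ 2 := by
    rw [← sq_abs t]; field_simp; ring
  nlinarith [sq_nonneg (B / h - h * |t| / 2)]

lemma integrable_mul_kernelLine {g : ℂ → ℂ} (hg : Continuous g) {h : ℝ} (hh : 0 < h) {c C B : ℝ}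
    (hgrow : ∀ t : ℝ, ‖g (c + t * I)‖ ≤ C * exp (B * |t|)) (v : ℝ) :
    Integrable fun t : ℝ => g (c + t * I) * kernelLine h c v t := by
  have hm : Integrable fun t : ℝ => C * exp (c * v + h ^ 2 * c ^ 2 / 2) *
      (exp (B ^ 2 / h ^ 2) * exp (-(h ^ 2 / 4) * t ^ 2)) :=
    ((integrable_exp_neg_mul_sq (by positivity)).const_mul _).const_mul _
  refine hm.mono' (Continuous.aestronglyMeasurable ?_) (Eventually.of_forall fun t => ?_)
  · exact (hg.comp (by fun_prop)).mul (continuous_kernelLine h c v)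
  · have hC : 0 ≤ C := by
      have := (norm_nonneg _).trans (hgrow 0)
      simpa using this
    rw [norm_mul, norm_kernelLine]
    calc _ ≤ C * exp (B * |t|) * (exp (c * v + h ^ 2 * c ^ 2 / 2) *
          exp (-(h ^ 2 / 2) * t ^ 2)) := by gcongr; exact hgrow t
      _ = C * exp (c * v + h ^ 2 * c ^ 2 / 2) *
          (exp (B * |t|) * exp (-(h ^ 2 / 2) * t ^ 2)) := by ring
      _ ≤ _ := mul_le_mul_of_nonneg_left (exp_mul_abs_mul_gaussian_le hh B t) (by positivity)

/-- Shifting a vertical contour across a strip in which the integrand has exponential growth. -/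
theorem integral_mul_kernelLine_eq {g : ℂ → ℂ} (hg : Differentiable ℂ g) {h : ℝ} (hh : 0 < h)
    {a b C B : ℝ} (hab : a ≤ b) (hB : 0 ≤ B)
    (hgrow : ∀ s : ℂ, a ≤ s.re → s.re ≤ b → 1 ≤ |s.im| → ‖g s‖ ≤ C * exp (B * |s.im|))
    (v : ℝ) :
    ∫ t : ℝ, g (a + t * I) * kernelLine h a v t = ∫ t : ℝ, g (b + t * I) * kernelLine h b v t := by
  obtain ⟨C, hC, hgr⟩ := exists_norm_le_exp_of_strip hg.continuous hB hgrow
  have hgl : ∀ x : ℝ, a ≤ x → x ≤ b → ∀ t : ℝ, ‖g (x + t * I)‖ ≤ C * exp (B * |t|) := by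
    intro x h1 h2 t
    have := hgr (x + t * I) (by simpa using h1) (by simpa using h2)
    simpa using this
  have ia := integrable_mul_kernelLine hg.continuous hh (hgl a le_rfl hab) v
  have ib := integrable_mul_kernelLine hg.continuous hh (hgl b hab le_rfl) v
  set F : ℂ → ℂ := fun s => g s * cexp (s * v + h ^ 2 * s ^ 2 / 2) with hF
  have hFk : ∀ x t : ℝ, F (x + t * I) = g (x + t * I) * kernelLine h x v t := fun x t => rfl
  have hFd : Differentiable ℂ F := by
    refine hg.mul ?_
    fun_prop
  set M := |a| + |b| with hM
  set D := C * exp (M * |v| + h ^ 2 * M ^ 2 / 2) * exp (B ^ 2 / h ^ 2) with hD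
  have hhor : ∀ T : ℝ, ‖∫ x in a..b, F (x + T * I)‖ ≤
      D * exp (-(h ^ 2 / 4) * T ^ 2) * |b - a| := by
    intro T
    refine intervalIntegral.norm_integral_le_of_norm_le_const fun x hx => ?_
    rw [Set.uIoc_of_le hab] at hx
    have hxM : |x| ≤ M := by
      rw [hM, abs_le]
      constructor
      · linarith [neg_abs_le a, abs_nonneg b, hx.1]
      · linarith [le_abs_self b, abs_nonneg a, hx.2]
    rw [hFk, norm_mul, norm_kernelLine]
    have h1 : x * v + h ^ 2 * x ^ 2 / 2 ≤ M * |v| + h ^ 2 * M ^ 2 / 2 := by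
      have h2 : x * v ≤ M * |v| := (le_abs_self _).trans (by rw [abs_mul]; gcongr)
      have h3 : x ^ 2 ≤ M ^ 2 := by rw [← sq_abs]; gcongr
      have h4 : h ^ 2 * x ^ 2 ≤ h ^ 2 * M ^ 2 := by gcongr
      linarith
    calc _ ≤ C * exp (B * |T|) * (exp (M * |v| + h ^ 2 * M ^ 2 / 2) *
          exp (-(h ^ 2 / 2) * T ^ 2)) := by
          gcongr
          exact hgl x hx.1.le hx.2 T
      _ = C * exp (M * |v| + h ^ 2 * M ^ 2 / 2) *
          (exp (B * |T|) * exp (-(h ^ 2 / 2) * T ^ 2)) := by ring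
      _ ≤ C * exp (M * |v| + h ^ 2 * M ^ 2 / 2) *
          (exp (B ^ 2 / h ^ 2) * exp (-(h ^ 2 / 4) * T ^ 2)) :=
          mul_le_mul_of_nonneg_left (exp_mul_abs_mul_gaussian_le hh B T) (by positivity)
      _ = _ := by rw [hD]; ring
  have hgauss : Tendsto (fun T : ℝ => D * exp (-(h ^ 2 / 4) * T ^ 2) * |b - a|) atTop (𝓝 0) := by
    have : Tendsto (fun T : ℝ => -(h ^ 2 / 4) * T ^ 2) atTop atBot :=
      (tendsto_pow_atTop two_ne_zero).const_mul_atTop_of_neg (by nlinarith [sq_pos_of_pos hh])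
    have h2 := ((Real.tendsto_exp_atBot.comp this).const_mul D).mul_const |b - a|
    simpa using h2
  have hup : Tendsto (fun T : ℝ => ∫ x in a..b, F (x + T * I)) atTop (𝓝 0) :=
    squeeze_zero_norm hhor hgauss
  have hdn : Tendsto (fun T : ℝ => ∫ x in a..b, F (x + (-T : ℝ) * I)) atTop (𝓝 0) :=
    squeeze_zero_norm (fun T => by simpa using hhor (-T)) hgauss
  have hla : Tendsto (fun T : ℝ => ∫ t in (-T)..T, F (a + t * I)) atTop
      (𝓝 (∫ t : ℝ, F (a + t * I))) :=
    intervalIntegral_tendsto_integral (by simpa only [hFk] using ia) tendsto_neg_atTop_atBot tendsto_id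
  have hlb : Tendsto (fun T : ℝ => ∫ t in (-T)..T, F (b + t * I)) atTop
      (𝓝 (∫ t : ℝ, F (b + t * I))) :=
    intervalIntegral_tendsto_integral (by simpa only [hFk] using ib) tendsto_neg_atTop_atBot tendsto_id
  have hrect : ∀ T : ℝ, ((∫ x in a..b, F (x + (-T : ℝ) * I)) - ∫ x in a..b, F (x + T * I)) +
      I • (∫ t in (-T)..T, F (b + t * I)) - I • (∫ t in (-T)..T, F (a + t * I)) = 0 := by
    intro T
    have := Complex.integral_boundary_rect_eq_zero_of_differentiableOn F ⟨a, -T⟩ ⟨b, T⟩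
      hFd.differentiableOn
    simpa using this
  have hlim := ((hdn.sub hup).add (hlb.const_smul I)).sub (hla.const_smul I)
  rw [tendsto_congr hrect] at hlim
  have h0 := tendsto_nhds_unique hlim tendsto_const_nhds
  rw [sub_zero, zero_add, ← smul_sub, smul_eq_zero] at h0
  have h1 := (h0.resolve_left I_ne_zero)
  simp only [hFk] at h1
  exact (sub_eq_zero.1 h1).symm

lemma kernelLine_neg (h c v t : ℝ) : kernelLine h (-c) (-v) (-t) = kernelLine h c v t := by
  simp only [kernelLine]
  congr 1
  push_cast
  ring

/-- The simple pole lies to the right of the line of integration. -/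
lemma integral_kernelLine_div_of_lt {h : ℝ} (hh : 0 < h) {a c : ℝ} (hca : c < a) (v : ℝ) :
    ∫ t, kernelLine h c v t / (((c : ℂ) + t * I) - a) =
      2 * π * (smoothExp h a v - exp (a * v + a ^ 2 * h ^ 2 / 2)) := by
  have h1 := integral_kernelLine_div hh (neg_lt_neg hca) (-v)
  rw [← integral_neg_eq_self] at h1
  have h2 : ∀ t : ℝ, kernelLine h (-c) (-v) (-t) / ((((-c : ℝ) : ℂ) + ((-t : ℝ) : ℂ) * I) - (-a : ℝ)) =
      -(kernelLine h c v t / (((c : ℂ) + t * I) - a)) := by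
    intro t
    rw [kernelLine_neg, ← div_neg]
    congr 1
    push_cast
    ring
  simp_rw [h2] at h1
  rw [integral_neg, neg_eq_iff_eq_neg] at h1
  rw [h1]
  have h3 : smoothExp h (-a) (-v) = exp (a * v + a ^ 2 * h ^ 2 / 2) - smoothExp h a v := by
    rw [smoothExp_eq hh (-a), smoothExp_eq hh a]
    have h4 := smoothExp_zero_add_neg hh (v + a * h ^ 2)
    rw [show -v + -a * h ^ 2 = -(v + a * h ^ 2) by ring, show -a * -v + (-a) ^ 2 * h ^ 2 / 2 =
      a * v + a ^ 2 * h ^ 2 / 2 by ring, eq_sub_iff_add_eq'.2 h4]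
    ring
  rw [h3]
  push_cast
  ring

lemma integrable_kernelLine_div_of_lt {h : ℝ} (hh : 0 < h) {a c : ℝ} (hca : c < a) (v : ℝ) :
    Integrable fun t : ℝ => kernelLine h c v t / (((c : ℂ) + t * I) - a) := by
  have h1 := (integrable_kernelLine_div hh (neg_lt_neg hca) (-v)).comp_neg.neg
  refine h1.congr (Eventually.of_forall fun t => ?_)
  simp only [Pi.neg_apply]
  rw [kernelLine_neg, ← div_neg]
  congr 1
  push_cast
  ring

lemma dslope_dslope_eq {g : ℂ → ℂ} {p s : ℂ} (hp : p ≠ 0) (h0 : s ≠ 0) (hs : s ≠ p) :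
    dslope (dslope g p) 0 s = g s / (s * (s - p)) - g p / p / (s - p) + g 0 / p / (s - 0) := by
  have hsp : s - p ≠ 0 := sub_ne_zero.2 hs
  rw [dslope_of_ne _ h0, slope_def_field, dslope_of_ne _ hs, dslope_of_ne _ hp.symm,
    slope_def_field, slope_def_field]
  rw [sub_zero, zero_sub]
  field_simp
  ring

lemma integral_div_mul_kernelLine {g : ℂ → ℂ} {h c C B p : ℝ}
    (hg : Continuous (dslope (dslope g p) 0)) (hh : 0 < h) (hp : 0 < p) (hc0 : c ≠ 0) (hcp : c ≠ p) (v : ℝ)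
    (hgrow : ∀ t : ℝ, ‖dslope (dslope g p) 0 (c + t * I)‖ ≤ C * exp (B * |t|)) :
    ∫ t : ℝ, g (c + t * I) / ((c + t * I) * (c + t * I - p)) * kernelLine h c v t =
      (∫ t : ℝ, dslope (dslope g p) 0 (c + t * I) * kernelLine h c v t) +
      g p / p * (∫ t : ℝ, kernelLine h c v t / (c + t * I - p)) -
      g 0 / p * (∫ t : ℝ, kernelLine h c v t / (c + t * I - (0 : ℝ))) := by
  have i : ∀ a : ℝ, c ≠ a → Integrable fun t : ℝ => kernelLine h c v t / (((c : ℂ) + t * I) - a) :=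
    fun a ha => (lt_or_gt_of_ne ha).elim (fun h => integrable_kernelLine_div_of_lt hh h v)
      fun h => integrable_kernelLine_div hh h v
  have i1 := integrable_mul_kernelLine hg hh hgrow v
  have i2 := (i p hcp).const_mul (g p / p)
  have i3 := (i 0 hc0).const_mul (g 0 / p)
  have i4 : Integrable fun t : ℝ => dslope (dslope g p) 0 (c + t * I) * kernelLine h c v t +
    g p / p * (kernelLine h c v t / (c + t * I - p)) := i1.add i2
  rw [← integral_const_mul, ← integral_const_mul, ← integral_add i1 i2, ← integral_sub i4 i3]
  refine integral_congr_ae (Eventually.of_forall fun t => ?_)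
  have hs0 : (c + t * I : ℂ) ≠ 0 := fun h => hc0 (by simpa using congrArg re h)
  have hsp : (c + t * I : ℂ) ≠ p := fun h => hcp (by simpa using congrArg re h)
  simp only
  rw [dslope_dslope_eq (by exact_mod_cast hp.ne') hs0 hsp, ofReal_zero]
  ring

/-- Shifting a contour to the left past simple poles at `0` and `p`. -/
theorem integral_div_mul_kernelLine_sub {g : ℂ → ℂ} (hg : Differentiable ℂ g)
    {h a σ p C B : ℝ} (hh : 0 < h) (ha : a < 0) (hp : 0 < p) (hpσ : p < σ) (hB : 0 ≤ B)
    (hgrow : ∀ s : ℂ, a ≤ s.re → s.re ≤ σ → 1 ≤ |s.im| → ‖g s‖ ≤ C * exp (B * |s.im|))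
    (v : ℝ) :
    ∫ t : ℝ, g (σ + t * I) / ((σ + t * I) * (σ + t * I - p)) * kernelLine h σ v t =
      (∫ t : ℝ, g (a + t * I) / ((a + t * I) * (a + t * I - p)) * kernelLine h a v t) +
      2 * π * (g p / p * exp (p * v + p ^ 2 * h ^ 2 / 2) - g 0 / p) := by
  set G := dslope (dslope g p) 0 with hG
  have hd1 : Differentiable ℂ (dslope g p) := by
    rw [← differentiableOn_univ, Complex.differentiableOn_dslope univ_mem]
    exact hg.differentiableOn
  have hd : Differentiable ℂ G := by
    rw [← differentiableOn_univ, Complex.differentiableOn_dslope univ_mem]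
    exact hd1.differentiableOn
  have hpc : (p : ℂ) ≠ 0 := by exact_mod_cast hp.ne'
  have hGgrow : ∀ s : ℂ, a ≤ s.re → s.re ≤ σ → 1 ≤ |s.im| →
      ‖G s‖ ≤ (|C| + ‖g p / p‖ + ‖g 0 / p‖) * exp (B * |s.im|) := by
    intro s h1 h2 h3
    have hs0 : s ≠ 0 := fun h => by rw [h] at h3; norm_num at h3
    have hsp : s ≠ p := fun h => by rw [h] at h3; norm_num at h3
    have n0 : 1 ≤ ‖s‖ := h3.trans (abs_im_le_norm s)
    have np : 1 ≤ ‖s - p‖ := h3.trans (by simpa using abs_im_le_norm (s - p))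
    rw [hG, dslope_dslope_eq hpc hs0 hsp, sub_zero]
    have he : 1 ≤ exp (B * |s.im|) := one_le_exp (by positivity)
    have b1 : ‖g s / (s * (s - p))‖ ≤ |C| * exp (B * |s.im|) := by
      rw [norm_div, norm_mul]
      refine (div_le_self (norm_nonneg _) (one_le_mul_of_one_le_of_one_le n0 np)).trans
        ((hgrow s h1 h2 h3).trans ?_)
      gcongr
      exact le_abs_self C
    have b2 : ‖g p / p / (s - p)‖ ≤ ‖g p / p‖ * exp (B * |s.im|) := by
      rw [norm_div (g p / p)]
      exact (div_le_self (norm_nonneg _) np).trans (le_mul_of_one_le_right (norm_nonneg _) he)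
    have b3 : ‖g 0 / p / s‖ ≤ ‖g 0 / p‖ * exp (B * |s.im|) := by
      rw [norm_div (g 0 / p)]
      exact (div_le_self (norm_nonneg _) n0).trans (le_mul_of_one_le_right (norm_nonneg _) he)
    refine (norm_add_le _ _).trans ((add_le_add (norm_sub_le _ _) le_rfl).trans ?_)
    linarith
  obtain ⟨D, hD, hGr⟩ := exists_norm_le_exp_of_strip hd.continuous hB hGgrow
  have haσ : a ≤ σ := by linarith
  have hline : ∀ x : ℝ, a ≤ x → x ≤ σ → ∀ t : ℝ, ‖G (x + t * I)‖ ≤ D * exp (B * |t|) := by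
    intro x h1 h2 t
    have := hGr (x + t * I) (by simpa using h1) (by simpa using h2)
    simpa using this
  have hshift := integral_mul_kernelLine_eq hd hh haσ hB hGgrow v
  rw [integral_div_mul_kernelLine hd.continuous hh hp (hp.trans hpσ).ne' hpσ.ne' v
      (hline σ haσ le_rfl), integral_div_mul_kernelLine hd.continuous hh hp ha.ne (ha.trans hp).ne v
      (hline a le_rfl haσ), hshift, integral_kernelLine_div hh hpσ,
      integral_kernelLine_div hh (hp.trans hpσ), integral_kernelLine_div_of_lt hh ha,
      integral_kernelLine_div_of_lt hh (ha.trans hp)]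
  simp only [zero_mul, ne_eq, OfNat.ofNat_ne_zero, not_false_eq_true, zero_pow, zero_div, add_zero,
    Real.exp_zero]
  push_cast
  ring

lemma integral_pow_mul_gaussian {b : ℝ} (hb : 0 < b) (k : ℕ) :
    ∫ t : ℝ, t ^ (2 * k) * exp (-b * t ^ 2) =
      b⁻¹ ^ k * (√b)⁻¹ * Real.Gamma (k + 1 / 2) := by
  have h1 := integral_comp_abs (f := fun t : ℝ => t ^ (2 * k) * exp (-b * t ^ 2))
  simp only [sq_abs, pow_mul] at h1
  simp only [pow_mul]
  rw [h1]
  have h2 := integral_rpow_mul_exp_neg_mul_rpow (p := 2) (q := 2 * k) (b := b) two_pos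
    (by linarith [k.cast_nonneg (α := ℝ)]) hb
  have h3 : ∀ t : ℝ, t ^ (2 * k : ℝ) * exp (-b * t ^ (2 : ℝ)) =
      (t ^ 2) ^ k * exp (-b * t ^ 2) := by
    intro t
    rw [← pow_mul, ← rpow_natCast t (2 * k)]
    norm_num
  simp_rw [h3] at h2
  rw [h2, show ((2 * k + 1) / 2 : ℝ) = k + 1 / 2 by ring,
    show (-(2 * k + 1) / 2 : ℝ) = -(k : ℝ) + -(1 / 2) by ring, rpow_add hb,
    rpow_neg hb.le, rpow_natCast, rpow_neg hb.le, ← sqrt_eq_rpow, inv_pow]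
  ring

lemma integrable_pow_mul_gaussian {b : ℝ} (hb : 0 < b) (k : ℕ) :
    Integrable fun t : ℝ => t ^ k * exp (-b * t ^ 2) := by
  have := integrable_rpow_mul_exp_neg_mul_sq hb (s := k) (by linarith [k.cast_nonneg (α := ℝ)])
  simpa using this

/-- The Gaussian moment occurring in the bound on the line `re = -3/2`. -/
noncomputable def leftMoment (h : ℝ) : ℝ :=
  √(2 * π) / h * (3 / 8 + 19 / 12 / h ^ 2 + 1 / h ^ 4)

lemma integral_left_gaussian {h : ℝ} (hh : 0 < h) :
    Integrable (fun t : ℝ => (3 / 2 + t ^ 2 / 3) * (1 / 4 + t ^ 2) *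
      exp (-(h ^ 2 / 2) * t ^ 2)) ∧
    ∫ t : ℝ, (3 / 2 + t ^ 2 / 3) * (1 / 4 + t ^ 2) * exp (-(h ^ 2 / 2) * t ^ 2) =
      leftMoment h := by
  set b := h ^ 2 / 2 with hbd
  have hb : 0 < b := by positivity
  have i0 := (integrable_pow_mul_gaussian hb 0).const_mul (3 / 8)
  have i2 := (integrable_pow_mul_gaussian hb 2).const_mul (19 / 12)
  have i4 := (integrable_pow_mul_gaussian hb 4).const_mul (1 / 3)
  have i02 : Integrable fun t : ℝ => 3 / 8 * (t ^ 0 * exp (-b * t ^ 2)) +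
    19 / 12 * (t ^ 2 * exp (-b * t ^ 2)) := i0.add i2
  have e : ∀ t : ℝ, (3 / 2 + t ^ 2 / 3) * (1 / 4 + t ^ 2) * exp (-b * t ^ 2) =
      3 / 8 * (t ^ 0 * exp (-b * t ^ 2)) + 19 / 12 * (t ^ 2 * exp (-b * t ^ 2)) +
      1 / 3 * (t ^ 4 * exp (-b * t ^ 2)) := fun t => by ring
  simp_rw [e]
  refine ⟨i02.add i4, ?_⟩
  rw [integral_add i02 i4, integral_add i0 i2, integral_const_mul, integral_const_mul,
    integral_const_mul]
  have m0 := integral_pow_mul_gaussian hb 0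
  have m2 := integral_pow_mul_gaussian hb 1
  have m4 := integral_pow_mul_gaussian hb 2
  have g1 : Real.Gamma (1 + 1 / 2) = √π / 2 := by
    rw [add_comm, Real.Gamma_add_one (by norm_num), Real.Gamma_one_half_eq]; ring
  have g2 : Real.Gamma (2 + 1 / 2) = 3 / 4 * √π := by
    rw [show (2 + 1 / 2 : ℝ) = (1 + 1 / 2) + 1 by norm_num, Real.Gamma_add_one (by norm_num), g1]
    ring
  simp only [Nat.cast_zero, zero_add, Real.Gamma_one_half_eq, mul_zero, pow_zero, one_mul] at m0
  simp only [Nat.cast_one, g1, mul_one, pow_one] at m2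
  simp only [Nat.cast_ofNat, g2, Nat.reduceMul] at m4
  have hsb : √b = h / √2 := by rw [hbd, Real.sqrt_div (by positivity), sqrt_sq hh.le]
  simp only [pow_zero, one_mul]
  rw [m0, m2, m4, hsb, leftMoment, sqrt_mul (by norm_num), hbd]
  have : √2 ≠ 0 := by positivity
  field_simp
  ring

/-- The coefficients of `ζ(s + β) L(s + β, χ)`. -/
noncomputable def twistedDivisorCoeff {f : ℕ} (χ : DirichletCharacter ℂ f) (n : ℕ) : ℂ :=
  LSeries.convolution (fun n : ℕ => χ n) (fun _ => 1) n

lemma zetaEntire_one : zetaEntire 1 = 1 := by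
  rw [zetaEntire_eq_mul (by simp)]; simp

lemma norm_zetaEntire_mul_LFunction_div_le {f : ℕ} [NeZero f] {χ : DirichletCharacter ℂ f}
    (hχ : χ.IsPrimitive) (hf : f ≠ 1) {β : ℝ} (hβ : 0 ≤ β) (t : ℝ) {s : ℂ}
    (hs : s = ((-(3 / 2) - β : ℝ) : ℂ) + t * I) :
    ‖zetaEntire (s + β) * LFunction χ (s + β) / (s * (s - (1 - β : ℝ)))‖ ≤
      (f : ℝ) ^ 2 * (((2 * π) ^ 4)⁻¹ * (137 / 100) ^ 2) *
        ((3 / 2 + t ^ 2 / 3) * (1 / 4 + t ^ 2)) := by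
  set w : ℂ := 5 / 2 - t * I with hw
  have hwre : w.re = 5 / 2 := by simp [w]
  have hwim : w.im = -t := by simp [w]
  have e1 : s + β = 1 - w := by rw [hs, hw]; push_cast; ring
  have hsne : s + β ≠ 1 := fun h => by
    have := congrArg re (e1.symm.trans h); rw [sub_re, hwre] at this; norm_num at this
  have e2 : s - (1 - β : ℝ) = s + β - 1 := by push_cast; ring
  have hs1 : s + β - 1 ≠ 0 := sub_ne_zero.2 hsne
  have hns : √(9 / 4 + t ^ 2) ≤ ‖s‖ := by
    rw [Complex.norm_def]
    refine Real.sqrt_le_sqrt ?_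
    rw [hs, normSq_add_mul_I]
    nlinarith
  have hs0 : 0 < √(9 / 4 + t ^ 2) := by positivity
  have hspos : 0 < ‖s‖ := hs0.trans_le hns
  have hsq : √(9 / 4 + t ^ 2) ≤ 3 / 2 + t ^ 2 / 3 := by
    rw [Real.sqrt_le_left (by positivity)]
    nlinarith [sq_nonneg t, sq_nonneg (t ^ 2)]
  have hb := norm_zeta_mul_LFunction_le hχ hf hwre
  rw [← e1, hwim, neg_sq] at hb
  rw [e2, zetaEntire_of_ne_one hsne, show (s + β - 1) * riemannZeta (s + β) *
    LFunction χ (s + β) / (s * (s + β - 1)) =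
    riemannZeta (s + β) * LFunction χ (s + β) / s by
      have : s ≠ 0 := norm_pos_iff.1 hspos
      field_simp, norm_div, div_le_iff₀ hspos]
  refine hb.trans ?_
  have h9 : 9 / 4 + t ^ 2 ≤ (3 / 2 + t ^ 2 / 3) * ‖s‖ := by
    calc 9 / 4 + t ^ 2 = √(9 / 4 + t ^ 2) * √(9 / 4 + t ^ 2) := (Real.mul_self_sqrt (by positivity)).symm
      _ ≤ _ := by gcongr
  calc (f : ℝ) ^ 2 * (((2 * π) ^ 4)⁻¹ * (137 / 100) ^ 2) *
        ((9 / 4 + t ^ 2) * (1 / 4 + t ^ 2)) ≤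
        (f : ℝ) ^ 2 * (((2 * π) ^ 4)⁻¹ * (137 / 100) ^ 2) *
        ((3 / 2 + t ^ 2 / 3) * ‖s‖ * (1 / 4 + t ^ 2)) := by gcongr
    _ = _ := by ring

lemma LSeries_twistedDivisorCoeff {f : ℕ} [NeZero f] (χ : DirichletCharacter ℂ f) (β : ℝ) {s : ℂ}
    (hs : 1 < (s + β).re) :
    LSeriesSummable (fun n => twistedDivisorCoeff χ n * (n : ℂ) ^ (-β : ℂ)) s ∧
    LSeries (fun n => twistedDivisorCoeff χ n * (n : ℂ) ^ (-β : ℂ)) s =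
      LFunction χ (s + β) * riemannZeta (s + β) := by
  have e : LSeries.term (fun n => twistedDivisorCoeff χ n * (n : ℂ) ^ (-β : ℂ)) s =
      LSeries.term (twistedDivisorCoeff χ) (s + β) := by
    ext n
    rcases eq_or_ne n 0 with rfl | hn
    · simp
    have hn' : (n : ℂ) ≠ 0 := by exact_mod_cast hn
    rw [LSeries.term_of_ne_zero hn, LSeries.term_of_ne_zero hn, cpow_add _ _ hn', cpow_neg]
    ring
  have s1 : LSeriesSummable (fun n : ℕ => χ n) (s + β) :=
    LSeriesSummable_of_bounded_of_one_lt_re (m := 1) (fun n _ => χ.norm_le_one _) hs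
  have s2 : LSeriesSummable (fun _ => 1) (s + β) :=
    LSeriesSummable_of_bounded_of_one_lt_re (m := 1) (fun n _ => by simp) hs
  have s3 : LSeriesSummable (twistedDivisorCoeff χ) (s + β) := s1.convolution s2
  have h4 : LSeries (twistedDivisorCoeff χ) (s + β) = _ := LSeries_convolution' s1 s2
  rw [LSeriesSummable, LSeries, e]
  refine ⟨s3, ?_⟩
  rw [LFunction_eq_LSeries _ hs, ← LSeries_one_eq_riemannZeta hs]
  exact h4

/-- The smoothed sum of the coefficients of `ζ L`, evaluated by shifting the contour to
`re = -3/2`. -/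
theorem exists_hasSum_twistedDivisorCoeff {f : ℕ} [NeZero f] {χ : DirichletCharacter ℂ f}
    (hχ : χ.IsPrimitive) (hf : f ≠ 1) {h β : ℝ} (hh : 0 < h) (hβ : 0 ≤ β) (hβ1 : β < 1) (v : ℝ) :
    ∃ E : ℂ, ‖E‖ ≤ (2 * π)⁻¹ * ((f : ℝ) ^ 2 * (((2 * π) ^ 4)⁻¹ * (137 / 100) ^ 2) *
        exp (-(3 / 2 + β) * v + h ^ 2 * (3 / 2 + β) ^ 2 / 2) * leftMoment h) ∧
      HasSum (fun n : ℕ => twistedDivisorCoeff χ n * (n : ℂ) ^ (-β : ℂ) *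
          smoothExp h 0 (v - log n))
        (E + (LFunction χ 1 / (1 - β) *
          exp ((1 - β) * v + (1 - β) ^ 2 * h ^ 2 / 2) -
          zetaEntire β * LFunction χ β / (1 - β))) := by
  set g : ℂ → ℂ := fun s => zetaEntire (s + β) * LFunction χ (s + β) with hg
  have hne : χ ≠ 1 := fun h => by
    have h3 := hχ.symm
    rw [h, DirichletCharacter.conductor_one] at h3
    exact hf h3
  have hgd : Differentiable ℂ g := by
    refine (differentiable_zetaEntire.comp (differentiable_id.add_const _)).mul
      ((differentiable_LFunction hne).comp (differentiable_id.add_const _))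
  obtain ⟨C1, hC1, g1⟩ := exists_norm_LFunction_le hχ hf
  obtain ⟨C2, hC2, g2⟩ := exists_norm_zetaEntire_le
  set a : ℝ := -(3 / 2) - β with ha
  have hgrow : ∀ s : ℂ, a ≤ s.re → s.re ≤ 3 / 2 → 1 ≤ |s.im| →
      ‖g s‖ ≤ C2 * C1 * exp (8 * |s.im|) := by
    intro s h1 h2 h3
    have r1 : (s + β).re = s.re + β := by simp
    have r2 : (s + β).im = s.im := by simp
    have b1 := g1 (s + β) (by rw [r1]; linarith) (by rw [r2]; exact h3)
    have b2 := g2 (s + β) (by rw [r1]; linarith) (by rw [r1]; linarith) (by rw [r2]; exact h3)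
    rw [r2] at b1 b2
    rw [hg, norm_mul]
    calc _ ≤ C2 * exp (5 * |s.im|) * (C1 * exp (3 * |s.im|)) := by gcongr
      _ = _ := by
        rw [show 8 * |s.im| = 5 * |s.im| + 3 * |s.im| by ring, exp_add]; ring
  have hshift := integral_div_mul_kernelLine_sub hgd hh (a := a) (σ := 3 / 2) (p := 1 - β)
    (by linarith) (by linarith) (by linarith) (by norm_num) hgrow v
  have hgp : g ((1 - β : ℝ) : ℂ) = LFunction χ 1 := by
    simp [hg, zetaEntire_one]
  have hg0 : g 0 = zetaEntire β * LFunction χ β := by simp [hg]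
  have hre : ∀ t : ℝ, 1 < ((((3 / 2 : ℝ) : ℂ) + t * I) + β).re := fun t => by
    simp; linarith
  set b : ℕ → ℂ := fun n => twistedDivisorCoeff χ n * (n : ℂ) ^ (-β : ℂ) with hb
  have hb0 : b 0 = 0 := by
    simp [hb, twistedDivisorCoeff, LSeries.convolution_map_zero]
  have hsum := hasSum_mul_smoothExp hh (σ := 3 / 2) (by norm_num) hb0
    ((LSeries_twistedDivisorCoeff χ β (s := ((3 / 2 : ℝ) : ℂ)) (by simpa using hre 0)).1) v
  have hint : ∀ t : ℝ, LSeries b (((3 / 2 : ℝ) : ℂ) + t * I) *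
      (kernelLine h (3 / 2) v t / (((3 / 2 : ℝ) : ℂ) + t * I)) =
      g (((3 / 2 : ℝ) : ℂ) + t * I) / ((((3 / 2 : ℝ) : ℂ) + t * I) *
        (((3 / 2 : ℝ) : ℂ) + t * I - (1 - β : ℝ))) * kernelLine h (3 / 2) v t := by
    intro t
    rw [(LSeries_twistedDivisorCoeff χ β (hre t)).2, hg]
    have h1 : (((3 / 2 : ℝ) : ℂ) + t * I + β) ≠ 1 := fun h => by
      have := hre t; rw [h] at this; simp at this
    have h2 : (((3 / 2 : ℝ) : ℂ) + t * I) ≠ 0 := fun h => by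
      have := congrArg re h; simp at this
    have h3 := sub_ne_zero.2 h1
    simp only
    rw [zetaEntire_of_ne_one h1, show ((3 / 2 : ℝ) : ℂ) + t * I - (1 - β : ℝ) =
      ((3 / 2 : ℝ) : ℂ) + t * I + β - 1 by push_cast; ring]
    field_simp
  simp_rw [hint] at hsum
  rw [hshift, hgp, hg0, mul_add] at hsum
  refine ⟨(2 * π : ℂ)⁻¹ * ∫ t : ℝ, g (a + t * I) / ((a + t * I) *
    (a + t * I - (1 - β : ℝ))) * kernelLine h a v t, ?_, ?_⟩
  · rw [norm_mul, norm_inv, norm_mul, norm_ofNat, norm_real, norm_of_nonneg pi_pos.le]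
    refine mul_le_mul_of_nonneg_left ?_ (by positivity)
    obtain ⟨im, em⟩ := integral_left_gaussian hh
    set K := (f : ℝ) ^ 2 * (((2 * π) ^ 4)⁻¹ * (137 / 100) ^ 2) *
        exp (-(3 / 2 + β) * v + h ^ 2 * (3 / 2 + β) ^ 2 / 2) with hK
    rw [← em, ← integral_const_mul]
    refine norm_integral_le_of_norm_le (im.const_mul K) (Eventually.of_forall fun t => ?_)
    have hb := norm_zetaEntire_mul_LFunction_div_le hχ hf hβ t (s := a + t * I) (by rw [ha])
    rw [norm_mul, norm_kernelLine, show a * v + h ^ 2 * a ^ 2 / 2 =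
      -(3 / 2 + β) * v + h ^ 2 * (3 / 2 + β) ^ 2 / 2 by rw [ha]; ring]
    refine (mul_le_mul_of_nonneg_right hb (by positivity)).trans_eq ?_
    rw [hK]; ring
  · convert! hsum using 2
    have : (2 * π : ℂ) ≠ 0 := by
      have := pi_ne_zero
      simpa using this
    rw [inv_mul_cancel_left₀ this]
    push_cast
    rfl

/-- The indicator function of the squarefree integers. -/
noncomputable def squarefreeIndicator : ArithmeticFunction ℝ :=
  ⟨fun n => if Squarefree n then 1 else 0, by simp⟩

/-- The indicator function of the nonzero squares. -/
noncomputable def squareIndicator : ArithmeticFunction ℝ :=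
  ⟨fun n => if n ≠ 0 ∧ IsSquare n then 1 else 0, by simp⟩

lemma squarefreeIndicator_apply (n : ℕ) :
    squarefreeIndicator n = if Squarefree n then 1 else 0 := rfl

lemma squareIndicator_apply (n : ℕ) :
    squareIndicator n = if n ≠ 0 ∧ IsSquare n then 1 else 0 := rfl

lemma isMultiplicative_squarefreeIndicator : squarefreeIndicator.IsMultiplicative := by
  refine ⟨by simp [squarefreeIndicator_apply], fun {m n} hmn => ?_⟩
  simp only [squarefreeIndicator_apply, Nat.squarefree_mul hmn]
  by_cases h1 : Squarefree m <;> by_cases h2 : Squarefree n <;> simp [h1, h2]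

lemma isSquare_mul_iff_of_coprime {m n : ℕ} (hmn : m.Coprime n) :
    IsSquare (m * n) ↔ IsSquare m ∧ IsSquare n := by
  refine ⟨fun ⟨r, hr⟩ => ?_, fun ⟨h1, h2⟩ => h1.mul h2⟩
  rw [← sq] at hr
  obtain ⟨d, hd⟩ := exists_eq_pow_of_mul_eq_pow
    (a := m) (b := n) (by rw [Nat.isUnit_iff]; exact hmn) hr
  obtain ⟨e, he⟩ := exists_eq_pow_of_mul_eq_pow
    (a := n) (b := m) (by rw [Nat.isUnit_iff]; exact hmn.symm) ((mul_comm n m).trans hr)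
  exact ⟨⟨d, by rw [hd, sq]⟩, ⟨e, by rw [he, sq]⟩⟩

lemma isMultiplicative_squareIndicator : squareIndicator.IsMultiplicative := by
  refine ⟨by simp [squareIndicator_apply], fun {m n} hmn => ?_⟩
  simp only [squareIndicator_apply, isSquare_mul_iff_of_coprime hmn, mul_ne_zero_iff]
  by_cases h1 : IsSquare m <;> by_cases h2 : IsSquare n <;> by_cases h3 : m = 0 <;>
    by_cases h4 : n = 0 <;> simp [h1, h2, h3, h4]

lemma isSquare_prime_pow_iff {p : ℕ} (hp : p.Prime) (k : ℕ) : IsSquare (p ^ k) ↔ Even k := by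
  refine ⟨fun ⟨r, hr⟩ => ?_, fun h => h.isSquare_pow p⟩
  rw [← sq] at hr
  have h1 := congrArg (fun n => n.factorization p) hr
  simp only [hp.factorization_pow, Nat.factorization_pow] at h1
  exact ⟨r.factorization p, by simpa [two_mul] using h1⟩

lemma squarefreeIndicator_mul_prime_pow (g : ArithmeticFunction ℝ) {p : ℕ} (hp : p.Prime) (k : ℕ) :
    (squarefreeIndicator * g) (p ^ (k + 1)) = g (p ^ (k + 1)) + g (p ^ k) := by
  rw [ArithmeticFunction.mul_apply,
    Nat.sum_divisorsAntidiagonal (fun a b => squarefreeIndicator a * g b),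
    Nat.sum_divisors_prime_pow hp, ← Finset.sum_subset
      (Finset.range_subset_range.2 (by omega : 2 ≤ k + 1 + 1))]
  · rw [sum_range_succ, Finset.sum_range_one, squarefreeIndicator_apply,
      squarefreeIndicator_apply, pow_zero, pow_one, if_pos squarefree_one,
      if_pos hp.prime.squarefree, Nat.div_one, pow_succ, Nat.mul_div_cancel _ hp.pos]
    ring
  · intro j _ hj
    rw [Finset.mem_range, not_lt] at hj
    rw [squarefreeIndicator_apply, if_neg, zero_mul]
    rw [Nat.squarefree_pow_iff hp.ne_one (by omega)]
    omega

lemma squarefreeIndicator_mul_squareIndicator :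
    squarefreeIndicator * squareIndicator = (ArithmeticFunction.zeta : ArithmeticFunction ℝ) := by
  rw [ArithmeticFunction.IsMultiplicative.eq_iff_eq_on_prime_powers _
    (isMultiplicative_squarefreeIndicator.mul isMultiplicative_squareIndicator) _
    ArithmeticFunction.isMultiplicative_zeta.natCast]
  intro p k hp
  rcases k with _ | k
  · simp [(isMultiplicative_squarefreeIndicator.mul isMultiplicative_squareIndicator).1]
  · rw [squarefreeIndicator_mul_prime_pow _ hp, squareIndicator_apply, squareIndicator_apply,
      ArithmeticFunction.natCoe_apply, ArithmeticFunction.zeta_apply_ne (pow_ne_zero _ hp.ne_zero)]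
    simp only [isSquare_prime_pow_iff hp, ne_eq, pow_ne_zero _ hp.ne_zero, not_false_eq_true, true_and, Nat.even_add_one]
    by_cases h : Even k <;> simp [h]

/-- A quadratic character as a real arithmetic function. -/
noncomputable def quadraticFunction {f : ℕ} (χ : DirichletCharacter ℂ f) (hf : f ≠ 1) :
    ArithmeticFunction ℝ :=
  ⟨fun n => (χ n).re, by
    rw [Nat.cast_zero]
    have : ¬ IsUnit (0 : ZMod f) := fun h => hf (by
      have h1 : (0 : ZMod f) = 1 := (isUnit_zero_iff.1 h)
      have : Subsingleton (ZMod f) := subsingleton_of_zero_eq_one h1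
      rcases f with _ | n
      · exact absurd h1 (by decide)
      · have := Fintype.card_le_one_iff_subsingleton.2 this
        rw [ZMod.card] at this; omega)
    rw [χ.map_nonunit this, zero_re]⟩

section
variable {f : ℕ} {χ : DirichletCharacter ℂ f} (hf : f ≠ 1)

lemma ofReal_quadraticFunction (hq : χ ^ 2 = 1) (n : ℕ) :
    ((quadraticFunction χ hf n : ℝ) : ℂ) = χ n ∧
      (quadraticFunction χ hf n = 0 ∨ quadraticFunction χ hf n = 1 ∨
        quadraticFunction χ hf n = -1) := by
  have e : quadraticFunction χ hf n = (χ n).re := rfl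
  rw [e]
  rcases MulChar.isQuadratic_iff_sq_eq_one.2 hq (n : ZMod f) with h | h | h <;> simp [h]

lemma quadraticFunction_mul (hq : χ ^ 2 = 1) (m n : ℕ) : quadraticFunction χ hf (m * n) =
    quadraticFunction χ hf m * quadraticFunction χ hf n := by
  have h1 := (ofReal_quadraticFunction hf hq (m * n)).1
  rw [Nat.cast_mul, map_mul χ, ← (ofReal_quadraticFunction hf hq m).1,
    ← (ofReal_quadraticFunction hf hq n).1] at h1
  exact_mod_cast h1

lemma quadraticFunction_one (hq : χ ^ 2 = 1) : quadraticFunction χ hf 1 = 1 := by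
  have h1 := (ofReal_quadraticFunction hf hq 1).1
  rw [Nat.cast_one, map_one χ] at h1
  exact_mod_cast h1

lemma quadraticFunction_pow (hq : χ ^ 2 = 1) (p k : ℕ) :
    quadraticFunction χ hf (p ^ k) = quadraticFunction χ hf p ^ k := by
  induction k with
  | zero => simp [quadraticFunction_one hf hq]
  | succ k ih => rw [pow_succ, quadraticFunction_mul hf hq, ih, pow_succ]

lemma isMultiplicative_quadraticFunction (hq : χ ^ 2 = 1) :
    (quadraticFunction χ hf).IsMultiplicative :=
  ⟨quadraticFunction_one hf hq, fun _ => quadraticFunction_mul hf hq _ _⟩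

/-- The coefficients of `ζ(s) L(s, χ) / ζ(2 s)` are nonnegative. -/
lemma squarefreeIndicator_mul_quadraticFunction_nonneg (hq : χ ^ 2 = 1) (n : ℕ) :
    0 ≤ (squarefreeIndicator * quadraticFunction χ hf) n := by
  rcases eq_or_ne n 0 with rfl | hn
  · simp
  have hm := isMultiplicative_squarefreeIndicator.mul (isMultiplicative_quadraticFunction hf hq)
  rw [ArithmeticFunction.IsMultiplicative.multiplicative_factorization _ hm hn]
  refine Finset.prod_nonneg fun p hp => ?_
  have hpp : p.Prime := Nat.prime_of_mem_primeFactors (by simpa using hp)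
  change 0 ≤ (squarefreeIndicator * quadraticFunction χ hf) (p ^ n.factorization p)
  generalize n.factorization p = k
  rcases k with _ | k
  · rw [pow_zero, hm.1]; norm_num
  · rw [squarefreeIndicator_mul_prime_pow _ hpp, quadraticFunction_pow hf hq,
      quadraticFunction_pow hf hq, pow_succ]
    rcases (ofReal_quadraticFunction hf hq p).2 with h | h | h <;> rw [h]
    · simp
    · norm_num
    · simp

lemma twistedDivisorCoeff_eq (hq : χ ^ 2 = 1) (n : ℕ) :
    twistedDivisorCoeff χ n =
      (((squarefreeIndicator * quadraticFunction χ hf) * squareIndicator) n : ℝ) := by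
  rw [mul_right_comm, squarefreeIndicator_mul_squareIndicator, mul_comm, ArithmeticFunction.mul_apply,
    twistedDivisorCoeff, LSeries.convolution_def]
  push_cast
  refine sum_congr rfl fun p hp => ?_
  rw [(ofReal_quadraticFunction hf hq p.1).1, ArithmeticFunction.natCoe_apply,
    ArithmeticFunction.zeta_apply_ne (Nat.right_ne_zero_of_mem_divisorsAntidiagonal hp)]
  simp

end

lemma smoothExp_zero_eq_integral (h y : ℝ) :
    smoothExp h 0 y = ∫ z in Set.Ioi (-y), gaussDensity h z := by
  rw [smoothExp_zero, ← integral_indicator measurableSet_Ioi,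
    ← integral_indicator measurableSet_Ioi,
    ← integral_sub_right_eq_self ((Set.Ioi (-y)).indicator (gaussDensity h)) y]
  refine integral_congr_ae (Eventually.of_forall fun u => ?_)
  simp only [Set.indicator_apply, Set.mem_Ioi]
  rw [← gaussDensity_neg, neg_sub]
  by_cases hu : 0 < u
  · rw [if_pos hu, if_pos (by linarith)]
  · rw [if_neg hu, if_neg (by linarith)]

lemma monotone_smoothExp_zero {h : ℝ} (hh : 0 < h) : Monotone (smoothExp h 0) := by
  intro x y hxy
  rw [smoothExp_zero_eq_integral, smoothExp_zero_eq_integral]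
  exact setIntegral_mono_set (integrable_gaussDensity hh).integrableOn
    (Eventually.of_forall fun u => gaussDensity_nonneg hh u)
    (Eventually.of_forall (Set.Ioi_subset_Ioi (by linarith)))

lemma ofReal_smoothExp_zero {h : ℝ} (hh : 0 < h) (y : ℝ) : ENNReal.ofReal (smoothExp h 0 y) =
    ∫⁻ z, (Set.Ioi (-y)).indicator (fun z => ENNReal.ofReal (gaussDensity h z)) z := by
  rw [smoothExp_zero_eq_integral, lintegral_indicator measurableSet_Ioi,
    ofReal_integral_eq_lintegral_ofReal (integrable_gaussDensity hh).integrableOn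
      (Eventually.of_forall fun u => gaussDensity_nonneg hh u)]

lemma gaussDensity_mul_exp {h : ℝ} (hh : 0 < h) (z : ℝ) : gaussDensity h z * exp (z / 2) =
    exp (h ^ 2 / 8) * gaussDensity h (z - h ^ 2 / 2) := by
  simp only [gaussDensity]
  rw [div_mul_eq_mul_div, ← mul_div_assoc, ← exp_add, ← exp_add]
  congr 2
  field_simp
  ring

lemma ofReal_sub_one_le_tsum {t : ℝ} (ht : 0 < t) :
    ENNReal.ofReal (t - 1) ≤ ∑' m : ℕ, if ((m : ℝ) + 1) < t then 1 else 0 := by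
  have h1 : ∑ m ∈ Finset.range (⌈t⌉₊ - 1), (if ((m : ℝ) + 1) < t then (1 : ENNReal) else 0) =
      ((⌈t⌉₊ - 1 : ℕ) : ENNReal) := by
    rw [sum_congr rfl fun m hm => if_pos ?_]
    · simp
    · rw [Finset.mem_range] at hm
      have : m + 1 < ⌈t⌉₊ := by omega
      exact_mod_cast Nat.lt_ceil.1 this
  refine le_trans ?_ (ENNReal.sum_le_tsum (Finset.range (⌈t⌉₊ - 1)))
  rw [h1, ← ENNReal.ofReal_natCast, Nat.cast_sub (Nat.one_le_ceil_iff.2 ht)]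
  exact ENNReal.ofReal_le_ofReal (by push_cast; linarith [Nat.le_ceil t])

/-- A smoothed count of the integers up to `exp (y / 2)`. -/
lemma ofReal_le_tsum_smoothExp {h : ℝ} (hh : 0 < h) (y : ℝ) :
    ENNReal.ofReal (exp (y / 2 + h ^ 2 / 8) - 1) ≤
      ∑' m : ℕ, ENNReal.ofReal (smoothExp h 0 (y - 2 * log (m + 1))) := by
  simp_rw [ofReal_smoothExp_zero hh]
  have hm : Measurable fun z => ENNReal.ofReal (gaussDensity h z) :=
    (continuous_gaussDensity h).measurable.ennreal_ofReal
  rw [← lintegral_tsum fun m => (hm.indicator measurableSet_Ioi).aemeasurable]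
  have i1 : Integrable fun z => gaussDensity h z * (exp ((y + z) / 2)) := by
    have := ((integrable_gaussDensity hh).comp_sub_right (h ^ 2 / 2)).const_mul
      (exp (y / 2) * exp (h ^ 2 / 8))
    refine this.congr (Eventually.of_forall fun z => ?_)
    simp only
    rw [mul_assoc, ← gaussDensity_mul_exp hh, add_div, exp_add]
    ring
  have e1 : ∫ z, gaussDensity h z * (exp ((y + z) / 2)) = exp (y / 2 + h ^ 2 / 8) := by
    have : ∀ z, gaussDensity h z * (exp ((y + z) / 2)) =
        exp (y / 2 + h ^ 2 / 8) * gaussDensity h (z - h ^ 2 / 2) := fun z => by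
      rw [exp_add (y / 2), mul_assoc, ← gaussDensity_mul_exp hh, add_div, exp_add]
      ring
    simp_rw [this]
    rw [integral_const_mul, integral_sub_right_eq_self (gaussDensity h), integral_gaussDensity hh,
      mul_one]
  have i2 := i1.sub (integrable_gaussDensity hh)
  have e2 : ∫ z, (gaussDensity h z * (exp ((y + z) / 2)) - gaussDensity h z) =
      exp (y / 2 + h ^ 2 / 8) - 1 := by
    rw [integral_sub i1 (integrable_gaussDensity hh), e1, integral_gaussDensity hh]
  rw [← e2]
  refine (ENNReal.ofReal_le_ofReal (integral_mono i2 i2.pos_part fun z => le_max_left _ 0)).trans ?_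
  rw [ofReal_integral_eq_lintegral_ofReal i2.pos_part
    (Eventually.of_forall fun z => le_max_right _ 0)]
  refine lintegral_mono fun z => ?_
  have e3 : ∀ m : ℕ, (Set.Ioi (-(y - 2 * log (m + 1)))).indicator
      (fun z => ENNReal.ofReal (gaussDensity h z)) z = ENNReal.ofReal (gaussDensity h z) *
        if ((m : ℝ) + 1) < exp ((y + z) / 2) then 1 else 0 := fun m => by
    have : z ∈ Set.Ioi (-(y - 2 * log (m + 1))) ↔
        ((m : ℝ) + 1) < exp ((y + z) / 2) := by
      rw [← Real.log_lt_iff_lt_exp (by positivity), Set.mem_Ioi]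
      constructor <;> intro h <;> linarith
    by_cases hc : ((m : ℝ) + 1) < exp ((y + z) / 2)
    · rw [if_pos hc, Set.indicator_of_mem (this.2 hc), mul_one]
    · rw [if_neg hc, Set.indicator_of_notMem (fun h => hc (this.1 h)), mul_zero]
  simp_rw [e3]
  rw [ENNReal.tsum_mul_left]
  refine le_trans (le_of_eq ?_) (mul_le_mul_right (ofReal_sub_one_le_tsum (exp_pos _)) _)
  rw [← ENNReal.ofReal_mul (gaussDensity_nonneg hh z), ENNReal.ofReal_max, ENNReal.ofReal_zero,
    max_eq_left zero_le]
  congr 1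
  simp only [Pi.sub_apply]
  ring

/-- Rearranging a weighted sum of a Dirichlet convolution. -/
lemma tsum_convolution_mul (r s F : ℕ → ENNReal) (hs : s 0 = 0) (hr : r 0 = 0) :
    ∑' n, (∑ p ∈ n.divisorsAntidiagonal, r p.1 * s p.2) * F n =
      ∑' a, r a * ∑' b, s b * F (a * b) := by
  have h1 : ∀ n, (∑ p ∈ n.divisorsAntidiagonal, r p.1 * s p.2) * F n =
      ∑' p : ℕ × ℕ, if p.1 * p.2 = n then r p.1 * s p.2 * F n else 0 := fun n => by
    rw [tsum_eq_sum (s := n.divisorsAntidiagonal), sum_mul]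
    · refine sum_congr rfl fun p hp => ?_
      rw [if_pos (Nat.mem_divisorsAntidiagonal.1 hp).1]
    · intro p hp
      split_ifs with hc
      · have : n = 0 := by
          by_contra h
          exact hp (Nat.mem_divisorsAntidiagonal.2 ⟨hc, h⟩)
        rw [this] at hc
        rcases Nat.mul_eq_zero.1 hc with h | h <;> simp [h, hs, hr]
      · rfl
  simp_rw [h1]
  rw [ENNReal.tsum_comm, ENNReal.tsum_prod']
  refine tsum_congr fun a => ?_
  rw [← ENNReal.tsum_mul_left]
  refine tsum_congr fun b => ?_
  rw [tsum_ite_eq' (a * b)]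
  ring

lemma tsum_squareIndicator_mul (F : ℕ → ENNReal) :
    ∑' b, ENNReal.ofReal (squareIndicator b) * F b = ∑' m : ℕ, F ((m + 1) ^ 2) := by
  have hinj : Function.Injective fun m : ℕ => (m + 1) ^ 2 := fun a b hab => by
    have := Nat.pow_left_injective (n := 2) (by norm_num) hab
    omega
  rw [← hinj.tsum_eq]
  · refine tsum_congr fun m => ?_
    rw [squareIndicator_apply, if_pos ⟨by positivity, IsSquare.sq _⟩]
    simp
  · intro b hb
    rw [Function.mem_support, squareIndicator_apply] at hb
    by_cases hc : b ≠ 0 ∧ IsSquare b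
    · obtain ⟨hb0, r, hr⟩ := hc
      have : r ≠ 0 := fun h => hb0 (by simp [hr, h])
      exact ⟨r - 1, by simp only; rw [Nat.sub_add_cancel (by omega), hr, sq]⟩
    · simp [hc] at hb

lemma rpow_neg_two_mul_le {β : ℝ} (hβ1 : β ≤ 1) (hβ : 3 / 4 ≤ β) {x : ℝ} (hx : 1 ≤ x) :
    x ^ (-(2 * β)) ≤ (1 - 4 * (1 - β)) * (1 / x ^ 2) + 4 * (1 - β) * x ^ (-(1 + 1 / 2) : ℝ) := by
  have hx0 : 0 < x := by linarith
  have h1 : x ^ (2 * (1 - β)) ≤ 1 + 4 * (1 - β) * (x ^ (1 / 2 : ℝ) - 1) := by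
    have h2 : 1 ≤ x ^ (1 / 2 : ℝ) := Real.one_le_rpow hx (by norm_num)
    have := rpow_one_add_le_one_add_mul_self (s := x ^ (1 / 2 : ℝ) - 1) (by linarith)
      (p := 4 * (1 - β)) (by linarith) (by linarith)
    rw [add_sub_cancel, ← rpow_mul hx0.le] at this
    convert this using 2
    ring
  have e1 : x ^ (-(2 * β)) = x ^ (2 * (1 - β)) * (1 / x ^ 2) := by
    rw [one_div, ← rpow_natCast, ← rpow_neg hx0.le, ← rpow_add hx0]
    congr 1; push_cast; ring
  have e2 : x ^ (-(1 + 1 / 2) : ℝ) = x ^ (1 / 2 : ℝ) * (1 / x ^ 2) := by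
    rw [one_div (x ^ 2), ← rpow_natCast, ← rpow_neg hx0.le, ← rpow_add hx0]
    congr 1; norm_num
  rw [e1, e2]
  calc _ ≤ (1 + 4 * (1 - β) * (x ^ (1 / 2 : ℝ) - 1)) * (1 / x ^ 2) := by gcongr
    _ = _ := by ring

lemma tsum_rpow_neg_two_mul_le {β : ℝ} (hβ1 : β ≤ 1) (hβ : 1 - β ≤ 27 / 10000) :
    ∑' m : ℕ, ENNReal.ofReal (((m : ℝ) + 1) ^ (-(2 * β))) ≤ ENNReal.ofReal (5 / 3) := by
  refine ENNReal.tsum_le_of_sum_range_le fun N => ?_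
  rw [← ENNReal.ofReal_sum_of_nonneg fun m _ => by positivity]
  refine ENNReal.ofReal_le_ofReal ?_
  have h1 : ∑ m ∈ Finset.range N, ((m : ℝ) + 1) ^ (-(1 + 1 / 2) : ℝ) ≤ 3 := by
    have := sum_Icc_rpow_neg_le (d := 1 / 2) (by norm_num) N
    rw [← Finset.Ico_add_one_right_eq_Icc, Finset.sum_Ico_eq_sum_range] at this
    simp only [Nat.add_sub_cancel] at this
    norm_num at this
    refine le_trans (le_of_eq (sum_congr rfl fun m _ => ?_)) this
    rw [add_comm]; norm_num
  have h2 : ∑ m ∈ Finset.range N, 1 / ((m : ℝ) + 1) ^ 2 ≤ π ^ 2 / 6 := by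
    have h3 := sum_le_hasSum (Finset.range (N + 1)) (fun _ _ => by positivity) hasSum_zeta_two
    rw [sum_range_succ'] at h3
    push_cast at h3
    simpa using h3
  have h3 : π ^ 2 / 6 ≤ 1645 / 1000 := by nlinarith [pi_lt_d4, pi_gt_three]
  calc _ ≤ ∑ m ∈ Finset.range N, ((1 - 4 * (1 - β)) * (1 / ((m : ℝ) + 1) ^ 2) +
        4 * (1 - β) * ((m : ℝ) + 1) ^ (-(1 + 1 / 2) : ℝ)) :=
        sum_le_sum fun m _ => rpow_neg_two_mul_le hβ1 (by linarith)
          (by linarith [(Nat.cast_nonneg m : (0 : ℝ) ≤ m)])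
    _ ≤ (1 - 4 * (1 - β)) * (1645 / 1000) + 4 * (1 - β) * 3 := by
        rw [sum_add_distrib, ← mul_sum, ← mul_sum]
        exact add_le_add (mul_le_mul_of_nonneg_left (h2.trans h3) (by linarith))
          (mul_le_mul_of_nonneg_left h1 (by linarith))
    _ ≤ 5 / 3 := by linarith

section
variable {h v β : ℝ}

/-- The weight attached to `n` in a smoothed sum with exponent `β`. -/
noncomputable def smoothWeight (h v β : ℝ) (n : ℕ) : ENNReal :=
  ENNReal.ofReal ((n : ℝ) ^ (-β) * smoothExp h 0 (v - log n))

lemma tsum_smoothWeight_le (hh : 0 < h) (hβ1 : β ≤ 1) (hβ : 1 - β ≤ 27 / 10000) {a : ℕ}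
    (ha : a ≠ 0) : ∑' m : ℕ, smoothWeight h v β (a * (m + 1) ^ 2) ≤
      smoothWeight h v β a * ENNReal.ofReal (5 / 3) := by
  refine le_trans ?_ (mul_le_mul_right (tsum_rpow_neg_two_mul_le hβ1 hβ) _)
  rw [← ENNReal.tsum_mul_left]
  refine ENNReal.tsum_le_tsum fun m => ?_
  have ha0 : (0 : ℝ) < a := by positivity
  have h0 := smoothExp_nonneg hh 0 (v - log a)
  rw [smoothWeight, smoothWeight, ← ENNReal.ofReal_mul (by positivity)]
  refine ENNReal.ofReal_le_ofReal ?_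
  have e1 : ((a * (m + 1) ^ 2 : ℕ) : ℝ) ^ (-β) = (a : ℝ) ^ (-β) * ((m : ℝ) + 1) ^ (-(2 * β)) := by
    push_cast
    rw [Real.mul_rpow ha0.le (by positivity), ← rpow_natCast, ← rpow_mul (by positivity)]
    congr 2; push_cast; ring
  have h1 : smoothExp h 0 (v - log (a * (m + 1) ^ 2 : ℕ)) ≤ smoothExp h 0 (v - log a) := by
    refine monotone_smoothExp_zero hh (sub_le_sub_left (log_le_log ha0 ?_) _)
    push_cast
    exact le_mul_of_one_le_right ha0.le
      (one_le_pow₀ (by linarith [(Nat.cast_nonneg m : (0 : ℝ) ≤ m)]))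
  rw [e1]
  calc _ ≤ (a : ℝ) ^ (-β) * ((m : ℝ) + 1) ^ (-(2 * β)) * smoothExp h 0 (v - log a) := by gcongr
    _ = _ := by ring

lemma ofReal_le_tsum_smoothWeight (hh : 0 < h) {a : ℕ} (ha : a ≠ 0) :
    ENNReal.ofReal (exp ((v - log a) / 2 + h ^ 2 / 8) - 1) ≤
      ∑' m : ℕ, smoothWeight h v 0 (a * (m + 1) ^ 2) := by
  refine (ofReal_le_tsum_smoothExp hh _).trans (le_of_eq (tsum_congr fun m => ?_))
  rw [smoothWeight, neg_zero, rpow_zero, one_mul]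
  push_cast
  rw [log_mul (by positivity) (by positivity), log_pow]
  congr 2
  push_cast; ring

lemma le_tsum_smoothWeight (hh : 0 < h) (hβ0 : 0 ≤ β) (hβ1 : β ≤ 1) {W : ℝ} (hW : 0 < W)
    (hWv : W + 1 = exp (v / 2 + h ^ 2 / 8)) {a : ℕ} (ha : a ≠ 0) :
    ENNReal.ofReal (W ^ β) * smoothWeight h v β a ≤
      ∑' m : ℕ, smoothWeight h v 0 (a * (m + 1) ^ 2) := by
  have ha0 : (0 : ℝ) < a := by positivity
  have ha1 : (1 : ℝ) ≤ a := by exact_mod_cast Nat.one_le_iff_ne_zero.2 ha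
  have h0 := smoothExp_nonneg hh 0 (v - log a)
  have e1 : W ^ β * ((a : ℝ) ^ (-β) * smoothExp h 0 (v - log a)) =
      (W / a) ^ β * smoothExp h 0 (v - log a) := by
    rw [Real.div_rpow hW.le ha0.le, rpow_neg ha0.le]; ring
  rw [smoothWeight, ← ENNReal.ofReal_mul (by positivity), e1]
  rcases le_total W a with hc | hc
  · have h1 : smoothWeight h v 0 (a * (0 + 1) ^ 2) ≤
        ∑' m : ℕ, smoothWeight h v 0 (a * (m + 1) ^ 2) :=
      ENNReal.le_tsum (f := fun m : ℕ => smoothWeight h v 0 (a * (m + 1) ^ 2)) 0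
    refine le_trans (ENNReal.ofReal_le_ofReal ?_) h1
    rw [zero_add, one_pow, mul_one, neg_zero, rpow_zero]
    refine mul_le_mul_of_nonneg_right (Real.rpow_le_one (by positivity) ?_ hβ0) h0
    exact (div_le_one ha0).2 hc
  · refine le_trans (ENNReal.ofReal_le_ofReal ?_) (ofReal_le_tsum_smoothWeight hh ha)
    have h1 : (1 : ℝ) ≤ W / a := (one_le_div ha0).2 hc
    have e2 : exp ((v - log a) / 2 + h ^ 2 / 8) = (W + 1) / √a := by
      rw [hWv, sqrt_eq_rpow, rpow_def_of_pos ha0, ← exp_sub]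
      congr 1; ring
    have hs : 1 ≤ √(a : ℝ) := Real.one_le_sqrt.2 ha1
    have hsq := sq_sqrt ha0.le
    calc _ ≤ (W / a) ^ β * 1 :=
          mul_le_mul_of_nonneg_left (smoothExp_zero_le_one hh _) (by positivity)
      _ ≤ W / a := by
          rw [mul_one]
          exact (rpow_le_rpow_of_exponent_le h1 hβ1).trans_eq (rpow_one _)
      _ ≤ _ := by
          have e3 : W / (a : ℝ) = W / √a ^ 2 := by rw [hsq]
          rw [e2, le_sub_iff_add_le, e3, div_add_one (by positivity), div_le_div_iff₀
            (by positivity) (by positivity)]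
          have hc' : √(a : ℝ) ^ 2 ≤ W := hsq.trans_le hc
          have h3 : 0 ≤ (√(a : ℝ) - 1) * (W + 1 - (√a + 1)) :=
            mul_nonneg (by linarith) (by nlinarith)
          nlinarith [mul_nonneg (zero_le_one.trans hs) h3]

variable {f : ℕ} {χ : DirichletCharacter ℂ f}

lemma tsum_twistedDivisorCoeff_mul (hf : f ≠ 1) (hq : χ ^ 2 = 1) (hh : 0 < h) {S : ℂ}
    (hS : HasSum (fun n : ℕ => twistedDivisorCoeff χ n * (n : ℂ) ^ (-β : ℂ) *
      smoothExp h 0 (v - log n)) S) :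
    ‖S‖ = S.re ∧ ENNReal.ofReal S.re = ∑' a : ℕ,
      ENNReal.ofReal ((squarefreeIndicator * quadraticFunction χ hf) a) *
        ∑' m : ℕ, smoothWeight h v β (a * (m + 1) ^ 2) := by
  set r := squarefreeIndicator * quadraticFunction χ hf with hr
  have hr0 : ∀ n, 0 ≤ r n := squarefreeIndicator_mul_quadraticFunction_nonneg hf hq
  have hs0 : ∀ n, 0 ≤ squareIndicator n := fun n => by
    rw [squareIndicator_apply]; split_ifs <;> norm_num
  have hrs : ∀ n, 0 ≤ (r * squareIndicator) n := fun n => by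
    rw [ArithmeticFunction.mul_apply]
    exact Finset.sum_nonneg fun p _ => mul_nonneg (hr0 _) (hs0 _)
  have ht : ∀ n : ℕ, twistedDivisorCoeff χ n * (n : ℂ) ^ (-β : ℂ) *
      smoothExp h 0 (v - log n) = (((r * squareIndicator) n *
        ((n : ℝ) ^ (-β) * smoothExp h 0 (v - log n)) : ℝ) : ℂ) := fun n => by
    rw [twistedDivisorCoeff_eq hf hq]
    push_cast
    rw [Complex.ofReal_cpow (Nat.cast_nonneg n)]
    push_cast
    ring
  have hn0 : ∀ n : ℕ, 0 ≤ (n : ℝ) ^ (-β) * smoothExp h 0 (v - log n) := fun n =>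
    mul_nonneg (by positivity) (smoothExp_nonneg hh _ _)
  simp_rw [ht] at hS
  have hre := Complex.hasSum_re hS
  simp only [Complex.ofReal_re] at hre
  have him := Complex.hasSum_im hS
  simp only [Complex.ofReal_im] at him
  have him0 : S.im = 0 := him.unique hasSum_zero
  have hS0 : 0 ≤ S.re := hre.nonneg fun n => mul_nonneg (hrs n) (hn0 n)
  refine ⟨?_, ?_⟩
  · rw [show S = (S.re : ℂ) from Complex.ext rfl (by simpa using him0), norm_real,
      Complex.ofReal_re, norm_of_nonneg hS0]
  · rw [← hre.tsum_eq, ENNReal.ofReal_tsum_of_nonneg (fun n => mul_nonneg (hrs n) (hn0 n))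
      hre.summable]
    have e1 : ∀ n, ENNReal.ofReal ((r * squareIndicator) n *
        ((n : ℝ) ^ (-β) * smoothExp h 0 (v - log n))) =
        (∑ p ∈ n.divisorsAntidiagonal, ENNReal.ofReal (r p.1) *
          ENNReal.ofReal (squareIndicator p.2)) * smoothWeight h v β n := fun n => by
      rw [ENNReal.ofReal_mul (hrs n), ArithmeticFunction.mul_apply,
        ENNReal.ofReal_sum_of_nonneg fun p _ => mul_nonneg (hr0 _) (hs0 _)]
      simp_rw [ENNReal.ofReal_mul (hr0 _)]
      rfl
    simp_rw [e1]
    rw [tsum_convolution_mul (fun a => ENNReal.ofReal (r a))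
      (fun b => ENNReal.ofReal (squareIndicator b)) _ (by simp) (by simp)]
    simp_rw [tsum_squareIndicator_mul]

/-- Comparison of the smoothed sums of the coefficients of `ζ(s) L(s, χ)` at exponents `0`
and `β`. -/
theorem rpow_mul_re_le (hf : f ≠ 1) (hq : χ ^ 2 = 1) (hh : 0 < h) (hβ1 : β ≤ 1)
    (hβ : 1 - β ≤ 27 / 10000) {W : ℝ} (hW : 0 < W)
    (hWv : W + 1 = exp (v / 2 + h ^ 2 / 8)) {S₁ S₂ : ℂ}
    (hS₁ : HasSum (fun n : ℕ => twistedDivisorCoeff χ n * (n : ℂ) ^ (-(0 : ℝ) : ℂ) *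
      smoothExp h 0 (v - log n)) S₁)
    (hS₂ : HasSum (fun n : ℕ => twistedDivisorCoeff χ n * (n : ℂ) ^ (-β : ℂ) *
      smoothExp h 0 (v - log n)) S₂) :
    W ≤ ‖S₁‖ ∧ W ^ β * ‖S₂‖ ≤ 5 / 3 * ‖S₁‖ := by
  obtain ⟨n1, e1⟩ := tsum_twistedDivisorCoeff_mul hf hq hh hS₁
  obtain ⟨n2, e2⟩ := tsum_twistedDivisorCoeff_mul hf hq hh hS₂
  rw [← n1] at e1
  rw [← n2] at e2
  set r := squarefreeIndicator * quadraticFunction χ hf with hr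
  constructor
  · rw [← ENNReal.ofReal_le_ofReal_iff (norm_nonneg _), e1]
    refine le_trans ?_ (ENNReal.le_tsum 1)
    have h1 := ofReal_le_tsum_smoothWeight (v := v) hh one_ne_zero
    rw [Nat.cast_one, Real.log_one, sub_zero, ← hWv, add_sub_cancel_right] at h1
    rw [(isMultiplicative_squarefreeIndicator.mul (isMultiplicative_quadraticFunction hf hq)).1,
      ENNReal.ofReal_one, one_mul]
    exact h1
  · rw [← ENNReal.ofReal_le_ofReal_iff (by positivity), ENNReal.ofReal_mul (by positivity),
      ENNReal.ofReal_mul (by positivity), e1, e2, ← ENNReal.tsum_mul_left, ← ENNReal.tsum_mul_left]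
    refine ENNReal.tsum_le_tsum fun a => ?_
    rcases eq_or_ne a 0 with rfl | ha
    · simp
    have u := tsum_smoothWeight_le (v := v) hh hβ1 hβ ha
    have l := le_tsum_smoothWeight hh (by linarith) hβ1 hW hWv ha
    calc _ ≤ ENNReal.ofReal (W ^ β) * (ENNReal.ofReal (r a) *
          (smoothWeight h v β a * ENNReal.ofReal (5 / 3))) := by gcongr
      _ = ENNReal.ofReal (5 / 3) * (ENNReal.ofReal (r a) *
          (ENNReal.ofReal (W ^ β) * smoothWeight h v β a)) := by ring
      _ ≤ _ := by gcongr

end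

lemma leftMoment_le : (2 * π)⁻¹ * (((2 * π) ^ 4)⁻¹ * (137 / 100) ^ 2) *
    leftMoment (17 / 20) ≤ 2536 / 1000000 := by
  have hp : 31415 / 10000 < π := by linarith [pi_gt_d4]
  have h1 : √(2 * π) ≤ 25067 / 10000 :=
    sqrt_le_iff.2 ⟨by norm_num, by nlinarith [pi_lt_d4]⟩
  have h2 : leftMoment (17 / 20) ≤ 1322 / 100 := by
    rw [leftMoment]
    calc _ ≤ (25067 / 10000 : ℝ) / (17 / 20) * (3 / 8 + 19 / 12 / (17 / 20) ^ 2 + 1 / (17 / 20) ^ 4) := by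
          gcongr
      _ ≤ _ := by norm_num
  have h3 : (2 * π)⁻¹ * (((2 * π) ^ 4)⁻¹ * (137 / 100) ^ 2) ≤
      (2 * (31415 / 10000))⁻¹ * (((2 * (31415 / 10000)) ^ 4)⁻¹ * (137 / 100) ^ 2) := by gcongr
  calc _ ≤ (2 * (31415 / 10000 : ℝ))⁻¹ * (((2 * (31415 / 10000)) ^ 4)⁻¹ * (137 / 100) ^ 2) * (1322 / 100) := by
        gcongr
        rw [leftMoment]; positivity
    _ ≤ _ := by norm_num

lemma exp_mem_Icc : exp (289 / 3200) ∈ Set.Icc (10943 / 10000) (10946 / 10000 : ℝ) := by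
  constructor
  · refine le_trans ?_ (Real.quadratic_le_exp_of_nonneg (by norm_num))
    norm_num
  · refine (Real.exp_bound' (by norm_num) (by norm_num) (n := 4) (by norm_num)).trans ?_
    norm_num [sum_range_succ, Nat.factorial]

lemma norm_LFunction_zero_le {f : ℕ} [NeZero f] {χ : DirichletCharacter ℂ f}
    (hχ : χ.IsPrimitive) (hf : f ≠ 1) (hq : χ ^ 2 = 1) :
    ‖LFunction χ 0‖ ≤
      √f / π * ‖LFunction χ 1‖ := by
  have h1 := norm_LFunction_one_sub_le_of_le hχ hf (s := 1) (by simp) (M := 1)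
    (by rw [mul_one, ← Complex.ofReal_ofNat, ← Complex.ofReal_div, ← Complex.ofReal_cos]; simp)
    (by rw [mul_one, ← Complex.ofReal_ofNat, ← Complex.ofReal_div, ← Complex.ofReal_sin]; simp)
  have hinv : χ⁻¹ = χ := by rw [inv_eq_iff_mul_eq_one, ← sq, hq]
  rw [sub_self, hinv, Complex.Gammaℂ_one, one_re] at h1
  refine h1.trans (le_of_eq ?_)
  rw [mul_one, norm_div, norm_one, norm_real, norm_of_nonneg pi_pos.le,
    sqrt_eq_rpow]
  norm_num only
  ring

lemma log_div_le {s : ℝ} (hs : 316 ≤ s) : log s / s ≤ 186 / 10000 := by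
  have h1 : log s ≤ log 512 + (s / 512 - 1) := by
    have := log_le_sub_one_of_pos (show 0 < s / 512 by linarith)
    rw [log_div (by linarith) (by norm_num)] at this
    linarith
  have h2 : log 512 ≤ 624 / 100 := by
    rw [show (512 : ℝ) = 2 ^ 9 by norm_num, log_pow]
    push_cast
    linarith [log_two_lt_d9]
  rw [div_le_iff₀ (by linarith)]
  linarith

/-- The numerical inequality behind the lower bound for the distance from `1` of a real zero. -/
lemma realZero_inequality {s w y W Wβ ℓ S₁ S₂ e₁ e₂ D d : ℝ} (hs : 316 ≤ s)
    (hw : 24494 / 10000 ≤ w) (hw' : w ≤ 24495 / 10000)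
    (hy : y ∈ Set.Icc (10943 / 10000) (10946 / 10000 : ℝ)) (hW : W + 1 = s / w * y)
    (hℓ : 0 ≤ ℓ) (he₁ : e₁ ≤ 2536 / 1000000 * (6 * w) * y ^ 9 * s)
    (he₂ : e₂ ≤ 2536 / 1000000 * (36 * w) * y ^ 25 * (105 / 100) / s)
    (hD : D ≤ s ^ 2 / 6 * y ^ 4 + s / (2 * (31415 / 10000))) (hWβ : 984 / 1000 * W ≤ Wβ) (hWβ' : Wβ ≤ W)
    (h1 : S₁ ≤ e₁ + ℓ * D) (h2 : ℓ / d - e₂ ≤ S₂) (h3 : W ≤ S₁)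
    (h4 : Wβ * S₂ ≤ 5 / 3 * S₁) (hd : 0 < d) (he₂0 : 0 ≤ e₂) : 85 / 100 / s ≤ d := by
  by_contra hc
  push Not at hc
  have hs0 : 0 < s := by linarith
  obtain ⟨hy1, hy2⟩ := hy
  have hy0 : 0 < y := by linarith
  have k1 : e₁ ≤ 845 / 10000 * s := by
    refine he₁.trans (mul_le_mul_of_nonneg_right ?_ hs0.le)
    calc _ ≤ 2536 / 1000000 * (6 * (24495 / 10000)) * (10946 / 10000 : ℝ) ^ 9 := by gcongr
      _ ≤ _ := by norm_num
  have k2 : e₂ ≤ 24 / 10 / s := by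
    refine he₂.trans (div_le_div_of_nonneg_right ?_ hs0.le)
    calc _ ≤ 2536 / 1000000 * (36 * (24495 / 10000)) * (10946 / 10000 : ℝ) ^ 25 * (105 / 100) := by
          gcongr
      _ ≤ _ := by norm_num
  have k3 : D ≤ 2398 / 10000 * s ^ 2 := by
    have a1 : y ^ 4 ≤ (10946 / 10000 : ℝ) ^ 4 := by gcongr
    have a2 : s ^ 2 / 6 * y ^ 4 ≤ s ^ 2 / 6 * (10946 / 10000 : ℝ) ^ 4 := by gcongr
    have a3 : s / (2 * (31415 / 10000)) ≤ 16 / 100 / 316 * s ^ 2 := by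
      rw [div_le_iff₀ (by norm_num)]; nlinarith
    have a4 : s ^ 2 / 6 * (10946 / 10000 : ℝ) ^ 4 + 16 / 100 / 316 * s ^ 2 ≤
        2398 / 10000 * s ^ 2 := by nlinarith [sq_nonneg s]
    linarith
  have k4 : 4435 / 10000 * s ≤ W := by
    have a1 : s / w * y ≥ s / (24495 / 10000) * (10943 / 10000) := by gcongr
    norm_num at a1
    linarith
  have k5 : W ≤ 447 / 1000 * s := by
    have a1 : s / w * y ≤ s / (24494 / 10000) * (10946 / 10000) := by gcongr
    norm_num at a1
    linarith
  have k6 : W * e₂ ≤ 34 / 10000 * s := by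
    calc W * e₂ ≤ 447 / 1000 * s * (24 / 10 / s) := by gcongr
      _ ≤ 447 / 1000 * (24 / 10) := by field_simp; linarith
      _ ≤ _ := by linarith
  have k7 : 359 / 1000 * s ≤ ℓ * (2398 / 10000 * s ^ 2) := by nlinarith
  have k8 : ℓ * s ≤ 85 / 100 * (ℓ / d) := by
    rw [lt_div_iff₀ hs0] at hc
    rw [← mul_div_assoc, le_div_iff₀ hd]
    nlinarith
  have k9 : 984 / 1000 * W * (ℓ / d) ≤ 5 / 3 * S₁ + 34 / 10000 * s := by
    have : 0 ≤ ℓ / d := by positivity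
    have a1 : Wβ * (ℓ / d - e₂) ≤ 5 / 3 * S₁ :=
      (mul_le_mul_of_nonneg_left h2 (by nlinarith)).trans h4
    nlinarith
  have k10 : 984 / 1000 * (4435 / 10000 * s) * (ℓ * s) ≤
      85 / 100 * (5 / 3 * (845 / 10000 * s + ℓ * (2398 / 10000 * s ^ 2)) + 34 / 10000 * s) := by
    have a1 : ℓ * D ≤ ℓ * (2398 / 10000 * s ^ 2) := mul_le_mul_of_nonneg_left k3 hℓ
    calc _ ≤ 984 / 1000 * W * (85 / 100 * (ℓ / d)) := by
          refine mul_le_mul (by linarith) k8 (by positivity) ?_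
          linarith [mul_pos (by norm_num : (0 : ℝ) < 4435 / 10000) hs0]
      _ = 85 / 100 * (984 / 1000 * W * (ℓ / d)) := by ring
      _ ≤ 85 / 100 * (5 / 3 * S₁ + 34 / 10000 * s) := by gcongr
      _ ≤ _ := by linarith
  nlinarith

set_option maxHeartbeats 800000 in
/-- Real zeros of quadratic `L`-functions are not too close to `1`. -/
theorem le_one_sub_of_LFunction_eq_zero {f : ℕ} [NeZero f] {χ : DirichletCharacter ℂ f}
    (hχ : χ.IsPrimitive) (hf : f ≠ 1) (hq : χ ^ 2 = 1) {Q : ℝ} (hQ : (10 : ℝ) ^ 5 ≤ Q)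
    (hfQ : (f : ℝ) ≤ Q) {β : ℝ} (hβ1 : β < 1) (h0 : LFunction χ β = 0) :
    85 / 100 / √Q ≤ 1 - β := by
  by_contra! hc
  have hQ0 : 0 < Q := by linarith [pow_pos (by norm_num : (0 : ℝ) < 10) 5]
  set s := √Q with hsdef
  have hs : 316 ≤ s := le_sqrt_of_sq_le (by linarith)
  have hs0 : 0 < s := by linarith
  have hsq : s ^ 2 = Q := sq_sqrt hQ0.le
  have hβ : 1 - β ≤ 27 / 10000 := by
    refine hc.le.trans ?_
    rw [div_le_iff₀ hs0]; linarith
  set w := √(6 : ℝ) with hwdef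
  have hw : 24494 / 10000 ≤ w := le_sqrt_of_sq_le (by norm_num)
  have hw' : w ≤ 24495 / 10000 := sqrt_le_iff.2 ⟨by norm_num, by norm_num⟩
  have hw0 : 0 < w := by linarith
  have hw2 : w ^ 2 = 6 := sq_sqrt (by norm_num)
  set u := log (s / w) with hu
  have hsw : 0 < s / w := by positivity
  have hu1 : exp u = s / w := exp_log hsw
  have hu0 : 0 ≤ u := log_nonneg ((one_le_div hw0).2 (by linarith))
  have hus : u ≤ log s :=
    log_le_log hsw (div_le_self hs0.le (by linarith))
  set y := exp (289 / 3200) with hy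
  have hyI := exp_mem_Icc
  rw [← hy] at hyI
  have hh : (0 : ℝ) < 17 / 20 := by norm_num
  have hl := log_div_le hs
  rw [div_le_iff₀ hs0] at hl
  have hdl : (1 - β) * log s ≤ 159 / 10000 := by
    have h1 : (1 - β) * s ≤ 85 / 100 := ((lt_div_iff₀ hs0).1 hc).le
    calc _ ≤ (1 - β) * (186 / 10000 * s) := mul_le_mul_of_nonneg_left hl (by linarith)
      _ ≤ _ := by linarith
  have hyW : 1 < s / w * y := by
    have : 1 < s / w := (one_lt_div hw0).2 (by linarith)
    nlinarith [hyI.1]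
  set W := s / w * y - 1 with hWdef
  have hWv : W + 1 = exp (2 * u / 2 + (17 / 20 : ℝ) ^ 2 / 8) := by
    rw [mul_div_cancel_left₀ _ two_ne_zero, exp_add, hu1, hWdef, hy]
    norm_num
  have hW1 : 1 ≤ W := by
    have : 2 ≤ s / w := (le_div_iff₀ hw0).2 (by linarith)
    nlinarith [hyI.1]
  have hWs : W ≤ s := by
    have : s / w ≤ s / 2 := by gcongr; linarith
    nlinarith [hyI.2]
  obtain ⟨E₁, hE₁, hS₁⟩ := exists_hasSum_twistedDivisorCoeff hχ hf hh le_rfl zero_lt_one (2 * u)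
  obtain ⟨E₂, hE₂, hS₂⟩ := exists_hasSum_twistedDivisorCoeff hχ hf hh (by linarith) hβ1 (2 * u)
  obtain ⟨h3, h4⟩ := rpow_mul_re_le hf hq hh hβ1.le hβ (by linarith) hWv hS₁ hS₂
  have hfs : (f : ℝ) ^ 2 ≤ s ^ 4 := by
    rw [show s ^ 4 = (s ^ 2) ^ 2 by ring, hsq]; gcongr
  have hM0 : 0 ≤ leftMoment (17 / 20) := by rw [leftMoment]; positivity
  have hE : ∀ {e b : ℝ}, 0 ≤ b → exp e ≤ b → (2 * π)⁻¹ * ((f : ℝ) ^ 2 *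
      (((2 * π) ^ 4)⁻¹ * (137 / 100) ^ 2) * exp e * leftMoment (17 / 20)) ≤
      2536 / 1000000 * (s ^ 4 * b) := fun {e b} hb heb => by
    calc _ = ((2 * π)⁻¹ * (((2 * π) ^ 4)⁻¹ * (137 / 100) ^ 2) *
          leftMoment (17 / 20)) * ((f : ℝ) ^ 2 * exp e) := by ring
      _ ≤ 2536 / 1000000 * ((f : ℝ) ^ 2 * exp e) := by gcongr; exact leftMoment_le
      _ ≤ _ := by gcongr
  have hexp : ∀ n : ℕ, exp (-((n : ℝ) * u)) = (w / s) ^ n := fun n => by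
    rw [Real.exp_neg, exp_nat_mul, hu1, ← inv_pow, inv_div]
  have hypow : ∀ n : ℕ, exp ((n : ℝ) * (289 / 3200)) = y ^ n := fun n => by
    rw [exp_nat_mul]
  have he₁ : ‖E₁‖ ≤ 2536 / 1000000 * (6 * w) * y ^ 9 * s := by
    refine (hE₁.trans (hE (b := (w / s) ^ 3 * y ^ 9) (by positivity) (le_of_eq ?_))).trans
      (le_of_eq ?_)
    · rw [← hexp, ← hypow, ← exp_add]
      congr 1; push_cast; ring
    · field_simp
      rw [← hw2]; ring
  have he₂ : ‖E₂‖ ≤ 2536 / 1000000 * (36 * w) * y ^ 25 * (105 / 100) / s := by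
    refine (hE₂.trans (hE (b := (w / s) ^ 5 * y ^ 25 * (105 / 100)) (by positivity) ?_)).trans
      (le_of_eq ?_)
    · have h1 : exp (2 * ((1 - β) * u)) ≤ 105 / 100 := by
        have h2 : 2 * ((1 - β) * u) ≤ 1 / 21 := by
          have := mul_le_mul_of_nonneg_left hus (by linarith : 0 ≤ 1 - β)
          linarith
        refine (exp_le_exp.2 h2).trans ?_
        have := Real.exp_bound_div_one_sub_of_interval (x := 1 / 21) (by norm_num) (by norm_num)
        norm_num at this ⊢
        linarith
      calc _ ≤ exp (-((5 : ℕ) * u) + (25 : ℕ) * (289 / 3200) + 2 * ((1 - β) * u)) := by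
            refine exp_le_exp.2 ?_
            push_cast
            nlinarith
        _ = (w / s) ^ 5 * y ^ 25 * exp (2 * ((1 - β) * u)) := by
            rw [exp_add, exp_add, hexp, hypow]
        _ ≤ _ := by gcongr
    · field_simp
      rw [show (36 : ℝ) = (w ^ 2) ^ 2 by rw [hw2]; norm_num]; ring
  have hWβ' : W ^ β ≤ W := (rpow_le_rpow_of_exponent_le hW1 hβ1.le).trans_eq (rpow_one W)
  have hWβ : 984 / 1000 * W ≤ W ^ β := by
    have h1 : W ^ β = W * exp (-((1 - β) * log W)) := by
      rw [rpow_def_of_pos (by linarith)]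
      nth_rewrite 2 [← exp_log (by linarith : 0 < W)]
      rw [← exp_add]; congr 1; ring
    have h2 : (1 - β) * log W ≤ 16 / 1000 := by
      have := mul_le_mul_of_nonneg_left (log_le_log (by linarith) hWs)
        (by linarith : 0 ≤ 1 - β)
      linarith
    have h3 := add_one_le_exp (-((1 - β) * log W))
    rw [h1]
    nlinarith
  have hz : zetaEntire ((0 : ℝ) : ℂ) = 1 / 2 := by
    rw [Complex.ofReal_zero, zetaEntire_of_ne_one zero_ne_one, riemannZeta_zero]; norm_num
  set ℓ := ‖LFunction χ 1‖ with hℓ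
  have hsf : √(f : ℝ) ≤ s := Real.sqrt_le_sqrt hfQ
  refine absurd (realZero_inequality (d := 1 - β) (ℓ := ℓ) (e₁ := ‖E₁‖) (e₂ := ‖E₂‖)
    (D := s ^ 2 / 6 * y ^ 4 + s / (2 * (31415 / 10000))) hs hw hw' hyI (sub_add_cancel _ _) (norm_nonneg _)
    he₁ he₂ le_rfl hWβ hWβ' ?_ ?_ h3 h4 (by linarith) (norm_nonneg _)) (not_le.2 hc)
  · refine (norm_add_le _ _).trans (add_le_add le_rfl ((norm_sub_le _ _).trans ?_))
    rw [hz, Complex.ofReal_zero, sub_zero, div_one, div_one, norm_mul, norm_mul, ← hℓ, mul_add,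
      norm_real, norm_of_nonneg (exp_pos _).le]
    refine add_le_add (mul_le_mul_of_nonneg_left (le_of_eq ?_) (norm_nonneg _)) ?_
    · rw [show ((1 : ℝ) - 0) * (2 * u) + (1 - 0) ^ 2 * (17 / 20) ^ 2 / 2 =
        (2 : ℕ) * u + (4 : ℕ) * (289 / 3200) by push_cast; ring, exp_add, hypow,
        exp_nat_mul, hu1, div_pow, hw2]
    · have h5 := norm_LFunction_zero_le hχ hf hq
      have h6 : √(f : ℝ) / π ≤ s / (31415 / 10000) := by
        have : 31415 / 10000 ≤ π := by linarith [pi_gt_d4]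
        gcongr
      rw [← hℓ] at h5
      have h7 := h5.trans (mul_le_mul_of_nonneg_right h6 (norm_nonneg _))
      rw [show ‖(1 / 2 : ℂ)‖ = 1 / 2 by norm_num]
      refine (mul_le_mul_of_nonneg_left h7 (by norm_num)).trans (le_of_eq ?_)
      ring
  · have e1 : E₂ + (LFunction χ 1 / (1 - β) *
          exp ((1 - β) * (2 * u) + (1 - β) ^ 2 * (17 / 20) ^ 2 / 2) -
          zetaEntire β * LFunction χ β / (1 - β)) =
        LFunction χ 1 / (1 - β) *
          exp ((1 - β) * (2 * u) + (1 - β) ^ 2 * (17 / 20) ^ 2 / 2) + E₂ := by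
      rw [h0]; ring
    rw [e1]
    refine le_trans (sub_le_sub_right ?_ _) (norm_sub_le_norm_add _ _)
    rw [norm_mul, norm_div, ← hℓ, norm_real, norm_of_nonneg (exp_pos _).le,
      show (1 - (β : ℂ)) = ((1 - β : ℝ) : ℂ) by push_cast; rfl, norm_real,
      norm_of_nonneg (by linarith : 0 ≤ 1 - β)]
    refine le_mul_of_one_le_right (div_nonneg (norm_nonneg _) (by linarith))
      (one_le_exp (add_nonneg (mul_nonneg (by linarith) (by linarith)) (by positivity)))

lemma le_two_mul_totient_sq (n : ℕ) : n ≤ 2 * n.totient ^ 2 ∧ (Odd n → n ≤ n.totient ^ 2) := by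
  induction n using Nat.recOnPosPrimePosCoprime with
  | zero => simp
  | one => simp
  | prime_pow p k hp hk =>
    obtain ⟨j, rfl⟩ : ∃ j, k = j + 1 := ⟨k - 1, by omega⟩
    rw [Nat.totient_prime_pow_succ hp, pow_succ]
    have h1 : p ^ j ≤ (p ^ j) ^ 2 := Nat.le_self_pow two_ne_zero _
    rcases hp.two_le.eq_or_lt with rfl | h3
    · refine ⟨by norm_num; nlinarith, fun h => ?_⟩
      exact absurd (Nat.odd_mul.mp h).2 (by decide)
    · have h2 : p ≤ (p - 1) ^ 2 := by
        obtain ⟨m, rfl⟩ : ∃ m, p = m + 3 := ⟨p - 3, by omega⟩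
        simp only [show m + 3 - 1 = m + 2 by omega]
        nlinarith
      have h4 : p ^ j * p ≤ (p ^ j * (p - 1)) ^ 2 := by
        rw [mul_pow]; exact Nat.mul_le_mul h1 h2
      exact ⟨h4.trans (by omega), fun _ => h4⟩
  | coprime a b ha hb hab iha ihb =>
    rw [Nat.totient_mul hab]
    refine ⟨?_, fun h => ?_⟩
    · rcases Nat.even_or_odd a with h | h
      · have hb' : Odd b := by
          rw [← Nat.not_even_iff_odd]
          intro h'
          have := Nat.dvd_gcd h.two_dvd h'.two_dvd
          rw [hab] at this
          omega
        calc a * b ≤ (2 * a.totient ^ 2) * b.totient ^ 2 := Nat.mul_le_mul iha.1 (ihb.2 hb')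
          _ = _ := by ring
      · calc a * b ≤ a.totient ^ 2 * (2 * b.totient ^ 2) := Nat.mul_le_mul (iha.2 h) ihb.1
          _ = _ := by ring
    · rw [Nat.odd_mul] at h
      rw [mul_pow]
      exact Nat.mul_le_mul (iha.2 h.1) (ihb.2 h.2)
/-- The Chernoff bound for the smoothed step function. -/
lemma smoothExp_zero_le_exp {h : ℝ} (hh : 0 < h) (σ : ℝ) (hσ : 0 ≤ σ) (y : ℝ) :
    smoothExp h 0 y ≤ exp (σ * y + σ ^ 2 * h ^ 2 / 2) := by
  rcases le_total 0 y with hy | hy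
  · exact (smoothExp_zero_le_one hh y).trans (one_le_exp (by positivity))
  · have := smoothExp_zero_neg_le hh (neg_nonneg.mpr hy)
    rw [neg_neg] at this
    refine this.trans (exp_le_exp.mpr ?_)
    have h1 : σ * y + σ ^ 2 * h ^ 2 / 2 + (-y) ^ 2 / (2 * h ^ 2) = (y / h + σ * h) ^ 2 / 2 := by
      field_simp
      ring
    nlinarith [sq_nonneg (y / h + σ * h)]

lemma smoothExp_zero_le_rpow {h : ℝ} (hh : 0 < h) (σ : ℝ) (hσ : 0 ≤ σ) (v : ℝ) {n : ℕ}
    (hn : n ≠ 0) : smoothExp h 0 (v - log n) ≤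
      exp (σ * v + σ ^ 2 * h ^ 2 / 2) * (n : ℝ) ^ (-σ) := by
  refine (smoothExp_zero_le_exp hh σ hσ _).trans (le_of_eq ?_)
  rw [rpow_def_of_pos (by positivity), ← exp_add]
  ring_nf

lemma summable_vonMangoldt_mul_rpow {σ : ℝ} (hσ : 1 < σ) :
    Summable (fun n : ℕ => Λ n * (n : ℝ) ^ (-σ)) ∧
    ∑' n : ℕ, Λ n * (n : ℝ) ^ (-σ) ≤
      2 / (σ - 1) * (1 + 2 / (σ - 1)) := by
  have h0 : ∀ n : ℕ, LSeries.term ((fun n : ℕ => (1 : DirichletCharacter ℂ 1) n) *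
      fun n => (Λ n : ℂ)) σ n =
      ((Λ n * (n : ℝ) ^ (-σ) : ℝ) : ℂ) := by
    intro n
    rcases Nat.eq_zero_or_pos n with rfl | hn
    · simp
    · have h1 : (1 : DirichletCharacter ℂ 1) (n : ZMod 1) = 1 := by
        rw [Subsingleton.elim (n : ZMod 1) 1, map_one]
      rw [LSeries.term_of_ne_zero hn.ne', Pi.mul_apply, h1, one_mul, Complex.ofReal_mul,
        Complex.ofReal_cpow (Nat.cast_nonneg n), Complex.ofReal_neg, Complex.cpow_neg]
      simp [div_eq_mul_inv]
  have h1 := DirichletCharacter.LSeriesSummable_twist_vonMangoldt (1 : DirichletCharacter ℂ 1)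
    (s := σ) (by simpa using hσ)
  have h2 := norm_LSeries_twist_vonMangoldt_le (1 : DirichletCharacter ℂ 1) (s := σ)
    (by simpa using hσ)
  rw [LSeries, tsum_congr h0, ← Complex.ofReal_tsum, norm_real] at h2
  rw [LSeriesSummable, summable_congr h0] at h1
  exact ⟨by exact_mod_cast h1, (Real.le_norm_self _).trans (by simpa using h2)⟩

lemma summable_vonMangoldt_mul_smoothExp {h : ℝ} (hh : 0 < h) (v : ℝ) :
    Summable (fun n : ℕ => Λ n *
      smoothExp h 0 (v - log n)) := by
  refine Summable.of_nonneg_of_le (fun n => mul_nonneg vonMangoldt_nonneg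
    (smoothExp_nonneg hh _ _)) (fun n => ?_)
    ((summable_vonMangoldt_mul_rpow one_lt_two).1.mul_left
      (exp (2 * v + 2 ^ 2 * h ^ 2 / 2)))
  rcases Nat.eq_zero_or_pos n with rfl | hn
  · simp
  · have h1 := mul_le_mul_of_nonneg_left (smoothExp_zero_le_rpow hh 2 zero_le_two v hn.ne')
      (vonMangoldt_nonneg (n := n))
    exact h1.trans (le_of_eq (by ring))

lemma sum_vonMangoldt_not_coprime_le {q : ℕ} (hq : q ≠ 0) (N : ℕ) :
    ∑ n ∈ Finset.range N, (if n.Coprime q then 0 else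
      Λ n * (n : ℝ) ^ (-(1 / 2) : ℝ)) ≤ 2 * q := by
  have hpos : ∀ n : ℕ, 0 ≤ Λ n * (n : ℝ) ^ (-(1 / 2) : ℝ) :=
    fun n => mul_nonneg vonMangoldt_nonneg (by positivity)
  set S := (q.primeFactors ×ˢ Finset.range N).image fun r => r.1 ^ (r.2 + 1)
  have h1 : ∑ n ∈ Finset.range N, (if n.Coprime q then 0 else
      Λ n * (n : ℝ) ^ (-(1 / 2) : ℝ)) ≤
      ∑ n ∈ S, Λ n * (n : ℝ) ^ (-(1 / 2) : ℝ) := by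
    rw [← Finset.sum_filter_of_ne (p := fun n => n ∈ S)]
    · rw [sum_filter]
      calc _ ≤ ∑ n ∈ Finset.range N, if n ∈ S then
            Λ n * (n : ℝ) ^ (-(1 / 2) : ℝ) else 0 := by
            refine sum_le_sum fun n _ => ?_
            split_ifs <;> first | exact le_rfl | exact hpos n
        _ ≤ _ := by
            rw [← sum_filter]
            exact sum_le_sum_of_subset_of_nonneg (fun n hn => (mem_filter.mp hn).2)
              fun n _ _ => hpos n
    · intro n hn h
      split_ifs at h with hc
      · exact absurd rfl h
      have hL := left_ne_zero_of_mul h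
      rw [ArithmeticFunction.vonMangoldt_ne_zero_iff, isPrimePow_nat_iff] at hL
      obtain ⟨p, k, hp, hk, rfl⟩ := hL
      have hpq : p ∣ q := by
        by_contra hpq
        exact hc (((Nat.Prime.coprime_iff_not_dvd hp).mpr hpq).pow_left k)
      refine Finset.mem_image.mpr ⟨(p, k - 1), Finset.mem_product.mpr
        ⟨Nat.mem_primeFactors.mpr ⟨hp, hpq, hq⟩, Finset.mem_range.mpr ?_⟩, ?_⟩
      · have := Nat.lt_pow_self hp.one_lt (n := k)
        have := Finset.mem_range.mp hn
        simp only
        omega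
      · simp only [Nat.sub_add_cancel hk]
  have h2 : ∀ p ∈ q.primeFactors, ∑ k ∈ Finset.range N,
      Λ (p ^ (k + 1)) *
        ((p ^ (k + 1) : ℕ) : ℝ) ^ (-(1 / 2) : ℝ) ≤ 2 := by
    intro p hp
    have hp' := Nat.prime_of_mem_primeFactors hp
    have hp2 : (2 : ℝ) ≤ p := by exact_mod_cast hp'.two_le
    have hs : 1 < √(p : ℝ) := by rw [Real.lt_sqrt zero_le_one]; linarith
    set r := (√(p : ℝ))⁻¹
    have hr1 : r < 1 := inv_lt_one_of_one_lt₀ hs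
    have hr0 : 0 < r := by positivity
    have hterm : ∀ k, Λ (p ^ (k + 1)) *
        ((p ^ (k + 1) : ℕ) : ℝ) ^ (-(1 / 2) : ℝ) = log p * r * r ^ k := by
      intro k
      rw [ArithmeticFunction.vonMangoldt_apply_pow k.succ_ne_zero,
        ArithmeticFunction.vonMangoldt_apply_prime hp', Nat.cast_pow, ← rpow_natCast,
        ← rpow_mul (by positivity), mul_comm ((k + 1 : ℕ) : ℝ), rpow_mul (by positivity),
        rpow_natCast, rpow_neg (by positivity), ← sqrt_eq_rpow]
      ring
    rw [sum_congr rfl fun k _ => hterm k, ← mul_sum]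
    have hg : ∑ k ∈ Finset.range N, r ^ k ≤ (1 - r)⁻¹ := by
      rw [← tsum_geometric_of_lt_one hr0.le hr1]
      exact (summable_geometric_of_lt_one hr0.le hr1).sum_le_tsum _ fun _ _ => by positivity
    have hl : log p ≤ 2 * (√(p : ℝ) - 1) := by
      have := log_le_sub_one_of_pos (zero_lt_one.trans hs)
      rw [log_sqrt (by positivity)] at this
      linarith
    have hr : r * (1 - r)⁻¹ = (√(p : ℝ) - 1)⁻¹ := by
      rw [← mul_inv_cancel_left₀ (show (√(p : ℝ)) ≠ 0 by positivity) (√(p : ℝ) - 1)⁻¹]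
      have : √(p : ℝ) - 1 ≠ 0 := by linarith
      have h3 : 1 - r ≠ 0 := by linarith
      have h4 : √(p : ℝ) * r = 1 := mul_inv_cancel₀ (by positivity)
      field_simp
      linear_combination h4
    calc _ ≤ log p * r * (1 - r)⁻¹ := by
          refine mul_le_mul_of_nonneg_left hg (mul_nonneg (log_nonneg (by linarith)) hr0.le)
      _ = log p * (√(p : ℝ) - 1)⁻¹ := by rw [mul_assoc, hr]
      _ ≤ 2 := by
          rw [← div_eq_mul_inv, div_le_iff₀ (by linarith)]
          exact hl
  calc _ ≤ _ := h1
    _ ≤ ∑ r ∈ q.primeFactors ×ˢ Finset.range N, Λ (r.1 ^ (r.2 + 1)) *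
        ((r.1 ^ (r.2 + 1) : ℕ) : ℝ) ^ (-(1 / 2) : ℝ) :=
        Finset.sum_image_le_of_nonneg fun _ _ => hpos _
    _ ≤ ∑ p ∈ q.primeFactors, 2 := by
        rw [Finset.sum_product]
        exact sum_le_sum h2
    _ ≤ 2 * q := by
        rw [Finset.sum_const, nsmul_eq_mul, mul_comm]
        have : q.primeFactors.card ≤ q := by
          refine (Finset.card_le_card (t := Finset.Icc 1 q) fun p hp => ?_).trans (by simp)
          exact Finset.mem_Icc.mpr ⟨(Nat.pos_of_mem_primeFactors hp),
            Nat.le_of_mem_primeFactors hp⟩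
        gcongr

lemma norm_char_sub_primitive_le {q : ℕ} [NeZero q] (χ : DirichletCharacter ℂ q) (n : ℕ) :
    ‖χ n - χ.primitiveCharacter n‖ ≤ if n.Coprime q then 0 else 1 := by
  split_ifs with hc
  · have := χ.primitiveCharacter_apply_of_isCoprime (a := n) (by exact_mod_cast hc.isCoprime)
    simp only [Int.cast_natCast] at this
    rw [this, sub_self, norm_zero]
  · rw [χ.map_nonunit (by rwa [ZMod.isUnit_iff_coprime]), zero_sub, norm_neg]
    exact χ.primitiveCharacter.norm_le_one _

lemma norm_tsum_char_sub_le {q : ℕ} [NeZero q] (χ : DirichletCharacter ℂ q) {h : ℝ} (hh : 0 < h)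
    (v : ℝ) {S : ℂ} (hS : HasSum (fun n : ℕ => χ.primitiveCharacter n *
      (Λ n : ℂ) * smoothExp h 0 (v - log n)) S) :
    ∃ S' : ℂ, HasSum (fun n : ℕ => χ n * (Λ n : ℂ) *
      smoothExp h 0 (v - log n)) S' ∧
      ‖S' - S‖ ≤ exp (v / 2 + h ^ 2 / 8) * (2 * q) := by
  have hw := summable_vonMangoldt_mul_smoothExp hh v
  have h1 : Summable (fun n : ℕ => χ n * (Λ n : ℂ) *
      smoothExp h 0 (v - log n)) := by
    refine Summable.of_norm_bounded hw fun n => ?_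
    rw [norm_mul, norm_mul, norm_real, norm_real,
      norm_of_nonneg vonMangoldt_nonneg,
      norm_of_nonneg (smoothExp_nonneg hh _ _)]
    refine mul_le_mul_of_nonneg_right ?_ (smoothExp_nonneg hh _ _)
    exact mul_le_of_le_one_left vonMangoldt_nonneg (χ.norm_le_one _)
  refine ⟨_, h1.hasSum, ?_⟩
  have h2 := HasSum.sub h1.hasSum hS
  set C := exp (v / 2 + h ^ 2 / 8)
  have h3 : ∀ n : ℕ, ‖χ n * (Λ n : ℂ) *
      smoothExp h 0 (v - log n) - χ.primitiveCharacter n *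
      (Λ n : ℂ) * smoothExp h 0 (v - log n)‖ ≤
      C * (if n.Coprime q then 0 else
        Λ n * (n : ℝ) ^ (-(1 / 2) : ℝ)) := by
    intro n
    rw [← sub_mul, ← sub_mul, norm_mul, norm_mul, norm_real, norm_real,
      norm_of_nonneg vonMangoldt_nonneg,
      norm_of_nonneg (smoothExp_nonneg hh _ _)]
    have h4 := norm_char_sub_primitive_le χ n
    split_ifs at h4 ⊢ with hc
    · rw [le_antisymm h4 (norm_nonneg _)]; simp
    · rcases Nat.eq_zero_or_pos n with rfl | hn
      · simp
      have h5 := smoothExp_zero_le_rpow hh (1 / 2) (by norm_num) v hn.ne'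
      rw [show 1 / 2 * v + (1 / 2) ^ 2 * h ^ 2 / 2 = v / 2 + h ^ 2 / 8 by ring] at h5
      calc _ ≤ 1 * Λ n * (C * (n : ℝ) ^ (-(1 / 2) : ℝ)) :=
            mul_le_mul (mul_le_mul_of_nonneg_right h4 vonMangoldt_nonneg) h5
              (smoothExp_nonneg hh _ _)
              (by rw [one_mul]; exact vonMangoldt_nonneg)
        _ = _ := by ring
  refine le_of_tendsto h2.tendsto_sum_nat.norm (Eventually.of_forall fun N => ?_)
  calc _ ≤ ∑ n ∈ Finset.range N, C * (if n.Coprime q then 0 else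
        Λ n * (n : ℝ) ^ (-(1 / 2) : ℝ)) :=
        norm_sum_le_of_le _ fun n _ => h3 n
    _ ≤ _ := by
        rw [← mul_sum]
        exact mul_le_mul_of_nonneg_left (sum_vonMangoldt_not_coprime_le (NeZero.ne q) N)
          (exp_pos _).le

/-- The smoothed count of prime powers in a residue class, from bounds on the smoothed character
sums. -/
lemma abs_tsum_residue_sub_le {q : ℕ} [NeZero q] {a : ZMod q} (ha : IsUnit a) {h : ℝ} (hh : 0 < h)
    {v E R : ℝ} (H : ∀ χ : DirichletCharacter ℂ q, ∃ S : ℂ, HasSum (fun n : ℕ =>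
      χ.primitiveCharacter n * (Λ n : ℂ) *
        smoothExp h 0 (v - log n)) S ∧ ‖S - (if χ = 1 then (E : ℂ) else 0)‖ ≤ R) :
    |∑' n : ℕ, (if (n : ZMod q) = a then Λ n *
      smoothExp h 0 (v - log n) else 0) - E / q.totient| ≤
      R + exp (v / 2 + h ^ 2 / 8) * (2 * q) := by
  have hφ : (0 : ℝ) < q.totient := by exact_mod_cast Nat.totient_pos.mpr (NeZero.pos q)
  set D := exp (v / 2 + h ^ 2 / 8) * (2 * q)
  have H' : ∀ χ : DirichletCharacter ℂ q, ∃ S : ℂ, HasSum (fun n : ℕ =>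
      χ n * (Λ n : ℂ) *
        smoothExp h 0 (v - log n)) S ∧ ‖S - (if χ = 1 then (E : ℂ) else 0)‖ ≤ R + D := by
    intro χ
    obtain ⟨S, hS, hSR⟩ := H χ
    obtain ⟨S', hS', hd⟩ := norm_tsum_char_sub_le χ hh v hS
    refine ⟨S', hS', ?_⟩
    calc _ = ‖(S - (if χ = 1 then (E : ℂ) else 0)) + (S' - S)‖ := by congr 1; ring
      _ ≤ _ := (norm_add_le _ _).trans (add_le_add hSR hd)
  choose S hS hSR using H'
  set W := ∑' n : ℕ, (if (n : ZMod q) = a then Λ n *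
      smoothExp h 0 (v - log n) else 0)
  have hW : HasSum (fun n : ℕ => ((if (n : ZMod q) = a then Λ n *
      smoothExp h 0 (v - log n) else 0 : ℝ) : ℂ)) (W : ℂ) := by
    refine Complex.hasSum_ofReal.mpr (Summable.hasSum ?_)
    refine Summable.of_nonneg_of_le (fun n => ?_) (fun n => ?_)
      (summable_vonMangoldt_mul_smoothExp hh v)
    · split_ifs
      · exact mul_nonneg vonMangoldt_nonneg (smoothExp_nonneg hh _ _)
      · exact le_rfl
    · split_ifs
      · exact le_rfl
      · exact mul_nonneg vonMangoldt_nonneg (smoothExp_nonneg hh _ _)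
  have h1 : HasSum (fun n : ℕ => ∑ χ : DirichletCharacter ℂ q, χ a⁻¹ *
      (χ n * (Λ n : ℂ) * smoothExp h 0 (v - log n)))
      (∑ χ : DirichletCharacter ℂ q, χ a⁻¹ * S χ) :=
    hasSum_sum fun χ _ => (hS χ).mul_left _
  have h2 : ∑ χ : DirichletCharacter ℂ q, χ a⁻¹ * S χ = q.totient * (W : ℂ) := by
    refine h1.unique ((hW.mul_left _).congr_fun ?_)
    intro n
    have h3 := DirichletCharacter.sum_char_inv_mul_char_eq ℂ ha (n : ZMod q)
    simp_rw [← mul_assoc]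
    rw [← sum_mul, ← sum_mul, h3]
    by_cases hn : (n : ZMod q) = a
    · rw [if_pos hn, if_pos hn.symm]; push_cast; ring
    · rw [if_neg hn, if_neg (Ne.symm hn)]; simp
  have h3 : (q.totient : ℂ) * (W : ℂ) - E = ∑ χ : DirichletCharacter ℂ q, χ a⁻¹ *
      (S χ - if χ = 1 then (E : ℂ) else 0) := by
    simp_rw [mul_sub, sum_sub_distrib, h2]
    simp only [mul_ite, mul_zero, Finset.sum_ite_eq', Finset.mem_univ, if_true]
    rw [MulChar.one_apply (IsUnit.of_mul_eq_one a (ZMod.inv_mul_of_unit a ha)), one_mul]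
  have h4 : ‖(q.totient : ℂ) * (W : ℂ) - E‖ ≤ q.totient * (R + D) := by
    rw [h3]
    refine (norm_sum_le_of_le (n := fun _ => R + D) _ fun χ _ => ?_).trans (le_of_eq ?_)
    · rw [norm_mul]
      exact (mul_le_of_le_one_left (norm_nonneg _) (χ.norm_le_one _)).trans (hSR χ)
    · rw [Finset.sum_const, nsmul_eq_mul, Finset.card_univ, ← Nat.card_eq_fintype_card,
        DirichletCharacter.card_eq_totient_of_hasEnoughRootsOfUnity]
  have h5 : ((q.totient : ℂ) * (W : ℂ) - E) = ((q.totient * (W - E / q.totient) : ℝ) : ℂ) := by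
    push_cast
    have : (q.totient : ℂ) ≠ 0 := by exact_mod_cast hφ.ne'
    field_simp
  rw [h5, norm_real, norm_eq_abs, abs_mul, abs_of_pos hφ] at h4
  exact le_of_mul_le_mul_left h4 hφ

/-- The smoothed count of prime powers in a residue class. -/
noncomputable def smoothPsi (h v : ℝ) (q : ℕ) (a : ℤ) : ℝ :=
  ∑' n : ℕ, (if (n : ZMod q) = (a : ZMod q) then Λ n *
    smoothExp h 0 (v - log n) else 0)

section Sandwich
variable {h η x : ℝ} {q : ℕ} {a : ℤ}

lemma abs_psi_sub_theta_le (hx : 1 ≤ x) : |psi x q a - theta x q a| ≤ 2 * √x * log x := by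
  have h1 : psi x q a - theta x q a = ∑ n ∈ Finset.Icc 1 ⌊x⌋₊,
      if (n : ZMod q) = (a : ZMod q) ∧ ¬ n.Prime then Λ n else 0 := by
    rw [psi, theta, sum_filter, ← sum_sub_distrib]
    refine sum_congr rfl fun n _ => ?_
    by_cases hp : n.Prime <;> by_cases hn : (n : ZMod q) = (a : ZMod q) <;>
      simp [hp, hn, ArithmeticFunction.vonMangoldt_apply_prime]
  rw [h1, abs_of_nonneg (Finset.sum_nonneg fun n _ => by
    split_ifs <;> first | exact vonMangoldt_nonneg | exact le_rfl)]
  refine le_trans ?_ (Chebyshev.psi_sub_theta_le hx)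
  rw [Chebyshev.psi_sub_theta_eq_sum_not_prime, sum_filter,
    show Finset.Ioc 0 ⌊x⌋₊ = Finset.Icc 1 ⌊x⌋₊ from rfl]
  refine sum_le_sum fun n _ => ?_
  by_cases hp : n.Prime <;> by_cases hn : (n : ZMod q) = (a : ZMod q) <;>
    simp [hp, hn, vonMangoldt_nonneg]

lemma summable_smoothPsi (hh : 0 < h) (v : ℝ) : Summable fun n : ℕ =>
    (if (n : ZMod q) = (a : ZMod q) then Λ n *
      smoothExp h 0 (v - log n) else 0) := by
  have h0 := fun n : ℕ => mul_nonneg (vonMangoldt_nonneg (n := n))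
    (smoothExp_nonneg hh 0 (v - log n))
  refine Summable.of_nonneg_of_le (fun n => ?_) (fun n => ?_)
    (summable_vonMangoldt_mul_smoothExp hh v) <;> split_ifs <;> first | exact h0 n | exact le_rfl

lemma psi_mul_le_smoothPsi (hh : 0 < h) (hη : 0 ≤ η) (hx : 0 < x) :
    psi x q a * (1 - exp (-(η ^ 2 / (2 * h ^ 2)))) ≤ smoothPsi h (log x + η) q a := by
  have h0 := fun n : ℕ => mul_nonneg (vonMangoldt_nonneg (n := n))
    (smoothExp_nonneg hh 0 (log x + η - log n))
  refine le_trans ?_ ((summable_smoothPsi hh (log x + η)).sum_le_tsum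
    (Finset.Icc 1 ⌊x⌋₊) fun n _ => ?_)
  · rw [psi, sum_mul]
    refine sum_le_sum fun n hn => ?_
    split_ifs
    · refine mul_le_mul_of_nonneg_left ?_ vonMangoldt_nonneg
      refine (one_sub_le_smoothExp_zero hh hη).trans (monotone_smoothExp_zero hh ?_)
      rw [Finset.mem_Icc] at hn
      have : log n ≤ log x := log_le_log (by exact_mod_cast hn.1)
        ((Nat.le_floor_iff hx.le).mp hn.2)
      linarith
    · rw [zero_mul]
  · split_ifs <;> first | exact h0 n | exact le_rfl

lemma smoothPsi_le_psi_add (hh : 0 < h) (hη : 2 * h ^ 2 ≤ η) (hL : 2 ≤ log x) (hx : 0 < x) :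
    smoothPsi h (log x - η) q a ≤ psi x q a + exp (-(η ^ 2 / (2 * h ^ 2))) *
      (exp 1 * x) * (2 * log x * (1 + 2 * log x)) := by
  set L := log x with hLdef
  set B := η ^ 2 / (2 * h ^ 2) with hB
  have hL0 : (0 : ℝ) < L := by linarith
  have hη0 : 0 < η := lt_of_lt_of_le (by positivity) hη
  obtain ⟨hs, hsle⟩ := summable_vonMangoldt_mul_rpow (σ := 1 + 1 / L)
    (by linarith [one_div_pos.mpr hL0])
  have h1 : HasSum (fun n : ℕ => if n ∈ Finset.Icc 1 ⌊x⌋₊ then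
      (if (n : ZMod q) = (a : ZMod q) then Λ n else 0) else 0)
      (psi x q a) := by
    have := hasSum_sum_of_ne_finset_zero (f := fun n : ℕ => if n ∈ Finset.Icc 1 ⌊x⌋₊ then
      (if (n : ZMod q) = (a : ZMod q) then Λ n else 0) else 0)
      (s := Finset.Icc 1 ⌊x⌋₊) (L := .unconditional ℕ) (fun n hn => if_neg hn)
    rwa [sum_congr rfl fun n hn => if_pos hn] at this
  have h2 := h1.add (hs.hasSum.mul_left (exp (-B) * (exp 1 * x)))
  refine (hasSum_le (fun n => ?_) (summable_smoothPsi hh (L - η)).hasSum h2).trans ?_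
  · have hΛ := vonMangoldt_nonneg (n := n)
    have hnn : 0 ≤ exp (-B) * (exp 1 * x) *
        (Λ n * (n : ℝ) ^ (-(1 + 1 / L))) := by positivity
    by_cases hna : (n : ZMod q) = (a : ZMod q)
    swap
    · simp only [if_neg hna, ite_self, zero_add]; exact hnn
    simp only [if_pos hna]
    by_cases hn : n ∈ Finset.Icc 1 ⌊x⌋₊
    · rw [if_pos hn]
      exact (mul_le_of_le_one_right hΛ (smoothExp_zero_le_one hh _)).trans (by linarith)
    rw [if_neg hn, zero_add]
    rcases Nat.eq_zero_or_pos n with rfl | hn0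
    · simp
    have hnx : x < n := by
      by_contra hc
      exact hn (Finset.mem_Icc.mpr ⟨hn0, Nat.le_floor (not_lt.mp hc)⟩)
    have hu : 0 ≤ log n - L := sub_nonneg.mpr (log_le_log hx hnx.le)
    set u := log n - L with hu'
    have h3 := smoothExp_zero_neg_le hh (show 0 ≤ η + u by linarith)
    rw [show -(η + u) = L - η - log n by rw [hu']; ring] at h3
    have h4 : exp (-((η + u) ^ 2 / (2 * h ^ 2))) ≤
        exp (-B) * (exp 1 * x) * (n : ℝ) ^ (-(1 + 1 / L)) := by
      rw [rpow_def_of_pos (by exact_mod_cast hn0), ← exp_log hx, ← exp_add,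
        ← exp_add, ← exp_add, ← hLdef]
      refine exp_le_exp.mpr ?_
      have h5 : -B + (1 + L) + log n * -(1 + 1 / L) = -B - u * (1 + 1 / L) := by
        rw [hu']; field_simp; ring
      have h6 : B + 2 * u ≤ (η + u) ^ 2 / (2 * h ^ 2) := by
        rw [hB, ← sub_nonneg]
        have : (η + u) ^ 2 / (2 * h ^ 2) - (η ^ 2 / (2 * h ^ 2) + 2 * u) =
          (2 * u * (η - 2 * h ^ 2) + u ^ 2) / (2 * h ^ 2) := by field_simp; ring
        rw [this]
        have := mul_nonneg hu (sub_nonneg.mpr hη)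
        exact div_nonneg (by nlinarith [sq_nonneg u]) (by positivity)
      have h7 : 1 / L ≤ 1 := by rw [div_le_one hL0]; linarith
      rw [h5]
      nlinarith
    calc _ ≤ Λ n *
          (exp (-B) * (exp 1 * x) * (n : ℝ) ^ (-(1 + 1 / L))) :=
          mul_le_mul_of_nonneg_left (h3.trans h4) hΛ
      _ = _ := by ring
  · refine add_le_add le_rfl (mul_le_mul_of_nonneg_left (hsle.trans (le_of_eq ?_)) (by positivity))
    rw [add_sub_cancel_left]
    field_simp

end Sandwich

/-- The total bound for the smoothed character sums, in terms of the kernel parameters. -/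
lemma kernel_error_le {Q h v V D M y : ℝ} (hD : 10 ≤ D) (hV : 1 ≤ V) (hh : 0 < h)
    (hh1 : h ≤ 1 / 100) (hv : 100 ≤ v) (hDv : D ≤ v) (hM0 : 0 ≤ M)
    (hM : log (logScale Q (V + 1)) + 1 / 16 +
      1 / D * (log (Q * (V + 4) / (2 * π)) / 2) + (log (1 + D) + log 9) ≤ M)
    (hy : 10 / 9 + log V ≤ y) :
    (2 * π)⁻¹ * (2 * (logDerivBound Q (1 / D) (24 / 25) V *
            exp ((1 - 24 / 25 * (1 / D)) * v + h ^ 2 * (1 - 24 / 25 * (1 / D)) ^ 2 / 2)) *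
            (10 / 9 + log V) +
          2 * ((1 / v + 24 / 25 * (1 / D)) * (logDerivBound Q (1 / D) (24 / 25) V *
            exp ((1 + 1 / v) * v + h ^ 2 * (1 + 1 / v) ^ 2 / 2) *
              exp (-(h ^ 2 / 2) * V ^ 2) / V)) +
          2 * ((2 * v * (1 + 2 * v) + v + 1) *
            exp ((1 + 1 / v) * v + h ^ 2 * (1 + 1 / v) ^ 2 / 2) / V *
              exp (-(h ^ 2 / 2) * V ^ 2) * √(π / (h ^ 2 / 2)))) + 3 ≤
      exp v * ((2 * π)⁻¹ * (10010 * (M * D * y) * exp (-(24 / 25 * v / D)) +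
        exp (-(h ^ 2 * V ^ 2 / 2)) * (54500 * M / V + 56 * v ^ 2 / (V * h)))) + 3 := by
  have hD0 : 0 < D := by linarith
  have hv0 : 0 < v := by linarith
  have hLV : 0 ≤ log V := log_nonneg hV
  have hK : logDerivBound Q (1 / D) (24 / 25) V ≤ 5000 * (M * D) := by
    rw [logDerivBound, one_div_one_div]
    have h1 : (1 / D * (1 - 24 / 25) ^ 2) = 1 / (625 * D) := by field_simp; norm_num
    rw [h1, div_div_eq_mul_div, div_one]
    nlinarith
  have hd1 : 1 / D ≤ 1 / 10 := one_div_le_one_div_of_le (by norm_num) hD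
  have hd0 : 0 < 1 / D := by positivity
  have hv1 : 1 / v ≤ 1 / D := one_div_le_one_div_of_le hD0 hDv
  have hv1' : 0 < 1 / v := by positivity
  have hsmall : exp (2 * h ^ 2) ≤ 10009 / 10000 := by
    have : 2 * h ^ 2 ≤ 1 / 5000 := by nlinarith
    refine (exp_le_exp.mpr this).trans ?_
    exact (Real.exp_bound_div_one_sub_of_interval (by norm_num) (by norm_num)).trans (by norm_num)
  have he1 : exp ((1 - 24 / 25 * (1 / D)) * v + h ^ 2 * (1 - 24 / 25 * (1 / D)) ^ 2 / 2) ≤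
      exp v * exp (-(24 / 25 * v / D)) * (10009 / 10000) := by
    refine le_trans ?_ (mul_le_mul_of_nonneg_left hsmall (by positivity))
    rw [← exp_add, ← exp_add]
    refine exp_le_exp.mpr ?_
    have h1 : (1 - 24 / 25 * (1 / D)) ^ 2 ≤ 1 := by
      rw [sq_le_one_iff_abs_le_one, abs_le]; constructor <;> linarith
    have h2 : (1 - 24 / 25 * (1 / D)) * v = v + -(24 / 25 * v / D) := by field_simp; ring
    rw [h2]
    nlinarith [mul_le_mul_of_nonneg_left h1 (sq_nonneg h)]
  have he2 : exp ((1 + 1 / v) * v + h ^ 2 * (1 + 1 / v) ^ 2 / 2) ≤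
      exp v * (2721 / 1000) := by
    have h3 : exp 1 * exp (2 * h ^ 2) ≤ 2721 / 1000 :=
      (mul_le_mul exp_one_lt_d9.le hsmall (exp_pos _).le (by norm_num)).trans
        (by norm_num)
    refine le_trans ?_ (mul_le_mul_of_nonneg_left h3 (exp_pos v).le)
    rw [← exp_add, ← exp_add]
    refine exp_le_exp.mpr ?_
    have h1 : (1 + 1 / v) ^ 2 ≤ 2 := by nlinarith
    have h2 : (1 + 1 / v) * v = v + 1 := by field_simp
    rw [h2]
    nlinarith [mul_le_mul_of_nonneg_left h1 (sq_nonneg h)]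
  have he3 : -(h ^ 2 / 2) * V ^ 2 = -(h ^ 2 * V ^ 2 / 2) := by ring
  rw [he3]
  set e := exp v
  set ε := exp (-(h ^ 2 * V ^ 2 / 2))
  have he0 : 0 < e := exp_pos _
  have hε0 : 0 < ε := exp_pos _
  have hMD : 0 ≤ 5000 * (M * D) := by positivity
  have hsq : √(π / (h ^ 2 / 2)) ≤ 2507 / 1000 / h := by
    refine sqrt_le_iff.mpr ⟨by positivity, ?_⟩
    rw [div_pow, div_le_div_iff₀ (by positivity) (by positivity)]
    nlinarith [pi_lt_d4, sq_pos_of_pos hh]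
  have t1 : 2 * (logDerivBound Q (1 / D) (24 / 25) V *
      exp ((1 - 24 / 25 * (1 / D)) * v + h ^ 2 * (1 - 24 / 25 * (1 / D)) ^ 2 / 2)) *
      (10 / 9 + log V) ≤ e * (10010 * (M * D * y) * exp (-(24 / 25 * v / D))) := by
    have hy0 : 0 ≤ y := by linarith
    calc _ ≤ 2 * (5000 * (M * D) * (e * exp (-(24 / 25 * v / D)) * (10009 / 10000))) * y := by
          gcongr
      _ = e * (10009 * (M * D * y) * exp (-(24 / 25 * v / D))) := by ring
      _ ≤ _ := by gcongr; norm_num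
  have t2 : 2 * ((1 / v + 24 / 25 * (1 / D)) * (logDerivBound Q (1 / D) (24 / 25) V *
      exp ((1 + 1 / v) * v + h ^ 2 * (1 + 1 / v) ^ 2 / 2) * ε / V)) ≤
      e * (ε * (54500 * M / V)) := by
    calc _ ≤ 2 * ((1 / v + 24 / 25 * (1 / D)) *
            (5000 * (M * D) * (e * (2721 / 1000)) * ε / V)) := by gcongr
      _ ≤ 2 * ((2 * (1 / D)) * (5000 * (M * D) * (e * (2721 / 1000)) * ε / V)) := by
          gcongr
          linarith
      _ = e * (ε * (54420 * M / V)) := by field_simp; ring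
      _ ≤ _ := by gcongr; norm_num
  have t3 : 2 * ((2 * v * (1 + 2 * v) + v + 1) *
      exp ((1 + 1 / v) * v + h ^ 2 * (1 + 1 / v) ^ 2 / 2) / V * ε *
        √(π / (h ^ 2 / 2))) ≤ e * (ε * (56 * v ^ 2 / (V * h))) := by
    calc _ ≤ 2 * ((404 / 100 * v ^ 2) * (e * (2721 / 1000)) / V * ε * (2507 / 1000 / h)) := by
          gcongr
          nlinarith
      _ = e * (ε * ((2 * 404 * 2721 * 2507 / 10 ^ 8) * v ^ 2 / (V * h))) := by field_simp; ring
      _ ≤ _ := by gcongr; norm_num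
  refine add_le_add ?_ le_rfl
  rw [mul_left_comm e]
  refine mul_le_mul_of_nonneg_left ?_ (inv_nonneg.mpr (by positivity))
  refine (add_le_add (add_le_add t1 t2) t3).trans (le_of_eq (by ring))

theorem abs_smoothPsi_sub_le {q : ℕ} (hq : 10 ^ 5 ≤ q) {a : ℤ} (ha : Int.gcd a q = 1)
    {h v V D M y : ℝ} (hD1 : √(q : ℝ) / (85 / 100) ≤ D)
    (hD2 : 2762 / 100 * (discBound q 1 (3 * (V + 1) + 1) + 28 / 100) ≤ D)
    (hD3 : 6178 / 100 * (discBound q 1 (9 / 5) + 30 / 100) ≤ D)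
    (hV : 1 ≤ V) (hh : 0 < h) (hh1 : h ≤ 1 / 100) (hv : 100 ≤ v) (hDv : D ≤ v) (hM0 : 0 ≤ M)
    (hM : log (logScale q (V + 1)) + 1 / 16 +
      1 / D * (log (q * (V + 4) / (2 * π)) / 2) + (log (1 + D) + log 9) ≤ M)
    (hy : 10 / 9 + log V ≤ y) :
    |smoothPsi h v q a - exp (v + h ^ 2 / 2) / q.totient| ≤
      exp v * ((2 * π)⁻¹ * (10010 * (M * D * y) * exp (-(24 / 25 * v / D)) +
        exp (-(h ^ 2 * V ^ 2 / 2)) * (54500 * M / V + 56 * v ^ 2 / (V * h)))) + 3 +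
      exp (v / 2 + h ^ 2 / 8) * (2 * q) := by
  have hq5 : (10 : ℝ) ^ 5 ≤ q := by exact_mod_cast hq
  have : NeZero q := ⟨by rintro rfl; norm_num at hq⟩
  have hs : 316 ≤ √(q : ℝ) := le_sqrt_of_sq_le (by linarith)
  have hD : 100 ≤ D := by
    refine le_trans ?_ hD1
    rw [le_div_iff₀ (by norm_num)]
    linarith
  have hD0 : 0 < D := by linarith
  have hunit : IsUnit (a : ZMod q) := by
    rw [ZMod.coe_int_isUnit_iff_isCoprime, Int.isCoprime_iff_gcd_eq_one, Int.gcd_comm]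
    exact ha
  refine abs_tsum_residue_sub_le hunit hh fun χ => ?_
  have hf0 : χ.conductor ≠ 0 := χ.conductor_ne_zero
  have : NeZero χ.conductor := ⟨hf0⟩
  have hfq : (χ.conductor : ℝ) ≤ q := by
    exact_mod_cast Nat.le_of_dvd (NeZero.pos q) χ.conductor_dvd_level
  have hd : (1 / D) ≤ 1 / 10 := one_div_le_one_div_of_le (by norm_num) (by linarith)
  obtain ⟨S, hS, hSb⟩ := exists_hasSum_mul_smoothExp (h := h) (v := v) (V := V) (T := V + 1)
    (θ := 24 / 25) (δ := 1 / D) χ.primitiveCharacter_isPrimitive hfq (by linarith) (by positivity)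
    hd (by norm_num) (by norm_num) hV le_rfl hh (by linarith)
    (by rw [mul_one_div, le_div_iff₀ hD0]; linarith) (fun s hs1 hs2 => by
      refine regularizedL_ne_zero χ.primitiveCharacter_isPrimitive hfq hq5 hd ?_ ?_ ?_ hs1 hs2
      · rw [mul_one_div, div_le_one hD0]; exact hD2
      · rw [mul_one_div, div_le_one hD0]; exact hD3
      · intro h2 h1 β hβ hβ1 h0
        have hf1 : χ.conductor ≠ 1 := fun hf => h1 (DirichletCharacter.level_one' _ hf)
        have h3 := le_one_sub_of_LFunction_eq_zero χ.primitiveCharacter_isPrimitive hf1 h2 hq5 hfq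
          hβ1 h0
        have h4 : 1 / D ≤ 85 / 100 / √(q : ℝ) := by
          rw [div_le_iff₀ (by norm_num)] at hD1
          rw [div_le_div_iff₀ hD0 (by linarith)]
          linarith
        linarith)
  refine ⟨S, hS, ?_⟩
  have h5 : (if χ = 1 then ((exp (v + h ^ 2 / 2) : ℝ) : ℂ) else 0) =
      if χ.conductor = 1 then ((exp (v + h ^ 2 / 2) : ℝ) : ℂ) else 0 := by
    simp only [eq_one_iff_conductor_eq_one]
  rw [h5]
  rw [← one_div_one_div D] at hM
  refine hSb.trans (kernel_error_le (by linarith) hV hh hh1 hv hDv hM0 ?_ hy)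
  simpa only [one_div_one_div] using hM

/-- The Gaussian cut-off exponent. -/
noncomputable def cutoff (A L : ℝ) : ℝ := (A + 2) * log L + 12

/-- The height at which the contour integrals are truncated. -/
noncomputable def truncHeight (A L s : ℝ) : ℝ := 4000 * cutoff A L * L ^ A / s

section Assembly
variable {q : ℕ} {a : ℤ} {A x D M y : ℝ}

lemma exp_le_of_small {t : ℝ} (ht : t ≤ 1 / 1000) (h0 : 0 ≤ t) :
    exp t ≤ 1 + 1002 / 1000 * t := by
  refine (Real.exp_bound_div_one_sub_of_interval h0 (by linarith)).trans ?_
  rw [div_le_iff₀ (by linarith)]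
  nlinarith

lemma mul_pow_le_sqrt (hx : 0 < x) (hL : 14000 ≤ log x) :
    10 ^ 8 * log x ^ 11 ≤ √x := by
  set L := log x
  have hL0 : 0 < L := by linarith
  have h1 : log L ≤ L / 1024 - 1 + 10 * log 2 := by
    have := log_le_sub_one_of_pos (show 0 < L / 1024 by positivity)
    rw [log_div hL0.ne' (by norm_num), show (1024 : ℝ) = 2 ^ 10 by norm_num, log_pow]
      at this
    push_cast at this
    linarith
  have h2 : √x = exp (L / 2) := by
    rw [exp_half, exp_log hx]
  have h3 : (10 : ℝ) ^ 8 * L ^ 11 ≤ exp (27 * log 2 + 11 * log L) := by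
    rw [exp_add, ← log_rpow two_pos, ← log_rpow hL0, exp_log (by positivity),
      exp_log (by positivity)]
    norm_cast
    exact mul_le_mul_of_nonneg_right (by norm_num) (by positivity)
  rw [h2]
  exact h3.trans (exp_le_exp.mpr (by linarith [log_two_lt_d9]))

lemma sqrt_le_totient (q : ℕ) : √(q : ℝ) ≤ 14143 / 10000 * q.totient := by
  refine sqrt_le_iff.mpr ⟨by positivity, ?_⟩
  have : (q : ℝ) ≤ 2 * (q.totient : ℝ) ^ 2 := by exact_mod_cast (le_two_mul_totient_sq q).1
  nlinarith

set_option maxHeartbeats 1000000 in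
theorem psi_theta_bounds_of_parameters (hq : 10 ^ 5 ≤ q) (ha : Int.gcd a q = 1) (hA1 : 1 ≤ A)
    (hA8 : A ≤ 8) (hx : 0 < x) (hL : 14000 ≤ log x) (hsL : 45 * √(q : ℝ) ≤ log x)
    (hD1 : √(q : ℝ) / (85 / 100) ≤ D)
    (hD2 : 2762 / 100 * (discBound q 1 (3 * (truncHeight A (log x) √(q : ℝ) + 1) + 1) +
      28 / 100) ≤ D)
    (hD3 : 6178 / 100 * (discBound q 1 (9 / 5) + 30 / 100) ≤ D)
    (hDL : D + 1 ≤ log x) (hM0 : 0 ≤ M) (hML : M ≤ log x)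
    (hM : log (logScale q (truncHeight A (log x) √(q : ℝ) + 1)) + 1 / 16 +
      1 / D * (log (q * (truncHeight A (log x) √(q : ℝ) + 4) / (2 * π)) / 2) +
      (log (1 + D) + log 9) ≤ M)
    (hy : 10 / 9 + log (truncHeight A (log x) √(q : ℝ)) ≤ y)
    (hN : 512000 * (M * D * y) * log x ^ A ≤ exp (24 / 25 * log x / D)) :
    |psi x q a - x / q.totient| ≤ (1 / 160) * x / log x ^ A ∧
    |theta x q a - x / q.totient| ≤ (1 / 160) * x / log x ^ A := by
  set L := log x with hLdef
  set s := √(q : ℝ) with hs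
  set V := truncHeight A L s with hVdef
  set B := cutoff A L with hBdef
  set P := L ^ A with hP
  have hq5 : (10 : ℝ) ^ 5 ≤ q := by exact_mod_cast hq
  have hs316 : 316 ≤ s := le_sqrt_of_sq_le (by linarith)
  have hs2 : s ^ 2 = q := sq_sqrt (by positivity)
  have hL0 : 0 < L := by linarith
  have hs0 : 0 < s := by linarith
  have hPL : L ≤ P := by
    calc L = L ^ (1 : ℝ) := (rpow_one L).symm
      _ ≤ P := rpow_le_rpow_of_exponent_le (by linarith) hA1
  have hP8 : P ≤ L ^ 8 := by
    calc P ≤ L ^ (8 : ℝ) := rpow_le_rpow_of_exponent_le (by linarith) hA8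
      _ = L ^ 8 := by norm_cast
  have hP0 : 0 < P := by linarith
  have hlog : 0 ≤ log L := log_nonneg (by linarith)
  have hB12 : 12 ≤ B := by
    have : 0 ≤ (A + 2) * log L := by positivity
    simp only [hBdef, cutoff]; linarith
  set ε := exp (-B) with hε
  have hε' : ε ≤ 62 / 10 ^ 7 / (P * L ^ 2) := by
    have h1 : ε = exp (-12) / (P * L ^ 2) := by
      rw [hε, hP, rpow_def_of_pos hL0, show L ^ 2 = exp (2 * log L) by
        rw [two_mul, exp_add, exp_log hL0, sq], ← exp_add, ← exp_sub]
      simp only [hBdef, cutoff]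
      ring_nf
    rw [h1]
    gcongr
    rw [Real.exp_neg, inv_le_comm₀ (exp_pos _) (by norm_num),
      show (12 : ℝ) = (12 : ℕ) * 1 by norm_num, exp_nat_mul]
    refine le_trans ?_ (pow_le_pow_left₀ (by norm_num) Real.exp_one_gt_d9.le _)
    norm_num
  have hε0 : 0 < ε := exp_pos _
  set η := s / (2000 * P) with hη
  have hη0 : 0 < η := by positivity
  have hη1 : η ≤ 1 / 90000 := by
    rw [hη, div_le_div_iff₀ (by positivity) (by norm_num)]
    linarith
  set C := √(2 * B) with hC
  have hC2 : C ^ 2 = 2 * B := sq_sqrt (by linarith)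
  have hC1 : 4 ≤ C := le_sqrt_of_sq_le (by linarith)
  set h := η / C with hh
  have hh0 : 0 < h := by positivity
  have hhη : 4 * h ≤ η := by
    rw [hh, mul_div_assoc', div_le_iff₀ (by linarith)]
    nlinarith only [hC1, hη0]
  have hVη : V = 2 * B / η := by
    rw [hVdef, truncHeight, hη]
    field_simp
    ring
  have hV : 100 ≤ V := by
    rw [hVη, le_div_iff₀ hη0]
    linarith
  have hVh : V * h = C := by
    rw [hVη, ← hC2, hh]
    field_simp
  have hhV : h ^ 2 * V ^ 2 / 2 = B := by
    rw [← mul_pow, mul_comm h, hVh, hC2]; ring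
  have hηh : η ^ 2 / (2 * h ^ 2) = B := by
    have h1 : η = h * C := by rw [hh]; field_simp
    rw [h1, mul_pow, hC2]
    field_simp
  have hφ := sqrt_le_totient q
  rw [← hs] at hφ
  have hφ1 : 1 ≤ (q.totient : ℝ) := by
    exact_mod_cast Nat.totient_pos.mpr (by omega : 0 < q)
  have hsqrt := mul_pow_le_sqrt hx hL
  rw [← hLdef] at hsqrt
  set z := √x with hz
  have hz0 : 0 < z := sqrt_pos.mpr hx
  have hz2 : z ^ 2 = x := sq_sqrt hx.le
  have hPz : 10 ^ 8 * L ^ 3 * P ≤ z := by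
    calc 10 ^ 8 * L ^ 3 * P ≤ 10 ^ 8 * L ^ 3 * L ^ 8 := by gcongr
      _ = 10 ^ 8 * L ^ 11 := by ring
      _ ≤ z := hsqrt
  set τ := x / P with hτ
  have hτz : 10 ^ 8 * L ^ 3 * z ≤ τ := by
    rw [hτ, le_div_iff₀ hP0, ← hz2]
    nlinarith only [mul_le_mul_of_nonneg_right hPz hz0.le]
  have hτ0 : 0 < τ := by positivity
  have hετ : ε * L ^ 2 * x ≤ 62 / 10 ^ 7 * τ := by
    calc ε * L ^ 2 * x ≤ 62 / 10 ^ 7 / (P * L ^ 2) * L ^ 2 * x := by gcongr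
      _ = 62 / 10 ^ 7 * τ := by rw [hτ]; field_simp
  have hexpL : exp L = x := exp_log hx
  have hL3 : (14000 : ℝ) * L ^ 2 ≤ L ^ 3 := by
    nlinarith only [mul_le_mul_of_nonneg_right hL (sq_nonneg L)]
  have hR : ∀ v, |v - L| ≤ η → |smoothPsi h v q a - exp (v + h ^ 2 / 2) / q.totient| ≤
      33 / 10000 * τ := by
    intro v hv
    obtain ⟨hv1, hv2⟩ := abs_le.mp hv
    refine (abs_smoothPsi_sub_le hq ha (V := V) (y := y) hD1 hD2 hD3 (by linarith) hh0
      (by linarith) (by linarith) (by linarith) hM0 hM hy).trans ?_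
    have hev : exp v ≤ 1001 / 1000 * x := by
      rw [← hexpL, mul_comm, ← div_le_iff₀' (exp_pos _), ← exp_sub]
      refine (exp_le_exp.mpr (show v - L ≤ η by linarith)).trans
        ((exp_le_of_small (by linarith) hη0.le).trans (by linarith))
    have hDpos : 100 ≤ D := le_trans (by rw [le_div_iff₀ (by norm_num)]; linarith) hD1
    have hy0 : 0 ≤ y := le_trans (by linarith [log_nonneg (show 1 ≤ V by linarith)]) hy
    have h1 : 10010 * (M * D * y) * exp (-(24 / 25 * v / D)) ≤ 196 / 10000 / P := by
      have h2 : exp (-(24 / 25 * v / D)) ≤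
          1001 / 1000 * (exp (24 / 25 * L / D))⁻¹ := by
        rw [← Real.exp_neg]
        refine le_trans ?_ (mul_le_mul_of_nonneg_right ((exp_le_of_small (t := η) (by linarith)
          hη0.le).trans (show _ ≤ (1001 / 1000 : ℝ) by linarith)) (exp_pos _).le)
        rw [← exp_add]
        refine exp_le_exp.mpr ?_
        have h3 : 24 / 25 * (L - v) / D ≤ η := by
          rw [div_le_iff₀ (by linarith)]
          nlinarith only [hv1, hDpos, hη0]
        have h4 : 24 / 25 * (L - v) / D = 24 / 25 * L / D - 24 / 25 * v / D := by ring
        linarith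
      calc _ ≤ 10010 * (M * D * y) * (1001 / 1000 * (exp (24 / 25 * L / D))⁻¹) :=
            mul_le_mul_of_nonneg_left h2 (by positivity)
        _ = (10010 * 1001 / 1000 / 512000 / P) *
            (512000 * (M * D * y) * P / exp (24 / 25 * L / D)) := by
            field_simp
        _ ≤ (10010 * 1001 / 1000 / 512000 / P) * 1 :=
            mul_le_mul_of_nonneg_left ((div_le_one (exp_pos _)).mpr hN) (by positivity)
        _ ≤ 196 / 10000 / P := by
            rw [mul_one]
            exact div_le_div_of_nonneg_right (by norm_num) hP0.le
    have h2 : exp (-(h ^ 2 * V ^ 2 / 2)) * (54500 * M / V + 56 * v ^ 2 / (V * h)) ≤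
        15 * (ε * L ^ 2) := by
      rw [hhV, hVh]
      have h3 : 54500 * M / V ≤ L ^ 2 / 2 := by
        rw [div_le_iff₀ (by linarith)]
        nlinarith only [mul_le_mul_of_nonneg_right hL hL0.le, hML, hL0,
          mul_le_mul_of_nonneg_left hV (sq_nonneg L)]
      have h4 : 56 * v ^ 2 / C ≤ 145 / 10 * L ^ 2 := by
        rw [div_le_iff₀ (by linarith)]
        have : v ≤ 1001 / 1000 * L := by linarith
        nlinarith only [pow_le_pow_left₀ (show 0 ≤ v by linarith) this 2, sq_nonneg L,
          mul_le_mul_of_nonneg_left hC1 (sq_nonneg L)]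
      calc _ ≤ ε * (15 * L ^ 2) := mul_le_mul_of_nonneg_left (by linarith) hε0.le
        _ = _ := by ring
    have hpi : (2 * π)⁻¹ ≤ 15916 / 100000 := by
      rw [inv_le_comm₀ (by positivity) (by norm_num)]
      linarith [pi_gt_d4]
    have h3 : exp (v / 2 + h ^ 2 / 8) * (2 * q) ≤ 3 * L ^ 2 * z := by
      have h4 : exp (v / 2 + h ^ 2 / 8) ≤ z * (1001 / 1000) := by
        have : z = exp (L / 2) := by rw [exp_half, hexpL]
        rw [this]
        refine le_trans (exp_le_exp.mpr (show _ ≤ L / 2 + η by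
          nlinarith only [hv2, hhη, hη0, hη1, hh0])) ?_
        rw [exp_add]
        refine mul_le_mul_of_nonneg_left ?_ (exp_pos _).le
        exact (exp_le_of_small (by linarith) hη0.le).trans (by linarith)
      have h5 : (q : ℝ) ≤ L ^ 2 := by rw [← hs2]; nlinarith only [hsL, hs0]
      calc _ ≤ z * (1001 / 1000) * (2 * L ^ 2) := by gcongr
        _ ≤ _ := by nlinarith only [mul_pos hz0 (sq_pos_of_pos hL0)]
    have h4 : exp v * ((2 * π)⁻¹ * (10010 * (M * D * y) *
        exp (-(24 / 25 * v / D)) + exp (-(h ^ 2 * V ^ 2 / 2)) *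
          (54500 * M / V + 56 * v ^ 2 / (V * h)))) ≤
        1001 / 1000 * x * (15916 / 100000 * (196 / 10000 / P + 15 * (ε * L ^ 2))) := by
      have : 0 ≤ 10010 * (M * D * y) * exp (-(24 / 25 * v / D)) +
          exp (-(h ^ 2 * V ^ 2 / 2)) * (54500 * M / V + 56 * v ^ 2 / (V * h)) := by positivity
      exact mul_le_mul hev (mul_le_mul hpi (add_le_add h1 h2) this (by norm_num))
        (mul_nonneg (by positivity) this) (by positivity)
    have h5 : 1001 / 1000 * x * (15916 / 100000 * (196 / 10000 / P + 15 * (ε * L ^ 2))) =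
        1001 / 1000 * (15916 / 100000) * (196 / 10000 * τ + 15 * (ε * L ^ 2 * x)) := by
      rw [hτ]; ring
    have h6 : 3 ≤ L ^ 2 * z := by
      have h11 : 1 ≤ L ^ 11 := one_le_pow₀ (by linarith)
      have hz1 : 1 ≤ z := by linarith
      have hL2 : 3 ≤ L ^ 2 := by nlinarith only [hL]
      nlinarith only [hz1, hL2]
    have h7 : 4 * L ^ 2 * z ≤ 1 / 10 ^ 5 * τ := by
      nlinarith only [mul_le_mul_of_nonneg_right hL3 hz0.le, hτz, hz0, sq_nonneg L]
    linarith only [h3, h4, h5, h6, h7, hετ, hτ0]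
  have hmain : x / q.totient * η ≤ 708 / 10 ^ 6 * τ := by
    rw [hη, hτ, div_mul_div_comm, div_le_iff₀ (by positivity)]
    have : 708 / 10 ^ 6 * (x / P) * (q.totient * (2000 * P)) =
      x * (708 * 2000 / 10 ^ 6 * q.totient) := by field_simp
    rw [this]
    exact mul_le_mul_of_nonneg_left (by linarith) hx.le
  have hxφ : 0 < x / q.totient := by positivity
  have hτx : τ ≤ x := by
    rw [hτ, div_le_iff₀ hP0]; nlinarith only [hPL, hL, hx]
  have hxφ1 : x / q.totient ≤ x := div_le_self hx.le hφ1
  have hψ : |psi x q a - x / q.totient| ≤ 5 / 1000 * τ := by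
    have hup := psi_mul_le_smoothPsi (a := a) (q := q) hh0 hη0.le hx
    have hlo := smoothPsi_le_psi_add (a := a) (q := q) hh0 (show 2 * h ^ 2 ≤ η by nlinarith only [hhη, hη1, hh0])
      (show 2 ≤ log x by linarith) hx
    rw [← hLdef, hηh, ← hε] at hup hlo
    have hR1 := (abs_le.mp (hR (L + η) (by rw [add_sub_cancel_left, abs_of_pos hη0]))).2
    have hR2 := (abs_le.mp (hR (L - η) (by rw [abs_sub_comm, sub_sub_cancel, abs_of_pos hη0]))).1
    have hE1 : exp (L + η + h ^ 2 / 2) / q.totient ≤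
        x / q.totient * (1 + 101 / 100 * η) := by
      rw [add_assoc, exp_add, hexpL, div_mul_eq_mul_div]
      gcongr
      have h1 : h ^ 2 / 2 ≤ 1 / 1000 * η := by nlinarith only [hhη, hη1, hh0]
      exact (exp_le_of_small (by linarith) (by positivity)).trans (by linarith)
    have hE2 : x / q.totient * (1 - η) ≤ exp (L - η + h ^ 2 / 2) / q.totient := by
      rw [sub_add, exp_sub, hexpL, div_mul_eq_mul_div]
      gcongr
      rw [div_eq_mul_inv, ← Real.exp_neg]
      refine mul_le_mul_of_nonneg_left ?_ hx.le
      have := add_one_le_exp (-(η - h ^ 2 / 2))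
      linarith [sq_nonneg h]
    have hε1 : ε * x ≤ 1 / 10 ^ 6 * τ := by
      have h1 : 196000000 * (ε * x) ≤ ε * x * L ^ 2 := by
        rw [mul_comm]
        exact mul_le_mul_of_nonneg_left (by nlinarith only [hL]) (by positivity)
      linarith only [h1, hετ, hτ0]
    have hεs : ε ≤ 1 / 2 := by
      have : ε * x ≤ 1 / 2 * x := by linarith
      exact le_of_mul_le_mul_right this hx
    rw [abs_le]
    constructor
    · have htail : ε * (exp 1 * x) * (2 * L * (1 + 2 * L)) ≤ 8 / 10 ^ 5 * τ := by
        calc _ ≤ ε * (272 / 100 * x) * (401 / 100 * L ^ 2) := by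
              refine mul_le_mul ?_ (by nlinarith only [hL]) (by positivity) (by positivity)
              gcongr
              linarith only [exp_one_lt_d9]
          _ = 272 / 100 * (401 / 100) * (ε * L ^ 2 * x) := by ring
          _ ≤ _ := by linarith only [hετ, hτ0]
      linarith only [htail, hlo, hR2, hE2, hmain, hτ0]
    · set W := smoothPsi h (L + η) q a
      have hW : W ≤ 19 / 10 * x := by
        nlinarith only [hR1, hE1, hmain, hτ0, hτx, hxφ1]
      have hψ2 : psi x q a ≤ 4 * x := by
        by_contra! hc
        nlinarith only [mul_le_mul hc.le (show 1 / 2 ≤ 1 - ε by linarith only [hεs])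
          (by norm_num) (by linarith only [hc, hx]), hup, hW, hc, hx]
      nlinarith only [mul_le_mul_of_nonneg_right hψ2 hε0.le, hup, hR1, hE1, hmain, hτ0, hε1]
  have hfin : (1 / 160) * x / P = 1 / 160 * τ := by rw [hτ]; ring
  rw [hfin]
  refine ⟨hψ.trans (by linarith), ?_⟩
  have hθ := abs_psi_sub_theta_le (q := q) (a := a) (show 1 ≤ x by
    by_contra hc
    linarith [Real.log_nonpos hx.le (not_le.mp hc).le])
  rw [abs_sub_comm] at hθ
  have h8 : 2 * z * L ≤ 1 / 1000 * τ := by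
    nlinarith only [mul_le_mul_of_nonneg_right hL3 hz0.le, mul_pos hL0 hz0, hτz,
      mul_le_mul_of_nonneg_right hL (mul_pos hL0 hz0).le]
  calc |theta x q a - x / q.totient| =
        |(theta x q a - psi x q a) + (psi x q a - x / q.totient)| := by
        congr 1; ring
    _ ≤ _ := (abs_add_le _ _).trans (add_le_add (hθ.trans h8) hψ)
    _ ≤ _ := by linarith

end Assembly

lemma log_le_log_add_div_sub_one {z c : ℝ} (hz : 0 < z) (hc : 0 < c) :
    log z ≤ log c + z / c - 1 := by
  have h := log_le_sub_one_of_pos (div_pos hz hc)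
  rw [log_div hz.ne' hc.ne'] at h
  linarith

lemma log_le_two_pow_tangent (k : ℕ) {z : ℝ} (hz : 0 < z) :
    log z ≤ k * log 2 + z / 2 ^ k - 1 := by
  simpa using log_le_log_add_div_sub_one hz (c := 2 ^ k) (by positivity)

lemma log_ten_pow_five_bounds :
    11512 / 1000 ≤ log (10 ^ 5) ∧ log (10 ^ 5) ≤ 115135 / 10000 := by
  have h1 := log_le_sub_one_of_pos (show (0 : ℝ) < 128 / 125 by norm_num)
  have h2 := Real.one_sub_inv_le_log_of_pos (show (0 : ℝ) < 128 / 125 by norm_num)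
  have h3 : log (128 / 125) = 10 * log 2 - 3 * log 10 := by
    rw [show (128 : ℝ) / 125 = 2 ^ 10 / 10 ^ 3 by norm_num, log_div (by norm_num)
      (by norm_num), log_pow, log_pow]
    norm_num
  have h4 := log_two_gt_d9
  have h5 := log_two_lt_d9
  rw [log_pow]
  norm_num at h2
  constructor <;> push_cast <;> linarith

lemma log_ge_of_ten_pow_five_le {z : ℝ} (hz : 10 ^ 5 ≤ z) : 11512 / 1000 ≤ log z :=
  log_ten_pow_five_bounds.1.trans (log_le_log (by norm_num) hz)

section Numerics
variable {q : ℕ} {A L D V y : ℝ}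

lemma discBound_nine_fifths_le_sqrt (hq : 10 ^ 5 ≤ q) :
    6178 / 100 * (discBound q 1 (9 / 5) + 30 / 100) ≤ √(q : ℝ) / (85 / 100) := by
  have hq5 : (10 : ℝ) ^ 5 ≤ q := by exact_mod_cast hq
  have hq0 : (0 : ℝ) < q := by linarith
  set s := √(q : ℝ) with hs
  have hs316 : 31622 / 100 ≤ s := le_sqrt_of_sq_le (by linarith)
  have hs2 : (q : ℝ) = s ^ 2 := (sq_sqrt hq0.le).symm
  have hlq : log q ≤ 115135 / 10000 + 2 * (s / (31622 / 100) - 1) := by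
    have h1 := log_le_log (by norm_num) (show ((31622 : ℝ) / 100) ^ 2 ≤ 10 ^ 5 by norm_num)
    have h2 := log_le_log_add_div_sub_one (z := s) (c := 31622 / 100) (by linarith) (by norm_num)
    rw [log_pow] at h1
    rw [hs2, log_pow]
    push_cast at h1 ⊢
    linarith [log_ten_pow_five_bounds.2]
  have h2 := log_two_lt_d9
  have h58 : log (29 / 5) ≤ 17586 / 10000 := by
    have h := log_le_two_pow_tangent 5 (show (0 : ℝ) < (29 / 5) ^ 2 by norm_num)
    rw [log_pow] at h
    push_cast at h
    linarith
  have hls : logScale q (|9 / 5| + 1) = log q + log (29 / 5) + 5 / 2 := by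
    rw [logScale, ← log_mul hq0.ne' (by norm_num)]
    norm_num [abs_of_pos]
  have hls0 := logScale_ge (show (30 : ℝ) ≤ q by linarith) (|9 / 5| + 1)
  have hlls := log_le_two_pow_tangent 4 (show 0 < logScale q (|9 / 5| + 1) by linarith)
  have hπ := Real.pi_gt_d2
  have hπ' := pi_gt_d4
  have hlg : log (q * (|9 / 5| + 4) / (2 * π)) ≤ log q - 76 / 1000 := by
    have h := log_le_sub_one_of_pos (show 0 < 29 / 5 / (2 * π) by positivity)
    have h' : 29 / 5 / (2 * π) ≤ 924 / 1000 := by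
      rw [div_le_iff₀ (by positivity)]
      linarith
    rw [abs_of_pos (by norm_num), mul_div_assoc, log_mul hq0.ne' (by positivity)]
    norm_num at h h' ⊢
    linarith
  have hcoef : 2 / (99 / 100 * π) ≤ 6431 / 10000 := by
    rw [div_le_iff₀ (by positivity)]
    linarith
  have hll0 : 0 ≤ log (logScale q (|9 / 5| + 1)) := log_nonneg (by linarith)
  rw [hls] at hlls hll0
  rw [discBound, hls]
  have := mul_le_mul_of_nonneg_right hcoef (show 0 ≤
    log (log q + log (29 / 5) + 5 / 2) + 1 / 16 by linarith)
  norm_num at hlls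
  linarith

lemma discBound_add_eq (hV : 0 ≤ V) (hq : 0 < q) (hy : y = log (q * (3 * V + 8)) + 5 / 2) :
    discBound q 1 (3 * (V + 1) + 1) = 2 / (99 / 100 * π) * (log y + 1 / 16) +
      (y - 5 / 2 - log (2 * π)) / 4 + (100 / 99) ^ 2 := by
  have hq0 : (0 : ℝ) < q := by exact_mod_cast hq
  rw [discBound, logScale, abs_of_nonneg (show 0 ≤ 3 * (V + 1) + 1 by linarith),
    abs_of_nonneg (show 0 ≤ 3 * (V + 1) + 1 + 1 by linarith),
    show 3 * (V + 1) + 1 + 1 + 3 = 3 * V + 8 by ring,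
    show 3 * (V + 1) + 1 + 4 = 3 * V + 8 by ring, ← hy,
    log_div (by positivity) (by positivity), hy]
  ring

lemma discBound_add_bounds (hV : 0 ≤ V) (hq : 0 < q) (hy1 : 1 ≤ y)
    (hy : y = log (q * (3 * V + 8)) + 5 / 2) :
    y / 4 ≤ discBound q 1 (3 * (V + 1) + 1) + 28 / 100 ∧
    2762 / 100 * (discBound q 1 (3 * (V + 1) + 1) + 28 / 100) ≤
      762 / 10 + 70445 / 10000 * y := by
  have hπ' := pi_gt_d4
  have hπ4 := pi_lt_d4
  have h2 := log_two_lt_d9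
  have h2' := log_two_gt_d9
  have hl0 : 0 ≤ log y := log_nonneg hy1
  have hly := log_le_two_pow_tangent 7 (show 0 < y by linarith)
  have hcoef : 2 / (99 / 100 * π) ≤ 6431 / 10000 := by
    rw [div_le_iff₀ (by positivity)]
    linarith
  have hup : log (2 * π) ≤ 2 + 7 / 100 + 1 / 100 := by
    have := log_le_two_pow_tangent 3 (show 0 < 2 * π by positivity)
    push_cast at this
    linarith
  have hlo : 1749 / 1000 ≤ log (2 * π) := by
    rw [log_mul two_ne_zero pi_ne_zero]
    have := Real.one_sub_inv_le_log_of_pos (show 0 < π / 2 by positivity)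
    rw [log_div pi_ne_zero two_ne_zero] at this
    have h3 : (π / 2)⁻¹ ≤ 637 / 1000 := by
      rw [inv_div, div_le_iff₀ (by positivity)]
      linarith
    linarith
  rw [discBound_add_eq hV hq hy]
  have h1 := mul_le_mul_of_nonneg_right hcoef (show 0 ≤ log y + 1 / 16 by linarith)
  have h0 : 0 ≤ 2 / (99 / 100 * π) * (log y + 1 / 16) := by positivity
  push_cast at hly
  constructor <;> linarith

end Numerics

/-- A bound for the logarithmic derivatives on the contour. -/
noncomputable def contourBound (D y : ℝ) : ℝ :=
  log y + 1 / 16 + 73 / 1000 + log (1 + D) + log 9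

section Numerics
variable {q : ℕ} {A L D V M y : ℝ}

lemma mul_rpow_le_exp_of_log_le (hM : 0 < M) (hD : 0 < D) (hy : 0 < y) (hL : 0 < L)
    (h : 131465 / 10000 + log M + log D + log y + A * log L ≤
      24 / 25 * L / D) :
    512000 * (M * D * y) * L ^ A ≤ exp (24 / 25 * L / D) := by
  have h5 : log 512000 ≤ 131465 / 10000 := by
    have := log_le_two_pow_tangent 19 (show (0 : ℝ) < 512000 by norm_num)
    have h2 := log_two_lt_d9
    push_cast at this
    linarith
  rw [← Real.log_le_iff_le_exp (by positivity), log_mul (by positivity) (by positivity),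
    log_mul (by positivity) (by positivity), log_mul (by positivity) (by positivity),
    log_mul (by positivity) (by positivity), log_rpow hL]
  linarith

lemma truncHeight_facts (hq : 10 ^ 5 ≤ q) (hA1 : 1 ≤ A) (hL : 14000 ≤ L)
    (hsL : 45 * √(q : ℝ) ≤ L) (hV : V = truncHeight A L √(q : ℝ))
    (hy : y = log (q * (3 * V + 8)) + 5 / 2) :
    8000 ≤ V ∧ y ≤ log q / 2 + A * log L + log (cutoff A L) + 11898 / 1000 := by
  have hq5 : (10 : ℝ) ^ 5 ≤ q := by exact_mod_cast hq
  have hq0 : (0 : ℝ) < q := by linarith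
  have hs0 : 0 < √(q : ℝ) := sqrt_pos.2 hq0
  have hL0 : 0 < L := by linarith
  have hB : 12 ≤ cutoff A L := by
    have := log_nonneg (show 1 ≤ L by linarith)
    have : 0 ≤ (A + 2) * log L := by positivity
    rw [cutoff]
    linarith
  have hLA : L ≤ L ^ A := by
    simpa using rpow_le_rpow_of_exponent_le (show 1 ≤ L by linarith) hA1
  have hV8 : 8000 ≤ V := by
    rw [hV, truncHeight, le_div_iff₀ hs0]
    nlinarith only [mul_le_mul hB hLA hL0.le (by linarith only [hB]), hsL, hs0]
  refine ⟨hV8, ?_⟩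
  have h1 : log (3 * V + 8) ≤ log (301 / 100 * V) :=
    log_le_log (by linarith) (by linarith)
  have h2 : log (301 / 100 * V) = log 12040 + log (cutoff A L) +
      A * log L - log q / 2 := by
    rw [hV, truncHeight, show 301 / 100 * (4000 * cutoff A L * L ^ A / √(q : ℝ)) =
      12040 * cutoff A L * L ^ A / √(q : ℝ) by ring, log_div (by positivity) hs0.ne',
      log_mul (by positivity) (by positivity), log_mul (by positivity) (by positivity),
      log_rpow hL0, log_sqrt hq0.le]
  have h3 : log 12040 ≤ 9398 / 1000 := by
    have := log_le_two_pow_tangent 27 (show (0 : ℝ) < 12040 ^ 2 by norm_num)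
    have h2 := log_two_lt_d9
    rw [log_pow] at this
    push_cast at this
    linarith
  rw [hy, log_mul hq0.ne' (by linarith)]
  linarith

lemma contourBound_spec (hq : 10 ^ 5 ≤ q) (hV : 8000 ≤ V) (hD : 1 ≤ D)
    (hy : y = log (q * (3 * V + 8)) + 5 / 2) (hyD : 2762 / 400 * y ≤ D) :
    log (logScale q (V + 1)) + 1 / 16 +
      1 / D * (log (q * (V + 4) / (2 * π)) / 2) + (log (1 + D) + log 9) ≤
      contourBound D y ∧ 10 / 9 + log V ≤ y := by
  have hq5 : (10 : ℝ) ^ 5 ≤ q := by exact_mod_cast hq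
  have hq0 : (0 : ℝ) < q := by linarith
  have hls := logScale_ge (show (30 : ℝ) ≤ q by linarith) (V + 1)
  have h1 : log (logScale q (V + 1)) ≤ log y := by
    refine log_le_log (by linarith) ?_
    rw [logScale, hy, abs_of_nonneg (by linarith)]
    have : V + 1 + 3 ≤ 3 * V + 8 := by linarith
    gcongr
  have h2 : log (q * (V + 4) / (2 * π)) ≤ y := by
    rw [hy]
    have : q * (V + 4) / (2 * π) ≤ q * (3 * V + 8) := by
      rw [div_le_iff₀ (by positivity)]
      nlinarith only [pi_gt_three, hV, hq0, mul_pos hq0 (show 0 < V by linarith only [hV]),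
        mul_nonneg (mul_pos hq0 (show 0 < 3 * V + 8 by linarith only [hV])).le
          (sub_nonneg.2 pi_gt_three.le)]
    linarith [log_le_log (by positivity) this]
  refine ⟨?_, ?_⟩
  · have : 1 / D * (log (q * (V + 4) / (2 * π)) / 2) ≤ 73 / 1000 := by
      rw [one_div_mul_eq_div, div_le_iff₀ (by linarith)]
      linarith
    rw [contourBound]
    linarith
  · have : log V ≤ log (q * (3 * V + 8)) := by
      refine log_le_log (by linarith) ?_
      nlinarith
    rw [hy]
    linarith

lemma contourBound_le (hD : 1 ≤ D) (hy : 1 ≤ y) :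
    0 < contourBound D y ∧ contourBound D y ≤ log y + log (1 + D) + 2340 / 1000 := by
  have h9 := log_le_two_pow_tangent 3 (show (0 : ℝ) < 9 by norm_num)
  have h2 := log_two_lt_d9
  push_cast at h9
  have := log_nonneg hy
  have := log_nonneg (show 1 ≤ 1 + D by linarith)
  have := log_nonneg (show (1 : ℝ) ≤ 9 by norm_num)
  rw [contourBound]
  constructor <;> linarith

lemma budget_of_eq_sqrt (hq : 10 ^ 5 ≤ q) (hA1 : 1 ≤ A) (hA8 : A ≤ 8)
    (hL : 3 / 100 * A * √(q : ℝ) * log q ^ 3 ≤ L) (hy1 : 1 ≤ y)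
    (hD : D = √(q : ℝ) / (85 / 100)) (hyD : 2762 / 400 * y ≤ D) :
    contourBound D y ≤ log q + 778 / 1000 ∧
    131465 / 10000 + log (contourBound D y) + log D + log y + A * log L ≤
      24 / 25 * L / D := by
  have hq5 : (10 : ℝ) ^ 5 ≤ q := by exact_mod_cast hq
  have hq0 : (0 : ℝ) < q := by linarith
  set s := √(q : ℝ) with hs
  have hs316 : 316 ≤ s := le_sqrt_of_sq_le (by linarith)
  have hs0 : 0 < s := by linarith
  have hls : log s = log q / 2 := log_sqrt hq0.le
  set l := log q with hl
  have hl0 : 11512 / 1000 ≤ l := log_ge_of_ten_pow_five_le hq5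
  have h2 := log_two_lt_d9
  have h2' := log_two_gt_d9
  have hDs : D * (85 / 100) = s := by rw [hD]; field_simp
  have hD0 : 300 ≤ D := by linarith
  have hlD : log D ≤ l / 2 + 177 / 1000 := by
    have := Real.one_sub_inv_le_log_of_pos (show (0 : ℝ) < 85 / 100 by norm_num)
    rw [hD, log_div hs0.ne' (by norm_num), hls]
    norm_num at this ⊢
    linarith
  have hly : log y ≤ log D - 192 / 100 := by
    have h1 := log_le_log (by positivity) hyD
    rw [log_mul (by norm_num) (by positivity)] at h1
    have h3 := log_le_log_add_div_sub_one (z := 8) (c := 2762 / 400) (by norm_num) (by norm_num)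
    rw [show (8 : ℝ) = 2 ^ 3 by norm_num, log_pow] at h3
    norm_num at h1 h3
    linarith
  have hl1D : log (1 + D) ≤ log D + 34 / 10000 := by
    have := log_le_log_add_div_sub_one (z := 1 + D) (c := D) (by linarith) (by linarith)
    rw [add_div, div_self (by positivity)] at this
    have h3 : 1 / D ≤ 34 / 10000 := by
      rw [div_le_iff₀ (by linarith)]
      linarith
    linarith
  obtain ⟨hM0, hM⟩ := contourBound_le (D := D) (by linarith) hy1
  have hM' : contourBound D y ≤ l + 778 / 1000 := by linarith
  refine ⟨hM', ?_⟩
  have hlM : log (contourBound D y) ≤ 4 * log 2 + (l + 778 / 1000) / 16 - 1 := by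
    have := log_le_two_pow_tangent 4 hM0
    norm_num at this
    linarith
  have hll := log_le_two_pow_tangent 4 (show 0 < l by linarith)
  set m := 3 / 100 * s * l ^ 3 with hm
  have hm0 : 0 < m := by positivity
  have hlm : log m ≤ -5 * log 2 + l / 2 + 3 * log l := by
    have h3 := log_le_log (by norm_num) (show (3 : ℝ) / 100 ≤ (2 ^ 5)⁻¹ by norm_num)
    rw [Real.log_inv, log_pow] at h3
    rw [hm, log_mul (by positivity) (by positivity), log_mul (by norm_num) hs0.ne',
      log_pow, hls]
    push_cast at h3 ⊢
    linarith
  have hA0 : 0 < A := by linarith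
  set r := L / (A * m) with hr
  have hLr : L = A * m * r := by rw [hr]; field_simp
  have hr1 : 1 ≤ r := by
    rw [hr, one_le_div (by positivity), hm]
    linarith
  have hlL : log L ≤ A - 1 + log m + (r - 1) := by
    have h3 := log_le_sub_one_of_pos (show 0 < r by linarith)
    have h4 := log_le_sub_one_of_pos hA0
    rw [hLr, log_mul (by positivity) (by positivity), log_mul hA0.ne' hm0.ne']
    linarith
  set u := 2448 / 100000 * l ^ 3 with hu
  have hgoal : 24 / 25 * L / D = A * u * r := by
    rw [hLr, hm, hu, hD]
    field_simp
    norm_num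
  have hu1 : 324 / 100 * l ≤ u := by
    rw [hu]
    nlinarith only [mul_le_mul hl0 hl0 (by norm_num) (by linarith only [hl0]), hl0,
      mul_le_mul_of_nonneg_left (mul_le_mul hl0 hl0 (by norm_num) (by linarith only [hl0]))
        (show 0 ≤ l by linarith only [hl0])]
  push_cast at hll
  norm_num at hll
  have hW : 131465 / 10000 + log (contourBound D y) + log D + log y ≤
      u - log m := by linarith
  have hW8 : 8 ≤ u - log m := by linarith
  rw [hgoal]
  have h5 := mul_le_mul_of_nonneg_left hlL hA0.le
  have h6 : 0 ≤ (A - 1) * (u - log m - A) :=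
    mul_nonneg (by linarith) (by linarith)
  have h7 : 0 ≤ A * (u - 1) * (r - 1) :=
    mul_nonneg (mul_nonneg hA0.le (by linarith)) (by linarith)
  nlinarith only [h5, h6, h7, hW]

/-- The final inequality of the budget, with all logarithms replaced by tangent lines. -/
lemma linearized_budget {h g : ℝ} (hA1 : 1 ≤ A) (hA8 : A ≤ 8) (hh : 0 ≤ h)
    (hg : g ≤ 116685 / 10000 + h) (hg0 : 0 ≤ g) (hy0 : 0 ≤ y)
    (hy : y ≤ 996 / 100 + g * (130 / 128) + A * g * (129 / 128)) (hD0 : 0 ≤ D)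
    (hD : D ≤ 762 / 10 + 70445 / 10000 * y)
    (hM : M ≤ 1213 / 100 + y / 128 + D / 1024) :
    D * (2471 / 100 + M / 16 + D / 1024 + y / 128 + A * g) ≤
      12 / 100 * A * (115700 * (1 + h + h ^ 2 / 2)) := by
  set G := 116685 / 10000 + h with hG
  set Y := 996 / 100 + G * (130 / 128) + A * G * (129 / 128) with hY
  have hAg : A * g ≤ A * G := mul_le_mul_of_nonneg_left hg (by linarith)
  have hyY : y ≤ Y := by linarith
  have hDY : D ≤ 762 / 10 + 70445 / 10000 * Y := by linarith
  have hAG : 0 ≤ A * G := by positivity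
  calc _ ≤ D * (2471 / 100 + (1213 / 100 + Y / 128 + (762 / 10 + 70445 / 10000 * Y) / 1024) / 16 +
        (762 / 10 + 70445 / 10000 * Y) / 1024 + Y / 128 + A * G) :=
        mul_le_mul_of_nonneg_left (by linarith) hD0
    _ ≤ (762 / 10 + 70445 / 10000 * Y) *
        (2471 / 100 + (1213 / 100 + Y / 128 + (762 / 10 + 70445 / 10000 * Y) / 1024) / 16 +
        (762 / 10 + 70445 / 10000 * Y) / 1024 + Y / 128 + A * G) :=
        mul_le_mul_of_nonneg_right hDY (by linarith)
    _ ≤ _ := by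
        rw [hY, hG]
        have k1 := mul_nonneg (sub_nonneg.2 hA1) (sub_nonneg.2 hA8)
        have k2 := mul_nonneg k1 hh
        have k3 := mul_nonneg k2 hh
        have k4 := mul_nonneg (sub_nonneg.2 hA1) hh
        have k5 := mul_nonneg (sub_nonneg.2 hA8) hh
        have k6 := mul_nonneg k4 hh
        have k7 := mul_nonneg k5 hh
        linarith only [k1, k2, k3, k4, k5, k6, k7, hA1, hA8, hh]

lemma budget_of_le_linear (hq : 10 ^ 5 ≤ q) (hA1 : 1 ≤ A) (hA8 : A ≤ 8)
    (hL : 3 / 100 * A * √(q : ℝ) * log q ^ 3 ≤ L) (hy1 : 1 ≤ y)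
    (hy : y ≤ log q / 2 + A * log L + log (cutoff A L) + 11898 / 1000)
    (hD1 : 1 ≤ D) (hD : D ≤ 762 / 10 + 70445 / 10000 * y) (hyD : y ≤ D) :
    D + 1 ≤ L ∧ contourBound D y ≤ L ∧
    131465 / 10000 + log (contourBound D y) + log D + log y + A * log L ≤
      24 / 25 * L / D := by
  have hq5 : (10 : ℝ) ^ 5 ≤ q := by exact_mod_cast hq
  have hq0 : (0 : ℝ) < q := by linarith
  set s := √(q : ℝ) with hs
  have hs316 : 3162 / 10 ≤ s := le_sqrt_of_sq_le (by linarith)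
  have hs0 : 0 < s := by linarith
  have hls : log s = log q / 2 := log_sqrt hq0.le
  set l := log q with hl
  have hl0 : 11512 / 1000 ≤ l := log_ge_of_ten_pow_five_le hq5
  have h2 := log_two_lt_d9
  have h2' := log_two_gt_d9
  have hA0 : 0 < A := by linarith
  have hl3 : 15256 / 10 ≤ l ^ 3 := by
    refine le_trans ?_ (pow_le_pow_left₀ (by norm_num) hl0 3)
    norm_num
  set E := 8 * (L / A) with hE
  have hLE : 8 * L = A * E := by rw [hE]; field_simp
  have hEs : 366 * s ≤ E := by
    have : 3 / 100 * s * l ^ 3 ≤ L / A := by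
      rw [le_div_iff₀ hA0]
      linarith
    nlinarith only [this, mul_le_mul_of_nonneg_left hl3 hs0.le, hE, hs0]
  have hE0 : 115700 ≤ E := by linarith
  have hE0' : 0 < E := by linarith
  have hL0 : 14000 ≤ L := by nlinarith only [hLE, hA1, hE0]
  set g := log E with hg
  have hLg : log L ≤ g := log_le_log (by linarith) (by nlinarith only [hLE, hA8, hE0])
  have hL1 : 1 ≤ log L := by
    rw [le_log_iff_exp_le (by linarith)]
    linarith [exp_one_lt_d9]
  have hlg : 17 * log 2 + l ≤ 2 * g := by
    have h3 := log_le_log (show 0 < 2 ^ 17 * s ^ 2 by positivity)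
      (show 2 ^ 17 * s ^ 2 ≤ E ^ 2 by
        nlinarith only [pow_le_pow_left₀ (by positivity) hEs 2, sq_nonneg s])
    rw [log_mul (by positivity) (by positivity), log_pow, log_pow, log_pow,
      hls] at h3
    push_cast at h3
    linarith
  set h := log (E / 115700) with hh
  have hh0 : 0 ≤ h := log_nonneg (by rw [le_div_iff₀ (by norm_num)]; linarith)
  have hgh : g ≤ 116685 / 10000 + h := by
    have h3 := log_le_two_pow_tangent 17 (show (0 : ℝ) < 115700 by norm_num)
    rw [hh, log_div hE0'.ne' (by norm_num)]
    push_cast at h3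
    linarith
  have hEh : 115700 * (1 + h + h ^ 2 / 2) ≤ E := by
    have h3 := Real.quadratic_le_exp_of_nonneg hh0
    rw [hh, exp_log (by positivity), ← hh] at h3
    linarith
  have hB : log (cutoff A L) ≤ 7 * log 2 + ((A + 2) * g + 12) / 128 - 1 := by
    have h4 : (A + 2) * log L ≤ (A + 2) * g := by gcongr
    have h3 := log_le_two_pow_tangent 7 (z := cutoff A L) (by rw [cutoff]; positivity)
    rw [cutoff] at h3 ⊢
    norm_num at h3
    linarith
  have hAg : A * log L ≤ A * g := by gcongr
  have hy' : y ≤ 996 / 100 + g * (130 / 128) + A * g * (129 / 128) := by linarith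
  obtain ⟨hM0, hM⟩ := contourBound_le hD1 hy1
  have hly := log_le_two_pow_tangent 7 (show 0 < y by linarith)
  have hlD := log_le_two_pow_tangent 10 (show 0 < D by linarith)
  have hlD' := log_le_two_pow_tangent 10 (show 0 < 1 + D by linarith)
  have hlM := log_le_two_pow_tangent 4 hM0
  push_cast at hly hlD hlD' hlM
  norm_num at hly hlD hlD' hlM
  have hM' : contourBound D y ≤ 1213 / 100 + y / 128 + D / 1024 := by linarith
  have hfin := linearized_budget hA1 hA8 hh0 hgh (by linarith) (by linarith) hy' (by linarith)
    hD hM'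
  have hfin' : D * (2471 / 100 + contourBound D y / 16 + D / 1024 + y / 128 + A * g) ≤
      24 / 25 * L := by
    nlinarith only [hfin, mul_le_mul_of_nonneg_left hEh hA0.le, hLE]
  have hDL : D * (2471 / 100) ≤ 24 / 25 * L := by
    refine le_trans (mul_le_mul_of_nonneg_left ?_ (by linarith)) hfin'
    have : 0 ≤ A * g := mul_nonneg hA0.le (by linarith)
    linarith
  refine ⟨by linarith, by linarith, ?_⟩
  rw [le_div_iff₀ (by linarith), mul_comm]
  refine le_trans (mul_le_mul_of_nonneg_left ?_ (by linarith)) hfin'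
  linarith

end Numerics

theorem psi_theta_large_q_logpow_bounds (q : ℕ) (hq : 10 ^ 5 ≤ q)
    (a : ℤ) (ha : Int.gcd a q = 1) (A : ℝ) (hA1 : 1 ≤ A) (hA8 : A ≤ 8)
    (x : ℝ) (hx : Real.exp (0.03 * A * Real.sqrt q * Real.log q ^ 3) ≤ x) :
    |psi x q a - x / (Nat.totient q : ℝ)| ≤ (1 / 160) * x / Real.log x ^ A ∧
    |theta x q a - x / (Nat.totient q : ℝ)| ≤ (1 / 160) * x / Real.log x ^ A := by
  have hx0 : 0 < x := (exp_pos _).trans_le hx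
  have hq5 : (10 : ℝ) ^ 5 ≤ q := by exact_mod_cast hq
  have hL : 3 / 100 * A * √(q : ℝ) * log q ^ 3 ≤ log x := by
    rw [le_log_iff_exp_le hx0]
    norm_num at hx ⊢
    exact hx
  have hs316 : 3162 / 10 ≤ √(q : ℝ) := le_sqrt_of_sq_le (by linarith)
  have hl0 : 11512 / 1000 ≤ log q := log_ge_of_ten_pow_five_le hq5
  have hsL : 457 / 10 * √(q : ℝ) ≤ log x := by
    have hl3 : 15256 / 10 ≤ log q ^ 3 := by
      refine le_trans ?_ (pow_le_pow_left₀ (by norm_num) hl0 3)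
      norm_num
    have h1 : 1 * √(q : ℝ) * (15256 / 10) ≤ A * √(q : ℝ) * log q ^ 3 := by gcongr
    linarith
  have hlq : log q ≤ 2 * √(q : ℝ) := by
    have := log_le_sub_one_of_pos (show 0 < √(q : ℝ) by linarith)
    rw [log_sqrt (by linarith)] at this
    linarith
  have hL14 : 14000 ≤ log x := by linarith
  obtain ⟨V, hV⟩ : ∃ V, V = truncHeight A (log x) √(q : ℝ) := ⟨_, rfl⟩
  obtain ⟨y, hy⟩ : ∃ y, y = log (q * (3 * V + 8)) + 5 / 2 := ⟨_, rfl⟩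
  obtain ⟨hV8, hyle⟩ := truncHeight_facts hq hA1 hL14 (by linarith) hV hy
  have hy1 : 1 ≤ y := by
    have := log_nonneg (show 1 ≤ q * (3 * V + 8) by nlinarith)
    linarith
  obtain ⟨hK1, hK2⟩ := discBound_add_bounds (by linarith) (by linarith) hy1 hy
  have hD3 := discBound_nine_fifths_le_sqrt hq
  have hs85 : 370 ≤ √(q : ℝ) / (85 / 100) := by
    rw [le_div_iff₀ (by norm_num)]
    linarith
  have key : ∀ D, √(q : ℝ) / (85 / 100) ≤ D →
      2762 / 100 * (discBound q 1 (3 * (V + 1) + 1) + 28 / 100) ≤ D →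
      D + 1 ≤ log x → contourBound D y ≤ log x →
      131465 / 10000 + log (contourBound D y) + log D + log y +
        A * log (log x) ≤ 24 / 25 * log x / D →
      |psi x q a - x / (Nat.totient q : ℝ)| ≤ (1 / 160) * x / log x ^ A ∧
      |theta x q a - x / (Nat.totient q : ℝ)| ≤ (1 / 160) * x / log x ^ A := by
    intro D hD1 hD2 hDL hML hN
    have hM0 := (contourBound_le (show 1 ≤ D by linarith) hy1).1
    obtain ⟨hM, hyV⟩ := contourBound_spec hq hV8 (show 1 ≤ D by linarith) hy (by linarith)
    subst hV
    exact psi_theta_bounds_of_parameters hq ha hA1 hA8 hx0 hL14 (by linarith) hD1 hD2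
      (hD3.trans hD1) hDL hM0.le hML hM hyV
      (mul_rpow_le_exp_of_log_le hM0 (by linarith) (by linarith) (by linarith) hN)
  rcases le_total (2762 / 100 * (discBound q 1 (3 * (V + 1) + 1) + 28 / 100))
    (√(q : ℝ) / (85 / 100)) with hc | hc
  · obtain ⟨hM, hN⟩ := budget_of_eq_sqrt hq hA1 hA8 hL hy1 rfl (by linarith)
    exact key _ le_rfl hc (by linarith) (by linarith) hN
  · obtain ⟨hDL, hM, hN⟩ := budget_of_le_linear hq hA1 hA8 hL hy1 hyle (by linarith) hK2
      (by linarith)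
    exact key _ hc le_rfl hDL hM hN
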